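/- Let κ > 0, let Ω ⊂ ℝ² be a bounded open connected set, let L be a straight line contained in ℝ² \ closure(Ω), and let Λ be a nonempty open subinterval of L. For j = 1, 2 let v_j ∈ L^∞(ℝ²) vanish almost everywhere outside Ω, satisfy the unique-solvability condition at energy κ, and let R_j : ℝ² × ℝ² → ℂ be an outgoing Green function for v_j at energy κ. If Im R₁(x,y) = Im R₂(x,y) for all x, y ∈ Λ, then v₁ = v₂ almost everywhere on ℝ². -/

import Mathlib

noncomputable section

open Real MeasureTheory Set

/-- The plane `ℝ²`. -/
abbrev R2 : Type := EuclideanSpace ℝ (Fin 2)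

/-- The Bessel function `J₀` of the first kind of order zero, defined by its power series. -/
def J0 (r : ℝ) : ℝ :=
  ∑' m : ℕ, (-1 : ℝ) ^ m * (r / 2) ^ (2 * m) / (Nat.factorial m : ℝ) ^ 2

/-- The Bessel function `Y₀` of the second kind of order zero, defined by its series,
where `γ` is the Euler–Mascheroni constant and `h_m = Σ_{k=1}^m 1/k`. -/
def Y0 (r : ℝ) : ℝ :=
  (2 / π) * (Real.log (r / 2) + Real.eulerMascheroniConstant) * J0 r +
    (2 / π) * ∑' m : ℕ, (-1 : ℝ) ^ (m + 1) * (∑ k ∈ Finset.range m, (1 : ℝ) / (k + 1)) *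
      (r / 2) ^ (2 * m) / (Nat.factorial m : ℝ) ^ 2

/-- The Hankel function `H₀ = J₀ + iY₀` of the first kind of order zero. -/
def H0 (r : ℝ) : ℂ := (J0 r : ℂ) + Complex.I * (Y0 r : ℂ)

/-- The outgoing Green function `G⁺(x, κ) = (i/4) H₀(κ|x|)` of the two-dimensional
Helmholtz equation. -/
def Gplus (κ : ℝ) (x : R2) : ℂ := (Complex.I / 4) * H0 (κ * ‖x‖)

/-- `R` is an outgoing Green function for the potential `v` (supported in `Ω`) at energy `κ`:
for each `y`, `R(·, y)` is `L²` on `Ω` and satisfies the Lippmann–Schwinger type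
integral equation `R(x,y) = −G⁺(x−y,κ) + ∫_Ω G⁺(x−z,κ) v(z) R(z,y) dz` for all `x ≠ y`. -/
def IsOutgoingGreen (κ : ℝ) (Ω : Set R2) (v : R2 → ℂ) (R : R2 → R2 → ℂ) : Prop :=
  ∀ y : R2,
    MemLp (fun x => R x y) 2 (volume.restrict Ω) ∧
    ∀ x : R2, x ≠ y →
      R x y = -Gplus κ (x - y) + ∫ z in Ω, Gplus κ (x - z) * v z * R z y

/-- The unique-solvability condition at energy `κ`: for each `y` there is at most one
`w ∈ L²(Ω)` satisfying the integral equation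
`w(x) = −G⁺(x−y,κ) + ∫_Ω G⁺(x−z,κ) v(z) w(z) dz` a.e. on `Ω`. -/
def UniqueSolvability (κ : ℝ) (Ω : Set R2) (v : R2 → ℂ) : Prop :=
  ∀ y : R2, ∀ w₁ w₂ : R2 → ℂ,
    MemLp w₁ 2 (volume.restrict Ω) → MemLp w₂ 2 (volume.restrict Ω) →
    (∀ᵐ x ∂volume.restrict Ω,
      w₁ x = -Gplus κ (x - y) + ∫ z in Ω, Gplus κ (x - z) * v z * w₁ z) →
    (∀ᵐ x ∂volume.restrict Ω,
      w₂ x = -Gplus κ (x - y) + ∫ z in Ω, Gplus κ (x - z) * v z * w₂ z) →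
    w₁ =ᵐ[volume.restrict Ω] w₂

namespace GKL

open Filter Topology

/-! ### Power series with factorially decaying coefficients -/

/-- The sum of the power series with coefficients `a`. -/
def pser (a : ℕ → ℂ) (X : ℂ) : ℂ := ∑' m : ℕ, a m * X ^ m

/-- The coefficients of the derivative of a power series. -/
def dcoef (a : ℕ → ℂ) (m : ℕ) : ℂ := (m + 1) * a (m + 1)

/-- Factorial decay of coefficients. -/
def FacDecay (a : ℕ → ℂ) : Prop := ∃ C K : ℝ, 0 ≤ C ∧ 0 ≤ K ∧ ∀ m, ‖a m‖ ≤ C * K ^ m / m.factorial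

lemma FacDecay.dcoef {a : ℕ → ℂ} (h : FacDecay a) : FacDecay (dcoef a) := by
  obtain ⟨C, K, hC, hK, hb⟩ := h
  refine ⟨C * K, K, by positivity, hK, fun m => ?_⟩
  have h1 := hb (m + 1)
  have h2 : ‖GKL.dcoef a m‖ = (m + 1) * ‖a (m + 1)‖ := by
    rw [GKL.dcoef, norm_mul]
    congr 1
    exact_mod_cast Complex.norm_natCast (m + 1)
  rw [h2]
  calc ((m : ℝ) + 1) * ‖a (m + 1)‖ ≤ (m + 1) * (C * K ^ (m + 1) / (m + 1).factorial) := by gcongr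
    _ = C * K * K ^ m / m.factorial := by
      rw [Nat.factorial_succ]; push_cast; field_simp; ring

lemma FacDecay.summable {a : ℕ → ℂ} (h : FacDecay a) (X : ℂ) : Summable fun m => a m * X ^ m := by
  obtain ⟨C, K, hC, hK, hb⟩ := h
  refine Summable.of_norm_bounded (g := fun m => C * ((K * ‖X‖) ^ m / m.factorial))
    ((Real.summable_pow_div_factorial _).mul_left C) fun m => ?_
  rw [norm_mul, norm_pow, mul_pow]
  calc ‖a m‖ * ‖X‖ ^ m ≤ (C * K ^ m / m.factorial) * ‖X‖ ^ m := by gcongr; exact hb m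
    _ = _ := by ring

lemma hasDerivAt_pser {a : ℕ → ℂ} (h : FacDecay a) (X : ℂ) :
    HasDerivAt (pser a) (pser (dcoef a) X) X := by
  have h' := h.dcoef
  obtain ⟨C, K, hC, hK, hb⟩ := h
  set r : ℝ := ‖X‖ + 1
  have hr : 0 ≤ r := by positivity
  have key := hasDerivAt_tsum_of_isPreconnected (𝕜 := ℂ) (g := fun m X => a m * X ^ m)
    (g' := fun m X => a m * (m * X ^ (m - 1))) (u := fun m => ‖a m‖ * (m * r ^ (m - 1)))
    (t := Metric.ball 0 r) (y₀ := 0) (y := X) ?_ Metric.isOpen_ball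
    (convex_ball _ _).isPreconnected ?_ ?_ (by simp [r]; positivity) ?_ (by simp [r])
  · refine key.congr_deriv (Eq.symm ?_)
    unfold pser
    rw [Summable.tsum_eq_zero_add (f := fun m => a m * (m * X ^ (m - 1)))]
    · simp only [dcoef, Nat.cast_zero, zero_mul, mul_zero, zero_add, Nat.cast_add, Nat.cast_one,
        Nat.add_sub_cancel]
      exact tsum_congr fun m => by ring
    · rw [← summable_nat_add_iff 1]
      refine (h'.summable X).congr fun m => ?_
      simp only [dcoef, Nat.cast_add, Nat.cast_one, Nat.add_sub_cancel]; ring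
  · rw [← summable_nat_add_iff 1]
    refine ((h'.summable r).norm).congr fun m => ?_
    have : ‖((m : ℂ) + 1)‖ = (m : ℝ) + 1 := by exact_mod_cast Complex.norm_natCast (m + 1)
    simp only [dcoef, norm_mul, norm_pow, this, Complex.norm_real, Real.norm_eq_abs, abs_of_nonneg hr,
      Nat.cast_add, Nat.cast_one, Nat.add_sub_cancel]
    ring
  · intro m y _
    exact ((hasDerivAt_pow m y).const_mul (a m))
  · intro m y hy
    rw [norm_mul, norm_mul, norm_pow, Complex.norm_natCast]
    have : ‖y‖ ≤ r := by simpa using (Metric.mem_ball.1 hy).le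
    gcongr
  · refine summable_of_ne_finset_zero (s := {0}) fun m hm => ?_
    simp at hm
    simp [hm]

lemma FacDecay.nat_mul {a : ℕ → ℂ} (h : FacDecay a) : FacDecay fun m => m * a m := by
  obtain ⟨C, K, hC, hK, hb⟩ := h
  refine ⟨C, 2 * K, hC, by positivity, fun m => ?_⟩
  rw [norm_mul, Complex.norm_natCast, mul_pow]
  have : (m : ℝ) ≤ 2 ^ m := by exact_mod_cast Nat.lt_two_pow_self.le
  calc (m : ℝ) * ‖a m‖ ≤ 2 ^ m * (C * K ^ m / m.factorial) := by gcongr; exact hb m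
    _ = _ := by ring

lemma mul_pser_dcoef {a : ℕ → ℂ} (h : FacDecay a) (X : ℂ) :
    X * pser (dcoef a) X = pser (fun m => m * a m) X := by
  rw [pser, pser, Summable.tsum_eq_zero_add (h.nat_mul.summable X), ← tsum_mul_left]
  simp only [Nat.cast_zero, zero_mul, zero_add, dcoef]
  refine tsum_congr fun m => ?_
  push_cast; ring

/-- Coefficients with doubly factorial decay give growth of order one half. -/
lemma norm_pser_le {a : ℕ → ℂ} {C K : ℝ} (hC : 0 ≤ C) (hK : 0 ≤ K)
    (hb : ∀ m, ‖a m‖ ≤ C * (K ^ m / m.factorial) ^ 2) (X : ℂ) :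
    ‖pser a X‖ ≤ C * rexp (2 * K * √‖X‖) := by
  set y := K * √‖X‖ with hy
  have hy0 : 0 ≤ y := by positivity
  have hsq : y ^ 2 = K ^ 2 * ‖X‖ := by rw [hy, mul_pow, Real.sq_sqrt (norm_nonneg _)]
  have hterm : ∀ m, ‖a m * X ^ m‖ ≤ C * rexp y * (y ^ m / m.factorial) := fun m => by
    rw [norm_mul, norm_pow]
    calc ‖a m‖ * ‖X‖ ^ m ≤ C * (K ^ m / m.factorial) ^ 2 * ‖X‖ ^ m := by gcongr; exact hb m
      _ = C * (y ^ m / m.factorial) * (y ^ m / m.factorial) := by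
        have : (y ^ m) * (y ^ m) = (K ^ m) ^ 2 * ‖X‖ ^ m := by
          rw [← pow_add, ← two_mul, pow_mul, hsq, mul_pow]; ring
        rw [div_pow]; field_simp; nlinarith [this]
      _ ≤ _ := by gcongr; exact Real.pow_div_factorial_le_exp y hy0 m
  have hs : HasSum (fun m : ℕ => C * rexp y * (y ^ m / m.factorial)) (C * rexp y * rexp y) := by
    have := (NormedSpace.expSeries_div_hasSum_exp y).mul_left (C * rexp y)
    rwa [← Real.exp_eq_exp_ℝ] at this
  calc ‖pser a X‖ ≤ C * rexp y * rexp y := tsum_of_norm_bounded hs hterm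
    _ = _ := by rw [mul_assoc, ← Real.exp_add, hy]; ring_nf

/-! ### The two entire functions behind the Bessel functions of order zero -/

/-- Coefficients of `J₀(2√X)`. -/
def acoef (m : ℕ) : ℂ := (-1) ^ m / (m.factorial : ℂ) ^ 2

/-- Partial harmonic sums. -/
def harm (m : ℕ) : ℝ := ∑ k ∈ Finset.range m, (1 : ℝ) / (k + 1)

/-- Coefficients of the regular part of `Y₀(2√X)`. -/
def bcoef (m : ℕ) : ℂ := -(harm m : ℂ) * acoef m

lemma harm_nonneg (m : ℕ) : 0 ≤ harm m := Finset.sum_nonneg fun k _ => by positivity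

lemma harm_le (m : ℕ) : harm m ≤ m := by
  calc harm m ≤ ∑ k ∈ Finset.range m, (1 : ℝ) := Finset.sum_le_sum fun k _ => by
        rw [div_le_one (by positivity)]; linarith [(Nat.cast_nonneg k : (0 : ℝ) ≤ k)]
    _ = m := by simp

lemma norm_acoef (m : ℕ) : ‖acoef m‖ = (1 / m.factorial) ^ 2 := by
  simp [acoef]

lemma norm_acoef_le (m : ℕ) : ‖acoef m‖ ≤ 1 * (2 ^ m / m.factorial) ^ 2 := by
  rw [norm_acoef, one_mul]
  gcongr
  exact one_le_pow₀ (by norm_num)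

lemma norm_bcoef_le (m : ℕ) : ‖bcoef m‖ ≤ 1 * (2 ^ m / m.factorial) ^ 2 := by
  rw [bcoef, norm_mul, norm_acoef, norm_neg, Complex.norm_real, Real.norm_eq_abs,
    abs_of_nonneg (harm_nonneg m), div_pow, div_pow, one_mul, one_pow]
  have : harm m ≤ (2 ^ m) ^ 2 := by
    have h1 := harm_le m
    have h2 : (m : ℝ) ≤ 2 ^ m := by exact_mod_cast Nat.lt_two_pow_self.le
    nlinarith [one_le_pow₀ (n := m) (by norm_num : (1 : ℝ) ≤ 2)]
  calc harm m * (1 / (m.factorial : ℝ) ^ 2) ≤ (2 ^ m) ^ 2 * (1 / (m.factorial : ℝ) ^ 2) := by gcongr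
    _ = _ := by ring

lemma facDecay_of_sq {a : ℕ → ℂ} (h : ∀ m, ‖a m‖ ≤ 1 * (2 ^ m / m.factorial) ^ 2) : FacDecay a := by
  refine ⟨1, 4, by norm_num, by norm_num, fun m => (h m).trans ?_⟩
  rw [div_pow, one_mul, one_mul, ← pow_mul, mul_comm m 2, pow_mul]
  have : (1 : ℝ) ≤ m.factorial := by exact_mod_cast Nat.one_le_iff_ne_zero.2 (Nat.factorial_ne_zero m)
  norm_num
  gcongr
  nlinarith

lemma facDecay_acoef : FacDecay acoef := facDecay_of_sq norm_acoef_le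
lemma facDecay_bcoef : FacDecay bcoef := facDecay_of_sq norm_bcoef_le

/-- `besA X = J₀(2√X)`. -/
def besA : ℂ → ℂ := pser acoef
/-- The derivative of `besA`. -/
def besA' : ℂ → ℂ := pser (dcoef acoef)
/-- The entire part of `π Y₀(2√X) / 2`. -/
def besB : ℂ → ℂ := pser bcoef
/-- The derivative of `besB`. -/
def besB' : ℂ → ℂ := pser (dcoef bcoef)

lemma hasDerivAt_besA (X : ℂ) : HasDerivAt besA (besA' X) X := hasDerivAt_pser facDecay_acoef X
lemma hasDerivAt_besB (X : ℂ) : HasDerivAt besB (besB' X) X := hasDerivAt_pser facDecay_bcoef X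

lemma continuous_besA : Continuous besA :=
  continuous_iff_continuousAt.2 fun X => (hasDerivAt_besA X).continuousAt
lemma continuous_besB : Continuous besB :=
  continuous_iff_continuousAt.2 fun X => (hasDerivAt_besB X).continuousAt
lemma continuous_besA' : Continuous besA' :=
  continuous_iff_continuousAt.2 fun X => (hasDerivAt_pser facDecay_acoef.dcoef X).continuousAt
lemma continuous_besB' : Continuous besB' :=
  continuous_iff_continuousAt.2 fun X => (hasDerivAt_pser facDecay_bcoef.dcoef X).continuousAt

lemma acoef_succ (m : ℕ) : ((m : ℂ) + 1) ^ 2 * acoef (m + 1) = -acoef m := by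
  have h1 : (m.factorial : ℂ) ≠ 0 := by exact_mod_cast Nat.factorial_ne_zero m
  have h2 : (m : ℂ) + 1 ≠ 0 := Nat.cast_add_one_ne_zero m
  rw [acoef, acoef, Nat.factorial_succ]
  push_cast
  field_simp
  ring

lemma harm_succ (m : ℕ) : harm (m + 1) = harm m + 1 / (m + 1) := by
  rw [harm, Finset.sum_range_succ, ← harm]

lemma bcoef_succ (m : ℕ) :
    ((m : ℂ) + 1) ^ 2 * bcoef (m + 1) = -bcoef m - dcoef acoef m := by
  have h2 : (m : ℂ) + 1 ≠ 0 := Nat.cast_add_one_ne_zero m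
  have h := acoef_succ m
  rw [bcoef, bcoef, dcoef, harm_succ]
  push_cast
  have : ((m : ℂ) + 1) ^ 2 * (-((harm m : ℂ) + 1 / (m + 1)) * acoef (m + 1)) =
    -(harm m : ℂ) * (((m : ℂ) + 1) ^ 2 * acoef (m + 1)) - (m + 1) * acoef (m + 1) := by
    field_simp; ring
  rw [this, h]; ring

lemma hasDerivAt_mul_besA' (X : ℂ) : HasDerivAt (fun X => X * besA' X) (-besA X) X := by
  have h1 : (fun X => X * besA' X) = pser (fun m => m * acoef m) :=
    funext fun X => mul_pser_dcoef facDecay_acoef X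
  rw [h1]
  convert hasDerivAt_pser facDecay_acoef.nat_mul X using 1
  rw [besA, pser, pser, ← tsum_neg]
  refine tsum_congr fun m => ?_
  have := acoef_succ m
  simp only [dcoef]; push_cast
  linear_combination -(X ^ m) * this

lemma hasDerivAt_mul_besB' (X : ℂ) :
    HasDerivAt (fun X => X * besB' X) (-besB X - besA' X) X := by
  have h1 : (fun X => X * besB' X) = pser (fun m => m * bcoef m) :=
    funext fun X => mul_pser_dcoef facDecay_bcoef X
  rw [h1]
  convert hasDerivAt_pser facDecay_bcoef.nat_mul X using 1
  rw [besB, besA', pser, pser, pser, ← tsum_neg, ← Summable.tsum_sub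
    (facDecay_bcoef.summable X).neg (facDecay_acoef.dcoef.summable X)]
  refine tsum_congr fun m => ?_
  have := bcoef_succ m
  simp only [dcoef] at *; push_cast
  linear_combination -(X ^ m) * this

lemma besA_zero : besA 0 = 1 := by
  rw [besA, pser, tsum_eq_single 0]
  · simp [acoef]
  · intro m hm; simp [hm]

lemma besB_zero : besB 0 = 0 := by
  rw [besB, pser, tsum_eq_single 0]
  · simp [bcoef, harm]
  · intro m hm; simp [hm]

/-! ### The outgoing fundamental solution as a function of the squared distance -/

/-- The outgoing fundamental solution, as a function of `X = (κ|x|/2)²`. -/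
def Efun (X : ℂ) : ℂ :=
  (Complex.I / 4 - eulerMascheroniConstant / (2 * π)) * besA X - 1 / (2 * π) * besB X -
    1 / (4 * π) * (Complex.log X * besA X)

/-- The derivative of `Efun`. -/
def Efun' (X : ℂ) : ℂ :=
  (Complex.I / 4 - eulerMascheroniConstant / (2 * π)) * besA' X - 1 / (2 * π) * besB' X -
    1 / (4 * π) * (X⁻¹ * besA X + Complex.log X * besA' X)

lemma hasDerivAt_Efun {X : ℂ} (hX : X ∈ Complex.slitPlane) : HasDerivAt Efun (Efun' X) X :=
  (((hasDerivAt_besA X).const_mul _).sub ((hasDerivAt_besB X).const_mul _)).sub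
    (((Complex.hasDerivAt_log hX).mul (hasDerivAt_besA X)).const_mul _)

lemma mul_Efun' {X : ℂ} (hX : X ≠ 0) : X * Efun' X =
    (Complex.I / 4 - eulerMascheroniConstant / (2 * π)) * (X * besA' X) -
      1 / (2 * π) * (X * besB' X) - 1 / (4 * π) * (besA X + Complex.log X * (X * besA' X)) := by
  rw [Efun']; field_simp

lemma hasDerivAt_mul_Efun' {X : ℂ} (hX : X ∈ Complex.slitPlane) :
    HasDerivAt (fun X => X * Efun' X) (-Efun X) X := by
  have hX0 : X ≠ 0 := Complex.slitPlane_ne_zero hX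
  have h1 : (fun X => X * Efun' X) =ᶠ[𝓝 X] fun X =>
    (Complex.I / 4 - eulerMascheroniConstant / (2 * π)) * (X * besA' X) -
      1 / (2 * π) * (X * besB' X) - 1 / (4 * π) * (besA X + Complex.log X * (X * besA' X)) := by
    filter_upwards [isOpen_ne.mem_nhds hX0] with Y hY using mul_Efun' hY
  refine HasDerivAt.congr_of_eventuallyEq ?_ h1
  refine ((((hasDerivAt_mul_besA' X).const_mul _).sub
    ((hasDerivAt_mul_besB' X).const_mul _)).sub (((hasDerivAt_besA X).add
      ((Complex.hasDerivAt_log hX).mul (hasDerivAt_mul_besA' X))).const_mul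
        (1 / (4 * π : ℂ)))).congr_deriv ?_
  simp only [Efun]
  field_simp
  ring

lemma Gplus_eq (κ : ℝ) (hκ : 0 < κ) (x : R2) :
    Gplus κ x = Efun (((κ ^ 2 / 4 * ‖x‖ ^ 2 : ℝ)) : ℂ) := by
  have hX : κ ^ 2 / 4 * ‖x‖ ^ 2 = (κ * ‖x‖ / 2) ^ 2 := by ring
  rw [Gplus, hX]
  have hr : 0 ≤ κ * ‖x‖ := by positivity
  generalize κ * ‖x‖ = r at hr
  have hJ : (J0 r : ℂ) = besA (((r / 2) ^ 2 : ℝ) : ℂ) := by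
    rw [J0, besA, pser, Complex.ofReal_tsum]
    refine tsum_congr fun m => ?_
    rw [acoef, pow_mul]; push_cast; ring
  have hY : ((∑' m : ℕ, (-1 : ℝ) ^ (m + 1) * (∑ k ∈ Finset.range m, (1 : ℝ) / (k + 1)) *
      (r / 2) ^ (2 * m) / (Nat.factorial m : ℝ) ^ 2 : ℝ) : ℂ) = besB (((r / 2) ^ 2 : ℝ) : ℂ) := by
    rw [besB, pser, Complex.ofReal_tsum]
    refine tsum_congr fun m => ?_
    rw [bcoef, acoef, harm, pow_mul]; push_cast; ring
  have hL : Complex.log (((r / 2) ^ 2 : ℝ) : ℂ) = 2 * (Real.log (r / 2) : ℂ) := by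
    rw [← Complex.ofReal_log (by positivity), Real.log_pow]; push_cast; ring
  rw [H0, Y0, Efun, hL, ← hJ, ← hY]
  have hpi : (π : ℂ) ≠ 0 := by exact_mod_cast Real.pi_ne_zero
  generalize (∑' m : ℕ, (-1 : ℝ) ^ (m + 1) * (∑ k ∈ Finset.range m, (1 : ℝ) / (k + 1)) *
      (r / 2) ^ (2 * m) / (Nat.factorial m : ℝ) ^ 2 : ℝ) = S
  generalize Real.log (r / 2) = l
  generalize J0 r = j
  push_cast
  field_simp
  ring_nf
  simp only [Complex.I_sq]
  ring

end GKL

namespace GKL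

open Filter Topology

/-! ### The Macdonald function -/

/-- The integrals `∫₀^∞ (cosh θ)ⁿ exp (-w cosh θ) dθ`. -/
def macd (n : ℕ) (w : ℂ) : ℂ :=
  ∫ θ in Ioi (0 : ℝ), ((Real.cosh θ : ℝ) : ℂ) ^ n * Complex.exp (-w * (Real.cosh θ : ℝ))

lemma le_cosh (θ : ℝ) : θ ≤ Real.cosh θ := by
  rcases le_total 0 θ with h | h
  · exact (Real.self_le_sinh_iff.2 h).trans (Real.sinh_lt_cosh θ).le
  · exact h.trans (Real.cosh_pos θ).le

lemma cosh_pow_mul_exp_le (n : ℕ) {a : ℝ} (ha : 0 < a) (θ : ℝ) :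
    Real.cosh θ ^ n * rexp (-a * Real.cosh θ) ≤
      n.factorial / (a / 2) ^ n * rexp (-(a / 2) * θ) := by
  have hc : 0 < Real.cosh θ := Real.cosh_pos θ
  have h1 := Real.pow_div_factorial_le_exp (a / 2 * Real.cosh θ) (by positivity) n
  have h2 : Real.cosh θ ^ n ≤ n.factorial / (a / 2) ^ n * rexp (a / 2 * Real.cosh θ) := by
    rw [div_le_iff₀ (by positivity), mul_pow] at h1
    rw [div_mul_eq_mul_div, le_div_iff₀ (by positivity)]
    linarith
  calc Real.cosh θ ^ n * rexp (-a * Real.cosh θ)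
      ≤ n.factorial / (a / 2) ^ n * rexp (a / 2 * Real.cosh θ) * rexp (-a * Real.cosh θ) := by gcongr
    _ = n.factorial / (a / 2) ^ n * rexp (-(a / 2) * Real.cosh θ) := by
      rw [mul_assoc, ← Real.exp_add]; ring_nf
    _ ≤ _ := by
      gcongr _ * rexp ?_
      exact mul_le_mul_of_nonpos_left (le_cosh θ) (by linarith)

lemma continuous_macd_integrand (n : ℕ) (w : ℂ) : Continuous fun θ : ℝ =>
    ((Real.cosh θ : ℝ) : ℂ) ^ n * Complex.exp (-w * (Real.cosh θ : ℝ)) := by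
  have := Real.continuous_cosh
  fun_prop

lemma norm_macd_integrand (n : ℕ) (w : ℂ) (θ : ℝ) :
    ‖((Real.cosh θ : ℝ) : ℂ) ^ n * Complex.exp (-w * (Real.cosh θ : ℝ))‖ =
      Real.cosh θ ^ n * rexp (-w.re * Real.cosh θ) := by
  rw [norm_mul, norm_pow, Complex.norm_exp, Complex.norm_real, Real.norm_eq_abs,
    abs_of_pos (Real.cosh_pos θ)]
  simp

lemma integrableOn_macd (n : ℕ) {w : ℂ} (hw : 0 < w.re) : IntegrableOn (fun θ : ℝ =>
    ((Real.cosh θ : ℝ) : ℂ) ^ n * Complex.exp (-w * (Real.cosh θ : ℝ))) (Ioi 0) := by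
  refine Integrable.mono' (g := fun θ => n.factorial / (w.re / 2) ^ n * rexp (-(w.re / 2) * θ))
    ((integrableOn_exp_mul_Ioi (by linarith) 0).const_mul _)
    (continuous_macd_integrand n w).aestronglyMeasurable ?_
  filter_upwards with θ
  rw [norm_macd_integrand]
  exact cosh_pow_mul_exp_le n hw θ

lemma hasDerivAt_macd (n : ℕ) {w : ℂ} (hw : 0 < w.re) :
    HasDerivAt (macd n) (-macd (n + 1) w) w := by
  have hs : {y : ℂ | w.re / 2 < y.re} ∈ 𝓝 w :=
    (isOpen_lt continuous_const Complex.continuous_re).mem_nhds (by simp; linarith)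
  have key := hasDerivAt_integral_of_dominated_loc_of_deriv_le (𝕜 := ℂ) (x₀ := w)
    (μ := volume.restrict (Ioi (0 : ℝ)))
    (F := fun w θ => ((Real.cosh θ : ℝ) : ℂ) ^ n * Complex.exp (-w * (Real.cosh θ : ℝ)))
    (F' := fun w θ => -(((Real.cosh θ : ℝ) : ℂ) ^ (n + 1) * Complex.exp (-w * (Real.cosh θ : ℝ))))
    (bound := fun θ => (n + 1).factorial / (w.re / 2 / 2) ^ (n + 1) * rexp (-(w.re / 2 / 2) * θ))
    (s := {y : ℂ | w.re / 2 < y.re}) hs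
    (Eventually.of_forall fun y => (continuous_macd_integrand n y).aestronglyMeasurable)
    (integrableOn_macd n hw) (continuous_macd_integrand (n + 1) w).neg.aestronglyMeasurable
    ?_ ((integrableOn_exp_mul_Ioi (by linarith) 0).const_mul _) ?_
  · refine key.2.congr_deriv ?_
    rw [integral_neg]; rfl
  · filter_upwards with θ y hy
    rw [norm_neg, norm_macd_integrand]
    refine le_trans ?_ (cosh_pow_mul_exp_le (n + 1) (by linarith : 0 < w.re / 2) θ)
    have := Real.cosh_pos θ
    gcongr
  · filter_upwards with θ y hy
    have h := ((((hasDerivAt_neg y).mul_const ((Real.cosh θ : ℝ) : ℂ)).cexp).const_mul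
      (((Real.cosh θ : ℝ) : ℂ) ^ n))
    refine h.congr_deriv ?_
    ring

lemma tendsto_exp_neg_mul_cosh {a : ℝ} (ha : 0 < a) (n : ℕ) :
    Tendsto (fun θ => Real.cosh θ ^ n * rexp (-a * Real.cosh θ)) atTop (𝓝 0) := by
  refine squeeze_zero (fun θ => by have := Real.cosh_pos θ; positivity)
    (cosh_pow_mul_exp_le n ha) ?_
  have : Tendsto (fun θ : ℝ => rexp (-(a / 2) * θ)) atTop (𝓝 0) :=
    Real.tendsto_exp_atBot.comp (tendsto_id.const_mul_atTop_of_neg (by linarith))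
  simpa using this.const_mul (n.factorial / (a / 2) ^ n)

lemma abs_sinh_le_cosh (θ : ℝ) : |Real.sinh θ| ≤ Real.cosh θ := by
  refine abs_le_of_sq_le_sq ?_ (Real.cosh_pos θ).le
  have := Real.cosh_sq θ
  linarith

lemma macd_ode {w : ℂ} (hw : 0 < w.re) : w * macd 2 w - macd 1 w = w * macd 0 w := by
  have h0 := integrableOn_macd 0 hw
  have h1 := integrableOn_macd 1 hw
  have h2 := integrableOn_macd 2 hw
  have key := integral_Ioi_of_hasDerivAt_of_tendsto' (a := 0) (m := (0 : ℂ))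
    (f := fun θ : ℝ => ((Real.sinh θ : ℝ) : ℂ) * Complex.exp (-w * (Real.cosh θ : ℝ)))
    (f' := fun θ : ℝ =>
      (((Real.cosh θ : ℝ) : ℂ) ^ 1 * Complex.exp (-w * (Real.cosh θ : ℝ)) -
        w * (((Real.cosh θ : ℝ) : ℂ) ^ 2 * Complex.exp (-w * (Real.cosh θ : ℝ)))) +
        w * (((Real.cosh θ : ℝ) : ℂ) ^ 0 * Complex.exp (-w * (Real.cosh θ : ℝ)))) ?_
    ((h1.sub (h2.const_mul w)).add (h0.const_mul w)) ?_
  · have e1 := integral_add (h1.sub (h2.const_mul w)) (h0.const_mul w)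
    have e2 := integral_sub h1 (h2.const_mul w)
    simp only [Pi.sub_apply] at e1
    rw [e1, e2, integral_const_mul, integral_const_mul] at key
    simp only [Real.sinh_zero, Complex.ofReal_zero, zero_mul, sub_zero] at key
    rw [macd, macd, macd]
    linear_combination -key
  · intro θ _
    have hs := (Real.hasDerivAt_sinh θ).ofReal_comp
    have hc := (Real.hasDerivAt_cosh θ).ofReal_comp
    have h := hs.mul ((hc.const_mul (-w)).cexp)
    refine h.congr_deriv ?_
    have hsq : ((Real.cosh θ : ℝ) : ℂ) ^ 2 = ((Real.sinh θ : ℝ) : ℂ) ^ 2 + 1 := by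
      exact_mod_cast Real.cosh_sq θ
    linear_combination (-w * Complex.exp (-w * (Real.cosh θ : ℝ))) * (-hsq)
  · refine squeeze_zero_norm (fun θ => ?_) (tendsto_exp_neg_mul_cosh hw 1)
    rw [norm_mul, Complex.norm_exp, Complex.norm_real, Real.norm_eq_abs]
    simp only [pow_one, Complex.mul_re, Complex.neg_re, Complex.ofReal_re, Complex.neg_im,
      Complex.ofReal_im, mul_zero, sub_zero]
    gcongr
    exact abs_sinh_le_cosh θ

lemma norm_macd_zero_le {w : ℂ} (hw : 1 ≤ w.re) :
    ‖macd 0 w‖ ≤ (∫ θ in Ioi (0 : ℝ), rexp (-Real.cosh θ)) * rexp 1 * rexp (-w.re) := by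
  have hi : IntegrableOn (fun θ : ℝ => rexp (-Real.cosh θ)) (Ioi 0) := by
    have := (integrableOn_macd 0 (w := 1) (by simp)).norm
    simp_rw [norm_macd_integrand] at this
    simpa [IntegrableOn] using this
  rw [mul_assoc, ← integral_mul_const, macd]
  refine norm_integral_le_of_norm_le (hi.mul_const _) ?_
  filter_upwards with θ
  rw [norm_macd_integrand, pow_zero, one_mul, ← Real.exp_add, ← Real.exp_add]
  gcongr
  have := Real.one_le_cosh θ
  nlinarith

end GKL

namespace GKL

open Filter Topology

/-! ### The connection formula -/

lemma eq_of_hasDerivAt_zero {f : ℝ → ℂ} {l : ℂ} (h : ∀ x, 0 < x → HasDerivAt f 0 x)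
    (ht : Tendsto f (𝓝[>] 0) (𝓝 l)) {x : ℝ} (hx : 0 < x) : f x = l := by
  have hc : ∀ y, 0 < y → f y = f x := fun y hy =>
    isOpen_Ioi.is_const_of_deriv_eq_zero (𝕜 := ℝ) (s := Ioi 0) (convex_Ioi 0).isPreconnected
      (fun z hz => (h z hz).differentiableAt.differentiableWithinAt) (fun z hz => (h z hz).deriv) hy hx
  refine tendsto_nhds_unique (tendsto_const_nhds.congr' ?_) ht
  filter_upwards [self_mem_nhdsWithin] with y hy using (hc y hy).symm

lemma tendsto_log_mul_self_nhdsGT :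
    Tendsto (fun x : ℝ => Real.log x * x) (𝓝[>] 0) (𝓝 0) := by
  simpa using tendsto_log_mul_rpow_nhdsGT_zero zero_lt_one

lemma abs_log_le {v : ℝ} (hv : 0 < v) : |Real.log v| ≤ v + 2 * v ^ (-(1 / 2 : ℝ)) := by
  have h1 : Real.log v ≤ v := (Real.log_le_sub_one_of_pos hv).trans (by linarith)
  have h2 := Real.log_le_sub_one_of_pos (Real.rpow_pos_of_pos hv (-(1 / 2 : ℝ)))
  rw [Real.log_rpow hv] at h2
  have h3 := Real.rpow_pos_of_pos hv (-(1 / 2 : ℝ))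
  rw [abs_le]; constructor <;> linarith

lemma integrableOn_log_mul_exp : IntegrableOn (fun v : ℝ => Real.log v * rexp (-v)) (Ioi 0) := by
  have h1 := Real.GammaIntegral_convergent (s := 2) (by norm_num)
  have h2 := Real.GammaIntegral_convergent (s := 1 / 2) (by norm_num)
  refine Integrable.mono' (h1.add (h2.const_mul 2)) ?_ ?_
  · exact (Real.measurable_log.mul (by fun_prop)).aestronglyMeasurable
  · filter_upwards [ae_restrict_mem measurableSet_Ioi] with v hv
    have h := abs_log_le (mem_Ioi.1 hv)
    rw [norm_mul, Real.norm_eq_abs, Real.norm_eq_abs, Real.abs_exp]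
    calc |Real.log v| * rexp (-v) ≤ (v + 2 * v ^ (-(1 / 2 : ℝ))) * rexp (-v) := by gcongr
      _ = _ := by
        simp only [Pi.add_apply]
        norm_num
        ring

lemma integral_log_mul_exp : ∫ v in Ioi (0 : ℝ), Real.log v * rexp (-v) = -eulerMascheroniConstant := by
  have h1 := Complex.hasDerivAt_GammaIntegral (s := 1) (by simp)
  have h2 : Complex.GammaIntegral =ᶠ[𝓝 1] Complex.Gamma := by
    filter_upwards [(isOpen_lt continuous_const Complex.continuous_re).mem_nhds
      (show (0 : ℝ) < (1 : ℂ).re by simp)] with s hs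
    exact (Complex.Gamma_eq_integral hs).symm
  have h3 := (h1.congr_of_eventuallyEq h2.symm).unique Complex.hasDerivAt_Gamma_one
  simp only [sub_self, Complex.cpow_zero, one_mul] at h3
  have h4 : ((∫ v in Ioi (0 : ℝ), Real.log v * rexp (-v) : ℝ) : ℂ) =
    ((-eulerMascheroniConstant : ℝ) : ℂ) := by
    rw [← integral_complex_ofReal]
    push_cast
    simpa using h3
  exact_mod_cast h4

lemma integral_exp_neg_mul_exp {ε : ℝ} (hε : 0 < ε) :
    IntegrableOn (fun θ : ℝ => rexp (-ε * rexp θ)) (Ioi 0) ∧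
    ∫ θ in Ioi (0 : ℝ), rexp (-ε * rexp θ) =
      -Real.log ε * rexp (-ε) + ∫ v in Ioi ε, Real.log v * rexp (-v) := by
  have hsub : Ioi ε ⊆ Ioi 0 := Ioi_subset_Ioi hε.le
  have hlog := integrableOn_log_mul_exp.mono_set hsub
  have hdiv' : IntegrableOn (fun v : ℝ => v⁻¹ * rexp (-v)) (Ioi ε) := by
    have h1 := (integrableOn_exp_mul_Ioi (a := -1) (by norm_num) ε).const_mul ε⁻¹
    refine Integrable.mono' h1 (by fun_prop) ?_
    filter_upwards [ae_restrict_mem measurableSet_Ioi] with v hv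
    have hv' : ε < v := hv
    have : 0 < v := hε.trans hv'
    rw [Real.norm_of_nonneg (by positivity)]
    simp only [neg_mul, one_mul]
    gcongr
  have hdiv : IntegrableOn (fun v : ℝ => v⁻¹ * rexp (-v)) (Ici ε) :=
    (integrableOn_Ici_iff_integrableOn_Ioi).2 hdiv'
  have hinteg : IntegrableOn (fun θ : ℝ => rexp (-ε * rexp θ)) (Ioi 0) := by
    refine Integrable.mono' (integrableOn_exp_mul_Ioi (a := -ε) (by linarith) 0)
      (by fun_prop) ?_
    filter_upwards with θ
    rw [Real.norm_of_nonneg (by positivity)]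
    refine Real.exp_le_exp.2 (mul_le_mul_of_nonpos_left ?_ (by linarith))
    linarith [Real.add_one_le_exp θ]
  refine ⟨hinteg, ?_⟩
  have hcv := integral_deriv_smul_comp_Ioi (f := fun θ => ε * rexp θ) (f' := fun θ => ε * rexp θ)
    (g := fun v : ℝ => v⁻¹ * rexp (-v)) (a := 0) (by fun_prop)
    (Real.tendsto_exp_atTop.const_mul_atTop hε)
    (fun x _ => ((Real.hasDerivAt_exp x).const_mul ε).hasDerivWithinAt)
    ?_ ?_ ?_
  · have e1 : ∀ θ : ℝ, (ε * rexp θ) • ((fun v : ℝ => v⁻¹ * rexp (-v)) ∘ fun θ => ε * rexp θ) θ =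
        rexp (-ε * rexp θ) := fun θ => by
      have := Real.exp_pos θ
      simp only [Function.comp, smul_eq_mul]
      field_simp
    simp only [e1, Real.exp_zero, mul_one] at hcv
    rw [hcv]
    have key := integral_Ioi_of_hasDerivAt_of_tendsto' (a := ε) (m := (0 : ℝ))
      (f := fun v => Real.log v * rexp (-v))
      (f' := fun v => v⁻¹ * rexp (-v) - Real.log v * rexp (-v)) ?_ (hdiv'.sub hlog) ?_
    · have e2 := integral_sub hdiv' hlog
      rw [e2] at key
      linarith
    · intro v hv
      have hv' : v ≠ 0 := (hε.trans_le hv).ne'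
      refine ((Real.hasDerivAt_log hv').mul ((hasDerivAt_neg v).exp)).congr_deriv ?_
      ring
    · have h1 : Tendsto (fun v : ℝ => v ^ 1 * rexp (-v)) atTop (𝓝 0) :=
        Real.tendsto_pow_mul_exp_neg_atTop_nhds_zero 1
      refine squeeze_zero_norm' ?_ h1
      filter_upwards [eventually_ge_atTop 1] with v hv
      rw [norm_mul, Real.norm_eq_abs, Real.norm_eq_abs, Real.abs_exp, pow_one,
        abs_of_nonneg (Real.log_nonneg hv)]
      gcongr
      exact (Real.log_le_sub_one_of_pos (by linarith)).trans (by linarith)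
  · refine ContinuousOn.mul (continuousOn_inv₀.mono ?_) (by fun_prop)
    rintro _ ⟨θ, _, rfl⟩
    have := Real.exp_pos θ
    simp only [mem_compl_iff, mem_singleton_iff]
    positivity
  · refine hdiv.mono_set ?_
    rintro _ ⟨θ, hθ, rfl⟩
    have := Real.one_le_exp (mem_Ici.1 hθ)
    simp only [mem_Ici]
    nlinarith
  · rw [integrableOn_Ici_iff_integrableOn_Ioi]
    refine hinteg.congr_fun (fun θ _ => ?_) measurableSet_Ioi
    have := Real.exp_pos θ
    simp only [Function.comp, smul_eq_mul]
    field_simp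

lemma tendsto_integral_exp_neg_mul_exp :
    Tendsto (fun ε => (∫ θ in Ioi (0 : ℝ), rexp (-ε * rexp θ)) + Real.log ε) (𝓝[>] 0)
      (𝓝 (-eulerMascheroniConstant)) := by
  have h1 : Tendsto (fun ε : ℝ => ∫ v in Ioi ε, Real.log v * rexp (-v)) (𝓝[>] 0)
      (𝓝 (∫ v in Ioi (0 : ℝ), Real.log v * rexp (-v))) := by
    simp_rw [← integral_indicator measurableSet_Ioi]
    refine tendsto_integral_filter_of_dominated_convergence
      (fun v => ‖(Ioi 0).indicator (fun v => Real.log v * rexp (-v)) v‖) ?_ ?_ ?_ ?_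
    · refine Eventually.of_forall fun ε => (Measurable.indicator ?_ measurableSet_Ioi).aestronglyMeasurable
      exact Real.measurable_log.mul (by fun_prop)
    · filter_upwards [self_mem_nhdsWithin] with ε hε
      filter_upwards with v
      exact norm_indicator_le_of_subset (Ioi_subset_Ioi (mem_Ioi.1 hε).le) _ _
    · exact (integrableOn_log_mul_exp.integrable_indicator measurableSet_Ioi).norm
    · filter_upwards with v
      by_cases hv : 0 < v
      · refine tendsto_const_nhds.congr' ?_
        filter_upwards [(Ioo_mem_nhdsGT hv)] with ε hε
        rw [indicator_of_mem (mem_Ioi.2 hv), indicator_of_mem (mem_Ioi.2 hε.2)]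
      · refine tendsto_const_nhds.congr' ?_
        filter_upwards [self_mem_nhdsWithin] with ε hε
        rw [indicator_of_notMem (by simpa using hv), indicator_of_notMem]
        simp only [mem_Ioi, not_lt] at *
        linarith
  rw [integral_log_mul_exp] at h1
  have h2 : Tendsto (fun ε : ℝ => Real.log ε * (1 - rexp (-ε))) (𝓝[>] 0) (𝓝 0) := by
    have h3 : Tendsto (fun ε : ℝ => |Real.log ε * ε|) (𝓝[>] 0) (𝓝 0) := by
      simpa using tendsto_log_mul_self_nhdsGT.abs
    refine squeeze_zero_norm' ?_ h3
    filter_upwards [self_mem_nhdsWithin] with ε hε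
    have hε' : 0 < ε := hε
    rw [Real.norm_eq_abs, abs_mul, abs_mul]
    have h4 : rexp (-ε) ≤ 1 := Real.exp_le_one_iff.2 (by linarith)
    refine mul_le_mul_of_nonneg_left ?_ (abs_nonneg _)
    rw [abs_of_nonneg (by linarith), abs_of_pos hε']
    linarith [Real.add_one_le_exp (-ε)]
  have := h2.add h1
  rw [zero_add] at this
  refine this.congr' ?_
  filter_upwards [self_mem_nhdsWithin] with ε hε
  rw [(integral_exp_neg_mul_exp hε).2]
  ring

lemma macd_zero_ofReal (x : ℝ) :
    macd 0 x = ((∫ θ in Ioi (0 : ℝ), rexp (-x * Real.cosh θ) : ℝ) : ℂ) := by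
  rw [macd, ← integral_complex_ofReal]
  simp

lemma integrableOn_exp_neg_Ioi_zero : IntegrableOn (fun θ : ℝ => rexp (-θ)) (Ioi 0) := by
  simpa using integrableOn_exp_mul_Ioi (a := -1) (by norm_num) 0

lemma tendsto_macd_zero :
    Tendsto (fun x : ℝ => macd 0 x + (Real.log (x / 2) + eulerMascheroniConstant : ℝ)) (𝓝[>] 0)
      (𝓝 0) := by
  have hinteg : ∀ x : ℝ, 0 < x → IntegrableOn (fun θ => rexp (-x * Real.cosh θ)) (Ioi 0) := fun x hx => by
    have := (integrableOn_macd 0 (w := x) (by simpa)).norm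
    simp_rw [norm_macd_integrand] at this
    simpa [IntegrableOn] using this
  have h1 : Tendsto (fun x : ℝ => (∫ θ in Ioi (0 : ℝ), rexp (-(x / 2) * rexp θ)) + Real.log (x / 2))
      (𝓝[>] 0) (𝓝 (-eulerMascheroniConstant)) := by
    refine tendsto_integral_exp_neg_mul_exp.comp (tendsto_nhdsWithin_iff.2 ⟨?_, ?_⟩)
    · have : Tendsto (fun x : ℝ => x / 2) (𝓝 0) (𝓝 (0 / 2)) := tendsto_id.div_const 2
      simpa using this.mono_left nhdsWithin_le_nhds
    · filter_upwards [self_mem_nhdsWithin] with x hx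
      exact half_pos (mem_Ioi.1 hx)
  have h2 : Tendsto (fun x : ℝ => (∫ θ in Ioi (0 : ℝ), rexp (-x * Real.cosh θ)) -
      ∫ θ in Ioi (0 : ℝ), rexp (-(x / 2) * rexp θ)) (𝓝[>] 0) (𝓝 0) := by
    have h3 : Tendsto (fun x : ℝ => x / 2 * ∫ θ in Ioi (0 : ℝ), rexp (-θ)) (𝓝[>] 0) (𝓝 0) := by
      have : Tendsto (fun x : ℝ => x / 2 * ∫ θ in Ioi (0 : ℝ), rexp (-θ)) (𝓝 0)
        (𝓝 (0 / 2 * ∫ θ in Ioi (0 : ℝ), rexp (-θ))) := (tendsto_id.div_const 2).mul_const _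
      simpa using this.mono_left nhdsWithin_le_nhds
    refine squeeze_zero_norm' ?_ h3
    filter_upwards [self_mem_nhdsWithin] with x hx
    have hx' : 0 < x := hx
    rw [← integral_sub (hinteg x hx') (integral_exp_neg_mul_exp (half_pos hx')).1, ← integral_const_mul]
    refine norm_integral_le_of_norm_le (integrableOn_exp_neg_Ioi_zero.const_mul _) ?_
    filter_upwards with θ
    have e : rexp (-x * Real.cosh θ) =
        rexp (-(x / 2) * rexp θ) * rexp (-(x / 2) * rexp (-θ)) := by
      rw [← Real.exp_add, Real.cosh_eq]; ring_nf
    rw [e, Real.norm_eq_abs, abs_sub_comm, ← mul_one_sub, abs_mul, Real.abs_exp]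
    have h5 : rexp (-(x / 2) * rexp θ) ≤ 1 := Real.exp_le_one_iff.2 (by
      have := Real.exp_pos θ; nlinarith)
    have h6 : rexp (-(x / 2) * rexp (-θ)) ≤ 1 := Real.exp_le_one_iff.2 (by
      have := Real.exp_pos (-θ); nlinarith)
    have h7 := Real.add_one_le_exp (-(x / 2) * rexp (-θ))
    rw [abs_of_nonneg (by linarith)]
    calc _ ≤ 1 * (1 - rexp (-(x / 2) * rexp (-θ))) := by gcongr
      _ ≤ _ := by linarith
  have h4 := (h2.add h1).add_const eulerMascheroniConstant
  rw [zero_add, neg_add_cancel] at h4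
  have h5 := (Complex.continuous_ofReal.tendsto 0).comp h4
  rw [Complex.ofReal_zero] at h5
  refine h5.congr fun x => ?_
  rw [macd_zero_ofReal]
  simp only [Function.comp]
  push_cast
  ring

lemma tendsto_mul_macd_one : Tendsto (fun x : ℝ => x * macd 1 x) (𝓝[>] 0) (𝓝 1) := by
  have h1 : Tendsto (fun x : ℝ => (rexp (-x) : ℂ)) (𝓝[>] 0) (𝓝 1) := by
    have : Continuous fun x : ℝ => (rexp (-x) : ℂ) := by fun_prop
    simpa using (this.tendsto 0).mono_left nhdsWithin_le_nhds
  have h2 : Tendsto (fun x : ℝ => x * macd 1 x - rexp (-x)) (𝓝[>] 0) (𝓝 0) := by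
    have h3 : Tendsto (fun x : ℝ => x * ∫ θ in Ioi (0 : ℝ), rexp (-θ)) (𝓝[>] 0) (𝓝 0) := by
      have : Tendsto (fun x : ℝ => x * ∫ θ in Ioi (0 : ℝ), rexp (-θ)) (𝓝 0)
        (𝓝 (0 * ∫ θ in Ioi (0 : ℝ), rexp (-θ))) := tendsto_id.mul_const _
      simpa using this.mono_left nhdsWithin_le_nhds
    refine squeeze_zero_norm' ?_ h3
    filter_upwards [self_mem_nhdsWithin] with x hx
    have hx' : 0 < x := hx
    have hi := (integrableOn_macd 1 (w := x) (by simpa)).const_mul (x : ℂ)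
    have hsi : IntegrableOn (fun θ : ℝ => (x : ℂ) * ((Real.sinh θ : ℝ) : ℂ) *
        Complex.exp (-x * (Real.cosh θ : ℝ))) (Ioi 0) := by
      refine Integrable.mono hi ?_ ?_
      · have := Real.continuous_cosh
        have := Real.continuous_sinh
        exact Continuous.aestronglyMeasurable (by fun_prop)
      · filter_upwards with θ
        rw [mul_assoc, norm_mul, norm_mul, pow_one, norm_mul, norm_mul, Complex.norm_real,
          Complex.norm_real, Complex.norm_real, Real.norm_eq_abs, Real.norm_eq_abs, Real.norm_eq_abs,
          abs_of_pos (Real.cosh_pos θ)]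
        gcongr
        exact abs_sinh_le_cosh θ
    have key := integral_Ioi_of_hasDerivAt_of_tendsto' (a := 0) (m := (0 : ℂ))
      (f := fun θ : ℝ => -Complex.exp (-x * (Real.cosh θ : ℝ)))
      (f' := fun θ : ℝ => (x : ℂ) * ((Real.sinh θ : ℝ) : ℂ) * Complex.exp (-x * (Real.cosh θ : ℝ)))
      ?_ hsi ?_
    · have e1 : (rexp (-x) : ℂ) = ∫ θ in Ioi (0 : ℝ), (x : ℂ) * ((Real.sinh θ : ℝ) : ℂ) *
          Complex.exp (-x * (Real.cosh θ : ℝ)) := by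
        rw [key]; simp
      rw [e1, macd, ← integral_const_mul, ← integral_sub hi hsi, ← integral_const_mul]
      refine norm_integral_le_of_norm_le (integrableOn_exp_neg_Ioi_zero.const_mul _) ?_
      filter_upwards with θ
      have e2 : (x : ℂ) * (((Real.cosh θ : ℝ) : ℂ) ^ 1 * Complex.exp (-x * (Real.cosh θ : ℝ))) -
          (x : ℂ) * ((Real.sinh θ : ℝ) : ℂ) * Complex.exp (-x * (Real.cosh θ : ℝ)) =
          (((x * rexp (-θ) * rexp (-x * Real.cosh θ)) : ℝ) : ℂ) := by
        rw [← Real.cosh_sub_sinh]; push_cast; ring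
      rw [e2, Complex.norm_real, Real.norm_of_nonneg (by positivity)]
      have : rexp (-x * Real.cosh θ) ≤ 1 := Real.exp_le_one_iff.2 (by
        have := Real.cosh_pos θ; nlinarith)
      exact mul_le_of_le_one_right (by positivity) this
    · intro θ _
      have hc := (Real.hasDerivAt_cosh θ).ofReal_comp
      refine ((hc.const_mul (-(x : ℂ))).cexp).neg.congr_deriv ?_
      ring
    · refine squeeze_zero_norm (fun θ => ?_) (tendsto_exp_neg_mul_cosh hx' 0)
      rw [norm_neg, Complex.norm_exp]
      simp
  have := h2.add h1
  simpa using this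

end GKL

namespace GKL

open Filter Topology

/-- The series expression of the Macdonald function. -/
def macdSer (w : ℂ) : ℂ :=
  -(Complex.log (w / 2) + eulerMascheroniConstant) * besA (-w ^ 2 / 4) - besB (-w ^ 2 / 4)

/-- The series expression of `w` times the derivative of the Macdonald function. -/
def macdSerW (w : ℂ) : ℂ :=
  -besA (-w ^ 2 / 4) -
    2 * (Complex.log (w / 2) + eulerMascheroniConstant) * (-w ^ 2 / 4 * besA' (-w ^ 2 / 4)) -
    2 * (-w ^ 2 / 4 * besB' (-w ^ 2 / 4))

lemma hasDerivAt_negSq (w : ℂ) : HasDerivAt (fun w : ℂ => -w ^ 2 / 4) (-w / 2) w := by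
  refine (((hasDerivAt_pow 2 w).neg).div_const 4).congr_deriv ?_
  push_cast; ring

lemma hasDerivAt_logHalf {w : ℂ} (hw : 0 < w.re) :
    HasDerivAt (fun w : ℂ => Complex.log (w / 2) + eulerMascheroniConstant) w⁻¹ w := by
  have h2 : w / 2 ∈ Complex.slitPlane := Or.inl (by simpa using half_pos hw)
  have hw0 : w ≠ 0 := by rintro rfl; simp at hw
  refine ((((hasDerivAt_id w).div_const 2).clog h2).add_const _).congr_deriv ?_
  simp only [id]; field_simp

lemma hasDerivAt_macdSer {w : ℂ} (hw : 0 < w.re) : HasDerivAt macdSer (w⁻¹ * macdSerW w) w := by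
  have hw0 : w ≠ 0 := by rintro rfl; simp at hw
  have hA := (hasDerivAt_besA (-w ^ 2 / 4)).comp w (hasDerivAt_negSq w)
  have hB := (hasDerivAt_besB (-w ^ 2 / 4)).comp w (hasDerivAt_negSq w)
  refine (((hasDerivAt_logHalf hw).neg.mul hA).sub hB).congr_deriv ?_
  simp only [Function.comp, macdSerW, Pi.neg_apply]
  field_simp
  ring

lemma hasDerivAt_macdSerW {w : ℂ} (hw : 0 < w.re) : HasDerivAt macdSerW (w * macdSer w) w := by
  have hw0 : w ≠ 0 := by rintro rfl; simp at hw
  have hA := (hasDerivAt_besA (-w ^ 2 / 4)).comp w (hasDerivAt_negSq w)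
  have hA' := (hasDerivAt_mul_besA' (-w ^ 2 / 4)).comp w (hasDerivAt_negSq w)
  have hB' := (hasDerivAt_mul_besB' (-w ^ 2 / 4)).comp w (hasDerivAt_negSq w)
  refine ((hA.neg.sub (((hasDerivAt_logHalf hw).const_mul 2).mul hA')).sub
    (hB'.const_mul 2)).congr_deriv ?_
  simp only [Function.comp, macdSer]
  field_simp
  ring

lemma besA_neg_sq_ne_zero (x : ℝ) : besA (-(x : ℂ) ^ 2 / 4) ≠ 0 := by
  have h : besA (-(x : ℂ) ^ 2 / 4) = ((∑' m : ℕ, ((x ^ 2 / 4) ^ m / (m.factorial : ℝ) ^ 2) : ℝ) : ℂ) := by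
    rw [besA, pser, Complex.ofReal_tsum]
    refine tsum_congr fun m => ?_
    rw [acoef]
    push_cast
    rw [neg_div, neg_pow ((x : ℂ) ^ 2 / 4) m]
    have : ((-1 : ℂ) ^ m) * (-1) ^ m = 1 := by rw [← mul_pow]; simp
    linear_combination ((x : ℂ) ^ 2 / 4) ^ m / (m.factorial : ℂ) ^ 2 * this
  have hs : Summable fun m : ℕ => (x ^ 2 / 4) ^ m / (m.factorial : ℝ) ^ 2 := by
    refine Summable.of_nonneg_of_le (fun m => by positivity) (fun m => ?_)
      (Real.summable_pow_div_factorial (x ^ 2 / 4))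
    have : (1 : ℝ) ≤ m.factorial := by
      exact_mod_cast Nat.one_le_iff_ne_zero.2 (Nat.factorial_ne_zero m)
    gcongr
    nlinarith
  have h1 := hs.le_tsum 0 (fun m _ => by positivity)
  rw [h]
  simp only [pow_zero, Nat.factorial_zero, Nat.cast_one, one_pow, div_one] at h1
  exact_mod_cast (by linarith : (∑' m : ℕ, ((x ^ 2 / 4) ^ m / (m.factorial : ℝ) ^ 2) : ℝ) > 0).ne'

lemma tendsto_negSq : Tendsto (fun x : ℝ => (-(x : ℂ) ^ 2 / 4)) (𝓝[>] 0) (𝓝 0) := by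
  have : Continuous fun x : ℝ => (-(x : ℂ) ^ 2 / 4) := by fun_prop
  simpa using (this.tendsto 0).mono_left nhdsWithin_le_nhds

lemma tendsto_logHalf_mul_sq :
    Tendsto (fun x : ℝ => (Complex.log ((x : ℂ) / 2) + eulerMascheroniConstant) * (-(x : ℂ) ^ 2 / 4))
      (𝓝[>] 0) (𝓝 0) := by
  have h1 := tendsto_log_mul_self_nhdsGT
  have h2 : Tendsto (fun x : ℝ => (Real.log x * x) * (-x / 4) +
      (eulerMascheroniConstant - Real.log 2) * (-x ^ 2 / 4)) (𝓝[>] 0) (𝓝 0) := by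
    have e1 : Tendsto (fun x : ℝ => -x / 4) (𝓝[>] 0) (𝓝 0) := by
      have : Continuous fun x : ℝ => -x / 4 := by fun_prop
      simpa using (this.tendsto 0).mono_left nhdsWithin_le_nhds
    have e2 : Tendsto (fun x : ℝ => (eulerMascheroniConstant - Real.log 2) * (-x ^ 2 / 4))
        (𝓝[>] 0) (𝓝 0) := by
      have : Continuous fun x : ℝ => (eulerMascheroniConstant - Real.log 2) * (-x ^ 2 / 4) := by fun_prop
      simpa using (this.tendsto 0).mono_left nhdsWithin_le_nhds
    simpa using (h1.mul e1).add e2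
  have h3 := (Complex.continuous_ofReal.tendsto 0).comp h2
  rw [Complex.ofReal_zero] at h3
  refine h3.congr' ?_
  filter_upwards [self_mem_nhdsWithin] with x hx
  have hx' : 0 < x := hx
  have : Complex.log ((x : ℂ) / 2) = ((Real.log x - Real.log 2 : ℝ) : ℂ) := by
    rw [← Real.log_div hx'.ne' (by norm_num), Complex.ofReal_log (by positivity)]
    push_cast; rfl
  rw [this]
  simp only [Function.comp]
  push_cast
  ring

lemma tendsto_macdSerW : Tendsto (fun x : ℝ => macdSerW x) (𝓝[>] 0) (𝓝 (-1)) := by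
  have hA := (continuous_besA.tendsto 0).comp tendsto_negSq
  have hA' := (continuous_besA'.tendsto 0).comp tendsto_negSq
  have hB' := (continuous_besB'.tendsto 0).comp tendsto_negSq
  have h := (hA.neg.sub ((tendsto_logHalf_mul_sq.const_mul 2).mul hA')).sub
    ((tendsto_negSq.const_mul 2).mul hB')
  rw [besA_zero] at h
  simp only [mul_zero, zero_mul, sub_zero] at h
  refine h.congr fun x => ?_
  simp only [Function.comp, macdSerW]
  ring

lemma tendsto_macdSer :
    Tendsto (fun x : ℝ => macdSer x + (Real.log (x / 2) + eulerMascheroniConstant : ℝ)) (𝓝[>] 0)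
      (𝓝 0) := by
  have hB := (continuous_besB.tendsto 0).comp tendsto_negSq
  have hc : ContinuousAt (dslope besA 0) 0 :=
    continuousAt_dslope_same.2 (hasDerivAt_besA 0).differentiableAt
  have hq := hc.tendsto.comp tendsto_negSq
  have h := ((tendsto_logHalf_mul_sq.mul hq).neg).sub hB
  rw [besB_zero] at h
  simp only [zero_mul, neg_zero, sub_zero] at h
  refine h.congr' ?_
  filter_upwards [self_mem_nhdsWithin] with x hx
  have hx' : 0 < x := hx
  have e1 : (-(x : ℂ) ^ 2 / 4) * dslope besA 0 (-(x : ℂ) ^ 2 / 4) = besA (-(x : ℂ) ^ 2 / 4) - 1 := by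
    have := sub_smul_dslope besA 0 (-(x : ℂ) ^ 2 / 4)
    rwa [sub_zero, smul_eq_mul, besA_zero] at this
  have e2 : ((Real.log (x / 2) : ℝ) : ℂ) = Complex.log ((x : ℂ) / 2) := by
    rw [Complex.ofReal_log (by positivity)]
    push_cast; rfl
  simp only [Function.comp, macdSer]
  push_cast
  rw [e2]
  linear_combination (-(Complex.log ((x : ℂ) / 2) + eulerMascheroniConstant)) * e1

lemma macd_eq_macdSer_real {x : ℝ} (hx : 0 < x) : macd 0 x = macdSer x := by
  have hre : ∀ y : ℝ, 0 < y → 0 < (y : ℂ).re := fun y hy => by simpa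
  have hf : ∀ y : ℝ, 0 < y → HasDerivAt (fun y : ℝ => macd 0 y - macdSer y)
      (-macd 1 y - (y : ℂ)⁻¹ * macdSerW y) y := fun y hy =>
    ((hasDerivAt_macd 0 (hre y hy)).sub (hasDerivAt_macdSer (hre y hy))).comp_ofReal
  have hP : ∀ y : ℝ, 0 < y → HasDerivAt (fun y : ℝ => -(y * macd 1 y) - macdSerW y)
      (y * (macd 0 y - macdSer y)) y := fun y hy => by
    have h := (((hasDerivAt_id (y : ℂ)).mul (hasDerivAt_macd 1 (hre y hy))).neg.sub
      (hasDerivAt_macdSerW (hre y hy))).comp_ofReal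
    refine h.congr_deriv ?_
    have := macd_ode (hre y hy)
    simp only [id]
    linear_combination this
  have hI : ∀ y : ℝ, HasDerivAt (fun y : ℝ => besA (-(y : ℂ) ^ 2 / 4))
      (-y / 2 * besA' (-(y : ℂ) ^ 2 / 4)) y := fun y => by
    have h := ((hasDerivAt_besA (-(y : ℂ) ^ 2 / 4)).comp (y : ℂ) (hasDerivAt_negSq y)).comp_ofReal
    refine h.congr_deriv ?_
    ring
  have hI' : ∀ y : ℝ, HasDerivAt (fun y : ℝ => 2 * (-(y : ℂ) ^ 2 / 4 * besA' (-(y : ℂ) ^ 2 / 4)))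
      (y * besA (-(y : ℂ) ^ 2 / 4)) y := fun y => by
    have h := (((hasDerivAt_mul_besA' (-(y : ℂ) ^ 2 / 4)).comp (y : ℂ)
      (hasDerivAt_negSq y)).const_mul 2).comp_ofReal
    refine h.congr_deriv ?_
    ring
  have tA := (continuous_besA.tendsto 0).comp tendsto_negSq
  rw [besA_zero] at tA
  have tA' := (continuous_besA'.tendsto 0).comp tendsto_negSq
  have tf : Tendsto (fun y : ℝ => macd 0 y - macdSer y) (𝓝[>] 0) (𝓝 0) := by
    have := tendsto_macd_zero.sub tendsto_macdSer
    simpa using this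
  have tP : Tendsto (fun y : ℝ => -(y * macd 1 y) - macdSerW y) (𝓝[>] 0) (𝓝 0) := by
    have := tendsto_mul_macd_one.neg.sub tendsto_macdSerW
    simpa using this
  have hW : ∀ y : ℝ, 0 < y → (-(y * macd 1 y) - macdSerW y) * besA (-(y : ℂ) ^ 2 / 4) -
      (macd 0 y - macdSer y) * (2 * (-(y : ℂ) ^ 2 / 4 * besA' (-(y : ℂ) ^ 2 / 4))) = 0 := by
    intro y hy
    refine eq_of_hasDerivAt_zero (f := fun y : ℝ =>
      (-(y * macd 1 y) - macdSerW y) * besA (-(y : ℂ) ^ 2 / 4) -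
      (macd 0 y - macdSer y) * (2 * (-(y : ℂ) ^ 2 / 4 * besA' (-(y : ℂ) ^ 2 / 4))))
      (fun z hz => ?_) ?_ hy
    · refine (((hP z hz).mul (hI z)).sub ((hf z hz).mul (hI' z))).congr_deriv ?_
      have hz0 : (z : ℂ) ≠ 0 := by exact_mod_cast hz.ne'
      field_simp
      ring
    · have := (tP.mul tA).sub (tf.mul ((tendsto_negSq.mul tA').const_mul 2))
      simpa using this
  have hq : (macd 0 x - macdSer x) / besA (-(x : ℂ) ^ 2 / 4) = 0 := by
    refine eq_of_hasDerivAt_zero (f := fun y : ℝ =>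
      (macd 0 y - macdSer y) / besA (-(y : ℂ) ^ 2 / 4)) (fun z hz => ?_) ?_ hx
    · refine ((hf z hz).div (hI z) (besA_neg_sq_ne_zero z)).congr_deriv ?_
      have hz0 : (z : ℂ) ≠ 0 := by exact_mod_cast hz.ne'
      have hA0 := besA_neg_sq_ne_zero z
      rw [div_eq_zero_iff]
      left
      have := hW z hz
      have h2 : (z : ℂ) * ((-macd 1 z - (z : ℂ)⁻¹ * macdSerW z) * besA (-(z : ℂ) ^ 2 / 4) -
        (macd 0 z - macdSer z) * (-z / 2 * besA' (-(z : ℂ) ^ 2 / 4))) = 0 := by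
        rw [← this]; field_simp; ring
      exact (mul_eq_zero.1 h2).resolve_left hz0
    · have := tf.div tA (by norm_num)
      rw [zero_div] at this
      exact this
  have := (div_eq_zero_iff.1 hq).resolve_right (besA_neg_sq_ne_zero x)
  exact sub_eq_zero.1 this

lemma macd_eq_macdSer {w : ℂ} (hw : 0 < w.re) : macd 0 w = macdSer w := by
  have ho : IsOpen {w : ℂ | 0 < w.re} := isOpen_lt continuous_const Complex.continuous_re
  have hc : IsPreconnected {w : ℂ | 0 < w.re} := (convex_halfSpace_re_gt 0).isPreconnected
  have h1 : AnalyticOnNhd ℂ (macd 0) {w : ℂ | 0 < w.re} :=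
    DifferentiableOn.analyticOnNhd (fun w hw =>
      (hasDerivAt_macd 0 hw).differentiableAt.differentiableWithinAt) ho
  have h2 : AnalyticOnNhd ℂ macdSer {w : ℂ | 0 < w.re} :=
    DifferentiableOn.analyticOnNhd (fun w hw =>
      (hasDerivAt_macdSer hw).differentiableAt.differentiableWithinAt) ho
  refine h1.eqOn_of_preconnected_of_frequently_eq h2 hc (z₀ := 1) (by simp) ?_ hw
  have ht : Tendsto (fun n : ℕ => ((1 + 1 / ((n : ℝ) + 1) : ℝ) : ℂ)) atTop (𝓝[≠] 1) := by
    refine tendsto_nhdsWithin_iff.2 ⟨?_, Eventually.of_forall fun n => ?_⟩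
    · have := (tendsto_one_div_add_atTop_nhds_zero_nat (𝕜 := ℝ)).const_add 1
      rw [add_zero] at this
      have h3 := (Complex.continuous_ofReal.tendsto 1).comp this
      rw [Complex.ofReal_one] at h3
      exact h3
    · have : (1 + 1 / ((n : ℝ) + 1) : ℝ) ≠ 1 := by
        have : 0 < 1 / ((n : ℝ) + 1) := by positivity
        linarith
      simp only [mem_compl_iff, mem_singleton_iff]
      exact_mod_cast this
  refine ht.frequently (Eventually.frequently (Eventually.of_forall fun n => ?_))
  exact macd_eq_macdSer_real (by positivity)

/-- In the upper half-plane the outgoing fundamental solution decays exponentially. -/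
lemma norm_Efun_sq_le : ∃ C : ℝ, 0 ≤ C ∧ ∀ z : ℂ, 0 < z.re → 1 / 2 ≤ z.im →
    ‖Efun (z ^ 2)‖ ≤ C * rexp (-2 * z.im) := by
  refine ⟨1 / (2 * π) * ((∫ θ in Ioi (0 : ℝ), rexp (-Real.cosh θ)) * rexp 1), ?_, ?_⟩
  · have : 0 ≤ ∫ θ in Ioi (0 : ℝ), rexp (-Real.cosh θ) := integral_nonneg fun θ => (Real.exp_pos _).le
    positivity
  intro z hre him
  set w : ℂ := -2 * Complex.I * z with hwdef
  have hwre : w.re = 2 * z.im := by simp [hwdef]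
  have hz0 : z ≠ 0 := by rintro rfl; simp at hre
  have hE : Efun (z ^ 2) = 1 / (2 * π) * macd 0 w := by
    have hlog1 : Complex.log (z ^ 2) = 2 * Complex.log z := by
      have hb := Complex.abs_arg_lt_pi_div_two_iff.2 (Or.inl hre)
      rw [abs_lt] at hb
      rw [sq, (Complex.log_mul_eq_add_log_iff hz0 hz0).2 ⟨by linarith, by linarith⟩]
      ring
    have hlog2 : Complex.log (w / 2) = Complex.log z - Complex.I * (π / 2) := by
      have e : w / 2 = -Complex.I * z := by rw [hwdef]; ring
      have ha : 0 ≤ Complex.arg z := Complex.arg_nonneg_iff.2 (by linarith)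
      have hp := Complex.arg_le_pi z
      rw [e, Complex.log_mul_eq_add_log_iff (by simp) hz0 |>.2, Complex.log_neg_I]
      · ring
      · rw [Complex.arg_neg_I]
        constructor <;> linarith [Real.pi_pos]
    have hsq : -w ^ 2 / 4 = z ^ 2 := by
      rw [hwdef, mul_pow, mul_pow, Complex.I_sq]; ring
    rw [macd_eq_macdSer (by rw [hwre]; linarith), macdSer, Efun, hlog1, hlog2, hsq]
    have hpi : (π : ℂ) ≠ 0 := by exact_mod_cast Real.pi_ne_zero
    field_simp
    ring
  rw [hE, norm_mul]
  have h1 := norm_macd_zero_le (w := w) (by rw [hwre]; linarith)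
  have h2 : ‖(1 / (2 * π) : ℂ)‖ = 1 / (2 * π) := by
    rw [show (1 / (2 * π) : ℂ) = ((1 / (2 * π) : ℝ) : ℂ) by push_cast; rfl, Complex.norm_real,
      Real.norm_of_nonneg (by positivity)]
  rw [h2, mul_assoc]
  rw [hwre, ← neg_mul] at h1
  exact mul_le_mul_of_nonneg_left h1 (by positivity)

end GKL

namespace GKL

open Filter Topology
open scoped ENNReal

/-! ### Riesz-type kernels on the plane -/

/-- The kernel `|u|^{-s}`, with values in `[0, ∞]`. -/
def kn (s : ℝ) (u : ℂ) : ℝ≥0∞ := ‖u‖ₑ ^ (-s)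

lemma measurable_kn (s : ℝ) : Measurable (kn s) := by unfold kn; fun_prop

lemma kn_sub_comm (s : ℝ) (z w : ℂ) : kn s (z - w) = kn s (w - z) := by
  rw [kn, kn, enorm_sub_rev]

lemma kn_of_ne {s : ℝ} {u : ℂ} (hu : u ≠ 0) : kn s u = ENNReal.ofReal (‖u‖ ^ (-s)) := by
  rw [kn, ← ofReal_norm, ENNReal.ofReal_rpow_of_pos (norm_pos_iff.2 hu)]

lemma kn_le_one {s : ℝ} (hs : 0 ≤ s) {u : ℂ} (hu : 1 ≤ ‖u‖) : kn s u ≤ 1 := by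
  rw [kn_of_ne (norm_pos_iff.1 (by linarith)), ← ENNReal.ofReal_one]
  exact ENNReal.ofReal_le_ofReal (Real.rpow_le_one_of_one_le_of_nonpos hu (by linarith))

lemma kn_zero_right {s : ℝ} (hs : 0 < s) : kn s 0 = ⊤ := by
  simp [kn, ENNReal.zero_rpow_of_neg (neg_lt_zero.2 hs)]

lemma kn_mul_self (s t : ℝ) (u : ℂ) (h : u ≠ 0) : kn s u * kn t u = kn (s + t) u := by
  rw [kn, kn, kn, ← ENNReal.rpow_add _ _ (by simpa using h) (by simp)]
  congr 1; ring

lemma enorm_inv_le_kn (u : ℂ) : ‖u⁻¹‖ₑ ≤ kn 1 u := by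
  rcases eq_or_ne u 0 with rfl | h
  · simp
  · rw [kn, enorm_inv h, ENNReal.rpow_neg_one]

/-- The integral of `|u|^{-s}` over the unit disc. -/
def knC (s : ℝ) : ℝ≥0∞ := ∫⁻ u in Metric.ball (0 : ℂ) 1, kn s u

lemma knC_lt_top {s : ℝ} (hs : s < 2) : knC s < ⊤ := by
  have h : IntegrableOn (fun u : ℂ => ‖u‖ ^ (-s)) (Metric.ball 0 1) := by
    refine integrableOn_ball_of_norm_le_rpow (C := 1) (α := s) ?_ ?_ ?_ ?_
    · simp [Complex.finrank_real_complex]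
    · simpa [Complex.finrank_real_complex] using hs
    · refine Eventually.of_forall fun x => ?_
      rw [one_mul, Real.norm_of_nonneg (by positivity)]
    · exact (measurable_norm.pow_const (-s)).aestronglyMeasurable
  have h2 := h.2
  rw [HasFiniteIntegral] at h2
  refine lt_of_le_of_lt (le_of_eq ?_) h2
  refine lintegral_congr_ae (ae_restrict_of_ae ?_)
  have h0 : ∀ᵐ u : ℂ, u ≠ 0 := by
    rw [ae_iff]; simp
  filter_upwards [h0] with u hu
  rw [kn_of_ne hu, Real.enorm_of_nonneg (by positivity)]

lemma lintegral_kn_le {s : ℝ} (hs : 0 ≤ s) (S : Set ℂ) (z : ℂ) :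
    ∫⁻ w in S, kn s (w - z) ≤ knC s + volume S := by
  calc ∫⁻ w in S, kn s (w - z)
      ≤ ∫⁻ w in S, ((Metric.ball (0 : ℂ) 1).indicator (kn s) (w - z) + 1) := by
        refine lintegral_mono fun w => ?_
        by_cases h : w - z ∈ Metric.ball (0 : ℂ) 1
        · simp [indicator_of_mem h]
        · rw [indicator_of_notMem h, zero_add]
          exact kn_le_one hs (by simpa using h)
    _ = (∫⁻ w in S, (Metric.ball (0 : ℂ) 1).indicator (kn s) (w - z)) + volume S := by
        rw [lintegral_add_right _ measurable_const]; simp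
    _ ≤ (∫⁻ w, (Metric.ball (0 : ℂ) 1).indicator (kn s) (w - z)) + volume S := by
        exact add_le_add (setLIntegral_le_lintegral _ _) le_rfl
    _ = knC s + volume S := by
        rw [lintegral_sub_right_eq_self (fun w => (Metric.ball (0 : ℂ) 1).indicator (kn s) w) z,
          lintegral_indicator measurableSet_ball, knC]

lemma kn_anti {s : ℝ} (hs : 0 ≤ s) {u v : ℂ} (h : ‖u‖ₑ ≤ ‖v‖ₑ) : kn s v ≤ kn s u := by
  rw [kn, kn, ENNReal.rpow_neg, ENNReal.rpow_neg]
  exact ENNReal.inv_le_inv.2 (ENNReal.rpow_le_rpow h hs)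

lemma kn_mul_kn_le {s t : ℝ} (hs : 0 ≤ s) (ht : 0 ≤ t) (hst : 0 < s + t) (u v : ℂ) :
    kn s u * kn t v ≤ kn (s + t) u + kn (s + t) v := by
  rcases eq_or_ne u 0 with rfl | hu
  · simp [kn_zero_right hst]
  rcases eq_or_ne v 0 with rfl | hv
  · simp [kn_zero_right hst]
  rcases le_total ‖u‖ₑ ‖v‖ₑ with h | h
  · refine le_add_right ?_
    rw [← kn_mul_self s t u hu]
    gcongr
    exact kn_anti ht h
  · refine le_add_left ?_
    rw [← kn_mul_self s t v hv]
    gcongr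
    exact kn_anti hs h

/-- `∫_S |z-w|⁻¹ |z-w'|⁻¹ dz ≲ |w-w'|^{-1/4}`. -/
lemma lintegral_kn_mul_kn_le (S : Set ℂ) (w w' : ℂ) :
    ∫⁻ z in S, kn 1 (z - w) * kn 1 (z - w') ≤
      4 * (knC (7 / 4) + volume S) * kn (1 / 4) (w - w') := by
  rcases eq_or_ne w w' with rfl | hne
  · rw [sub_self, kn_zero_right (by norm_num)]
    rcases eq_or_ne (volume S) 0 with h0 | h0
    · rw [Measure.restrict_eq_zero.2 h0]; simp
    · rw [ENNReal.mul_top]; · exact le_top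
      simp [h0]
  have hne' : w - w' ≠ 0 := sub_ne_zero.2 hne
  have key : ∀ z, kn 1 (z - w) * kn 1 (z - w') ≤
      kn (1 / 4) (w - w') * (2 * (kn (7 / 4) (z - w) + kn (7 / 4) (z - w'))) := by
    intro z
    rcases eq_or_ne z w with rfl | h1
    · rw [sub_self, kn_zero_right (s := 7 / 4) (by norm_num)]
      have : kn (1 / 4) (z - w') ≠ 0 := by simp [kn]
      simp only [top_add]
      rw [ENNReal.mul_top two_ne_zero, ENNReal.mul_top this]
      exact le_top
    rcases eq_or_ne z w' with rfl | h2
    · rw [sub_self, kn_zero_right (s := 7 / 4) (by norm_num)]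
      have : kn (1 / 4) (w - z) ≠ 0 := by simp [kn]
      simp only [add_top]
      rw [ENNReal.mul_top two_ne_zero, ENNReal.mul_top this]
      exact le_top
    have e1 : kn 1 (z - w) = kn (3 / 4) (z - w) * kn (1 / 4) (z - w) := by
      rw [kn_mul_self _ _ _ (sub_ne_zero.2 h1)]; norm_num
    have e2 : kn 1 (z - w') = kn (3 / 4) (z - w') * kn (1 / 4) (z - w') := by
      rw [kn_mul_self _ _ _ (sub_ne_zero.2 h2)]; norm_num
    have tri : kn (1 / 4) (z - w) * kn (1 / 4) (z - w') ≤
        kn (1 / 4) (w - w') * (kn (1 / 4) (z - w) + kn (1 / 4) (z - w')) := by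
      rw [kn_of_ne hne', kn_of_ne (sub_ne_zero.2 h1), kn_of_ne (sub_ne_zero.2 h2),
        ← ENNReal.ofReal_mul (by positivity), ← ENNReal.ofReal_add (by positivity) (by positivity),
        ← ENNReal.ofReal_mul (by positivity)]
      refine ENNReal.ofReal_le_ofReal ?_
      have hx : 0 < ‖z - w‖ := norm_pos_iff.2 (sub_ne_zero.2 h1)
      have hy : 0 < ‖z - w'‖ := norm_pos_iff.2 (sub_ne_zero.2 h2)
      have hd : 0 < ‖w - w'‖ := norm_pos_iff.2 hne'
      have hle : ‖w - w'‖ ≤ ‖z - w‖ + ‖z - w'‖ := by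
        rw [← norm_sub_rev w z]
        calc ‖w - w'‖ = ‖(w - z) + (z - w')‖ := by congr 1; ring
          _ ≤ _ := norm_add_le _ _
      have h4 : ‖w - w'‖ ^ (1 / 4 : ℝ) ≤ ‖z - w‖ ^ (1 / 4 : ℝ) + ‖z - w'‖ ^ (1 / 4 : ℝ) :=
        (Real.rpow_le_rpow hd.le hle (by norm_num)).trans
          (Real.rpow_add_le_add_rpow hx.le hy.le (by norm_num) (by norm_num))
      rw [Real.rpow_neg hx.le, Real.rpow_neg hy.le, Real.rpow_neg hd.le]
      have px : 0 < ‖z - w‖ ^ (1 / 4 : ℝ) := by positivity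
      have py : 0 < ‖z - w'‖ ^ (1 / 4 : ℝ) := by positivity
      have pd : 0 < ‖w - w'‖ ^ (1 / 4 : ℝ) := by positivity
      rw [← mul_inv, inv_add_inv px.ne' py.ne', ← div_eq_inv_mul, div_div, inv_eq_one_div,
        div_le_div_iff₀ (by positivity) (by positivity)]
      nlinarith [mul_pos px py]
    calc kn 1 (z - w) * kn 1 (z - w')
        = (kn (3 / 4) (z - w) * kn (3 / 4) (z - w')) *
            (kn (1 / 4) (z - w) * kn (1 / 4) (z - w')) := by rw [e1, e2]; ring
      _ ≤ (kn (3 / 4) (z - w) * kn (3 / 4) (z - w')) *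
            (kn (1 / 4) (w - w') * (kn (1 / 4) (z - w) + kn (1 / 4) (z - w'))) := by gcongr
      _ = kn (1 / 4) (w - w') * (kn 1 (z - w) * kn (3 / 4) (z - w') +
            kn (3 / 4) (z - w) * kn 1 (z - w')) := by rw [e1, e2]; ring
      _ ≤ kn (1 / 4) (w - w') * ((kn (7 / 4) (z - w) + kn (7 / 4) (z - w')) +
            (kn (7 / 4) (z - w) + kn (7 / 4) (z - w'))) := by
          gcongr
          · have := kn_mul_kn_le (s := 1) (t := 3 / 4) (by norm_num) (by norm_num) (by norm_num)
              (z - w) (z - w')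
            norm_num at this ⊢; exact this
          · have := kn_mul_kn_le (s := 3 / 4) (t := 1) (by norm_num) (by norm_num) (by norm_num)
              (z - w) (z - w')
            norm_num at this ⊢; exact this
      _ = _ := by ring
  have hm : ∀ w : ℂ, Measurable fun z => kn (7 / 4) (z - w) := fun w =>
    (measurable_kn _).comp (measurable_id.sub_const w)
  calc ∫⁻ z in S, kn 1 (z - w) * kn 1 (z - w')
      ≤ ∫⁻ z in S, kn (1 / 4) (w - w') * (2 * (kn (7 / 4) (z - w) + kn (7 / 4) (z - w'))) :=
        lintegral_mono key
    _ = kn (1 / 4) (w - w') * (2 * ((∫⁻ z in S, kn (7 / 4) (z - w)) +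
          ∫⁻ z in S, kn (7 / 4) (z - w'))) := by
        have h2 : Measurable fun z => kn (7 / 4) (z - w) + kn (7 / 4) (z - w') :=
          (hm w).add (hm w')
        rw [← lintegral_add_left (hm w), ← lintegral_const_mul _ h2,
          ← lintegral_const_mul _ (h2.const_mul 2)]
    _ ≤ kn (1 / 4) (w - w') * (2 * ((knC (7 / 4) + volume S) + (knC (7 / 4) + volume S))) := by
        gcongr <;> exact lintegral_kn_le (by norm_num) _ _
    _ = _ := by ring

end GKL

namespace GKL

open Filter Topology ComplexConjugate
open scoped ENNReal

/-! ### Gaussian averages of quadratic oscillations -/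

/-- The oscillating factor `exp(2iτ Re (z - z₀)²)`. -/
def osc (τ : ℝ) (z₀ z : ℂ) : ℂ := Complex.exp (Complex.I * ((2 * τ * ((z - z₀) ^ 2).re : ℝ) : ℂ))

/-- The Gaussian weight `exp(-b|z - a|²)`. -/
def gw (b : ℝ) (a z : ℂ) : ℝ := rexp (-b * ‖z - a‖ ^ 2)

lemma norm_osc (τ : ℝ) (z₀ z : ℂ) : ‖osc τ z₀ z‖ = 1 := by
  rw [osc, Complex.norm_exp]; simp

lemma enorm_osc (τ : ℝ) (z₀ z : ℂ) : ‖osc τ z₀ z‖ₑ = 1 := by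
  rw [← ofReal_norm, norm_osc, ENNReal.ofReal_one]

lemma conj_osc (τ : ℝ) (z₀ z : ℂ) : conj (osc τ z₀ z) = osc (-τ) z₀ z := by
  rw [osc, osc, ← Complex.exp_conj]
  congr 1
  rw [map_mul, Complex.conj_I, Complex.conj_ofReal]
  push_cast; ring

lemma osc_mul_osc_neg (τ : ℝ) (z₀ z : ℂ) : osc τ z₀ z * osc (-τ) z₀ z = 1 := by
  rw [osc, osc, ← Complex.exp_add, ← Complex.exp_zero]
  congr 1
  push_cast; ring

lemma continuous_osc (τ : ℝ) : Continuous fun p : ℂ × ℂ => osc τ p.1 p.2 := by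
  unfold osc; fun_prop

lemma continuous_osc_right (τ : ℝ) (z₀ : ℂ) : Continuous fun z : ℂ => osc τ z₀ z := by
  unfold osc; fun_prop

lemma continuous_gw (b : ℝ) (a : ℂ) : Continuous (gw b a) := by unfold gw; fun_prop

lemma gw_pos (b : ℝ) (a z : ℂ) : 0 < gw b a z := Real.exp_pos _

lemma gw_comm (b : ℝ) (a z : ℂ) : gw b a z = gw b z a := by rw [gw, gw, norm_sub_rev]

lemma integrable_gw {b : ℝ} (hb : 0 < b) (a : ℂ) : Integrable (gw b a) := by
  have h : Integrable fun v : ℂ => Complex.exp (-(b : ℂ) * ‖v‖ ^ 2) := by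
    simpa using GaussianFourier.integrable_cexp_neg_mul_sq_norm_add (V := ℂ) (b := (b : ℂ))
      (by simpa using hb) 0 0
  have h2 := (h.norm).comp_sub_right a
  refine h2.congr (Eventually.of_forall fun z => ?_)
  simp only [gw, Complex.norm_exp]
  congr 1
  rw [← Complex.ofReal_neg, ← Complex.ofReal_pow, ← Complex.ofReal_mul, Complex.ofReal_re]

lemma norm_integral_gw_osc {b : ℝ} (hb : 0 < b) (a : ℂ) (τ : ℝ) (w w' : ℂ) :
    ‖∫ z₀, (gw b a z₀ : ℂ) * (osc τ z₀ w * conj (osc τ z₀ w'))‖ =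
      π / b * rexp (-(4 * τ ^ 2 * ‖w - w'‖ ^ 2 / b)) := by
  rw [← integral_add_right_eq_self _ a]
  have key : ∀ v : ℂ, (gw b a (v + a) : ℂ) * (osc τ (v + a) w * conj (osc τ (v + a) w')) =
      Complex.exp (Complex.I * ((2 * τ * ((w - w') * (w + w' - 2 * a)).re : ℝ) : ℂ)) *
        Complex.exp (-(b : ℂ) * ‖v‖ ^ 2 +
          (-4 * τ * Complex.I) * (inner ℝ (conj (w - w')) v : ℝ)) := by
    intro v
    rw [conj_osc, osc, osc, gw, add_sub_cancel_right, Complex.ofReal_exp, ← Complex.exp_add,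
      ← Complex.exp_add, ← Complex.exp_add]
    congr 1
    have e1 : (2 * τ * ((w - (v + a)) ^ 2).re : ℝ) + (2 * (-τ) * ((w' - (v + a)) ^ 2).re : ℝ) =
        2 * τ * ((w - w') * (w + w' - 2 * a)).re + (-4 * τ) * (inner ℝ (conj (w - w')) v : ℝ) := by
      rw [Complex.inner, Complex.conj_conj]
      have : (w - (v + a)) ^ 2 - (w' - (v + a)) ^ 2 = (w - w') * (w + w' - 2 * a) -
          ((2 : ℝ) : ℂ) * (v * (w - w')) := by push_cast; ring
      have h := congrArg Complex.re this
      rw [Complex.sub_re, Complex.sub_re, Complex.re_ofReal_mul] at h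
      linear_combination (2 * τ) * h
    have e2 := congrArg (fun x : ℝ => (x : ℂ)) e1
    simp only [Complex.ofReal_add] at e2
    rw [← mul_add, e2]
    push_cast; ring
  simp_rw [key]
  rw [integral_const_mul, GaussianFourier.integral_cexp_neg_mul_sq_norm_add
    (by simpa using hb), norm_mul, norm_mul, Complex.norm_exp, Complex.norm_exp]
  have h1 : ((Module.finrank ℝ ℂ : ℂ) / 2) = 1 := by
    rw [Complex.finrank_real_complex]; norm_num
  rw [h1, Complex.cpow_one, ← Complex.ofReal_div, Complex.norm_real,
    Real.norm_of_nonneg (by positivity), RCLike.norm_conj]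
  have h2 : (-4 * (τ : ℂ) * Complex.I) ^ 2 * (‖w - w'‖ : ℂ) ^ 2 / (4 * b) =
      ((-(4 * τ ^ 2 * ‖w - w'‖ ^ 2 / b) : ℝ) : ℂ) := by
    push_cast
    rw [mul_pow, Complex.I_sq]
    have : (b : ℂ) ≠ 0 := by exact_mod_cast hb.ne'
    field_simp
  rw [h2, Complex.ofReal_re]
  simp

lemma exp_neg_sq_le {y : ℝ} (hy : 0 < y) : rexp (-y ^ 2) ≤ y ^ (-(5 / 4) : ℝ) := by
  rw [Real.exp_neg, Real.rpow_neg hy.le]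
  refine inv_anti₀ (by positivity) ?_
  rcases le_total y 1 with h | h
  · exact (Real.rpow_le_one hy.le h (by norm_num)).trans (Real.one_le_exp (by positivity))
  · calc y ^ (5 / 4 : ℝ) ≤ y ^ (2 : ℝ) := Real.rpow_le_rpow_of_exponent_le h (by norm_num)
      _ = y ^ 2 := Real.rpow_two y
      _ ≤ y ^ 2 + 1 := by linarith
      _ ≤ _ := Real.add_one_le_exp _

lemma enorm_integral_gw_osc_le {b : ℝ} (hb : 0 < b) (a : ℂ) {τ : ℝ} (hτ : τ ≠ 0) (w w' : ℂ) :
    ‖∫ z₀, (gw b a z₀ : ℂ) * (osc τ z₀ w * conj (osc τ z₀ w'))‖ₑ ≤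
      ENNReal.ofReal (π / b * (2 * |τ| / √b) ^ (-(5 / 4) : ℝ)) * kn (5 / 4) (w - w') := by
  have hτ' : 0 < |τ| := abs_pos.2 hτ
  rcases eq_or_ne w w' with rfl | h
  · rw [sub_self, kn_zero_right (by norm_num), ENNReal.mul_top]
    · exact le_top
    · rw [ne_eq, ENNReal.ofReal_eq_zero, not_le]; positivity
  have hd : 0 < ‖w - w'‖ := norm_pos_iff.2 (sub_ne_zero.2 h)
  rw [← ofReal_norm, norm_integral_gw_osc hb, kn_of_ne (sub_ne_zero.2 h),
    ← ENNReal.ofReal_mul (by positivity)]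
  refine ENNReal.ofReal_le_ofReal ?_
  rw [mul_assoc (π / b), ← Real.mul_rpow (by positivity) (by positivity)]
  refine mul_le_mul_of_nonneg_left ?_ (by positivity)
  refine le_trans (le_of_eq ?_) (exp_neg_sq_le (by positivity))
  congr 1
  rw [mul_pow, div_pow, mul_pow, sq_abs, Real.sq_sqrt hb.le]
  ring

/-- The averaged square of an oscillatory integral. -/
lemma lintegral_gw_osc_sq_le {b : ℝ} (hb : 0 < b) (a : ℂ) {τ : ℝ} (hτ : τ ≠ 0)
    {μ : Measure ℂ} [SFinite μ] {F : ℂ → ℂ} (hF : Integrable F μ) :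
    ∫⁻ z₀, ENNReal.ofReal (gw b a z₀) * ‖∫ w, F w * osc τ z₀ w ∂μ‖ₑ ^ 2 ≤
      ENNReal.ofReal (π / b * (2 * |τ| / √b) ^ (-(5 / 4) : ℝ)) *
        ∫⁻ w, ∫⁻ w', ‖F w‖ₑ * ‖F w'‖ₑ * kn (5 / 4) (w - w') ∂μ ∂μ := by
  set K := ENNReal.ofReal (π / b * (2 * |τ| / √b) ^ (-(5 / 4) : ℝ))
  set Φ : ℂ → ℂ × ℂ → ℂ := fun z₀ p =>
    (gw b a z₀ : ℂ) * ((F p.1 * osc τ z₀ p.1) * conj (F p.2 * osc τ z₀ p.2)) with hΦ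
  have hFF : Integrable (fun p : ℂ × ℂ => F p.1 * conj (F p.2)) (μ.prod μ) :=
    hF.mul_prod ((LinearIsometryEquiv.integrable_comp_iff Complex.conjLIE).2 hF)
  have hΦi : Integrable (Function.uncurry Φ) (volume.prod (μ.prod μ)) := by
    have h1 : Integrable (fun q : ℂ × (ℂ × ℂ) => (gw b a q.1 : ℂ) * (F q.2.1 * conj (F q.2.2)))
        (volume.prod (μ.prod μ)) := (integrable_gw hb a).ofReal.mul_prod hFF
    have hc : Continuous fun q : ℂ × (ℂ × ℂ) => osc τ q.1 q.2.1 * conj (osc τ q.1 q.2.2) := by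
      have h2 := (continuous_osc τ).comp
        (continuous_fst.prodMk (continuous_fst.comp continuous_snd) :
          Continuous fun q : ℂ × (ℂ × ℂ) => (q.1, q.2.1))
      have h3 := (continuous_osc τ).comp
        (continuous_fst.prodMk (continuous_snd.comp continuous_snd) :
          Continuous fun q : ℂ × (ℂ × ℂ) => (q.1, q.2.2))
      exact h2.mul (Complex.continuous_conj.comp h3)
    have h4 := h1.mul_bdd (c := 1) hc.aestronglyMeasurable (Eventually.of_forall fun q => by
      rw [norm_mul, RCLike.norm_conj, norm_osc, norm_osc, one_mul])
    refine h4.congr (Eventually.of_forall fun q => ?_)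
    simp only [Function.uncurry, hΦ, map_mul]
    ring
  have hin : ∀ z₀, ∫ p, Φ z₀ p ∂(μ.prod μ) =
      ((gw b a z₀ * ‖∫ w, F w * osc τ z₀ w ∂μ‖ ^ 2 : ℝ) : ℂ) := by
    intro z₀
    simp only [hΦ]
    rw [integral_const_mul, integral_prod_mul (fun w => F w * osc τ z₀ w)
      (fun w => conj (F w * osc τ z₀ w)), integral_conj, Complex.mul_conj, Complex.normSq_eq_norm_sq]
    push_cast; rfl
  have hI : Integrable (fun z₀ => gw b a z₀ * ‖∫ w, F w * osc τ z₀ w ∂μ‖ ^ 2) := by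
    have h1 := hΦi.integral_prod_left
    simp only [Function.uncurry] at h1
    simp_rw [hin] at h1
    exact h1.re.congr (Eventually.of_forall fun z => Complex.ofReal_re _)
  have e1 : ∫⁻ z₀, ENNReal.ofReal (gw b a z₀) * ‖∫ w, F w * osc τ z₀ w ∂μ‖ₑ ^ 2 =
      ‖∫ z₀, ∫ p, Φ z₀ p ∂(μ.prod μ)‖ₑ := by
    simp_rw [hin]
    rw [integral_complex_ofReal, ← ofReal_norm, Complex.norm_real, Real.norm_of_nonneg
      (integral_nonneg fun z₀ => mul_nonneg (gw_pos _ _ _).le (by positivity)),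
      ofReal_integral_eq_lintegral_ofReal hI
        (Eventually.of_forall fun z₀ => mul_nonneg (gw_pos _ _ _).le (by positivity))]
    refine lintegral_congr fun z₀ => ?_
    rw [ENNReal.ofReal_mul (gw_pos _ _ _).le, ENNReal.ofReal_pow (norm_nonneg _), ofReal_norm]
  rw [e1, integral_integral_swap hΦi]
  refine (enorm_integral_le_lintegral_enorm _).trans ?_
  have e2 : ∀ p : ℂ × ℂ, ‖∫ z₀, Φ z₀ p‖ₑ ≤ K * (‖F p.1‖ₑ * ‖F p.2‖ₑ * kn (5 / 4) (p.1 - p.2)) := by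
    intro p
    have : ∀ z₀, Φ z₀ p = (F p.1 * conj (F p.2)) *
        ((gw b a z₀ : ℂ) * (osc τ z₀ p.1 * conj (osc τ z₀ p.2))) := by
      intro z₀; simp only [hΦ, map_mul]; ring
    simp_rw [this]
    rw [integral_const_mul, enorm_mul, enorm_mul, RCLike.enorm_conj]
    calc _ ≤ ‖F p.1‖ₑ * ‖F p.2‖ₑ * (K * kn (5 / 4) (p.1 - p.2)) := by
          gcongr; exact enorm_integral_gw_osc_le hb a hτ _ _
      _ = _ := by ring
  refine (lintegral_mono e2).trans ?_
  rw [lintegral_const_mul' _ _ ENNReal.ofReal_ne_top]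
  gcongr
  exact lintegral_prod_le _

end GKL

namespace GKL

open Filter Topology ComplexConjugate
open scoped ENNReal NNReal

/-! ### Bounded measurable functions and the Cauchy transforms -/

/-- Bounded measurable functions on the plane. -/
structure BM (g : ℂ → ℂ) : Prop where
  meas : Measurable g
  bdd : ∃ C : ℝ≥0, ∀ z, ‖g z‖ₑ ≤ C

lemma BM.const (c : ℂ) : BM fun _ => c := ⟨measurable_const, ‖c‖₊, fun _ => le_rfl⟩

lemma BM.add {f g : ℂ → ℂ} (hf : BM f) (hg : BM g) : BM fun z => f z + g z := by
  obtain ⟨C, hC⟩ := hf.bdd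
  obtain ⟨D, hD⟩ := hg.bdd
  refine ⟨hf.meas.add hg.meas, C + D, fun z => ?_⟩
  push_cast
  exact (enorm_add_le _ _).trans (add_le_add (hC z) (hD z))

lemma BM.mul {f g : ℂ → ℂ} (hf : BM f) (hg : BM g) : BM fun z => f z * g z := by
  obtain ⟨C, hC⟩ := hf.bdd
  obtain ⟨D, hD⟩ := hg.bdd
  refine ⟨hf.meas.mul hg.meas, C * D, fun z => ?_⟩
  rw [enorm_mul]; push_cast
  exact mul_le_mul' (hC z) (hD z)

lemma BM.conj {f : ℂ → ℂ} (hf : BM f) : BM fun z => conj (f z) := by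
  obtain ⟨C, hC⟩ := hf.bdd
  exact ⟨Complex.continuous_conj.measurable.comp hf.meas, C, fun z => by
    rw [RCLike.enorm_conj]; exact hC z⟩

lemma BM.osc (τ : ℝ) (z₀ : ℂ) : BM (osc τ z₀) :=
  ⟨(continuous_osc_right τ z₀).measurable, 1, fun z => by rw [enorm_osc]; rfl⟩

lemma BM.integrable {f : ℂ → ℂ} (hf : BM f) {B : Set ℂ} (hB : volume B ≠ ⊤) :
    IntegrableOn f B := by
  obtain ⟨C, hC⟩ := hf.bdd
  have : IsFiniteMeasure (volume.restrict B) := ⟨by simpa using hB.lt_top⟩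
  refine Integrable.of_bound hf.meas.aestronglyMeasurable C (Eventually.of_forall fun z => ?_)
  have := hC z
  rwa [enorm_eq_nnnorm, ENNReal.coe_le_coe] at this

/-- The square of the `L²(B)` norm. -/
def nsq (B : Set ℂ) (g : ℂ → ℂ) : ℝ≥0∞ := ∫⁻ z in B, ‖g z‖ₑ ^ 2

lemma nsq_le {B : Set ℂ} {g : ℂ → ℂ} {C : ℝ≥0∞} (h : ∀ z, ‖g z‖ₑ ≤ C) :
    nsq B g ≤ C ^ 2 * volume B := by
  rw [nsq]
  refine (lintegral_mono fun z => pow_le_pow_left' (h z) 2).trans ?_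
  simp

lemma BM.nsq_ne_top {B : Set ℂ} (hB : volume B ≠ ⊤) {g : ℂ → ℂ} (hg : BM g) : nsq B g ≠ ⊤ := by
  obtain ⟨C, hC⟩ := hg.bdd
  exact ne_top_of_le_ne_top (by finiteness) (nsq_le hC)

lemma nsq_conj (B : Set ℂ) (g : ℂ → ℂ) : nsq B (fun z => conj (g z)) = nsq B g := by
  simp only [nsq, RCLike.enorm_conj]

lemma nsq_mul_le (B : Set ℂ) (f g : ℂ → ℂ) (M : ℝ≥0) (h : ∀ z, ‖f z‖ₑ ≤ M) :
    nsq B (fun z => f z * g z) ≤ M ^ 2 * nsq B g := by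
  rw [nsq, nsq, ← lintegral_const_mul' _ _ (by finiteness)]
  refine lintegral_mono fun z => ?_
  rw [enorm_mul, mul_pow]
  exact mul_le_mul_left (pow_le_pow_left' (h z) 2) _

lemma add_sq_le_two_mul (a b : ℝ≥0∞) : (a + b) ^ 2 ≤ 2 * (a ^ 2 + b ^ 2) := by
  rcases eq_or_ne a ⊤ with rfl | ha
  · simp
  rcases eq_or_ne b ⊤ with rfl | hb
  · simp
  lift a to ℝ≥0 using ha
  lift b to ℝ≥0 using hb
  exact_mod_cast add_sq_le (a := a) (b := b)

lemma nsq_add_le (B : Set ℂ) {f g : ℂ → ℂ} (hf : Measurable f) :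
    nsq B (fun z => f z + g z) ≤ 2 * (nsq B f + nsq B g) := by
  rw [nsq, nsq, nsq, ← lintegral_add_left (by fun_prop), ← lintegral_const_mul' _ _ (by simp)]
  refine lintegral_mono fun z => ?_
  exact (pow_le_pow_left' (enorm_add_le _ _) 2).trans (add_sq_le_two_mul _ _)

lemma sq_lintegral_mul_le {μ : Measure ℂ} {f g : ℂ → ℝ≥0∞} (hf : AEMeasurable f μ)
    (hg : AEMeasurable g μ) :
    (∫⁻ z, f z * g z ∂μ) ^ 2 ≤ (∫⁻ z, f z ^ 2 ∂μ) * ∫⁻ z, g z ^ 2 ∂μ := by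
  have h := ENNReal.lintegral_mul_le_Lp_mul_Lq μ Real.HolderConjugate.two_two hf hg
  simp only [Pi.mul_apply, ENNReal.rpow_two] at h
  refine (pow_le_pow_left' h 2).trans (le_of_eq ?_)
  rw [mul_pow, ← ENNReal.rpow_two, ← ENNReal.rpow_two, ← ENNReal.rpow_mul, ← ENNReal.rpow_mul]
  norm_num

/-- Weighted Cauchy–Schwarz. -/
lemma sq_lintegral_mul_le_weight {μ : Measure ℂ} {k g : ℂ → ℝ≥0∞} (hk : AEMeasurable k μ)
    (hg : AEMeasurable g μ) :
    (∫⁻ z, k z * g z ∂μ) ^ 2 ≤ (∫⁻ z, k z ∂μ) * ∫⁻ z, k z * g z ^ 2 ∂μ := by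
  have hs : ∀ z, k z ^ (1 / 2 : ℝ) * k z ^ (1 / 2 : ℝ) = k z := fun z => by
    rw [← ENNReal.rpow_add_of_nonneg _ _ (by norm_num) (by norm_num)]; norm_num
  have h := sq_lintegral_mul_le (μ := μ) (f := fun z => k z ^ (1 / 2 : ℝ))
    (g := fun z => k z ^ (1 / 2 : ℝ) * g z) (by fun_prop) (by fun_prop)
  simp only [← mul_assoc, hs, mul_pow, sq (k _ ^ (1 / 2 : ℝ))] at h
  exact h

/-- The solid Cauchy transform over `B`. -/
def cau (B : Set ℂ) (g : ℂ → ℂ) (z : ℂ) : ℂ := (π : ℂ)⁻¹ * ∫ w in B, g w * (z - w)⁻¹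

/-- The conjugate solid Cauchy transform over `B`. -/
def cauc (B : Set ℂ) (g : ℂ → ℂ) (z : ℂ) : ℂ := (π : ℂ)⁻¹ * ∫ w in B, g w * (conj (z - w))⁻¹

lemma cauc_eq (B : Set ℂ) (g : ℂ → ℂ) (z : ℂ) :
    cauc B g z = conj (cau B (fun w => conj (g w)) z) := by
  rw [cau, cauc, map_mul, map_inv₀, Complex.conj_ofReal, ← integral_conj]
  simp only [map_mul, map_inv₀, Complex.conj_conj]

lemma cau_eq (B : Set ℂ) (g : ℂ → ℂ) (z : ℂ) :
    cau B g z = conj (cauc B (fun w => conj (g w)) z) := by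
  rw [cauc_eq]; simp

lemma enorm_pi_inv_le : ‖(π : ℂ)⁻¹‖ₑ ≤ 1 := by
  rw [← ofReal_norm, norm_inv, Complex.norm_real, Real.norm_of_nonneg pi_pos.le,
    ← ENNReal.ofReal_one]
  exact ENNReal.ofReal_le_ofReal (inv_le_one_of_one_le₀ (by linarith [pi_gt_three]))

lemma enorm_cau_le (B : Set ℂ) (g : ℂ → ℂ) (z : ℂ) :
    ‖cau B g z‖ₑ ≤ ∫⁻ w in B, kn 1 (w - z) * ‖g w‖ₑ := by
  rw [cau, enorm_mul]
  refine (mul_le_of_le_one_left' enorm_pi_inv_le).trans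
    ((enorm_integral_le_lintegral_enorm _).trans (lintegral_mono fun w => ?_))
  rw [enorm_mul, mul_comm]
  refine mul_le_mul_left ?_ _
  rw [kn_sub_comm]
  exact enorm_inv_le_kn _

/-- The Schur constant of the Cauchy transform. -/
def schur (B : Set ℂ) : ℝ≥0∞ := knC 1 + volume B

lemma schur_ne_top {B : Set ℂ} (hB : volume B ≠ ⊤) : schur B ≠ ⊤ :=
  ENNReal.add_ne_top.2 ⟨(knC_lt_top (by norm_num)).ne, hB⟩

lemma measurable_cau (B : Set ℂ) {g : ℂ → ℂ} (hg : Measurable g) : Measurable (cau B g) := by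
  have h : StronglyMeasurable (Function.uncurry fun z w : ℂ => g w * (z - w)⁻¹) := by
    apply Measurable.stronglyMeasurable
    simp only [Function.uncurry_def]; fun_prop
  exact (h.integral_prod_right (ν := volume.restrict B)).measurable.const_mul _

lemma BM.cau {B : Set ℂ} (hB : volume B ≠ ⊤) {g : ℂ → ℂ} (hg : BM g) : BM (cau B g) := by
  obtain ⟨C, hC⟩ := hg.bdd
  refine ⟨measurable_cau B hg.meas, (schur B).toNNReal * C, fun z => ?_⟩
  push_cast
  rw [ENNReal.coe_toNNReal (schur_ne_top hB)]
  refine (enorm_cau_le B g z).trans ?_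
  refine (lintegral_mono fun w => mul_le_mul_right (hC w) _).trans ?_
  rw [lintegral_mul_const' _ _ (by finiteness)]
  exact mul_le_mul_left (lintegral_kn_le (by norm_num) B z) _

lemma BM.cauc {B : Set ℂ} (hB : volume B ≠ ⊤) {g : ℂ → ℂ} (hg : BM g) : BM (cauc B g) := by
  have : GKL.cauc B g = fun z => (starRingEnd ℂ) (GKL.cau B (fun w => (starRingEnd ℂ) (g w)) z) :=
    funext fun z => cauc_eq B g z
  rw [this]
  exact (hg.conj.cau hB).conj

lemma nsq_cau_le (B : Set ℂ) {g : ℂ → ℂ} (hg : Measurable g) :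
    nsq B (cau B g) ≤ schur B ^ 2 * nsq B g := by
  calc nsq B (cau B g) ≤ ∫⁻ z in B, schur B * ∫⁻ w in B, kn 1 (w - z) * ‖g w‖ₑ ^ 2 := by
        refine lintegral_mono fun z => ?_
        refine (pow_le_pow_left' (enorm_cau_le B g z) 2).trans ?_
        have hk : Measurable fun w : ℂ => kn 1 (w - z) :=
          (measurable_kn 1).comp (measurable_id.sub_const z)
        refine (sq_lintegral_mul_le_weight hk.aemeasurable (by fun_prop)).trans ?_
        exact mul_le_mul_left (lintegral_kn_le (by norm_num) B z) _
    _ = schur B * ∫⁻ w in B, ∫⁻ z in B, kn 1 (w - z) * ‖g w‖ₑ ^ 2 := by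
        have hm : Measurable fun p : ℂ × ℂ => kn 1 (p.2 - p.1) * ‖g p.2‖ₑ ^ 2 :=
          ((measurable_kn 1).comp (measurable_snd.sub measurable_fst)).mul (by fun_prop)
        rw [lintegral_const_mul _ hm.lintegral_prod_right', lintegral_lintegral_swap]
        exact hm.aemeasurable
    _ ≤ schur B * ∫⁻ w in B, schur B * ‖g w‖ₑ ^ 2 := by
        gcongr with w
        rw [lintegral_mul_const' _ _ (by finiteness)]
        simp_rw [kn_sub_comm 1 w]
        exact mul_le_mul_left (lintegral_kn_le (by norm_num) B w) _
    _ = _ := by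
        rw [lintegral_const_mul _ (by fun_prop), ← mul_assoc, ← sq, nsq]

lemma nsq_cauc_le (B : Set ℂ) {g : ℂ → ℂ} (hg : Measurable g) :
    nsq B (cauc B g) ≤ schur B ^ 2 * nsq B g := by
  have : cauc B g = fun z => conj (cau B (fun w => conj (g w)) z) :=
    funext fun z => cauc_eq B g z
  rw [this, nsq_conj, ← nsq_conj B g]
  exact nsq_cau_le B (Complex.continuous_conj.measurable.comp hg)

end GKL

namespace GKL

open Filter Topology ComplexConjugate
open scoped ENNReal NNReal

/-! ### The iterated kernel -/

/-- The kernel of the operator `g ↦ C[e⁻¹ C̄[g]]`. -/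
def aker (B : Set ℂ) (τ : ℝ) (z₀ z x : ℂ) : ℂ :=
  ∫ w in B, ((z - w)⁻¹ * (conj (w - x))⁻¹) * osc (-τ) z₀ w

/-- The squared Hilbert–Schmidt norm of the kernel `aker`. -/
def hsq (B : Set ℂ) (τ : ℝ) (z₀ : ℂ) : ℝ≥0∞ :=
  ∫⁻ z in B, ∫⁻ x in B, ‖aker B τ z₀ z x‖ₑ ^ 2

lemma enorm_conj_inv_le_kn (u : ℂ) : ‖(conj u)⁻¹‖ₑ ≤ kn 1 u := by
  rw [← map_inv₀, RCLike.enorm_conj]; exact enorm_inv_le_kn u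

lemma enorm_kernel_le (z w x : ℂ) :
    ‖(z - w)⁻¹ * (conj (w - x))⁻¹‖ₑ ≤ kn 1 (w - z) * kn 1 (w - x) := by
  rw [enorm_mul, kn_sub_comm 1 w z]
  exact mul_le_mul' (enorm_inv_le_kn _) (enorm_conj_inv_le_kn _)

/-- The constant in the pointwise bound of `aker`. -/
def akC (B : Set ℂ) : ℝ≥0∞ := 4 * (knC (7 / 4) + volume B)

lemma akC_ne_top {B : Set ℂ} (hB : volume B ≠ ⊤) : akC B ≠ ⊤ :=
  ENNReal.mul_ne_top (by simp)
    (ENNReal.add_ne_top.2 ⟨(knC_lt_top (by norm_num)).ne, hB⟩)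

lemma enorm_aker_le (B : Set ℂ) (τ : ℝ) (z₀ z x : ℂ) :
    ‖aker B τ z₀ z x‖ₑ ≤ akC B * kn (1 / 4) (z - x) := by
  refine (enorm_integral_le_lintegral_enorm _).trans
    (le_trans (lintegral_mono fun w => ?_) (lintegral_kn_mul_kn_le B z x))
  rw [enorm_mul, enorm_osc, mul_one]
  exact enorm_kernel_le z w x

lemma measurable_kernel : Measurable fun p : (ℂ × ℂ) × ℂ =>
    (p.1.1 - p.2)⁻¹ * (conj (p.2 - p.1.2))⁻¹ := by
  have : Measurable fun p : (ℂ × ℂ) × ℂ => conj (p.2 - p.1.2) :=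
    Complex.continuous_conj.measurable.comp (by fun_prop)
  exact (by fun_prop : Measurable fun p : (ℂ × ℂ) × ℂ => (p.1.1 - p.2)⁻¹).mul this.inv

lemma measurable_aker (B : Set ℂ) (τ : ℝ) :
    Measurable fun p : ℂ × (ℂ × ℂ) => aker B τ p.1 p.2.1 p.2.2 := by
  have h : StronglyMeasurable (Function.uncurry fun (p : ℂ × (ℂ × ℂ)) (w : ℂ) =>
      ((p.2.1 - w)⁻¹ * (conj (w - p.2.2))⁻¹) * osc (-τ) p.1 w) := by
    apply Measurable.stronglyMeasurable
    simp only [Function.uncurry_def]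
    have h1 : Measurable fun q : (ℂ × (ℂ × ℂ)) × ℂ => ((q.1.2.1, q.1.2.2), q.2) := by fun_prop
    have h2 : Measurable fun q : (ℂ × (ℂ × ℂ)) × ℂ => (q.1.1, q.2) := by fun_prop
    have h3 := measurable_kernel.comp h1
    have h4 := (continuous_osc (-τ)).measurable.comp h2
    simp only [Function.comp_def] at h3 h4
    exact h3.mul h4
  exact (h.integral_prod_right (ν := volume.restrict B)).measurable

lemma measurable_aker_right (B : Set ℂ) (τ : ℝ) (z₀ z : ℂ) : Measurable (aker B τ z₀ z) := by
  have h1 : Measurable fun x : ℂ => (z₀, (z, x)) := by fun_prop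
  have h2 := (measurable_aker B τ).comp h1
  simpa only [Function.comp_def] using h2

/-- The constant in the uniform square bound of `aker`. -/
def akS (B : Set ℂ) : ℝ≥0∞ := akC B ^ 2 * (knC (1 / 2) + volume B)

lemma akS_ne_top {B : Set ℂ} (hB : volume B ≠ ⊤) : akS B ≠ ⊤ :=
  ENNReal.mul_ne_top (ENNReal.pow_ne_top (akC_ne_top hB))
    (ENNReal.add_ne_top.2 ⟨(knC_lt_top (by norm_num)).ne, hB⟩)

lemma kn_sq (s : ℝ) (u : ℂ) : kn s u ^ 2 = kn (2 * s) u := by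
  rw [kn, kn, ← ENNReal.rpow_two, ← ENNReal.rpow_mul]; congr 1; ring

lemma lintegral_aker_sq_le {B : Set ℂ} (hB : volume B ≠ ⊤) (τ : ℝ) (z₀ z : ℂ) :
    ∫⁻ x in B, ‖aker B τ z₀ z x‖ₑ ^ 2 ≤ akS B := by
  calc _ ≤ ∫⁻ x in B, akC B ^ 2 * kn (1 / 2) (x - z) := by
        refine lintegral_mono fun x => ?_
        refine (pow_le_pow_left' (enorm_aker_le B τ z₀ z x) 2).trans (le_of_eq ?_)
        rw [mul_pow, kn_sq, kn_sub_comm]; norm_num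
    _ ≤ _ := by
        rw [lintegral_const_mul' _ _ (ENNReal.pow_ne_top (akC_ne_top hB)), akS]
        exact mul_le_mul_right (lintegral_kn_le (by norm_num) B z) _

/-- The operator `g ↦ C[e⁻¹ ¼ C̄[e q g]]`. -/
def opA (B : Set ℂ) (q : ℂ → ℂ) (τ : ℝ) (z₀ : ℂ) (g : ℂ → ℂ) : ℂ → ℂ :=
  cau B fun w => osc (-τ) z₀ w * (1 / 4 * cauc B (fun x => osc τ z₀ x * (q x * g x)) w)

lemma BM.opA {B : Set ℂ} (hB : volume B ≠ ⊤) {q g : ℂ → ℂ} (hq : BM q) (hg : BM g) (τ : ℝ)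
    (z₀ : ℂ) : BM (opA B q τ z₀ g) :=
  ((BM.osc (-τ) z₀).mul ((BM.const (1 / 4)).mul
    (((BM.osc τ z₀).mul (hq.mul hg)).cauc hB))).cau hB

lemma opA_eq {B : Set ℂ} (hB : volume B ≠ ⊤) {q g : ℂ → ℂ} (hq : BM q) (hg : BM g) (τ : ℝ)
    (z₀ z : ℂ) : opA B q τ z₀ g z =
      (π : ℂ)⁻¹ * (π : ℂ)⁻¹ * (1 / 4) *
        ∫ x in B, aker B τ z₀ z x * (osc τ z₀ x * (q x * g x)) := by
  have hf : BM fun x => osc τ z₀ x * (q x * g x) := (BM.osc τ z₀).mul (hq.mul hg)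
  set f := fun x => osc τ z₀ x * (q x * g x) with hfdef
  obtain ⟨C, hC⟩ := hf.bdd
  have hinteg : Integrable (Function.uncurry fun w x : ℂ =>
      ((z - w)⁻¹ * (conj (w - x))⁻¹) * osc (-τ) z₀ w * f x)
      ((volume.restrict B).prod (volume.restrict B)) := by
    have hm1 : Measurable fun p : ℂ × ℂ => ((z, p.2), p.1) := by fun_prop
    have hm : Measurable (Function.uncurry fun w x : ℂ =>
        ((z - w)⁻¹ * (conj (w - x))⁻¹) * osc (-τ) z₀ w * f x) :=
      ((measurable_kernel.comp hm1).mul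
        ((continuous_osc_right (-τ) z₀).measurable.comp measurable_fst)).mul
        (hf.meas.comp measurable_snd)
    refine ⟨hm.aestronglyMeasurable, ?_⟩
    rw [HasFiniteIntegral, lintegral_prod _ hm.enorm.aemeasurable]
    calc _ ≤ ∫⁻ w in B, ∫⁻ x in B, kn 1 (w - z) * (C * kn 1 (x - w)) := by
          refine lintegral_mono fun w => lintegral_mono fun x => ?_
          simp only [Function.uncurry]
          rw [enorm_mul, enorm_mul, enorm_osc, mul_one, mul_comm (C : ℝ≥0∞), ← mul_assoc,
            kn_sub_comm 1 x w]
          exact mul_le_mul' (enorm_kernel_le z w x) (hC x)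
      _ ≤ ∫⁻ w in B, kn 1 (w - z) * (C * schur B) := by
          refine lintegral_mono fun w => ?_
          have hk : Measurable fun x : ℂ => kn 1 (x - w) :=
            (measurable_kn 1).comp (measurable_id.sub_const w)
          rw [lintegral_const_mul _ (hk.const_mul _), lintegral_const_mul _ hk]
          exact mul_le_mul_right (mul_le_mul_right (lintegral_kn_le (by norm_num) B w) _) _
      _ ≤ schur B * (C * schur B) := by
          have hk : Measurable fun x : ℂ => kn 1 (x - z) :=
            (measurable_kn 1).comp (measurable_id.sub_const z)
          rw [lintegral_mul_const _ hk]
          exact mul_le_mul_left (lintegral_kn_le (by norm_num) B z) _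
      _ < ⊤ := by
          have := schur_ne_top hB
          exact (ENNReal.mul_ne_top this (ENNReal.mul_ne_top ENNReal.coe_ne_top this)).lt_top
  have e1 : ∀ x, aker B τ z₀ z x * (osc τ z₀ x * (q x * g x)) =
      ∫ w in B, ((z - w)⁻¹ * (conj (w - x))⁻¹) * osc (-τ) z₀ w * f x := fun x => by
    rw [integral_mul_const, aker]
  simp_rw [e1]
  rw [← integral_integral_swap hinteg, opA, cau, mul_assoc, mul_assoc]
  congr 1
  rw [← integral_const_mul, ← integral_const_mul]
  refine integral_congr_ae (Eventually.of_forall fun w => ?_)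
  simp only [cauc]
  have e2 : ∀ x, (z - w)⁻¹ * (conj (w - x))⁻¹ * osc (-τ) z₀ w * f x =
      ((z - w)⁻¹ * osc (-τ) z₀ w) * (f x * (conj (w - x))⁻¹) := fun x => by ring
  simp_rw [e2]
  rw [integral_const_mul]
  ring

lemma enorm_opA_sq_le {B : Set ℂ} (hB : volume B ≠ ⊤) {q g : ℂ → ℂ} (hq : BM q) (hg : BM g)
    {M : ℝ≥0} (hM : ∀ z, ‖q z‖ₑ ≤ M) (τ : ℝ) (z₀ z : ℂ) :
    ‖opA B q τ z₀ g z‖ₑ ^ 2 ≤ M ^ 2 * (∫⁻ x in B, ‖aker B τ z₀ z x‖ₑ ^ 2) * nsq B g := by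
  have h1 : ‖opA B q τ z₀ g z‖ₑ ≤ M * ∫⁻ x in B, ‖aker B τ z₀ z x‖ₑ * ‖g x‖ₑ := by
    rw [opA_eq hB hq hg, enorm_mul, enorm_mul, enorm_mul]
    have h4 : ‖(1 / 4 : ℂ)‖ₑ ≤ 1 := by
      rw [← ofReal_norm, ← ENNReal.ofReal_one]
      exact ENNReal.ofReal_le_ofReal (by norm_num)
    refine (mul_le_of_le_one_left' (mul_le_one' (mul_le_one' enorm_pi_inv_le enorm_pi_inv_le)
      h4)).trans ((enorm_integral_le_lintegral_enorm _).trans ?_)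
    rw [← lintegral_const_mul' _ _ ENNReal.coe_ne_top]
    refine lintegral_mono fun x => ?_
    rw [enorm_mul, enorm_mul, enorm_mul, enorm_osc, one_mul]
    calc _ ≤ ‖aker B τ z₀ z x‖ₑ * (M * ‖g x‖ₑ) := by gcongr; exact hM x
      _ = _ := by ring
  refine (pow_le_pow_left' h1 2).trans ?_
  rw [mul_pow, mul_assoc]
  refine mul_le_mul_right ?_ _
  exact sq_lintegral_mul_le ((measurable_aker_right B τ z₀ z).enorm.aemeasurable)
    hg.meas.enorm.aemeasurable

lemma nsq_opA_le {B : Set ℂ} (hB : volume B ≠ ⊤) {q g : ℂ → ℂ} (hq : BM q) (hg : BM g)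
    {M : ℝ≥0} (hM : ∀ z, ‖q z‖ₑ ≤ M) (τ : ℝ) (z₀ : ℂ) :
    nsq B (opA B q τ z₀ g) ≤ M ^ 2 * hsq B τ z₀ * nsq B g := by
  refine (lintegral_mono fun z => enorm_opA_sq_le hB hq hg hM τ z₀ z).trans (le_of_eq ?_)
  have := hg.nsq_ne_top hB
  rw [lintegral_mul_const' _ _ this, lintegral_const_mul' _ _ (by finiteness), hsq]

/-- The Neumann series terms. -/
def nterm (B : Set ℂ) (q : ℂ → ℂ) (τ : ℝ) (z₀ : ℂ) : ℕ → ℂ → ℂ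
  | 0 => fun _ => 1
  | n + 1 => opA B q τ z₀ (nterm B q τ z₀ n)

lemma BM.nterm {B : Set ℂ} (hB : volume B ≠ ⊤) {q : ℂ → ℂ} (hq : BM q) (τ : ℝ) (z₀ : ℂ) :
    ∀ n, BM (nterm B q τ z₀ n)
  | 0 => BM.const 1
  | n + 1 => BM.opA hB hq (BM.nterm hB hq τ z₀ n) τ z₀

lemma exists_nterm_bound {B : Set ℂ} (hB : volume B ≠ ⊤) {q : ℂ → ℂ} (hq : BM q)
    {M : ℝ≥0} (hM : ∀ z, ‖q z‖ₑ ≤ M) {τ : ℝ} {z₀ : ℂ} (hH : M ^ 2 * hsq B τ z₀ ≤ 1 / 4) :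
    ∃ D : ℝ≥0, ∀ n z, ‖nterm B q τ z₀ (n + 1) z‖ ≤ D * (1 / 2) ^ n := by
  have h1 : ∀ n, nsq B (nterm B q τ z₀ n) ≤ (1 / 4) ^ n * volume B := by
    intro n
    induction n with
    | zero => simpa using nsq_le (B := B) (g := nterm B q τ z₀ 0) (C := 1) (fun z => by simp [nterm])
    | succ n ih =>
      refine (nsq_opA_le hB hq (BM.nterm hB hq τ z₀ n) hM τ z₀).trans ?_
      rw [pow_succ' (1 / 4 : ℝ≥0∞), mul_assoc (1 / 4 : ℝ≥0∞)]
      exact mul_le_mul' hH ih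
  have hK : (M : ℝ≥0∞) ^ 2 * akS B * volume B ≠ ⊤ :=
    ENNReal.mul_ne_top (ENNReal.mul_ne_top (by finiteness) (akS_ne_top hB)) hB
  set K := ((M : ℝ≥0∞) ^ 2 * akS B * volume B).toNNReal with hKdef
  refine ⟨NNReal.sqrt K, fun n z => ?_⟩
  have h2 : ‖nterm B q τ z₀ (n + 1) z‖ₑ ^ 2 ≤ K * (1 / 4) ^ n := by
    refine (enorm_opA_sq_le hB hq (BM.nterm hB hq τ z₀ n) hM τ z₀ z).trans ?_
    rw [hKdef, ENNReal.coe_toNNReal hK]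
    calc _ ≤ (M : ℝ≥0∞) ^ 2 * akS B * ((1 / 4) ^ n * volume B) := by
          gcongr
          · exact lintegral_aker_sq_le hB τ z₀ z
          · exact h1 n
      _ = _ := by ring
  have h3 : ‖nterm B q τ z₀ (n + 1) z‖₊ ^ 2 ≤ K * (1 / 4) ^ n := by
    have e : ((1 / 4 : ℝ≥0) : ℝ≥0∞) = 1 / 4 := by
      rw [ENNReal.coe_div (by norm_num)]; norm_num
    rw [enorm_eq_nnnorm, ← e] at h2
    exact_mod_cast h2
  have h4 : ‖nterm B q τ z₀ (n + 1) z‖ ^ 2 ≤ K * (1 / 4) ^ n := by exact_mod_cast h3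
  refine abs_le_of_sq_le_sq' ?_ (by positivity) |>.2
  rw [mul_pow, Real.coe_sqrt, Real.sq_sqrt (NNReal.coe_nonneg K), ← pow_mul, mul_comm n 2, pow_mul]
  norm_num at h4 ⊢
  exact h4

end GKL

namespace GKL

open Filter Topology ComplexConjugate
open scoped ENNReal NNReal

/-! ### Geometrical optics correction terms -/

lemma exists_nterm_bound_all {B : Set ℂ} (hB : volume B ≠ ⊤) {q : ℂ → ℂ} (hq : BM q)
    {M : ℝ≥0} (hM : ∀ z, ‖q z‖ₑ ≤ M) {τ : ℝ} {z₀ : ℂ} (hH : M ^ 2 * hsq B τ z₀ ≤ 1 / 4) :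
    ∃ D : ℝ≥0, ∀ n z, ‖nterm B q τ z₀ n z‖ ≤ D * (1 / 2) ^ n := by
  obtain ⟨D, hD⟩ := exists_nterm_bound hB hq hM hH
  refine ⟨1 + 2 * D, fun n z => ?_⟩
  have hD0 : (0 : ℝ) ≤ D := D.2
  push_cast
  cases n with
  | zero => simp [nterm]
  | succ n =>
    refine (hD n z).trans ?_
    rw [pow_succ]
    have : (0 : ℝ) < (1 / 2) ^ n := by positivity
    nlinarith

lemma integrable_aker {B : Set ℂ} (hB : volume B ≠ ⊤) (τ : ℝ) (z₀ z : ℂ) :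
    IntegrableOn (aker B τ z₀ z) B := by
  refine ⟨(measurable_aker_right B τ z₀ z).aestronglyMeasurable, ?_⟩
  rw [HasFiniteIntegral]
  refine lt_of_le_of_lt (lintegral_mono fun x => enorm_aker_le B τ z₀ z x) ?_
  rw [lintegral_const_mul' _ _ (akC_ne_top hB)]
  refine (ENNReal.mul_ne_top (akC_ne_top hB)
    (ne_top_of_le_ne_top (b := knC (1 / 4) + volume B) ?_ ?_)).lt_top
  · exact ENNReal.add_ne_top.2 ⟨(knC_lt_top (by norm_num)).ne, hB⟩
  · simp_rw [kn_sub_comm (1 / 4) z]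
    exact lintegral_kn_le (by norm_num) B z

/-- The constant controlling the correction terms. -/
def cgoC (B : Set ℂ) (M : ℝ≥0) : ℝ≥0∞ :=
  4 * schur B ^ 2 + 2 * (1 + schur B ^ 2 * (M ^ 2 * (4 * schur B ^ 2)))

lemma cgoC_ne_top {B : Set ℂ} (hB : volume B ≠ ⊤) (M : ℝ≥0) : cgoC B M ≠ ⊤ := by
  have := schur_ne_top hB
  unfold cgoC
  finiteness

/-- The squared norm of `C̄[e q]`. -/
def osn (B : Set ℂ) (q : ℂ → ℂ) (τ : ℝ) (z₀ : ℂ) : ℝ≥0∞ :=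
  nsq B (cauc B fun x => osc τ z₀ x * q x)

lemma exists_correction {B : Set ℂ} (hB : volume B ≠ ⊤) {q : ℂ → ℂ} (hq : BM q)
    {M : ℝ≥0} (hM : ∀ z, ‖q z‖ₑ ≤ M) {τ : ℝ} {z₀ : ℂ} (hH : M ^ 2 * hsq B τ z₀ ≤ 1 / 4) :
    ∃ r : ℂ → ℂ, BM r ∧ ∀ z, r z = opA B q τ z₀ (fun x => 1 + r x) z := by
  obtain ⟨D, hD⟩ := exists_nterm_bound_all hB hq hM hH
  have hgeo : Summable fun n : ℕ => (D : ℝ) * (1 / 2) ^ n :=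
    (summable_geometric_of_lt_one (by norm_num) (by norm_num)).mul_left _
  have hsum : ∀ z, Summable fun n => nterm B q τ z₀ n z := fun z =>
    Summable.of_norm_bounded hgeo fun n => hD n z
  have hs_bdd : ∀ z, ‖∑' n, nterm B q τ z₀ n z‖ ≤ D * 2 := fun z => by
    have h2 : HasSum (fun n : ℕ => (D : ℝ) * (1 / 2) ^ n) (D * 2) :=
      hasSum_geometric_two.mul_left _
    exact tsum_of_norm_bounded h2 fun n => hD n z
  have hs : BM fun z => ∑' n, nterm B q τ z₀ n z := by
    refine ⟨?_, D * 2, fun z => ?_⟩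
    · refine measurable_of_tendsto_metrizable (f := fun N z => ∑ n ∈ Finset.range N,
        nterm B q τ z₀ n z) (fun N => ?_) ?_
      · exact Finset.measurable_fun_sum _ fun n _ => (BM.nterm hB hq τ z₀ n).meas
      · exact tendsto_pi_nhds.2 fun z => (hsum z).hasSum.tendsto_sum_nat
    · rw [enorm_eq_nnnorm, ENNReal.coe_le_coe]
      exact_mod_cast hs_bdd z
  have hfix : ∀ z, opA B q τ z₀ (fun x => ∑' n, nterm B q τ z₀ n x) z =
      ∑' n, nterm B q τ z₀ (n + 1) z := by
    intro z
    have hbase : IntegrableOn (fun x => aker B τ z₀ z x * (osc τ z₀ x * q x)) B := by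
      refine (integrable_aker hB τ z₀ z).mul_bdd (c := M)
        ((BM.osc τ z₀).mul hq).meas.aestronglyMeasurable (Eventually.of_forall fun x => ?_)
      have := hM x
      rw [enorm_eq_nnnorm, ENNReal.coe_le_coe] at this
      rw [norm_mul, norm_osc, one_mul]; exact_mod_cast this
    have hF : ∀ n, IntegrableOn
        (fun x => aker B τ z₀ z x * (osc τ z₀ x * (q x * nterm B q τ z₀ n x))) B := fun n => by
      refine (hbase.mul_bdd (c := D * (1 / 2) ^ n)
        (BM.nterm hB hq τ z₀ n).meas.aestronglyMeasurable
        (Eventually.of_forall fun x => hD n x)).congr (Eventually.of_forall fun x => ?_)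
      simp only; ring
    have h := hasSum_integral_of_summable_integral_norm hF (by
      refine Summable.of_nonneg_of_le (fun n => integral_nonneg fun _ => norm_nonneg _)
        (fun n => ?_) (hgeo.mul_left (∫ x in B, ‖aker B τ z₀ z x * (osc τ z₀ x * q x)‖))
      rw [← integral_mul_const]
      refine integral_mono (hF n).norm (hbase.norm.mul_const _) fun x => ?_
      simp only [← mul_assoc, norm_mul _ (nterm B q τ z₀ n x)]
      rw [mul_assoc _ (D : ℝ)]
      exact mul_le_mul_of_nonneg_left (hD n x) (norm_nonneg _))
    rw [opA_eq hB hq hs]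
    have e : ∀ x, aker B τ z₀ z x * (osc τ z₀ x * (q x * ∑' n, nterm B q τ z₀ n x)) =
        ∑' n, aker B τ z₀ z x * (osc τ z₀ x * (q x * nterm B q τ z₀ n x)) := fun x => by
      rw [tsum_mul_left, tsum_mul_left, tsum_mul_left]
    simp_rw [e]
    rw [← h.tsum_eq, ← tsum_mul_left]
    refine tsum_congr fun n => ?_
    rw [nterm, opA_eq hB hq (BM.nterm hB hq τ z₀ n)]
  have hsplit : ∀ z, ∑' n, nterm B q τ z₀ n z = 1 + ∑' n, nterm B q τ z₀ (n + 1) z := fun z => by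
    rw [(hsum z).tsum_eq_zero_add]; rfl
  refine ⟨fun z => -1 + ∑' n, nterm B q τ z₀ n z, (BM.const (-1)).add hs, fun z => ?_⟩
  simp only [add_neg_cancel_left]
  rw [hfix, hsplit]
  ring

lemma opA_add {B : Set ℂ} (hB : volume B ≠ ⊤) {q f g : ℂ → ℂ} (hq : BM q) (hf : BM f)
    (hg : BM g) (τ : ℝ) (z₀ z : ℂ) : opA B q τ z₀ (fun x => f x + g x) z =
      opA B q τ z₀ f z + opA B q τ z₀ g z := by
  have hi : ∀ {g : ℂ → ℂ}, BM g →
      IntegrableOn (fun x => aker B τ z₀ z x * (osc τ z₀ x * (q x * g x))) B := fun {g} hg => by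
    have hb := (BM.osc τ z₀).mul (hq.mul hg)
    obtain ⟨C, hC⟩ := hb.bdd
    refine (integrable_aker hB τ z₀ z).mul_bdd (c := C) hb.meas.aestronglyMeasurable
      (Eventually.of_forall fun x => ?_)
    have := hC x
    rw [enorm_eq_nnnorm, ENNReal.coe_le_coe] at this
    exact_mod_cast this
  rw [opA_eq hB hq (hf.add hg), opA_eq hB hq hf, opA_eq hB hq hg, ← mul_add,
    ← integral_add (hi hf) (hi hg)]
  congr 1
  refine integral_congr_ae (Eventually.of_forall fun x => ?_)
  simp only; ring

lemma BM.integrable_cauc_kernel {B : Set ℂ} (hB : volume B ≠ ⊤) {g : ℂ → ℂ} (hg : BM g) (z : ℂ) :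
    IntegrableOn (fun x => g x * (starRingEnd ℂ (z - x))⁻¹) B := by
  obtain ⟨C, hC⟩ := hg.bdd
  have hm : Measurable fun x : ℂ => (starRingEnd ℂ (z - x))⁻¹ :=
    (Complex.continuous_conj.measurable.comp (by fun_prop)).inv
  refine ⟨(hg.meas.mul hm).aestronglyMeasurable, ?_⟩
  rw [HasFiniteIntegral]
  calc _ ≤ ∫⁻ x in B, C * kn 1 (x - z) := by
        refine lintegral_mono fun x => ?_
        rw [enorm_mul, kn_sub_comm]
        exact mul_le_mul' (hC x) (enorm_conj_inv_le_kn _)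
    _ ≤ C * schur B := by
        rw [lintegral_const_mul' _ _ ENNReal.coe_ne_top]
        exact mul_le_mul_right (lintegral_kn_le (by norm_num) B z) _
    _ < ⊤ := (ENNReal.mul_ne_top ENNReal.coe_ne_top (schur_ne_top hB)).lt_top

lemma cauc_add {B : Set ℂ} (hB : volume B ≠ ⊤) {f g : ℂ → ℂ} (hf : BM f)
    (hg : BM g) (z : ℂ) : cauc B (fun x => f x + g x) z = cauc B f z + cauc B g z := by
  rw [cauc, cauc, cauc, ← mul_add,
    ← integral_add (hf.integrable_cauc_kernel hB z) (hg.integrable_cauc_kernel hB z)]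
  congr 1
  refine integral_congr_ae (Eventually.of_forall fun x => ?_)
  simp only; ring

lemma nsq_quarter_mul_le (B : Set ℂ) (g : ℂ → ℂ) :
    nsq B (fun z => 1 / 4 * g z) ≤ nsq B g := by
  refine (nsq_mul_le B (fun _ => 1 / 4) g 1 fun z => ?_).trans (by simp)
  rw [← ofReal_norm, ENNReal.coe_one, ← ENNReal.ofReal_one]
  exact ENNReal.ofReal_le_ofReal (by norm_num)

/-- The correction terms of complex geometrical optics solutions. -/
lemma exists_cgo {B : Set ℂ} (hB : volume B ≠ ⊤) {q : ℂ → ℂ} (hq : BM q)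
    {M : ℝ≥0} (hM : ∀ z, ‖q z‖ₑ ≤ M) {τ : ℝ} {z₀ : ℂ} (hH : M ^ 2 * hsq B τ z₀ ≤ 1 / 4) :
    ∃ r h : ℂ → ℂ, BM r ∧ BM h ∧ (∀ z, r z = cau B (fun w => osc (-τ) z₀ w * h w) z) ∧
      (∀ z, h z = 1 / 4 * cauc B (fun x => osc τ z₀ x * (q x * (1 + r x))) z) ∧
      nsq B r ≤ cgoC B M * osn B q τ z₀ ∧ nsq B h ≤ cgoC B M * osn B q τ z₀ := by
  obtain ⟨r, hr, hfix⟩ := exists_correction hB hq hM hH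
  have h1r : BM fun x => 1 + r x := (BM.const 1).add hr
  have hbase : nsq B (opA B q τ z₀ fun _ => 1) ≤ schur B ^ 2 * osn B q τ z₀ := by
    have hb : BM fun x => osc τ z₀ x * (q x * 1) := (BM.osc τ z₀).mul (hq.mul (BM.const 1))
    refine (nsq_cau_le B ((BM.osc (-τ) z₀).mul ((BM.const (1 / 4)).mul (hb.cauc hB))).meas).trans
      (mul_le_mul_right ?_ _)
    refine (nsq_mul_le B _ _ 1 fun z => by rw [enorm_osc]; rfl).trans ?_
    simp only [ENNReal.coe_one, one_pow, one_mul]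
    refine (nsq_quarter_mul_le B _).trans ?_
    simp only [mul_one]; exact le_rfl
  have hnr : nsq B r ≤ 4 * schur B ^ 2 * osn B q τ z₀ := by
    have e : r = fun z => opA B q τ z₀ (fun _ => 1) z + opA B q τ z₀ r z :=
      funext fun z => by rw [hfix, opA_add hB hq (BM.const 1) hr]
    have h1 : nsq B r ≤ 2 * (nsq B (opA B q τ z₀ fun _ => 1) + 1 / 4 * nsq B r) := by
      conv_lhs => rw [e]
      refine (nsq_add_le B (BM.opA hB hq (BM.const 1) τ z₀).meas).trans ?_
      refine mul_le_mul_right (add_le_add le_rfl ?_) _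
      exact (nsq_opA_le hB hq hr hM τ z₀).trans (mul_le_mul_left hH _)
    have hfin := hr.nsq_ne_top hB
    have hfin2 := (BM.opA hB hq (BM.const 1) τ z₀).nsq_ne_top hB
    have h2 : nsq B r ≤ 4 * nsq B (opA B q τ z₀ fun _ => 1) := by
      rw [← ENNReal.toReal_le_toReal hfin (by finiteness)]
      rw [← ENNReal.toReal_le_toReal hfin (by finiteness)] at h1
      rw [ENNReal.toReal_mul, ENNReal.toReal_add hfin2 (by finiteness), ENNReal.toReal_mul] at h1
      rw [ENNReal.toReal_mul]
      norm_num at h1 ⊢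
      linarith
    refine h2.trans ?_
    rw [mul_assoc]
    exact mul_le_mul_right hbase _
  have hb : BM fun x => osc τ z₀ x * (q x * (1 + r x)) := (BM.osc τ z₀).mul (hq.mul h1r)
  refine ⟨r, fun z => 1 / 4 * cauc B (fun x => osc τ z₀ x * (q x * (1 + r x))) z, hr,
    (BM.const (1 / 4)).mul (hb.cauc hB), hfix, fun z => rfl, ?_, ?_⟩
  · refine hnr.trans (mul_le_mul_left ?_ _)
    rw [cgoC]; exact le_self_add
  · have hb1 : BM fun x => osc τ z₀ x * q x := (BM.osc τ z₀).mul hq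
    have hb2 : BM fun x => osc τ z₀ x * (q x * r x) := (BM.osc τ z₀).mul (hq.mul hr)
    have e : cauc B (fun x => osc τ z₀ x * (q x * (1 + r x))) = fun z =>
        cauc B (fun x => osc τ z₀ x * q x) z + cauc B (fun x => osc τ z₀ x * (q x * r x)) z := by
      funext z
      rw [← cauc_add hB hb1 hb2]
      congr 1; funext x; ring
    refine (nsq_quarter_mul_le B _).trans ?_
    rw [e]
    refine (nsq_add_le B (hb1.cauc hB).meas).trans ?_
    calc _ ≤ 2 * (osn B q τ z₀ + schur B ^ 2 * (M ^ 2 * (4 * schur B ^ 2 * osn B q τ z₀))) := by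
          refine mul_le_mul_right (add_le_add le_rfl ((nsq_cauc_le B hb2.meas).trans ?_)) _
          refine mul_le_mul_right ?_ _
          refine (nsq_mul_le B _ _ 1 fun z => by rw [enorm_osc]; rfl).trans ?_
          simp only [ENNReal.coe_one, one_pow, one_mul]
          exact (nsq_mul_le B _ _ M hM).trans (mul_le_mul_right hnr _)
      _ = 2 * (1 + schur B ^ 2 * (M ^ 2 * (4 * schur B ^ 2))) * osn B q τ z₀ := by ring
      _ ≤ _ := by
          refine mul_le_mul_left ?_ _
          rw [cgoC]; exact le_add_self

end GKL

namespace GKL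

open Filter Topology ComplexConjugate
open scoped ENNReal NNReal

/-! ### Averages of the error terms -/

/-- The decaying factor in the averaged bounds. -/
def avK (b τ : ℝ) : ℝ≥0∞ := ENNReal.ofReal (π / b * (2 * |τ| / √b) ^ (-(5 / 4) : ℝ))

lemma avK_ne_top (b τ : ℝ) : avK b τ ≠ ⊤ := ENNReal.ofReal_ne_top

lemma avK_neg (b τ : ℝ) : avK b (-τ) = avK b τ := by rw [avK, avK, abs_neg]

lemma kn_mul_self_of_pos {s t : ℝ} (hs : 0 < s) (ht : 0 < t) (u : ℂ) :
    kn s u * kn t u = kn (s + t) u := by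
  rcases eq_or_ne u 0 with rfl | h
  · rw [kn_zero_right hs, kn_zero_right ht, kn_zero_right (add_pos hs ht)]; simp
  · exact kn_mul_self s t u h

lemma measurable_kn_sub (s : ℝ) : Measurable fun p : ℂ × ℂ => kn s (p.1 - p.2) :=
  (measurable_kn s).comp (measurable_fst.sub measurable_snd)

lemma lintegral_gw_osc_sq_le' {b : ℝ} (hb : 0 < b) (a : ℂ) {τ : ℝ} (hτ : τ ≠ 0)
    {μ : Measure ℂ} [SFinite μ] (F : ℂ → ℂ) :
    ∫⁻ z₀, ENNReal.ofReal (gw b a z₀) * ‖∫ w, F w * osc τ z₀ w ∂μ‖ₑ ^ 2 ≤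
      avK b τ * ∫⁻ w, ∫⁻ w', ‖F w‖ₑ * ‖F w'‖ₑ * kn (5 / 4) (w - w') ∂μ ∂μ := by
  by_cases hF : Integrable F μ
  · exact lintegral_gw_osc_sq_le hb a hτ hF
  · have h0 : ∀ z₀, ∫ w, F w * osc τ z₀ w ∂μ = 0 := fun z₀ => by
      refine integral_undef fun h => hF ?_
      refine (h.mul_bdd (c := 1) (continuous_osc_right (-τ) z₀).aestronglyMeasurable
        (Eventually.of_forall fun w => (norm_osc _ _ _).le)).congr
        (Eventually.of_forall fun w => ?_)
      simp only [mul_assoc, osc_mul_osc_neg, mul_one]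
    simp [h0]

lemma lintegral_gw_family_le {P : Type*} [MeasurableSpace P] {ν : Measure P} [SFinite ν]
    {B : Set ℂ} {F : P → ℂ → ℂ} (hF : Measurable (Function.uncurry F)) {A : ℝ≥0∞} (hA : A ≠ ⊤)
    {s : ℝ} (hs : 0 < s)
    (hFA : ∀ w w', ∫⁻ p, ‖F p w‖ₑ * ‖F p w'‖ₑ ∂ν ≤ A * kn s (w - w'))
    {b : ℝ} (hb : 0 < b) (a : ℂ) {τ : ℝ} (hτ : τ ≠ 0) :
    ∫⁻ z₀, ENNReal.ofReal (gw b a z₀) * ∫⁻ p, ‖∫ w in B, F p w * osc τ z₀ w‖ₑ ^ 2 ∂ν ≤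
      avK b τ * (A * (knC (5 / 4 + s) + volume B) * volume B) := by
  have hm0 : StronglyMeasurable (Function.uncurry fun (u : ℂ × P) (w : ℂ) =>
      F u.2 w * osc τ u.1 w) := by
    apply Measurable.stronglyMeasurable
    simp only [Function.uncurry_def]
    have h1 : Measurable fun u : (ℂ × P) × ℂ => (u.1.2, u.2) := by fun_prop
    have h2 : Measurable fun u : (ℂ × P) × ℂ => (u.1.1, u.2) := by fun_prop
    have h3 := hF.comp h1
    have h4 := (continuous_osc τ).measurable.comp h2
    simp only [Function.comp_def, Function.uncurry_def] at h3 h4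
    exact h3.mul h4
  have hm1 : Measurable fun u : ℂ × P => ‖∫ w in B, F u.2 w * osc τ u.1 w‖ₑ ^ 2 :=
    ((hm0.integral_prod_right (ν := volume.restrict B)).measurable.enorm).pow_const 2
  have hm2 : Measurable fun u : ℂ × P =>
      ENNReal.ofReal (gw b a u.1) * ‖∫ w in B, F u.2 w * osc τ u.1 w‖ₑ ^ 2 :=
    ((continuous_gw b a).measurable.comp measurable_fst).ennreal_ofReal.mul hm1
  have hFn : Measurable fun u : (P × ℂ) × ℂ =>
      ‖F u.1.1 u.1.2‖ₑ * ‖F u.1.1 u.2‖ₑ * kn (5 / 4) (u.1.2 - u.2) := by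
    have h1 : Measurable fun u : (P × ℂ) × ℂ => (u.1.1, u.2) := by fun_prop
    have h2 : Measurable fun u : (P × ℂ) × ℂ => (u.1.2, u.2) := by fun_prop
    have h3 := hF.comp h1
    have h4 := hF.comp (measurable_fst : Measurable fun u : (P × ℂ) × ℂ => u.1)
    have h5 := (measurable_kn_sub (5 / 4)).comp h2
    simp only [Function.comp_def, Function.uncurry_def] at h3 h4 h5
    exact (h4.enorm.mul h3.enorm).mul h5
  have hFn' : ∀ w, Measurable fun u : P × ℂ =>
      ‖F u.1 w‖ₑ * ‖F u.1 u.2‖ₑ * kn (5 / 4) (w - u.2) := fun w => by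
    have h1 : Measurable fun u : P × ℂ => ((u.1, w), u.2) := by fun_prop
    have h2 := hFn.comp h1
    simpa only [Function.comp_def] using h2
  calc _ = ∫⁻ z₀, ∫⁻ p, ENNReal.ofReal (gw b a z₀) * ‖∫ w in B, F p w * osc τ z₀ w‖ₑ ^ 2 ∂ν := by
        refine lintegral_congr fun z₀ => ?_
        rw [lintegral_const_mul' _ _ ENNReal.ofReal_ne_top]
    _ = ∫⁻ p, (∫⁻ z₀, ENNReal.ofReal (gw b a z₀) * ‖∫ w in B, F p w * osc τ z₀ w‖ₑ ^ 2) ∂ν :=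
        lintegral_lintegral_swap hm2.aemeasurable
    _ ≤ ∫⁻ p, (avK b τ * ∫⁻ w in B, ∫⁻ w' in B,
          ‖F p w‖ₑ * ‖F p w'‖ₑ * kn (5 / 4) (w - w')) ∂ν :=
        lintegral_mono fun p => lintegral_gw_osc_sq_le' hb a hτ _
    _ = avK b τ * ∫⁻ w in B, ∫⁻ p, (∫⁻ w' in B,
          ‖F p w‖ₑ * ‖F p w'‖ₑ * kn (5 / 4) (w - w')) ∂ν := by
        rw [lintegral_const_mul' _ _ (avK_ne_top b τ)]
        congr 1
        exact lintegral_lintegral_swap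
          (f := fun p w => ∫⁻ w' in B, ‖F p w‖ₑ * ‖F p w'‖ₑ * kn (5 / 4) (w - w'))
          (hFn.lintegral_prod_right' (ν := volume.restrict B)).aemeasurable
    _ = avK b τ * ∫⁻ w in B, ∫⁻ w' in B, ∫⁻ p,
          ‖F p w‖ₑ * ‖F p w'‖ₑ * kn (5 / 4) (w - w') ∂ν := by
        congr 1
        exact lintegral_congr fun w => lintegral_lintegral_swap (hFn' w).aemeasurable
    _ ≤ avK b τ * ∫⁻ w in B, ∫⁻ w' in B, A * kn (5 / 4 + s) (w' - w) := by
        refine mul_le_mul_right (lintegral_mono fun w => lintegral_mono fun w' => ?_) _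
        have h1 : Measurable fun p => ‖F p w‖ₑ * ‖F p w'‖ₑ := by
          have h3 := hF.comp (by fun_prop : Measurable fun p : P => (p, w))
          have h4 := hF.comp (by fun_prop : Measurable fun p : P => (p, w'))
          simp only [Function.comp_def, Function.uncurry_def] at h3 h4
          exact h3.enorm.mul h4.enorm
        rw [lintegral_mul_const _ h1]
        refine (mul_le_mul_left (hFA w w') _).trans (le_of_eq ?_)
        rw [mul_assoc, mul_comm (kn s _), kn_mul_self_of_pos (by norm_num) hs, kn_sub_comm]
    _ ≤ avK b τ * ∫⁻ w in B, A * (knC (5 / 4 + s) + volume B) := by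
        refine mul_le_mul_right (lintegral_mono fun w => ?_) _
        rw [lintegral_const_mul' _ _ hA]
        exact mul_le_mul_right (lintegral_kn_le (by linarith) B w) _
    _ = _ := by simp

/-- The constant in `lintegral_gw_osn_le`. -/
def osnC (B : Set ℂ) (M : ℝ≥0) : ℝ≥0∞ :=
  M ^ 2 * akC B * (knC (5 / 4 + 1 / 4) + volume B) * volume B

lemma osnC_ne_top {B : Set ℂ} (hB : volume B ≠ ⊤) (M : ℝ≥0) : osnC B M ≠ ⊤ := by
  have h1 := akC_ne_top hB
  have h2 := (knC_lt_top (s := 5 / 4 + 1 / 4) (by norm_num)).ne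
  unfold osnC
  finiteness

lemma lintegral_gw_osn_le {B : Set ℂ} (hB : volume B ≠ ⊤) {q : ℂ → ℂ} (hq : BM q)
    {M : ℝ≥0} (hM : ∀ z, ‖q z‖ₑ ≤ M) {b : ℝ} (hb : 0 < b) (a : ℂ) {τ : ℝ} (hτ : τ ≠ 0) :
    ∫⁻ z₀, ENNReal.ofReal (gw b a z₀) * osn B q τ z₀ ≤ avK b τ * osnC B M := by
  have hF : Measurable (Function.uncurry fun z w : ℂ => q w * (conj (z - w))⁻¹) := by
    have h1 : Measurable fun p : ℂ × ℂ => conj (p.1 - p.2) :=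
      Complex.continuous_conj.measurable.comp (by fun_prop)
    exact (hq.meas.comp measurable_snd).mul h1.inv
  refine le_trans (lintegral_mono fun z₀ => mul_le_mul_right ?_ _)
    (lintegral_gw_family_le (ν := volume.restrict B) (B := B) hF (A := M ^ 2 * akC B)
      (ENNReal.mul_ne_top (by finiteness) (akC_ne_top hB)) (s := 1 / 4) (by norm_num)
      (fun w w' => ?_) hb a hτ)
  · rw [osn, nsq]
    refine lintegral_mono fun z => pow_le_pow_left' ?_ 2
    rw [cauc, enorm_mul]
    refine (mul_le_of_le_one_left' enorm_pi_inv_le).trans (le_of_eq ?_)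
    congr 2
    funext w; ring
  · calc _ ≤ ∫⁻ z in B, M ^ 2 * (kn 1 (z - w) * kn 1 (z - w')) := by
          refine lintegral_mono fun z => ?_
          rw [enorm_mul, enorm_mul]
          calc _ ≤ (M * kn 1 (z - w)) * (M * kn 1 (z - w')) :=
                mul_le_mul' (mul_le_mul' (hM _) (enorm_conj_inv_le_kn _))
                  (mul_le_mul' (hM _) (enorm_conj_inv_le_kn _))
            _ = _ := by ring
      _ ≤ _ := by
          rw [lintegral_const_mul' _ _ (by finiteness), mul_assoc]
          exact mul_le_mul_right (lintegral_kn_mul_kn_le B w w') _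

/-- The constant in `lintegral_gw_hsq_le`. -/
def hsqC (B : Set ℂ) : ℝ≥0∞ := akC B ^ 2 * (knC (5 / 4 + 1 / 2) + volume B) * volume B

lemma hsqC_ne_top {B : Set ℂ} (hB : volume B ≠ ⊤) : hsqC B ≠ ⊤ := by
  have h1 := akC_ne_top hB
  have h2 := (knC_lt_top (s := 5 / 4 + 1 / 2) (by norm_num)).ne
  unfold hsqC
  finiteness

lemma lintegral_gw_hsq_le {B : Set ℂ} (hB : volume B ≠ ⊤) {b : ℝ} (hb : 0 < b) (a : ℂ) {τ : ℝ}
    (hτ : τ ≠ 0) :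
    ∫⁻ z₀, ENNReal.ofReal (gw b a z₀) * hsq B τ z₀ ≤ avK b τ * hsqC B := by
  rw [← avK_neg]
  refine le_trans (lintegral_mono fun z₀ => mul_le_mul_right ?_ _)
    (lintegral_gw_family_le (ν := (volume.restrict B).prod (volume.restrict B)) (B := B)
      (F := fun (p : ℂ × ℂ) w => (p.1 - w)⁻¹ * (conj (w - p.2))⁻¹) measurable_kernel
      (A := akC B ^ 2) (ENNReal.pow_ne_top (akC_ne_top hB)) (s := 1 / 2) (by norm_num)
      (fun w w' => ?_) hb a (neg_ne_zero.2 hτ))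
  · have h1 : Measurable fun p : ℂ × ℂ => (z₀, p) := by fun_prop
    have h2 := ((measurable_aker B τ).comp h1).enorm.pow_const 2
    simp only [Function.comp_def] at h2
    rw [hsq, ← lintegral_prod _ h2.aemeasurable]
    rfl
  · have hm : Measurable fun z : ℂ => kn 1 (z - w) * kn 1 (z - w') :=
      ((measurable_kn 1).comp (measurable_id.sub_const w)).mul
        ((measurable_kn 1).comp (measurable_id.sub_const w'))
    calc _ ≤ ∫⁻ p : ℂ × ℂ, (kn 1 (p.1 - w) * kn 1 (p.1 - w')) *
          (kn 1 (p.2 - w) * kn 1 (p.2 - w')) ∂((volume.restrict B).prod (volume.restrict B)) := by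
          refine lintegral_mono fun p => ?_
          calc _ ≤ (kn 1 (w - p.1) * kn 1 (w - p.2)) * (kn 1 (w' - p.1) * kn 1 (w' - p.2)) :=
                mul_le_mul' (enorm_kernel_le _ _ _) (enorm_kernel_le _ _ _)
            _ = _ := by
                rw [kn_sub_comm 1 w, kn_sub_comm 1 w, kn_sub_comm 1 w', kn_sub_comm 1 w']
                ring
      _ = (∫⁻ z in B, kn 1 (z - w) * kn 1 (z - w')) *
          ∫⁻ z in B, kn 1 (z - w) * kn 1 (z - w') :=
          lintegral_prod_mul hm.aemeasurable hm.aemeasurable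
      _ ≤ (akC B * kn (1 / 4) (w - w')) * (akC B * kn (1 / 4) (w - w')) :=
          mul_le_mul' (lintegral_kn_mul_kn_le B w w') (lintegral_kn_mul_kn_le B w w')
      _ = _ := by
          rw [mul_mul_mul_comm, kn_mul_self_of_pos (by norm_num) (by norm_num), sq]
          norm_num

end GKL

namespace GKL

open Filter Topology ComplexConjugate
open scoped ENNReal NNReal

/-! ### The oscillatory integral of the difference of potentials -/

/-- The data of a complex geometrical optics solution `exp(iτ(z - z₀)²)(1 + r)`. -/
structure IsCGO (B : Set ℂ) (q : ℂ → ℂ) (τ : ℝ) (z₀ : ℂ) (r h : ℂ → ℂ) : Prop where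
  bm_r : BM r
  bm_h : BM h
  eq_r : ∀ z, r z = cau B (fun w => osc (-τ) z₀ w * h w) z
  eq_h : ∀ z, h z = 1 / 4 * cauc B (fun x => osc τ z₀ x * (q x * (1 + r x))) z

lemma integral_mul_cau {B : Set ℂ} (hB : volume B ≠ ⊤) {f g : ℂ → ℂ} (hf : BM f) (hg : BM g) :
    ∫ z in B, f z * cau B g z = -∫ w in B, g w * cau B f w := by
  obtain ⟨C, hC⟩ := hf.bdd
  obtain ⟨D, hD⟩ := hg.bdd
  have hm : Measurable (Function.uncurry fun z w : ℂ => f z * (g w * (z - w)⁻¹)) := by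
    have h1 := hf.meas
    have h2 := hg.meas
    simp only [Function.uncurry_def]
    fun_prop
  have hinteg : Integrable (Function.uncurry fun z w : ℂ => f z * (g w * (z - w)⁻¹))
      ((volume.restrict B).prod (volume.restrict B)) := by
    refine ⟨hm.aestronglyMeasurable, ?_⟩
    rw [HasFiniteIntegral, lintegral_prod _ hm.enorm.aemeasurable]
    calc _ ≤ ∫⁻ z in B, ∫⁻ w in B, C * (D * kn 1 (w - z)) := by
          refine lintegral_mono fun z => lintegral_mono fun w => ?_
          simp only [Function.uncurry]
          rw [enorm_mul, enorm_mul, kn_sub_comm]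
          exact mul_le_mul' (hC z) (mul_le_mul' (hD w) (enorm_inv_le_kn _))
      _ ≤ ∫⁻ z in B, C * (D * schur B) := by
          refine lintegral_mono fun z => ?_
          rw [lintegral_const_mul' _ _ ENNReal.coe_ne_top,
            lintegral_const_mul' _ _ ENNReal.coe_ne_top]
          exact mul_le_mul_right (mul_le_mul_right (lintegral_kn_le (by norm_num) B z) _) _
      _ < ⊤ := by
          have := schur_ne_top hB
          rw [lintegral_const, Measure.restrict_apply_univ]
          finiteness
  have e1 : ∀ z, f z * cau B g z = (π : ℂ)⁻¹ * ∫ w in B, f z * (g w * (z - w)⁻¹) := fun z => by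
    rw [cau, integral_const_mul]; ring
  have e2 : ∀ w, g w * cau B f w = -((π : ℂ)⁻¹ * ∫ z in B, f z * (g w * (z - w)⁻¹)) := fun w => by
    rw [cau, ← mul_assoc, mul_comm (g w), mul_assoc, ← integral_const_mul, ← mul_neg,
      ← integral_neg]
    congr 2; funext z
    rw [← neg_sub z w, inv_neg]; ring
  simp_rw [e1, e2]
  rw [integral_neg, integral_const_mul, integral_const_mul, neg_neg,
    integral_integral_swap hinteg]

lemma mul_le_sq_add_sq (a b : ℝ≥0∞) : a * b ≤ a ^ 2 + b ^ 2 := by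
  rcases le_total a b with h | h
  · exact (mul_le_mul_left h b).trans (by rw [← sq]; exact le_add_self)
  · exact (mul_le_mul_right h a).trans (by rw [← sq]; exact le_self_add)

lemma lintegral_enorm_mul_le (B : Set ℂ) {f g : ℂ → ℂ} (hf : Measurable f) :
    ∫⁻ z in B, ‖f z‖ₑ * ‖g z‖ₑ ≤ nsq B f + nsq B g := by
  rw [nsq, nsq, ← lintegral_add_left (by fun_prop)]
  exact lintegral_mono fun z => mul_le_sq_add_sq _ _

lemma IsCGO.enorm_integral_le {B : Set ℂ} (hB : volume B ≠ ⊤) {q : ℂ → ℂ} {τ : ℝ} {z₀ : ℂ}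
    {r h Q : ℂ → ℂ} (H : IsCGO B q τ z₀ r h) (hQ : BM Q) :
    ‖∫ z in B, Q z * osc τ z₀ z * r z‖ₑ ≤ nsq B h + osn B (fun z => conj (Q z)) (-τ) z₀ := by
  have hQe : BM fun z => Q z * osc τ z₀ z := hQ.mul (BM.osc τ z₀)
  have hoh : BM fun w => osc (-τ) z₀ w * h w := (BM.osc _ _).mul H.bm_h
  have e : ∫ z in B, Q z * osc τ z₀ z * r z =
      -∫ w in B, osc (-τ) z₀ w * h w * cau B (fun z => Q z * osc τ z₀ z) w := by
    rw [← integral_mul_cau hB hQe hoh]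
    simp_rw [← H.eq_r]
  rw [e, enorm_neg]
  refine (enorm_integral_le_lintegral_enorm _).trans ?_
  have e2 : osn B (fun z => conj (Q z)) (-τ) z₀ = nsq B (cau B fun z => Q z * osc τ z₀ z) := by
    rw [osn, ← nsq_conj]
    congr 1; funext z
    rw [cau_eq]
    congr 2; funext w
    rw [map_mul, conj_osc, mul_comm]
  rw [e2]
  refine le_trans (le_of_eq ?_) (lintegral_enorm_mul_le B H.bm_h.meas)
  refine lintegral_congr fun w => ?_
  rw [enorm_mul, enorm_mul, enorm_osc, one_mul]

/-- The sum of the error terms. -/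
def errT (B : Set ℂ) (Q q₁ q₂ : ℂ → ℂ) (τ : ℝ) (z₀ : ℂ) : ℝ≥0∞ :=
  hsq B τ z₀ + hsq B (-τ) z₀ + osn B (fun z => conj (Q z)) (-τ) z₀ + osn B Q τ z₀ +
    osn B q₁ τ z₀ + osn B (fun z => conj (q₂ z)) (-τ) z₀

/-- The constant in `enorm_integral_osc_le`. -/
def errC (B : Set ℂ) (M : ℝ≥0) : ℝ≥0∞ :=
  M * volume B * (4 * M ^ 2) + (1 + cgoC B M + M * cgoC B M)

lemma errC_ne_top {B : Set ℂ} (hB : volume B ≠ ⊤) (M : ℝ≥0) : errC B M ≠ ⊤ := by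
  have := cgoC_ne_top hB M
  unfold errC
  finiteness

lemma enorm_integral_osc_le {B : Set ℂ} (hB : volume B ≠ ⊤) {Q q₁ q₂ : ℂ → ℂ} (hQ : BM Q)
    (hq₁ : BM q₁) (hq₂ : BM q₂) {M : ℝ≥0} (hQM : ∀ z, ‖Q z‖ₑ ≤ M) (hM₁ : ∀ z, ‖q₁ z‖ₑ ≤ M)
    (hM₂ : ∀ z, ‖q₂ z‖ₑ ≤ M) {τ : ℝ} {z₀ : ℂ}
    (horth : ∀ r₁ h₁ r₂ h₂, IsCGO B q₁ τ z₀ r₁ h₁ →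
      IsCGO B (fun z => conj (q₂ z)) (-τ) z₀ r₂ h₂ →
      ∫ z in B, Q z * (osc τ z₀ z * (1 + r₁ z) * (1 + conj (r₂ z))) = 0) :
    ‖∫ z in B, Q z * osc τ z₀ z‖ₑ ≤ errC B M * errT B Q q₁ q₂ τ z₀ := by
  have triv : ∀ H : ℝ≥0∞, 1 / 4 < M ^ 2 * H → H ≤ errT B Q q₁ q₂ τ z₀ →
      ‖∫ z in B, Q z * osc τ z₀ z‖ₑ ≤ errC B M * errT B Q q₁ q₂ τ z₀ := by
    intro H hH hle
    calc ‖∫ z in B, Q z * osc τ z₀ z‖ₑ ≤ ∫⁻ z in B, ‖Q z * osc τ z₀ z‖ₑ :=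
          enorm_integral_le_lintegral_enorm _
      _ ≤ ∫⁻ z in B, M := lintegral_mono fun z => by
          rw [enorm_mul, enorm_osc, mul_one]; exact hQM z
      _ = M * volume B * (4 * (1 / 4)) := by
          rw [lintegral_const, Measure.restrict_apply_univ, one_div,
            ENNReal.mul_inv_cancel (by simp) (by simp), mul_one]
      _ ≤ M * volume B * (4 * (M ^ 2 * H)) := by gcongr
      _ = M * volume B * (4 * M ^ 2) * H := by ring
      _ ≤ _ := mul_le_mul' (by rw [errC]; exact le_self_add) hle
  by_cases hH₁ : M ^ 2 * hsq B τ z₀ ≤ 1 / 4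
  swap
  · refine triv _ (not_le.1 hH₁) ?_
    simp only [errT, add_assoc]; exact le_self_add
  by_cases hH₂ : M ^ 2 * hsq B (-τ) z₀ ≤ 1 / 4
  swap
  · refine triv _ (not_le.1 hH₂) ?_
    simp only [errT, add_assoc]; exact le_add_left le_self_add
  have hM₂' : ∀ z, ‖conj (q₂ z)‖ₑ ≤ M := fun z => by rw [RCLike.enorm_conj]; exact hM₂ z
  obtain ⟨r₁, h₁, br₁, bh₁, er₁, eh₁, nr₁, nh₁⟩ := exists_cgo hB hq₁ hM₁ hH₁
  obtain ⟨r₂, h₂, br₂, bh₂, er₂, eh₂, nr₂, nh₂⟩ := exists_cgo hB hq₂.conj hM₂' hH₂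
  have H₁ : IsCGO B q₁ τ z₀ r₁ h₁ := ⟨br₁, bh₁, er₁, eh₁⟩
  have H₂ : IsCGO B (fun z => conj (q₂ z)) (-τ) z₀ r₂ h₂ := ⟨br₂, bh₂, er₂, eh₂⟩
  have ho := horth r₁ h₁ r₂ h₂ H₁ H₂
  have hQe : BM fun z => Q z * osc τ z₀ z := hQ.mul (BM.osc τ z₀)
  have i0 := hQe.integrable hB
  have i1 := (hQe.mul br₁).integrable hB
  have i2 := (hQe.mul br₂.conj).integrable hB
  have i3 := ((hQe.mul br₁).mul br₂.conj).integrable hB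
  have hsplit : ∫ z in B, Q z * osc τ z₀ z =
      -((∫ z in B, Q z * osc τ z₀ z * r₁ z) + (∫ z in B, Q z * osc τ z₀ z * conj (r₂ z)) +
        ∫ z in B, Q z * osc τ z₀ z * r₁ z * conj (r₂ z)) := by
    have e1 := integral_add i1 i2
    have e2 := integral_add (i1.add i2) i3
    have e3 := integral_add i0 ((i1.add i2).add i3)
    simp only [Pi.add_apply] at e1 e2 e3
    rw [← e1, ← e2, eq_neg_iff_add_eq_zero, ← e3, ← ho]
    refine integral_congr_ae (Eventually.of_forall fun z => ?_)
    simp only; ring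
  have b1 := H₁.enorm_integral_le hB hQ
  have b2 : ‖∫ z in B, Q z * osc τ z₀ z * conj (r₂ z)‖ₑ ≤ nsq B h₂ + osn B Q τ z₀ := by
    have := H₂.enorm_integral_le hB hQ.conj
    simp only [neg_neg, Complex.conj_conj] at this
    rw [← RCLike.enorm_conj, ← integral_conj]
    simpa only [map_mul, conj_osc, Complex.conj_conj] using this
  have b3 : ‖∫ z in B, Q z * osc τ z₀ z * r₁ z * conj (r₂ z)‖ₑ ≤ M * (nsq B r₁ + nsq B r₂) := by
    refine (enorm_integral_le_lintegral_enorm _).trans ?_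
    refine le_trans (lintegral_mono fun z => ?_)
      (le_trans (le_of_eq (lintegral_const_mul' _ _ ENNReal.coe_ne_top))
        (mul_le_mul_right (lintegral_enorm_mul_le B br₁.meas (g := r₂)) _))
    rw [enorm_mul, enorm_mul, enorm_mul, enorm_osc, RCLike.enorm_conj, mul_one, mul_assoc]
    exact mul_le_mul_left (hQM z) _
  rw [hsplit, enorm_neg]
  calc _ ≤ (nsq B h₁ + osn B (fun z => conj (Q z)) (-τ) z₀) + (nsq B h₂ + osn B Q τ z₀) +
        M * (nsq B r₁ + nsq B r₂) :=
        (enorm_add_le _ _).trans (add_le_add ((enorm_add_le _ _).trans (add_le_add b1 b2)) b3)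
    _ ≤ (cgoC B M * osn B q₁ τ z₀ + osn B (fun z => conj (Q z)) (-τ) z₀) +
        (cgoC B M * osn B (fun z => conj (q₂ z)) (-τ) z₀ + osn B Q τ z₀) +
        M * (cgoC B M * osn B q₁ τ z₀ + cgoC B M * osn B (fun z => conj (q₂ z)) (-τ) z₀) := by
        gcongr
    _ ≤ (1 + cgoC B M + M * cgoC B M) * errT B Q q₁ q₂ τ z₀ := by
        have e : (1 + cgoC B M + M * cgoC B M) * errT B Q q₁ q₂ τ z₀ =
          ((cgoC B M * osn B q₁ τ z₀ + osn B (fun z => conj (Q z)) (-τ) z₀) +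
          (cgoC B M * osn B (fun z => conj (q₂ z)) (-τ) z₀ + osn B Q τ z₀) +
          M * (cgoC B M * osn B q₁ τ z₀ + cgoC B M * osn B (fun z => conj (q₂ z)) (-τ) z₀)) +
          ((hsq B τ z₀ + hsq B (-τ) z₀) * (1 + cgoC B M + M * cgoC B M) +
            (osn B (fun z => conj (Q z)) (-τ) z₀ + osn B Q τ z₀) * (cgoC B M + M * cgoC B M) +
            (osn B q₁ τ z₀ + osn B (fun z => conj (q₂ z)) (-τ) z₀)) := by
          rw [errT]; ring
        rw [e]; exact le_self_add
    _ ≤ _ := mul_le_mul_left (by rw [errC]; exact le_add_self) _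

/-- The constant in `lintegral_gw_errT_le`. -/
def errA (B : Set ℂ) (M : ℝ≥0) : ℝ≥0∞ := 2 * hsqC B + 4 * osnC B M

lemma measurable_hsq (B : Set ℂ) (τ : ℝ) : Measurable (hsq B τ) := by
  have h1 : Measurable fun u : (ℂ × ℂ) × ℂ => (u.1.1, (u.1.2, u.2)) := by fun_prop
  have h2 := ((measurable_aker B τ).comp h1).enorm.pow_const 2
  simp only [Function.comp_def] at h2
  exact (h2.lintegral_prod_right' (ν := volume.restrict B)).lintegral_prod_right'
    (ν := volume.restrict B)

lemma measurable_osn (B : Set ℂ) {q : ℂ → ℂ} (hq : BM q) (τ : ℝ) : Measurable (osn B q τ) := by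
  have h : StronglyMeasurable (Function.uncurry fun (u : ℂ × ℂ) (w : ℂ) =>
      osc τ u.1 w * q w * (conj (u.2 - w))⁻¹) := by
    apply Measurable.stronglyMeasurable
    simp only [Function.uncurry_def]
    have h1 : Measurable fun u : (ℂ × ℂ) × ℂ => (u.1.1, u.2) := by fun_prop
    have h2 := (continuous_osc τ).measurable.comp h1
    have h3 : Measurable fun u : (ℂ × ℂ) × ℂ => conj (u.1.2 - u.2) :=
      Complex.continuous_conj.measurable.comp (by fun_prop)
    simp only [Function.comp_def] at h2
    exact (h2.mul (hq.meas.comp measurable_snd)).mul h3.inv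
  have h' := ((h.integral_prod_right (ν := volume.restrict B)).measurable.const_mul
    (π : ℂ)⁻¹).enorm.pow_const 2
  exact h'.lintegral_prod_right' (ν := volume.restrict B)

lemma lintegral_add_le_add {f g : ℂ → ℝ≥0∞} {x y : ℝ≥0∞} (hf : Measurable f)
    (hx : ∫⁻ z, f z ≤ x) (hy : ∫⁻ z, g z ≤ y) : ∫⁻ z, (f z + g z) ≤ x + y := by
  rw [lintegral_add_left hf]
  exact add_le_add hx hy

lemma lintegral_gw_errT_le {B : Set ℂ} (hB : volume B ≠ ⊤) {Q q₁ q₂ : ℂ → ℂ} (hQ : BM Q)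
    (hq₁ : BM q₁) (hq₂ : BM q₂) {M : ℝ≥0} (hQM : ∀ z, ‖Q z‖ₑ ≤ M) (hM₁ : ∀ z, ‖q₁ z‖ₑ ≤ M)
    (hM₂ : ∀ z, ‖q₂ z‖ₑ ≤ M) {b : ℝ} (hb : 0 < b) (a : ℂ) {τ : ℝ} (hτ : τ ≠ 0) :
    ∫⁻ z₀, ENNReal.ofReal (gw b a z₀) * errT B Q q₁ q₂ τ z₀ ≤ avK b τ * errA B M := by
  have hτ' : -τ ≠ 0 := neg_ne_zero.2 hτ
  have hg : Measurable fun z₀ => ENNReal.ofReal (gw b a z₀) :=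
    (continuous_gw b a).measurable.ennreal_ofReal
  have m1 : Measurable fun z₀ => ENNReal.ofReal (gw b a z₀) * hsq B τ z₀ :=
    hg.mul (measurable_hsq B τ)
  have m2 := hg.mul (measurable_hsq B (-τ))
  have m3 := hg.mul (measurable_osn B hQ.conj (-τ))
  have m4 := hg.mul (measurable_osn B hQ τ)
  have m5 := hg.mul (measurable_osn B hq₁ τ)
  have hcM : ∀ {g : ℂ → ℂ}, (∀ z, ‖g z‖ₑ ≤ M) → ∀ z, ‖conj (g z)‖ₑ ≤ M := fun h z => by
    rw [RCLike.enorm_conj]; exact h z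
  simp only [errT, mul_add]
  have b1 := lintegral_gw_hsq_le hB hb a hτ
  have b2 := lintegral_gw_hsq_le hB hb a hτ'
  have b3 := lintegral_gw_osn_le hB hQ.conj (hcM hQM) hb a hτ'
  have b4 := lintegral_gw_osn_le hB hQ hQM hb a hτ
  have b5 := lintegral_gw_osn_le hB hq₁ hM₁ hb a hτ
  have b6 := lintegral_gw_osn_le hB hq₂.conj (hcM hM₂) hb a hτ'
  rw [avK_neg] at b2 b3 b6
  have s2 := m1.add m2
  have s3 := s2.add m3
  have s4 := s3.add m4
  have s5 := s4.add m5
  refine (lintegral_add_le_add s5 (lintegral_add_le_add s4 (lintegral_add_le_add s3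
    (lintegral_add_le_add s2 (lintegral_add_le_add m1 b1 b2) b3) b4) b5) b6).trans (le_of_eq ?_)
  rw [errA]; ring

end GKL

namespace GKL

open Filter Topology ComplexConjugate
open scoped ENNReal NNReal

/-! ### Stationary phase for the Gaussian averages, and the density conclusion -/

lemma ofReal_sub_I_ne_zero {b : ℝ} (hb : 0 < b) (τ : ℝ) : (b : ℂ) - 2 * Complex.I * τ ≠ 0 := by
  intro h
  have := congrArg Complex.re h
  simp at this
  exact hb.ne' this

lemma integral_gauss_chirp {b : ℝ} (hb : 0 < b) (τ s : ℝ) :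
    ∫ x : ℝ, Complex.exp (-(b : ℂ) * x ^ 2 + 2 * Complex.I * τ * (s - x) ^ 2) =
      (π / (b - 2 * Complex.I * τ)) ^ (1 / 2 : ℂ) *
        Complex.exp (s ^ 2 * (2 * Complex.I * τ * b / (b - 2 * Complex.I * τ))) := by
  have hne := ofReal_sub_I_ne_zero hb τ
  have hb' : (-(b : ℂ) + 2 * Complex.I * τ).re < 0 := by simp [hb]
  have h := integral_cexp_quadratic hb' (-(4 * Complex.I * τ * s)) (2 * Complex.I * τ * s ^ 2)
  have e : -(-(b : ℂ) + 2 * Complex.I * τ) = b - 2 * Complex.I * τ := by ring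
  rw [e] at h
  convert h using 1
  · congr 1 with x
    congr 1
    ring
  · congr 2
    have hne' : -(b : ℂ) + 2 * Complex.I * τ ≠ 0 := by
      rw [← neg_ne_zero, e]; exact hne
    field_simp
    have hI : Complex.I ^ 2 = -1 := Complex.I_sq
    linear_combination (0 : ℂ) * hI

/-- The phase exponent of the averaged oscillation. -/
def chirp (b τ : ℝ) : ℂ := 2 * Complex.I * τ * b / (b - 2 * Complex.I * τ)

lemma integral_gw_mul_osc {b : ℝ} (hb : 0 < b) (a : ℂ) (τ : ℝ) (w : ℂ) :
    ∫ z₀, (gw b a z₀ : ℂ) * osc τ z₀ w =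
      (‖(π : ℂ) / (b - 2 * Complex.I * τ)‖ : ℂ) *
        Complex.exp ((w - a).re ^ 2 * chirp b τ + (w - a).im ^ 2 * chirp b (-τ)) := by
  rw [← integral_add_right_eq_self _ a]
  set s := w - a with hs
  have key : ∀ v : ℂ, (gw b a (v + a) : ℂ) * osc τ (v + a) w =
      Complex.exp (-(b : ℂ) * v.re ^ 2 + 2 * Complex.I * τ * (s.re - v.re) ^ 2) *
      Complex.exp (-(b : ℂ) * v.im ^ 2 + 2 * Complex.I * ((-τ : ℝ) : ℂ) * (s.im - v.im) ^ 2) := by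
    intro v
    rw [gw, osc, add_sub_cancel_right, Complex.ofReal_exp, ← Complex.exp_add, ← Complex.exp_add,
      show w - (v + a) = s - v by rw [hs]; ring, ← Complex.normSq_eq_norm_sq,
      Complex.normSq_apply, pow_two (s - v), Complex.mul_re, Complex.sub_re, Complex.sub_im]
    congr 1
    push_cast; ring
  simp_rw [key]
  rw [← (Complex.volume_preserving_equiv_real_prod.symm).integral_comp
    Complex.measurableEquivRealProd.symm.measurableEmbedding]
  simp only [Complex.measurableEquivRealProd_symm_apply]
  rw [Measure.volume_eq_prod, integral_prod_mul (μ := volume) (ν := volume)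
    (fun x : ℝ => Complex.exp (-(b : ℂ) * x ^ 2 + 2 * Complex.I * τ * (s.re - x) ^ 2))
    (fun x : ℝ => Complex.exp (-(b : ℂ) * x ^ 2 + 2 * Complex.I * ((-τ : ℝ) : ℂ) *
      (s.im - x) ^ 2)), integral_gauss_chirp hb, integral_gauss_chirp hb]
  rw [Complex.exp_add, chirp, chirp]
  have hne := ofReal_sub_I_ne_zero hb τ
  set Z : ℂ := (π : ℂ) / (b - 2 * Complex.I * τ) with hZ
  have hconj : (π : ℂ) / (b - 2 * Complex.I * ((-τ : ℝ) : ℂ)) = conj Z := by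
    have h2 : conj (2 : ℂ) = 2 := Complex.conj_ofNat 2
    rw [hZ]; simp [h2]
  have hZre : 0 < Z.re := by
    rw [hZ, Complex.div_re]
    have : 0 < Complex.normSq ((b : ℂ) - 2 * Complex.I * τ) := Complex.normSq_pos.2 hne
    simp
    positivity
  have harg : Z.arg ≠ π := fun h => by
    have := (Complex.arg_eq_pi_iff.1 h).1
    linarith
  have hprod : Z ^ (1 / 2 : ℂ) * conj Z ^ (1 / 2 : ℂ) = (‖Z‖ : ℂ) := by
    have h2 : conj (1 / 2 : ℂ) = 1 / 2 := by
      rw [map_div₀, map_one, Complex.conj_ofNat]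
    rw [Complex.conj_cpow _ _ harg, h2, Complex.mul_conj, Complex.normSq_eq_norm_sq,
      ← Complex.norm_pow, ← Complex.cpow_nat_mul]
    norm_num
  rw [hconj, ← hprod]
  ring

lemma chirp_re {b : ℝ} (hb : 0 < b) (τ : ℝ) : (chirp b τ).re ≤ 0 := by
  have hne := ofReal_sub_I_ne_zero hb τ
  have : 0 < Complex.normSq ((b : ℂ) - 2 * Complex.I * τ) := Complex.normSq_pos.2 hne
  rw [chirp, Complex.div_re]
  simp
  have h : 0 ≤ 2 * τ * b * (2 * τ) / Complex.normSq ((b : ℂ) - 2 * Complex.I * τ) := by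
    apply div_nonneg _ this.le
    nlinarith [mul_nonneg hb.le (sq_nonneg τ)]
  rw [neg_div]
  linarith

lemma tendsto_chirp {b : ℝ} {l : Filter ℝ} (h : Tendsto (fun τ : ℝ => τ⁻¹) l (𝓝 0))
    (h0 : ∀ᶠ τ in l, τ ≠ 0) : Tendsto (chirp b) l (𝓝 (-(b : ℂ))) := by
  have h1 : Tendsto (fun τ : ℝ => 2 * Complex.I * b / (b * ((τ⁻¹ : ℝ) : ℂ) - 2 * Complex.I)) l
      (𝓝 (2 * Complex.I * b / (b * ((0 : ℝ) : ℂ) - 2 * Complex.I))) := by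
    refine Tendsto.div tendsto_const_nhds ?_ (by simp)
    exact (((Complex.continuous_ofReal.tendsto 0).comp h).const_mul _).sub_const _
  have h2 : 2 * Complex.I * b / (b * ((0 : ℝ) : ℂ) - 2 * Complex.I) = -(b : ℂ) := by
    have := Complex.I_ne_zero
    rw [Complex.ofReal_zero, mul_zero, zero_sub, div_neg, mul_div_cancel_left₀ _ (by simp)]
  rw [h2] at h1
  refine h1.congr' (h0.mono fun τ hτ => ?_)
  have hτ' : (τ : ℂ) ≠ 0 := by exact_mod_cast hτ
  rw [chirp]
  have : (b : ℂ) * ((τ⁻¹ : ℝ) : ℂ) - 2 * Complex.I = (b - 2 * Complex.I * τ) * (τ : ℂ)⁻¹ := by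
    push_cast
    field_simp
  rw [this, mul_comm (b - 2 * Complex.I * (τ : ℂ)), ← div_div, div_inv_eq_mul]
  congr 1
  ring

lemma tendsto_mul_norm_chirp (b : ℝ) :
    Tendsto (fun τ : ℝ => τ * ‖(π : ℂ) / (b - 2 * Complex.I * τ)‖) atTop (𝓝 (π / 2)) := by
  have h1 : Tendsto (fun τ : ℝ => ‖(π : ℂ) / (b * ((τ⁻¹ : ℝ) : ℂ) - 2 * Complex.I)‖) atTop
      (𝓝 ‖(π : ℂ) / (b * ((0 : ℝ) : ℂ) - 2 * Complex.I)‖) := by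
    refine (Tendsto.div tendsto_const_nhds ?_ (by simp)).norm
    exact (((Complex.continuous_ofReal.tendsto 0).comp tendsto_inv_atTop_zero).const_mul _).sub_const
      _
  have h2 : ‖(π : ℂ) / (b * ((0 : ℝ) : ℂ) - 2 * Complex.I)‖ = π / 2 := by
    simp [abs_of_pos Real.pi_pos]
  rw [h2] at h1
  refine h1.congr' ((eventually_gt_atTop 0).mono fun τ hτ => ?_)
  have hτ' : (τ : ℂ) ≠ 0 := by exact_mod_cast hτ.ne'
  have e : (b : ℂ) * ((τ⁻¹ : ℝ) : ℂ) - 2 * Complex.I = (b - 2 * Complex.I * τ) * (τ : ℂ)⁻¹ := by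
    push_cast
    field_simp
  rw [e, mul_comm (b - 2 * Complex.I * (τ : ℂ)), ← div_div, div_inv_eq_mul, mul_div_right_comm,
    norm_mul, Complex.norm_real, Real.norm_of_nonneg hτ.le, mul_comm]

lemma tendsto_integral_gw_osc {b : ℝ} (hb : 0 < b) (a w : ℂ) :
    Tendsto (fun τ : ℝ => (τ : ℂ) * ∫ z₀, (gw b a z₀ : ℂ) * osc τ z₀ w) atTop
      (𝓝 ((π / 2 : ℝ) * (gw b a w : ℂ))) := by
  have h1 := (Complex.continuous_ofReal.tendsto _).comp (tendsto_mul_norm_chirp b)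
  have h2 : Tendsto (chirp b) atTop (𝓝 (-(b : ℂ))) :=
    tendsto_chirp tendsto_inv_atTop_zero (eventually_ne_atTop 0)
  have h3 : Tendsto (fun τ => chirp b (-τ)) atTop (𝓝 (-(b : ℂ))) :=
    (tendsto_chirp tendsto_inv_atBot_zero (eventually_ne_atBot 0)).comp tendsto_neg_atTop_atBot
  have h4 := (Complex.continuous_exp.tendsto _).comp
    ((h2.const_mul (((w - a).re : ℂ) ^ 2)).add (h3.const_mul (((w - a).im : ℂ) ^ 2)))
  have h5 := h1.mul h4
  have e : ((π / 2 : ℝ) : ℂ) * (gw b a w : ℂ) = ((π / 2 : ℝ) : ℂ) *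
      Complex.exp (((w - a).re : ℂ) ^ 2 * -(b : ℂ) + ((w - a).im : ℂ) ^ 2 * -(b : ℂ)) := by
    rw [gw, Complex.ofReal_exp, ← Complex.normSq_eq_norm_sq, Complex.normSq_apply]
    congr 2
    push_cast; ring
  rw [e]
  refine h5.congr fun τ => ?_
  rw [integral_gw_mul_osc hb]
  simp only [Function.comp_apply]
  push_cast; ring

lemma norm_mul_integral_gw_osc_le {b : ℝ} (hb : 0 < b) (a w : ℂ) {τ : ℝ} (hτ : 0 < τ) :
    ‖(τ : ℂ) * ∫ z₀, (gw b a z₀ : ℂ) * osc τ z₀ w‖ ≤ π := by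
  rw [integral_gw_mul_osc hb, norm_mul, norm_mul, Complex.norm_real, Complex.norm_real, norm_norm,
    Complex.norm_exp, Real.norm_of_nonneg hτ.le]
  have h1 : rexp ((((w - a).re : ℂ) ^ 2 * chirp b τ + ((w - a).im : ℂ) ^ 2 * chirp b (-τ)).re) ≤
      1 := by
    rw [Real.exp_le_one_iff, ← Complex.ofReal_pow, ← Complex.ofReal_pow, Complex.add_re,
      Complex.re_ofReal_mul, Complex.re_ofReal_mul]
    nlinarith [chirp_re hb τ, chirp_re hb (-τ), sq_nonneg (w - a).re, sq_nonneg (w - a).im]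
  have h2 : τ * ‖(π : ℂ) / (b - 2 * Complex.I * τ)‖ ≤ π := by
    rw [norm_div, Complex.norm_real, Real.norm_of_nonneg Real.pi_pos.le]
    have h3 : 2 * τ ≤ ‖(b : ℂ) - 2 * Complex.I * τ‖ := by
      have := Complex.abs_im_le_norm ((b : ℂ) - 2 * Complex.I * τ)
      simp [abs_of_pos hτ] at this
      exact this
    rw [← mul_div_assoc, div_le_iff₀ (by linarith)]
    nlinarith [Real.pi_pos]
  calc _ ≤ τ * ‖(π : ℂ) / (b - 2 * Complex.I * τ)‖ * 1 := by
        rw [← mul_assoc]; gcongr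
    _ ≤ π := by linarith

lemma integral_gw_integral_osc {B : Set ℂ} (hB : volume B ≠ ⊤) {Q : ℂ → ℂ} (hQ : BM Q) {b : ℝ}
    (hb : 0 < b) (a : ℂ) (τ : ℝ) :
    (τ : ℂ) * ∫ z₀, (gw b a z₀ : ℂ) * ∫ w in B, Q w * osc τ z₀ w =
      ∫ w in B, Q w * ((τ : ℂ) * ∫ z₀, (gw b a z₀ : ℂ) * osc τ z₀ w) := by
  have h1 : Integrable (fun p : ℂ × ℂ => (gw b a p.1 : ℂ) * Q p.2)
      (volume.prod (volume.restrict B)) := (integrable_gw hb a).ofReal.mul_prod (hQ.integrable hB)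
  have h2 : Integrable (fun p : ℂ × ℂ => (gw b a p.1 : ℂ) * Q p.2 * osc τ p.1 p.2)
      (volume.prod (volume.restrict B)) := by
    refine h1.mul_bdd (c := 1) (continuous_osc τ).aestronglyMeasurable ?_
    exact Eventually.of_forall fun p => (norm_osc _ _ _).le
  have h3 := integral_integral_swap (f := fun z₀ w => (gw b a z₀ : ℂ) * Q w * osc τ z₀ w) h2
  have e1 : ∀ z₀, (gw b a z₀ : ℂ) * ∫ w in B, Q w * osc τ z₀ w =
      ∫ w in B, (gw b a z₀ : ℂ) * Q w * osc τ z₀ w := fun z₀ => by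
    rw [← integral_const_mul]
    simp_rw [mul_assoc]
  simp_rw [e1]
  rw [h3, ← integral_const_mul]
  congr 1 with w
  rw [← integral_const_mul, ← integral_const_mul, ← integral_const_mul]
  congr 1 with z₀
  ring

lemma tendsto_integral_gw_integral_osc {B : Set ℂ} (hB : volume B ≠ ⊤) {Q : ℂ → ℂ} (hQ : BM Q)
    {b : ℝ} (hb : 0 < b) (a : ℂ) :
    Tendsto (fun τ : ℝ => (τ : ℂ) * ∫ z₀, (gw b a z₀ : ℂ) * ∫ w in B, Q w * osc τ z₀ w) atTop
      (𝓝 (∫ w in B, Q w * ((π / 2 : ℝ) * (gw b a w : ℂ)))) := by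
  simp_rw [integral_gw_integral_osc hB hQ hb a]
  refine tendsto_integral_filter_of_dominated_convergence (fun w => ‖Q w‖ * π) ?_ ?_
    ((hQ.integrable hB).norm.mul_const _) ?_
  · refine Eventually.of_forall fun τ => ?_
    have h : StronglyMeasurable (Function.uncurry fun (w z₀ : ℂ) =>
        (gw b a z₀ : ℂ) * osc τ z₀ w) := by
      apply Continuous.stronglyMeasurable
      have := continuous_gw b a
      unfold osc
      fun_prop
    exact (hQ.meas.mul (h.integral_prod_right.measurable.const_mul _)).aestronglyMeasurable
  · refine (eventually_gt_atTop 0).mono fun τ hτ => Eventually.of_forall fun w => ?_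
    rw [norm_mul]
    gcongr
    exact norm_mul_integral_gw_osc_le hb a w hτ
  · exact Eventually.of_forall fun w => (tendsto_integral_gw_osc hb a w).const_mul _

lemma tendsto_ofReal_mul_avK {b : ℝ} (hb : 0 < b) :
    Tendsto (fun τ : ℝ => ENNReal.ofReal τ * avK b τ) atTop (𝓝 0) := by
  have h1 : Tendsto (fun τ : ℝ => (π / b * (2 / √b) ^ (-(5 / 4) : ℝ)) * τ ^ (-(1 / 4) : ℝ)) atTop
      (𝓝 ((π / b * (2 / √b) ^ (-(5 / 4) : ℝ)) * 0)) :=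
    (tendsto_rpow_neg_atTop (by norm_num)).const_mul _
  rw [mul_zero] at h1
  have h2 := ENNReal.tendsto_ofReal h1
  rw [ENNReal.ofReal_zero] at h2
  refine h2.congr' ((eventually_gt_atTop 0).mono fun τ hτ => ?_)
  simp only [avK]
  rw [← ENNReal.ofReal_mul hτ.le, abs_of_pos hτ, mul_div_right_comm,
    Real.mul_rpow (by positivity) hτ.le]
  congr 1
  have : τ ^ (-(1 / 4) : ℝ) = τ * τ ^ (-(5 / 4) : ℝ) := by
    rw [← Real.rpow_one_add' hτ.le (by norm_num)]
    norm_num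
  rw [this]; ring

lemma integral_mul_gw_eq_zero {B : Set ℂ} (hB : volume B ≠ ⊤) {Q q₁ q₂ : ℂ → ℂ} (hQ : BM Q)
    (hq₁ : BM q₁) (hq₂ : BM q₂)
    (horth : ∀ τ z₀ r₁ h₁ r₂ h₂, IsCGO B q₁ τ z₀ r₁ h₁ →
      IsCGO B (fun z => conj (q₂ z)) (-τ) z₀ r₂ h₂ →
      ∫ z in B, Q z * (osc τ z₀ z * (1 + r₁ z) * (1 + conj (r₂ z))) = 0)
    {b : ℝ} (hb : 0 < b) (a : ℂ) : ∫ w in B, Q w * (gw b a w : ℂ) = 0 := by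
  obtain ⟨M₀, h₀⟩ := hQ.bdd
  obtain ⟨M₁, h₁⟩ := hq₁.bdd
  obtain ⟨M₂, h₂⟩ := hq₂.bdd
  set M := M₀ + M₁ + M₂ with hM
  have hQM : ∀ z, ‖Q z‖ₑ ≤ M := fun z => (h₀ z).trans (by
    rw [hM]; exact_mod_cast (le_add_right le_self_add))
  have hM₁ : ∀ z, ‖q₁ z‖ₑ ≤ M := fun z => (h₁ z).trans (by
    rw [hM]; exact_mod_cast (le_add_right le_add_self))
  have hM₂ : ∀ z, ‖q₂ z‖ₑ ≤ M := fun z => (h₂ z).trans (by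
    rw [hM]; exact_mod_cast le_add_self)
  have lim := tendsto_integral_gw_integral_osc hB hQ hb a
  have hbd : ∀ᶠ τ : ℝ in atTop,
      ‖(τ : ℂ) * ∫ z₀, (gw b a z₀ : ℂ) * ∫ w in B, Q w * osc τ z₀ w‖ₑ ≤
        ENNReal.ofReal τ * avK b τ * (errC B M * errA B M) := by
    refine (eventually_gt_atTop 0).mono fun τ hτ => ?_
    rw [enorm_mul]
    have e1 : ‖(τ : ℂ)‖ₑ = ENNReal.ofReal τ := by
      rw [← ofReal_norm, Complex.norm_real, Real.norm_of_nonneg hτ.le]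
    rw [e1, mul_assoc]
    gcongr
    calc ‖∫ z₀, (gw b a z₀ : ℂ) * ∫ w in B, Q w * osc τ z₀ w‖ₑ
        ≤ ∫⁻ z₀, ‖(gw b a z₀ : ℂ) * ∫ w in B, Q w * osc τ z₀ w‖ₑ :=
          enorm_integral_le_lintegral_enorm _
      _ ≤ ∫⁻ z₀, errC B M * (ENNReal.ofReal (gw b a z₀) * errT B Q q₁ q₂ τ z₀) := by
          refine lintegral_mono fun z₀ => ?_
          rw [enorm_mul, ← ofReal_norm, Complex.norm_real,
            Real.norm_of_nonneg (gw_pos b a z₀).le, mul_left_comm]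
          gcongr
          exact enorm_integral_osc_le hB hQ hq₁ hq₂ hQM hM₁ hM₂ (horth τ z₀)
      _ = errC B M * ∫⁻ z₀, ENNReal.ofReal (gw b a z₀) * errT B Q q₁ q₂ τ z₀ :=
          lintegral_const_mul' _ _ (errC_ne_top hB M)
      _ ≤ errC B M * (avK b τ * errA B M) := by
          gcongr
          exact lintegral_gw_errT_le hB hQ hq₁ hq₂ hQM hM₁ hM₂ hb a hτ.ne'
      _ = avK b τ * (errC B M * errA B M) := by ring
  have hne : errC B M * errA B M ≠ ⊤ := by
    have h1 := errC_ne_top hB M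
    have h2 := hsqC_ne_top hB
    have h3 := osnC_ne_top hB M
    rw [errA]
    finiteness
  have h0 : Tendsto (fun τ : ℝ => ENNReal.ofReal τ * avK b τ * (errC B M * errA B M)) atTop
      (𝓝 0) := by
    have := ENNReal.Tendsto.mul_const (tendsto_ofReal_mul_avK hb) (Or.inr hne)
    rwa [zero_mul] at this
  have h1 : ‖∫ w in B, Q w * ((π / 2 : ℝ) * (gw b a w : ℂ))‖ₑ ≤ 0 :=
    le_of_tendsto_of_tendsto (continuous_enorm.tendsto _ |>.comp lim) h0 hbd
  have h2 := enorm_eq_zero.1 (le_antisymm h1 bot_le)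
  have e : ∀ w, Q w * ((π / 2 : ℝ) * (gw b a w : ℂ)) =
      ((π / 2 : ℝ) : ℂ) * (Q w * (gw b a w : ℂ)) := fun w => by ring
  simp_rw [e] at h2
  rw [integral_const_mul] at h2
  refine (mul_eq_zero.1 h2).resolve_left ?_
  have : π / 2 ≠ 0 := by positivity
  exact_mod_cast this

lemma integral_gw {b : ℝ} (hb : 0 < b) (a : ℂ) : ∫ z, gw b a z = π / b := by
  have h := norm_integral_gw_osc hb a 0 0 0
  simp only [osc, mul_zero, zero_mul, Complex.ofReal_zero, Complex.exp_zero, map_one, mul_one,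
    sub_self] at h
  rw [integral_complex_ofReal, Complex.norm_real, Real.norm_of_nonneg
    (integral_nonneg fun z => (gw_pos b a z).le)] at h
  simpa using h

lemma ae_eq_zero_of_integral_gw {F : ℂ → ℂ} (hF : Integrable F)
    (h : ∀ b : ℝ, 0 < b → ∀ a, ∫ w, F w * (gw b a w : ℂ) = 0) : ∀ᵐ z, F z = 0 := by
  refine ae_eq_zero_of_integral_contDiff_smul_eq_zero hF.locallyIntegrable fun φ hφ hφc => ?_
  have hφi : Integrable φ := hφ.continuous.integrable_of_hasCompactSupport hφc
  obtain ⟨C, hC⟩ := hφ.continuous.bounded_above_of_compact_support hφc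
  have hlim : Tendsto (fun c : ℝ => ∫ v, F v * ∫ w, ((π * c * gw (π ^ 2 * c) v w * φ w : ℝ) : ℂ))
      atTop (𝓝 (∫ v, F v * (φ v : ℂ))) := by
    refine tendsto_integral_filter_of_dominated_convergence (fun v => ‖F v‖ * C) ?_ ?_
      (hF.norm.mul_const _) ?_
    · refine Eventually.of_forall fun c => ?_
      have hm : StronglyMeasurable (Function.uncurry fun (v w : ℂ) =>
          ((π * c * gw (π ^ 2 * c) v w * φ w : ℝ) : ℂ)) := by
        apply Continuous.stronglyMeasurable
        have := hφ.continuous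
        unfold gw
        fun_prop
      exact hF.aestronglyMeasurable.mul hm.integral_prod_right.aestronglyMeasurable
    · refine (eventually_gt_atTop 0).mono fun c hc => Eventually.of_forall fun v => ?_
      rw [norm_mul]
      gcongr
      have hbc : 0 < π ^ 2 * c := by positivity
      calc ‖∫ w, ((π * c * gw (π ^ 2 * c) v w * φ w : ℝ) : ℂ)‖
          ≤ ∫ w, π * c * C * gw (π ^ 2 * c) v w := by
            refine norm_integral_le_of_norm_le ((integrable_gw hbc v).const_mul _)
              (Eventually.of_forall fun w => ?_)
            rw [Complex.norm_real, norm_mul, Real.norm_of_nonneg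
              (mul_nonneg (by positivity) (gw_pos _ _ _).le)]
            have h1 := hC w
            have h2 := (gw_pos (π ^ 2 * c) v w).le
            calc _ ≤ π * c * gw (π ^ 2 * c) v w * C := by gcongr
              _ = _ := by ring
        _ = C := by
            rw [integral_const_mul, integral_gw hbc]
            field_simp
    · refine Eventually.of_forall fun v => Tendsto.const_mul _ ?_
      have := Real.tendsto_integral_gaussian_smul' (V := ℂ) (f := fun w => (φ w : ℂ)) hφi.ofReal
        (v := v) (Complex.continuous_ofReal.comp hφ.continuous).continuousAt
      refine this.congr fun c => ?_
      congr 1 with w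
      have h1 : ((Module.finrank ℝ ℂ : ℂ) / 2) = 1 := by
        rw [Complex.finrank_real_complex]; norm_num
      rw [h1, Complex.cpow_one, gw, norm_sub_rev w v, smul_eq_mul]
      push_cast
      congr 3
      ring
  have hzero : ∀ᶠ c : ℝ in atTop,
      ∫ v, F v * ∫ w, ((π * c * gw (π ^ 2 * c) v w * φ w : ℝ) : ℂ) = 0 := by
    refine (eventually_gt_atTop 0).mono fun c hc => ?_
    have hbc : 0 < π ^ 2 * c := by positivity
    have hinteg : Integrable (fun p : ℂ × ℂ => (F p.1 * (φ p.2 : ℂ)) *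
        (gw (π ^ 2 * c) p.1 p.2 : ℂ)) (volume.prod volume) := by
      refine (hF.mul_prod hφi.ofReal).mul_bdd (c := 1) ?_ (Eventually.of_forall fun p => ?_)
      · apply Continuous.aestronglyMeasurable
        unfold gw
        fun_prop
      · rw [Complex.norm_real, Real.norm_of_nonneg (gw_pos _ _ _).le, gw, Real.exp_le_one_iff]
        nlinarith [mul_nonneg hbc.le (sq_nonneg ‖p.2 - p.1‖)]
    have hsw := integral_integral_swap (f := fun v w => (F v * (φ w : ℂ)) *
      (gw (π ^ 2 * c) v w : ℂ)) hinteg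
    have e1 : ∀ v, F v * ∫ w, ((π * c * gw (π ^ 2 * c) v w * φ w : ℝ) : ℂ) =
        (π * c : ℝ) * ∫ w, (F v * (φ w : ℂ)) * (gw (π ^ 2 * c) v w : ℂ) := fun v => by
      rw [← integral_const_mul, ← integral_const_mul]
      congr 1 with w
      push_cast; ring
    simp_rw [e1]
    rw [integral_const_mul, hsw]
    have e2 : ∀ w, ∫ v, (F v * (φ w : ℂ)) * (gw (π ^ 2 * c) v w : ℂ) = 0 := fun w => by
      have e3 : ∀ v, (F v * (φ w : ℂ)) * (gw (π ^ 2 * c) v w : ℂ) =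
          (φ w : ℂ) * (F v * (gw (π ^ 2 * c) w v : ℂ)) := fun v => by
        rw [gw_comm]; ring
      simp_rw [e3]
      rw [integral_const_mul, h _ hbc, mul_zero]
    simp_rw [e2]
    simp
  have h0 : ∫ v, F v * (φ v : ℂ) = 0 :=
    tendsto_nhds_unique hlim ((tendsto_const_nhds (x := (0 : ℂ))).congr'
      (hzero.mono fun c hc => hc.symm))
  rw [← h0]
  congr 1 with v
  rw [Complex.real_smul, mul_comm]

/-- If `Q` is orthogonal to all products of complex geometric optics amplitudes, it vanishes. -/
theorem ae_eq_zero_of_orthogonal_cgo {B : Set ℂ} (hBm : MeasurableSet B) (hB : volume B ≠ ⊤)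
    {Q q₁ q₂ : ℂ → ℂ} (hQ : BM Q) (hq₁ : BM q₁) (hq₂ : BM q₂)
    (horth : ∀ τ z₀ r₁ h₁ r₂ h₂, IsCGO B q₁ τ z₀ r₁ h₁ →
      IsCGO B (fun z => conj (q₂ z)) (-τ) z₀ r₂ h₂ →
      ∫ z in B, Q z * (osc τ z₀ z * (1 + r₁ z) * (1 + conj (r₂ z))) = 0) :
    ∀ᵐ z ∂volume.restrict B, Q z = 0 := by
  have hi : Integrable (B.indicator Q) := (integrable_indicator_iff hBm).2 (hQ.integrable hB)
  have h := ae_eq_zero_of_integral_gw hi fun b hb a => by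
    have h1 := integral_mul_gw_eq_zero hB hQ hq₁ hq₂ horth hb a
    rw [← integral_indicator hBm] at h1
    rw [← h1]
    congr 1 with w
    by_cases hw : w ∈ B <;> simp [hw]
  rw [ae_restrict_iff' hBm]
  filter_upwards [h] with z hz hzB
  rwa [indicator_of_mem hzB] at hz

end GKL

namespace GKL

open Filter Topology ComplexConjugate
open scoped ENNReal NNReal ContDiff

/-! ### Wirtinger derivatives and the Cauchy formula -/

/-- The Wirtinger derivative `(∂₁ + σ∂₂)/2`; `σ = i` gives `∂̄` and `σ = -i` gives `∂`. -/
def wd (σ : ℂ) (φ : ℂ → ℂ) (z : ℂ) : ℂ := (fderiv ℝ φ z 1 + σ * fderiv ℝ φ z Complex.I) / 2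

lemma wd_eq {σ : ℂ} {φ : ℂ → ℂ} {z : ℂ} {φ' : ℂ →L[ℝ] ℂ} (h : HasFDerivAt φ φ' z) :
    wd σ φ z = (φ' 1 + σ * φ' Complex.I) / 2 := by rw [wd, h.fderiv]

lemma wd_congr {σ : ℂ} {φ ψ : ℂ → ℂ} {z : ℂ} (h : φ =ᶠ[𝓝 z] ψ) : wd σ φ z = wd σ ψ z := by
  rw [wd, wd, h.fderiv_eq]

lemma wd_add {σ : ℂ} {f g : ℂ → ℂ} {z : ℂ} (hf : DifferentiableAt ℝ f z)
    (hg : DifferentiableAt ℝ g z) : wd σ (fun z => f z + g z) z = wd σ f z + wd σ g z := by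
  have h : HasFDerivAt (fun z => f z + g z) _ z := hf.hasFDerivAt.add hg.hasFDerivAt
  rw [wd_eq h, wd, wd]
  simp only [add_apply]; ring

lemma wd_mul {σ : ℂ} {f g : ℂ → ℂ} {z : ℂ} (hf : DifferentiableAt ℝ f z)
    (hg : DifferentiableAt ℝ g z) :
    wd σ (fun z => f z * g z) z = wd σ f z * g z + f z * wd σ g z := by
  have h : HasFDerivAt (fun z => f z * g z) _ z := hf.hasFDerivAt.mul hg.hasFDerivAt
  rw [wd_eq h, wd, wd]
  simp only [add_apply, smul_apply, smul_eq_mul]; ring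

lemma wd_const (σ c z : ℂ) : wd σ (fun _ => c) z = 0 := by simp [wd]

lemma wd_comp {σ : ℂ} {g Y : ℂ → ℂ} {g' z : ℂ} (hg : HasDerivAt g g' (Y z))
    (hY : DifferentiableAt ℝ Y z) : wd σ (fun z => g (Y z)) z = g' * wd σ Y z := by
  have h : HasFDerivAt (fun z => g (Y z)) _ z :=
    (hg.hasFDerivAt.restrictScalars ℝ).comp z hY.hasFDerivAt
  rw [wd_eq h, wd]
  simp [ContinuousLinearMap.comp_apply]
  ring

lemma wd_id (σ z : ℂ) : wd σ (fun z => z) z = (1 + σ * Complex.I) / 2 := by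
  have h : HasFDerivAt (fun z : ℂ => z) (ContinuousLinearMap.id ℝ ℂ) z := hasFDerivAt_id z
  rw [wd_eq h]; rfl

lemma wd_starRingEnd (σ z : ℂ) :
    wd σ (fun z => conj z) z = (1 - σ * Complex.I) / 2 := by
  have h : HasFDerivAt (fun z : ℂ => conj z) (Complex.conjCLE : ℂ →L[ℝ] ℂ) z :=
    Complex.conjCLE.hasFDerivAt
  rw [wd_eq h]
  simp
  ring

lemma wd_comp_conj {σ : ℂ} {f : ℂ → ℂ} {z : ℂ} (hf : DifferentiableAt ℝ f z) :
    wd σ (fun z => conj (f z)) z = conj (wd (conj σ) f z) := by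
  have h : HasFDerivAt (fun z : ℂ => conj (f z)) _ z :=
    (Complex.conjCLE.hasFDerivAt (x := f z)).comp z hf.hasFDerivAt
  rw [wd_eq h, wd]
  simp [Complex.conj_ofNat]

lemma wd_comp_add_right (σ : ℂ) (φ : ℂ → ℂ) (y z : ℂ) :
    wd σ (fun x => φ (x + y)) z = wd σ φ (z + y) := by
  rw [wd, wd, fderiv_comp_add_right]

/-- Smooth functions with compact support. -/
structure TF (φ : ℂ → ℂ) : Prop where
  smooth : ContDiff ℝ ∞ φ
  comp : HasCompactSupport φ

lemma contDiff_wd {φ : ℂ → ℂ} (h : ContDiff ℝ ∞ φ) (σ : ℂ) : ContDiff ℝ ∞ (wd σ φ) := by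
  have h1 : ContDiff ℝ ∞ (fderiv ℝ φ) := h.fderiv_right (by simp)
  unfold wd
  have h2 := h1.clm_apply (contDiff_const (c := (1 : ℂ)))
  have h3 := h1.clm_apply (contDiff_const (c := Complex.I))
  exact (h2.add (contDiff_const.mul h3)).div_const 2

lemma support_wd_subset (σ : ℂ) (φ : ℂ → ℂ) : Function.support (wd σ φ) ⊆ tsupport φ := by
  intro z hz
  by_contra h
  apply hz
  have h0 : φ =ᶠ[𝓝 z] fun _ => 0 := notMem_tsupport_iff_eventuallyEq.1 h
  rw [wd_congr h0, wd_const]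

lemma tsupport_wd_subset (σ : ℂ) (φ : ℂ → ℂ) : tsupport (wd σ φ) ⊆ tsupport φ :=
  closure_minimal (support_wd_subset σ φ) (isClosed_tsupport φ)

namespace TF

variable {φ ψ f : ℂ → ℂ}

lemma differentiable (h : TF φ) : Differentiable ℝ φ := h.smooth.differentiable (by simp)

lemma continuous (h : TF φ) : Continuous φ := h.smooth.continuous

lemma wd (h : TF φ) (σ : ℂ) : TF (wd σ φ) :=
  ⟨contDiff_wd h.smooth σ, HasCompactSupport.of_support_subset_isCompact h.comp
    (support_wd_subset σ φ)⟩

lemma smooth_mul (h : TF φ) (hf : ContDiff ℝ ∞ f) : TF fun z => f z * φ z :=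
  ⟨hf.mul h.smooth, h.comp.mul_left⟩

lemma star (h : TF φ) : TF fun z => starRingEnd ℂ (φ z) :=
  ⟨Complex.conjCLE.contDiff.comp h.smooth, h.comp.comp_left (g := starRingEnd ℂ) (map_zero _)⟩

lemma comp_add (h : TF φ) (y : ℂ) : TF fun z => φ (z + y) :=
  ⟨h.smooth.comp (contDiff_id.add contDiff_const),
    h.comp.comp_homeomorph (Homeomorph.addRight y)⟩

lemma integrable (h : TF φ) : Integrable φ := h.continuous.integrable_of_hasCompactSupport h.comp

lemma integrable_mul (h : TF φ) (hf : Continuous f) : Integrable fun z => f z * φ z :=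
  (hf.mul h.continuous).integrable_of_hasCompactSupport h.comp.mul_left

lemma bm (h : TF φ) : BM φ := by
  obtain ⟨C, hC⟩ := h.continuous.bounded_above_of_compact_support h.comp
  refine ⟨h.continuous.measurable, C.toNNReal, fun z => ?_⟩
  rw [← ofReal_norm]
  exact ENNReal.ofReal_le_ofReal (hC z)

end TF

lemma integral_mul_wd {f φ : ℂ → ℂ} (hf : ContDiff ℝ ∞ f) (hφ : TF φ) (σ : ℂ) :
    ∫ z, f z * wd σ φ z = -∫ z, wd σ f z * φ z := by
  have hfd : ∀ v, Continuous fun z => fderiv ℝ f z v := fun v =>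
    (hf.continuous_fderiv (by simp)).clm_apply continuous_const
  have hφd : ∀ v, Continuous fun z => fderiv ℝ φ z v := fun v =>
    (hφ.smooth.continuous_fderiv (by simp)).clm_apply continuous_const
  have hφs : ∀ v, HasCompactSupport fun z => fderiv ℝ φ z v := fun v =>
    hφ.comp.fderiv_apply (𝕜 := ℝ) v
  have i1 : ∀ v, Integrable fun z => fderiv ℝ f z v * φ z := fun v => hφ.integrable_mul (hfd v)
  have i2 : ∀ v, Integrable fun z => f z * fderiv ℝ φ z v := fun v =>
    (hf.continuous.mul (hφd v)).integrable_of_hasCompactSupport (hφs v).mul_left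
  have key : ∀ v, ∫ z, f z * fderiv ℝ φ z v = -∫ z, fderiv ℝ f z v * φ z := fun v =>
    integral_mul_fderiv_eq_neg_fderiv_mul_of_integrable (i1 v) (i2 v)
      (hφ.integrable_mul hf.continuous) (fun x _ => hf.differentiable (by simp) x)
      (fun x _ => hφ.differentiable x)
  have e1 : ∀ z, f z * wd σ φ z = 1 / 2 * (f z * fderiv ℝ φ z 1) +
      σ / 2 * (f z * fderiv ℝ φ z Complex.I) := fun z => by rw [wd]; ring
  have e2 : ∀ z, wd σ f z * φ z = 1 / 2 * (fderiv ℝ f z 1 * φ z) +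
      σ / 2 * (fderiv ℝ f z Complex.I * φ z) := fun z => by rw [wd]; ring
  simp_rw [e1, e2]
  rw [integral_add ((i2 _).const_mul _) ((i2 _).const_mul _),
    integral_add ((i1 _).const_mul _) ((i1 _).const_mul _), integral_const_mul,
    integral_const_mul, integral_const_mul, integral_const_mul, key, key]
  ring

lemma integral_inv_one_add_sq : ∫ u : ℂ, ((1 + ‖u‖ ^ 2) ^ 2)⁻¹ = π := by
  rw [integral_fun_norm_addHaar volume (fun r : ℝ => ((1 + r ^ 2) ^ 2)⁻¹),
    Complex.finrank_real_complex]
  have h : ∫ y in Ioi (0 : ℝ), y ^ (2 - 1) • ((1 + y ^ 2) ^ 2)⁻¹ = 0 - (-(2 * (1 + 0 ^ 2))⁻¹) := by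
    refine integral_Ioi_of_hasDerivAt_of_nonneg' (g := fun y : ℝ => -(2 * (1 + y ^ 2))⁻¹)
      (fun y _ => ?_) (fun y hy => ?_) ?_
    · have h1 : HasDerivAt (fun y : ℝ => 2 * (1 + y ^ 2)) (4 * y) y :=
        (((hasDerivAt_pow 2 y).const_add 1).const_mul 2).congr_deriv (by simp; ring)
      refine (h1.inv (by positivity)).neg.congr_deriv ?_
      have : (1 + y ^ 2) ≠ 0 := by positivity
      simp
      field_simp
      ring
    · have : (0 : ℝ) < y := hy
      simp; positivity
    · rw [← neg_zero]
      refine (tendsto_inv_atTop_zero.comp ?_).neg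
      refine tendsto_atTop_mono (fun y => ?_) tendsto_id
      simp only [id]
      nlinarith [sq_nonneg (y - 1)]
  rw [h]
  simp [measureReal_def]
  ring

lemma integrable_inv_one_add_sq : Integrable fun u : ℂ => ((1 + ‖u‖ ^ 2) ^ 2)⁻¹ := by
  by_contra h
  have := integral_undef h
  rw [integral_inv_one_add_sq] at this
  exact pi_ne_zero this

/-- An approximate identity with a slowly varying factor. -/
lemma tendsto_integral_approx {K : ℝ → ℂ} {k : ℂ} (hK : ContinuousOn K (Ioi 0))
    (hk : Tendsto K (𝓝[>] 0) (𝓝 k)) {φ : ℂ → ℂ} (hφ : Continuous φ)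
    (hφc : HasCompactSupport φ) :
    Tendsto (fun ε : ℝ => ∫ x, K (‖x‖ ^ 2 + ε ^ 2) *
      ((ε ^ 2 / (‖x‖ ^ 2 + ε ^ 2) ^ 2 : ℝ) : ℂ) * φ x) (𝓝[>] 0) (𝓝 (π * k * φ 0)) := by
  obtain ⟨R, hR⟩ : ∃ R : ℝ, ∀ x, R < ‖x‖ → φ x = 0 := by
    obtain ⟨R, hR⟩ := hφc.isBounded.subset_closedBall 0
    refine ⟨R, fun x hx => ?_⟩
    by_contra h
    have := hR (subset_tsupport φ h)
    rw [mem_closedBall_zero_iff] at this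
    linarith
  obtain ⟨D, hD⟩ := hφ.bounded_above_of_compact_support hφc
  obtain ⟨C, hC⟩ : ∃ C : ℝ, ∀ Y, 0 < Y → Y ≤ R ^ 2 + 1 → ‖K Y‖ ≤ C := by
    obtain ⟨δ, hδ, hδ'⟩ : ∃ δ > 0, ∀ Y, 0 < Y → Y < δ → ‖K Y‖ ≤ ‖k‖ + 1 := by
      have h := hk.norm.eventually (Iio_mem_nhds (lt_add_one ‖k‖))
      rw [eventually_nhdsWithin_iff, Metric.eventually_nhds_iff] at h
      obtain ⟨δ, hδ, h⟩ := h
      refine ⟨δ, hδ, fun Y h1 h2 => (h ?_ h1).le⟩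
      rwa [Real.dist_0_eq_abs, abs_of_pos h1]
    obtain ⟨C, hC⟩ := isCompact_Icc.exists_bound_of_continuousOn
      (hK.mono fun Y (hY : Y ∈ Icc δ (R ^ 2 + 1)) => hδ.trans_le hY.1)
    refine ⟨max (‖k‖ + 1) C, fun Y h1 h2 => ?_⟩
    rcases lt_or_ge Y δ with h | h
    · exact (hδ' Y h1 h).trans (le_max_left _ _)
    · exact (hC Y ⟨h, h2⟩).trans (le_max_right _ _)
  have hC0 : 0 ≤ C := (norm_nonneg _).trans (hC (R ^ 2 + 1) (by positivity) le_rfl)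
  have hD0 : 0 ≤ D := (norm_nonneg _).trans (hD 0)
  have hscale : ∀ᶠ ε : ℝ in 𝓝[>] 0, (∫ u : ℂ, K (ε ^ 2 * (1 + ‖u‖ ^ 2)) *
      ((((1 + ‖u‖ ^ 2) ^ 2)⁻¹ : ℝ) : ℂ) * φ (ε • u)) = ∫ x, K (‖x‖ ^ 2 + ε ^ 2) *
      ((ε ^ 2 / (‖x‖ ^ 2 + ε ^ 2) ^ 2 : ℝ) : ℂ) * φ x := by
    filter_upwards [self_mem_nhdsWithin] with ε hε
    have hε : 0 < ε := hε
    have h := Measure.integral_comp_smul (μ := (volume : Measure ℂ)) (fun x => K (‖x‖ ^ 2 + ε ^ 2) *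
      ((ε ^ 2 / (‖x‖ ^ 2 + ε ^ 2) ^ 2 : ℝ) : ℂ) * φ x) ε
    rw [Complex.finrank_real_complex, abs_of_pos (by positivity), eq_inv_smul_iff₀
      (by positivity)] at h
    rw [← h, ← integral_smul]
    congr 1 with u
    rw [norm_smul, Real.norm_of_nonneg hε.le]
    have e1 : (ε * ‖u‖) ^ 2 + ε ^ 2 = ε ^ 2 * (1 + ‖u‖ ^ 2) := by ring
    have e2 : ((1 + ‖u‖ ^ 2) ^ 2)⁻¹ = ε ^ 2 * (ε ^ 2 / (ε ^ 2 * (1 + ‖u‖ ^ 2)) ^ 2) := by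
      field_simp
    simp only [e1, e2, Complex.real_smul (x := ε ^ 2)]
    push_cast; ring
  refine Tendsto.congr' hscale ?_
  have hlim : π * k * φ 0 = ∫ u : ℂ, k * ((((1 + ‖u‖ ^ 2) ^ 2)⁻¹ : ℝ) : ℂ) * φ 0 := by
    rw [integral_mul_const, integral_const_mul, integral_complex_ofReal, integral_inv_one_add_sq]
    ring
  rw [hlim]
  refine tendsto_integral_filter_of_dominated_convergence
    (fun u : ℂ => C * D * ((1 + ‖u‖ ^ 2) ^ 2)⁻¹) ?_ ?_ (integrable_inv_one_add_sq.const_mul _) ?_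
  · filter_upwards [self_mem_nhdsWithin] with ε hε
    have hε : 0 < ε := hε
    apply Continuous.aestronglyMeasurable
    have h1 : Continuous fun u : ℂ => K (ε ^ 2 * (1 + ‖u‖ ^ 2)) :=
      hK.comp_continuous (by fun_prop) fun u => by
        rw [mem_Ioi]
        positivity
    have h2 : Continuous fun u : ℂ => ((((1 + ‖u‖ ^ 2) ^ 2)⁻¹ : ℝ) : ℂ) :=
      Complex.continuous_ofReal.comp (Continuous.inv₀ (by fun_prop) fun u => by positivity)
    exact (h1.mul h2).mul (hφ.comp (by fun_prop))
  · filter_upwards [self_mem_nhdsWithin, Ioo_mem_nhdsGT (show (0 : ℝ) < 1 by norm_num)]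
      with ε hε hε1
    have hε : 0 < ε := hε
    refine Eventually.of_forall fun u => ?_
    have hp : 0 ≤ ((1 + ‖u‖ ^ 2) ^ 2)⁻¹ := by positivity
    rw [norm_mul, norm_mul, Complex.norm_real, Real.norm_of_nonneg hp]
    by_cases hu : R < ‖ε • u‖
    · rw [hR _ hu, norm_zero, mul_zero]
      positivity
    · have h1 : ‖K (ε ^ 2 * (1 + ‖u‖ ^ 2))‖ ≤ C := by
        refine hC _ (by positivity) ?_
        have h2 : ‖ε • u‖ ^ 2 ≤ R ^ 2 := by
          have := norm_nonneg (ε • u)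
          gcongr
          linarith
        rw [norm_smul, Real.norm_of_nonneg hε.le] at h2
        nlinarith [hε1.2]
      calc _ ≤ C * ((1 + ‖u‖ ^ 2) ^ 2)⁻¹ * D := by
            gcongr
            exact hD _
        _ = _ := by ring
  · refine Eventually.of_forall fun u => ?_
    refine Tendsto.mul (Tendsto.mul_const _ (hk.comp ?_)) ?_
    · refine tendsto_nhdsWithin_iff.2 ⟨?_, ?_⟩
      · have : Continuous fun ε : ℝ => ε ^ 2 * (1 + ‖u‖ ^ 2) := by fun_prop
        have h := this.tendsto 0
        simp only [ne_eq, OfNat.ofNat_ne_zero, not_false_eq_true, zero_pow, zero_mul] at h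
        exact h.mono_left nhdsWithin_le_nhds
      · filter_upwards [self_mem_nhdsWithin] with ε hε
        have hε : 0 < ε := hε
        rw [mem_Ioi]
        positivity
    · have : Continuous fun ε : ℝ => φ (ε • u) := hφ.comp (by fun_prop)
      have h := this.tendsto 0
      simp only [zero_smul] at h
      exact h.mono_left nhdsWithin_le_nhds

lemma integrable_inv_mul {φ : ℂ → ℂ} (hφ : Continuous φ) (hc : HasCompactSupport φ) :
    Integrable fun z : ℂ => z⁻¹ * φ z := by
  obtain ⟨D, hD⟩ := hφ.bounded_above_of_compact_support hc
  have hfin : volume (tsupport φ) ≠ ⊤ := hc.isCompact.measure_lt_top.ne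
  have hinteg : IntegrableOn (fun z : ℂ => z⁻¹) (tsupport φ) := by
    refine ⟨(measurable_inv).aestronglyMeasurable, ?_⟩
    refine lt_of_le_of_lt (lintegral_mono fun z => ?_) (lt_of_le_of_lt
      (lintegral_kn_le (s := 1) (by norm_num) (tsupport φ) 0)
      (ENNReal.add_lt_top.2 ⟨knC_lt_top (by norm_num), hfin.lt_top⟩))
    simpa using enorm_inv_le_kn z
  have h2 : IntegrableOn (fun z : ℂ => z⁻¹ * φ z) (tsupport φ) :=
    Integrable.mul_bdd (c := D) hinteg hφ.aestronglyMeasurable (Eventually.of_forall hD)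
  refine (integrableOn_iff_integrable_of_support_subset fun z hz => ?_).1 h2
  by_contra h
  exact hz (by simp [image_eq_zero_of_notMem_tsupport h])

lemma ofReal_norm_sq_eq (z : ℂ) : ((‖z‖ ^ 2 : ℝ) : ℂ) = z * conj z := by
  rw [Complex.mul_conj, Complex.normSq_eq_norm_sq]

lemma wd_mul_conj_add (σ c z : ℂ) : wd σ (fun z => z * conj z + c) z =
    (1 + σ * Complex.I) / 2 * conj z + z * ((1 - σ * Complex.I) / 2) := by
  have h1 : DifferentiableAt ℝ (fun z : ℂ => z) z := differentiableAt_id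
  have h2 : DifferentiableAt ℝ (fun z : ℂ => conj z) z := Complex.conjCLE.differentiableAt
  rw [wd_add (f := fun z => z * conj z) (h1.mul h2) (differentiableAt_const c), wd_mul h1 h2,
    wd_id, wd_starRingEnd, wd_const, add_zero]

lemma contDiff_conj : ContDiff ℝ ∞ fun z : ℂ => conj z := Complex.conjCLE.contDiff

lemma mul_conj_add_ne_zero {ε : ℝ} (hε : 0 < ε) (z : ℂ) : z * conj z + (ε : ℂ) ^ 2 ≠ 0 := by
  rw [← ofReal_norm_sq_eq, ← Complex.ofReal_pow, ← Complex.ofReal_add]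
  have : ‖z‖ ^ 2 + ε ^ 2 ≠ 0 := by positivity
  exact_mod_cast this

lemma integral_inv_mul_wd {φ : ℂ → ℂ} (hφ : TF φ) :
    ∫ z, z⁻¹ * wd Complex.I φ z = -(π * φ 0) := by
  have hd : ∀ z : ℂ, ∀ ε : ℝ, 0 < ε → wd Complex.I
      (fun z => conj z * (z * conj z + (ε : ℂ) ^ 2)⁻¹) z =
        ((ε ^ 2 / (‖z‖ ^ 2 + ε ^ 2) ^ 2 : ℝ) : ℂ) := by
    intro z ε hε
    have hne := mul_conj_add_ne_zero hε z
    have h1 : DifferentiableAt ℝ (fun z : ℂ => conj z) z := Complex.conjCLE.differentiableAt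
    have h2 : DifferentiableAt ℝ (fun z : ℂ => z * conj z + (ε : ℂ) ^ 2) z :=
      (differentiableAt_id.mul h1).add_const _
    have h3 : DifferentiableAt ℝ (fun z : ℂ => (z * conj z + (ε : ℂ) ^ 2)⁻¹) z := h2.inv hne
    rw [wd_mul h1 h3, wd_comp (g := fun w => w⁻¹) (Y := fun z => z * conj z + (ε : ℂ) ^ 2)
      (hasDerivAt_inv hne) h2, wd_mul_conj_add,
      wd_starRingEnd, Complex.I_mul_I]
    push_cast [ofReal_norm_sq_eq]
    have e : ((‖z‖ : ℂ)) ^ 2 = z * conj z := by rw [← ofReal_norm_sq_eq]; push_cast; rfl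
    rw [e]
    field_simp
    ring
  have hsm : ∀ ε : ℝ, 0 < ε → ContDiff ℝ ∞ fun z : ℂ => conj z * (z * conj z + (ε : ℂ) ^ 2)⁻¹ :=
    fun ε hε => contDiff_conj.mul (((contDiff_id.mul contDiff_conj).add contDiff_const).inv
      (mul_conj_add_ne_zero hε))
  have hψ := hφ.wd Complex.I
  have l1 : Tendsto (fun ε : ℝ => ∫ z, conj z * (z * conj z + (ε : ℂ) ^ 2)⁻¹ * wd Complex.I φ z)
      (𝓝[>] 0) (𝓝 (∫ z, z⁻¹ * wd Complex.I φ z)) := by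
    refine tendsto_integral_filter_of_dominated_convergence (fun z => ‖z⁻¹ * wd Complex.I φ z‖)
      ?_ ?_ (integrable_inv_mul hψ.continuous hψ.comp).norm ?_
    · filter_upwards [self_mem_nhdsWithin] with ε hε
      exact ((hsm ε hε).continuous.mul hψ.continuous).aestronglyMeasurable
    · filter_upwards [self_mem_nhdsWithin] with ε hε
      have hε : 0 < ε := hε
      refine Eventually.of_forall fun z => ?_
      rw [norm_mul, norm_mul _ (wd Complex.I φ z)]
      gcongr
      rw [norm_mul, norm_inv, norm_inv, RCLike.norm_conj, ← ofReal_norm_sq_eq,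
        ← Complex.ofReal_pow, ← Complex.ofReal_add, Complex.norm_real,
        Real.norm_of_nonneg (by positivity)]
      rcases eq_or_ne z 0 with rfl | hz
      · simp
      · have : 0 < ‖z‖ := norm_pos_iff.2 hz
        rw [← div_eq_mul_inv, div_le_iff₀ (by positivity), inv_mul_eq_div, le_div_iff₀ this]
        nlinarith [sq_nonneg ε]
    · have h0 : ∀ᵐ z : ℂ, z ≠ 0 := by
        rw [ae_iff]; simp
      filter_upwards [h0] with z hz
      refine Tendsto.mul_const _ ?_
      have h1 : ContinuousAt (fun ε : ℝ => conj z * (z * conj z + (ε : ℂ) ^ 2)⁻¹) 0 := by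
        refine ContinuousAt.mul continuousAt_const (ContinuousAt.inv₀ (by fun_prop) ?_)
        simp [hz]
      have h2 := h1.tendsto.mono_left (nhdsWithin_le_nhds (s := Ioi 0))
      convert h2 using 2
      have : conj z ≠ 0 := by simpa using hz
      simp
      field_simp
  have l2 := tendsto_integral_approx (K := fun _ => 1) (k := 1) continuousOn_const
    tendsto_const_nhds hφ.continuous hφ.comp
  have l3 := l2.neg
  rw [mul_one] at l3
  refine tendsto_nhds_unique l1 (l3.congr' ?_)
  filter_upwards [self_mem_nhdsWithin] with ε hε
  rw [integral_mul_wd (hsm ε hε) hφ]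
  congr 2 with z
  rw [hd z ε hε, one_mul]

lemma setIntegral_of_tsupport {B : Set ℂ} {ψ g : ℂ → ℂ} (hs : tsupport ψ ⊆ B)
    (hg : ∀ z, z ∉ tsupport ψ → g z = 0) : ∫ z in B, g z = ∫ z, g z :=
  setIntegral_eq_integral_of_forall_compl_eq_zero fun z hz => hg z fun h => hz (hs h)

lemma wd_eq_zero_of_notMem {σ : ℂ} {ψ : ℂ → ℂ} {z : ℂ} (h : z ∉ tsupport ψ) : wd σ ψ z = 0 := by
  by_contra h'
  exact h (support_wd_subset σ ψ h')

lemma cau_wd {B : Set ℂ} {ψ : ℂ → ℂ} (hψ : TF ψ) (hs : tsupport ψ ⊆ B) (w : ℂ) :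
    cau B (wd Complex.I ψ) w = ψ w := by
  rw [cau, setIntegral_of_tsupport hs fun z hz => by rw [wd_eq_zero_of_notMem hz, zero_mul],
    ← integral_add_right_eq_self _ w]
  have h := integral_inv_mul_wd (hψ.comp_add w)
  simp only [wd_comp_add_right, zero_add] at h
  have e : ∀ z, wd Complex.I ψ (z + w) * (w - (z + w))⁻¹ = -(z⁻¹ * wd Complex.I ψ (z + w)) := by
    intro z
    rw [show w - (z + w) = -z by ring, inv_neg]; ring
  simp_rw [e]
  rw [integral_neg, h]
  have : (π : ℂ) ≠ 0 := by exact_mod_cast pi_ne_zero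
  field_simp

lemma cauc_wd {B : Set ℂ} {ψ : ℂ → ℂ} (hψ : TF ψ) (hs : tsupport ψ ⊆ B) (w : ℂ) :
    cauc B (wd (-Complex.I) ψ) w = ψ w := by
  have hs' : tsupport (fun z => conj (ψ z)) ⊆ B := by
    refine subset_trans (closure_mono fun z hz => ?_) hs
    simpa using hz
  have h := cau_wd hψ.star hs' w
  have e : wd Complex.I (fun z => conj (ψ z)) = fun z => conj (wd (-Complex.I) ψ z) := by
    ext z
    rw [wd_comp_conj (hψ.differentiable z), Complex.conj_I]
  rw [e] at h
  rw [cauc_eq, h, Complex.conj_conj]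

lemma integral_mul_cauc {B : Set ℂ} (hB : volume B ≠ ⊤) {f g : ℂ → ℂ} (hf : BM f) (hg : BM g) :
    ∫ z in B, f z * cauc B g z = -∫ w in B, g w * cauc B f w := by
  have h := congrArg (starRingEnd ℂ) (integral_mul_cau hB hf.conj hg.conj)
  rw [map_neg, ← integral_conj, ← integral_conj] at h
  simpa only [map_mul, Complex.conj_conj, ← cauc_eq] using h

/-! ### Complex geometrical optics solutions are weak solutions -/

/-- The holomorphic phase `exp(iτ(z - z₀)²)`. -/
def hol (τ : ℝ) (z₀ z : ℂ) : ℂ := Complex.exp (Complex.I * τ * (z - z₀) ^ 2)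

lemma hasDerivAt_hol (τ : ℝ) (z₀ z : ℂ) :
    HasDerivAt (hol τ z₀) (hol τ z₀ z * (Complex.I * τ * (2 * (z - z₀)))) z := by
  have h := (((((hasDerivAt_id z).sub_const z₀).pow 2).const_mul (Complex.I * (τ : ℂ)))).cexp
  refine h.congr_deriv ?_
  simp [hol]

lemma contDiff_hol (τ : ℝ) (z₀ : ℂ) : ContDiff ℝ ∞ (hol τ z₀) := by
  unfold hol
  exact ((contDiff_const.mul ((contDiff_id.sub contDiff_const).pow 2))).cexp

lemma wd_hol (τ : ℝ) (z₀ z : ℂ) : wd Complex.I (hol τ z₀) z = 0 := by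
  have h := wd_comp (σ := Complex.I) (Y := fun z => z) (hasDerivAt_hol τ z₀ z) differentiableAt_id
  rw [wd_id, Complex.I_mul_I] at h
  simpa using h

lemma osc_eq (τ : ℝ) (z₀ z : ℂ) : osc τ z₀ z = hol τ z₀ z * conj (hol (-τ) z₀ z) := by
  rw [osc, hol, hol, ← Complex.exp_conj, ← Complex.exp_add]
  congr 1
  have := Complex.add_conj ((z - z₀) ^ 2)
  rw [map_mul, map_mul, Complex.conj_I, Complex.conj_ofReal]
  push_cast at this ⊢
  linear_combination (-Complex.I * τ) * this

lemma hol_mul_hol_neg (τ : ℝ) (z₀ z : ℂ) : hol τ z₀ z * hol (-τ) z₀ z = 1 := by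
  rw [hol, hol, ← Complex.exp_add, ← Complex.exp_zero]
  congr 1
  push_cast; ring

lemma IsCGO.weak {B : Set ℂ} (hB : volume B ≠ ⊤) {q : ℂ → ℂ} (hq : BM q) {τ : ℝ} {z₀ : ℂ}
    {r h : ℂ → ℂ} (H : IsCGO B q τ z₀ r h) {φ : ℂ → ℂ} (hφ : TF φ) (hs : tsupport φ ⊆ B) :
    ∫ z in B, hol τ z₀ z * (1 + r z) * (4 * wd Complex.I (wd (-Complex.I) φ) z) =
      ∫ z in B, q z * (hol τ z₀ z * (1 + r z)) * φ z := by
  set ψ := wd (-Complex.I) φ with hψ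
  have tψ : TF ψ := hφ.wd _
  have sψ : tsupport ψ ⊆ B := (tsupport_wd_subset _ _).trans hs
  set A := fun z => hol τ z₀ z * ψ z with hA
  have tA : TF A := tψ.smooth_mul (contDiff_hol τ z₀)
  have sA : tsupport A ⊆ B := (tsupport_mul_subset_right).trans sψ
  set D := fun z => conj (hol τ z₀ z) * φ z with hD
  have cD : ContDiff ℝ ∞ fun z => conj (hol τ z₀ z) := contDiff_conj.comp (contDiff_hol τ z₀)
  have tD : TF D := hφ.smooth_mul cD
  have sD : tsupport D ⊆ B := (tsupport_mul_subset_right).trans hs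
  have dhol : ∀ z, DifferentiableAt ℝ (hol τ z₀) z := fun z =>
    (contDiff_hol τ z₀).differentiable (by simp) z
  have wA : ∀ z, wd Complex.I A z = hol τ z₀ z * wd Complex.I ψ z := fun z => by
    rw [hA, wd_mul (dhol z) (tψ.differentiable z), wd_hol, zero_mul, zero_add]
  have wD : ∀ z, wd (-Complex.I) D z = conj (hol τ z₀ z) * ψ z := fun z => by
    rw [hD, wd_mul (cD.differentiable (by simp) z) (hφ.differentiable z), wd_comp_conj (dhol z),
      map_neg, Complex.conj_I, neg_neg, wd_hol, map_zero, zero_mul, zero_add]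
  have bA : BM (wd Complex.I A) := (tA.wd _).bm
  have bD : BM (wd (-Complex.I) D) := (tD.wd _).bm
  have z1 : ∫ z in B, wd Complex.I A z = 0 := by
    rw [setIntegral_of_tsupport sA fun z hz => wd_eq_zero_of_notMem hz]
    have := integral_mul_wd (f := fun _ => 1) contDiff_const tA Complex.I
    simpa [wd_const] using this
  have bg : BM fun w => osc (-τ) z₀ w * h w := (BM.osc _ _).mul H.bm_h
  have bk : BM fun x => osc τ z₀ x * (q x * (1 + r x)) :=
    (BM.osc _ _).mul (hq.mul ((BM.const 1).add H.bm_r))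
  have z2 : ∫ z in B, wd Complex.I A z * r z = -∫ z in B, wd (-Complex.I) D z * h z := by
    simp_rw [H.eq_r]
    rw [integral_mul_cau hB bA bg]
    congr 2 with z
    rw [cau_wd tA sA, wD, hA, osc_eq, neg_neg]
    have := hol_mul_hol_neg τ z₀ z
    linear_combination (conj (hol τ z₀ z) * h z * ψ z) * this
  have z3 : ∫ z in B, wd (-Complex.I) D z * h z =
      -(1 / 4 * ∫ z in B, q z * (hol τ z₀ z * (1 + r z)) * φ z) := by
    have e : ∀ z, wd (-Complex.I) D z * h z = 1 / 4 * (wd (-Complex.I) D z *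
        cauc B (fun x => osc τ z₀ x * (q x * (1 + r x))) z) := fun z => by
      rw [H.eq_h z]; ring
    simp_rw [e]
    rw [integral_const_mul, integral_mul_cauc hB bD bk, mul_neg]
    congr 3 with z
    rw [cauc_wd tD sD, hD, osc_eq]
    have := congrArg (starRingEnd ℂ) (hol_mul_hol_neg τ z₀ z)
    rw [map_mul, map_one] at this
    linear_combination (hol τ z₀ z * (q z * (1 + r z)) * φ z) * this
  have e : ∀ z, hol τ z₀ z * (1 + r z) * (4 * wd Complex.I ψ z) =
      4 * (wd Complex.I A z + wd Complex.I A z * r z) := fun z => by rw [wA]; ring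
  simp_rw [e]
  rw [integral_const_mul, integral_add (bA.integrable hB) ((bA.mul H.bm_r).integrable hB), z1, z2,
    z3]
  ring

end GKL

namespace GKL

open Filter Topology ComplexConjugate
open scoped ENNReal NNReal ContDiff

/-! ### The fundamental solution -/

/-- The outgoing Green function of `-Δ - 4` on the plane. -/
def grn (x : ℂ) : ℂ := Efun ((‖x‖ ^ 2 : ℝ) : ℂ)

lemma grn_neg (x : ℂ) : grn (-x) = grn x := by rw [grn, grn, norm_neg]

lemma grn_sub_comm (x y : ℂ) : grn (x - y) = grn (y - x) := by rw [← grn_neg, neg_sub]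

/-- The operator `-Δ - 4`. -/
def hlm (φ : ℂ → ℂ) (z : ℂ) : ℂ := -(4 * wd Complex.I (wd (-Complex.I) φ) z) - 4 * φ z

lemma wd_comm {φ : ℂ → ℂ} {z : ℂ} (h : ContDiffAt ℝ 2 φ z) (σ τ : ℂ) :
    wd σ (wd τ φ) z = wd τ (wd σ φ) z := by
  have hs := h.isSymmSndFDerivAt (by simp)
  have hd : DifferentiableAt ℝ (fderiv ℝ φ) z :=
    (h.fderiv_right (m := 1) (by norm_num)).differentiableAt (by simp)
  have key : ∀ σ τ : ℂ, wd σ (wd τ φ) z =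
      ((fderiv ℝ (fderiv ℝ φ) z 1 1 + τ * fderiv ℝ (fderiv ℝ φ) z 1 Complex.I) +
        σ * (fderiv ℝ (fderiv ℝ φ) z Complex.I 1 +
          τ * fderiv ℝ (fderiv ℝ φ) z Complex.I Complex.I)) / 4 := by
    intro σ τ
    have h1 : ∀ v : ℂ, HasFDerivAt (fun w => fderiv ℝ φ w v)
        ((fderiv ℝ (fderiv ℝ φ) z).flip v) z := fun v => by
      have := hd.hasFDerivAt.clm_apply (hasFDerivAt_const v z)
      refine this.congr_fderiv ?_
      ext; simp
    have h2 : HasFDerivAt (fun w => (fderiv ℝ φ w 1 + τ * fderiv ℝ φ w Complex.I) / 2)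
        ((2 : ℂ)⁻¹ • ((fderiv ℝ (fderiv ℝ φ) z).flip 1 +
          τ • (fderiv ℝ (fderiv ℝ φ) z).flip Complex.I)) z := by
      have := ((h1 1).add ((h1 Complex.I).const_mul τ)).const_mul (2 : ℂ)⁻¹
      refine this.congr_of_eventuallyEq (Eventually.of_forall fun w => ?_)
      simp [div_eq_inv_mul]
    have h3 : wd τ φ = fun w => (fderiv ℝ φ w 1 + τ * fderiv ℝ φ w Complex.I) / 2 := rfl
    rw [h3, wd_eq h2]
    simp
    ring
  rw [key, key, hs.eq 1 Complex.I]
  ring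

lemma hasDerivAt_Efun' {X : ℂ} (hX : X ∈ Complex.slitPlane) :
    HasDerivAt Efun' (-(Efun X + Efun' X) / X) X := by
  have hX0 := Complex.slitPlane_ne_zero hX
  have h := (hasDerivAt_mul_Efun' hX).mul (hasDerivAt_inv hX0)
  have h1 : Efun' =ᶠ[𝓝 X] fun X => (X * Efun' X) * X⁻¹ := by
    filter_upwards [isOpen_ne.mem_nhds hX0] with Y hY
    field_simp
  refine (HasDerivAt.congr_of_eventuallyEq h h1).congr_deriv ?_
  field_simp
  ring

lemma contDiffOn_Efun : ContDiffOn ℝ ∞ Efun Complex.slitPlane :=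
  ((show DifferentiableOn ℂ Efun Complex.slitPlane from fun _ hX =>
    (hasDerivAt_Efun hX).differentiableAt.differentiableWithinAt).contDiffOn
      Complex.isOpen_slitPlane).restrict_scalars ℝ

lemma continuousOn_Efun : ContinuousOn Efun Complex.slitPlane := contDiffOn_Efun.continuousOn

lemma continuousOn_Efun' : ContinuousOn Efun' Complex.slitPlane := fun _ hX =>
  (hasDerivAt_Efun' hX).continuousAt.continuousWithinAt

lemma ofReal_mem_slitPlane {x : ℝ} (hx : 0 < x) : (x : ℂ) ∈ Complex.slitPlane :=
  Complex.ofReal_mem_slitPlane.2 hx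

/-- A bound for `Efun` in terms of the logarithm. -/
lemma norm_Efun_le : ∃ C : ℝ, 0 ≤ C ∧ ∀ X : ℂ, X ≠ 0 →
    ‖Efun X‖ ≤ C * (1 + |Real.log ‖X‖|) * rexp (4 * √‖X‖) := by
  set a : ℝ := ‖Complex.I / 4 - eulerMascheroniConstant / (2 * π)‖
  set b : ℝ := ‖(1 / (2 * π) : ℂ)‖
  set d : ℝ := ‖(1 / (4 * π) : ℂ)‖
  refine ⟨a + b + d * (1 + π), by positivity, fun X hX => ?_⟩
  have hA : ‖besA X‖ ≤ rexp (4 * √‖X‖) := by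
    have := norm_pser_le (a := acoef) (C := 1) (K := 2) (by norm_num) (by norm_num)
      norm_acoef_le X
    rw [one_mul] at this
    refine this.trans (Real.exp_le_exp.2 (by nlinarith [Real.sqrt_nonneg ‖X‖]))
  have hB : ‖besB X‖ ≤ rexp (4 * √‖X‖) := by
    have := norm_pser_le (a := bcoef) (C := 1) (K := 2) (by norm_num) (by norm_num)
      norm_bcoef_le X
    rw [one_mul] at this
    refine this.trans (Real.exp_le_exp.2 (by nlinarith [Real.sqrt_nonneg ‖X‖]))
  have hL : ‖Complex.log X‖ ≤ |Real.log ‖X‖| + π := by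
    refine (Complex.norm_le_abs_re_add_abs_im _).trans ?_
    rw [Complex.log_re, Complex.log_im]
    gcongr
    exact Complex.abs_arg_le_pi X
  have hl := abs_nonneg (Real.log ‖X‖)
  have hp := pi_pos
  calc ‖Efun X‖ ≤ a * ‖besA X‖ + b * ‖besB X‖ + d * (‖Complex.log X‖ * ‖besA X‖) := by
        rw [Efun]
        refine (norm_sub_le _ _).trans (add_le_add ((norm_sub_le _ _).trans ?_) ?_)
        · rw [norm_mul, norm_mul]
        · rw [norm_mul, norm_mul]
    _ ≤ a * rexp (4 * √‖X‖) + b * rexp (4 * √‖X‖) +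
        d * ((|Real.log ‖X‖| + π) * rexp (4 * √‖X‖)) := by gcongr
    _ = (a + b + d * (|Real.log ‖X‖| + π)) * rexp (4 * √‖X‖) := by ring
    _ ≤ ((a + b + d * (1 + π)) * (1 + |Real.log ‖X‖|)) * rexp (4 * √‖X‖) := by
        gcongr
        have h1 : 0 ≤ (a + b + d * π) * |Real.log ‖X‖| := by positivity
        have h2 : 0 ≤ d := norm_nonneg _
        nlinarith

lemma norm_Efun_real_le (M : ℝ) : ∃ C : ℝ, 0 < C ∧ ∀ X : ℝ, 0 < X → X ≤ M →
    ‖Efun (X : ℂ)‖ ≤ C * X ^ (-(1 / 4 : ℝ)) := by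
  obtain ⟨C, hC, h⟩ := norm_Efun_le
  have hM0 : 0 ≤ |M| := abs_nonneg M
  refine ⟨(C + 1) * (4 + 3 * |M| ^ (3 / 4 : ℝ) + |M| ^ (1 / 4 : ℝ)) * rexp (4 * √|M|), by positivity,
    fun X hX hXM => ?_⟩
  have hXM : X ≤ |M| := hXM.trans (le_abs_self M)
  have h1 := h X (by exact_mod_cast hX.ne')
  rw [Complex.norm_real, Real.norm_of_nonneg hX.le] at h1
  have hq : 0 < X ^ (-(1 / 4 : ℝ)) := Real.rpow_pos_of_pos hX _
  have h2 : |Real.log X| ≤ 2 * X ^ (1 / 2 : ℝ) + 4 * X ^ (-(1 / 4 : ℝ)) := by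
    have h3 := abs_log_le (Real.rpow_pos_of_pos hX (1 / 2))
    rw [Real.log_rpow hX, ← Real.rpow_mul hX.le, abs_mul, abs_of_pos (by norm_num : (0:ℝ) < 1 / 2)]
      at h3
    norm_num at h3 ⊢
    linarith
  have e1 : X ^ (1 / 2 : ℝ) = X ^ (3 / 4 : ℝ) * X ^ (-(1 / 4 : ℝ)) := by
    rw [← Real.rpow_add hX]; norm_num
  have e2 : (1 : ℝ) = X ^ (1 / 4 : ℝ) * X ^ (-(1 / 4 : ℝ)) := by
    rw [← Real.rpow_add hX]; norm_num
  have h4 : X ^ (3 / 4 : ℝ) ≤ |M| ^ (3 / 4 : ℝ) := Real.rpow_le_rpow hX.le hXM (by norm_num)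
  have h5 : X ^ (1 / 4 : ℝ) ≤ |M| ^ (1 / 4 : ℝ) := Real.rpow_le_rpow hX.le hXM (by norm_num)
  have h6 : 1 + |Real.log X| ≤
      (4 + 3 * |M| ^ (3 / 4 : ℝ) + |M| ^ (1 / 4 : ℝ)) * X ^ (-(1 / 4 : ℝ)) := by
    rw [e1] at h2
    have p0 : 0 ≤ |M| ^ (3 / 4 : ℝ) := by positivity
    nlinarith [mul_le_mul_of_nonneg_right h4 hq.le, mul_le_mul_of_nonneg_right h5 hq.le,
      mul_nonneg p0 hq.le]
  calc ‖Efun (X : ℂ)‖ ≤ C * (1 + |Real.log X|) * rexp (4 * √X) := h1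
    _ ≤ (C + 1) * ((4 + 3 * |M| ^ (3 / 4 : ℝ) + |M| ^ (1 / 4 : ℝ)) * X ^ (-(1 / 4 : ℝ))) *
        rexp (4 * √|M|) := by
          gcongr
          linarith
    _ = _ := by ring

lemma measurable_besA : Measurable besA := continuous_besA.measurable

lemma measurable_Efun : Measurable Efun := by
  unfold Efun
  exact ((measurable_besA.const_mul _).sub (continuous_besB.measurable.const_mul _)).sub
    ((Complex.measurable_log.mul measurable_besA).const_mul _)

lemma measurable_grn : Measurable grn :=
  measurable_Efun.comp (Complex.measurable_ofReal.comp (measurable_norm.pow_const 2))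

/-- Local bound for the fundamental solution, including its regularisations. -/
lemma enorm_Efun_add_le (ρ : ℝ) : ∃ C : ℝ≥0, ∀ (x : ℂ) (ε : ℝ), ‖x‖ ≤ ρ → |ε| ≤ 1 →
    ‖Efun ((‖x‖ ^ 2 + ε ^ 2 : ℝ) : ℂ)‖ₑ ≤ C * kn (1 / 2) x := by
  obtain ⟨C, hC, h⟩ := norm_Efun_real_le (ρ ^ 2 + 1)
  refine ⟨C.toNNReal, fun x ε hx hε => ?_⟩
  rcases eq_or_ne x 0 with rfl | h0
  · rw [kn_zero_right (by norm_num), ENNReal.mul_top (by simpa using hC)]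
    exact le_top
  · have hn : 0 < ‖x‖ := norm_pos_iff.2 h0
    have hε2 : ε ^ 2 ≤ 1 := by
      rw [← sq_abs]; exact pow_le_one₀ (abs_nonneg ε) hε
    have hb := h (‖x‖ ^ 2 + ε ^ 2) (by positivity)
      (add_le_add (pow_le_pow_left₀ hn.le hx 2) hε2)
    have e1 : ((C.toNNReal : ℝ≥0) : ℝ≥0∞) = ENNReal.ofReal C := rfl
    rw [kn_of_ne h0, ← ofReal_norm, e1, ← ENNReal.ofReal_mul hC.le]
    refine ENNReal.ofReal_le_ofReal (hb.trans ?_)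
    gcongr
    have e2 : ‖x‖ ^ (-(1 / 2 : ℝ)) = (‖x‖ ^ 2) ^ (-(1 / 4 : ℝ)) := by
      rw [← Real.rpow_natCast, ← Real.rpow_mul hn.le]; norm_num
    rw [e2]
    exact Real.rpow_le_rpow_of_nonpos (by positivity) (by nlinarith [sq_nonneg ε]) (by norm_num)

lemma enorm_grn_le (ρ : ℝ) : ∃ C : ℝ≥0, ∀ x : ℂ, ‖x‖ ≤ ρ → ‖grn x‖ₑ ≤ C * kn (1 / 2) x := by
  obtain ⟨C, h⟩ := enorm_Efun_add_le ρ
  refine ⟨C, fun x hx => ?_⟩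
  have := h x 0 hx (by simp)
  rwa [zero_pow two_ne_zero, add_zero] at this

lemma tendsto_Efun_delta :
    Tendsto (fun X : ℝ => -4 * ((X : ℂ) * (Efun X + Efun' X))) (𝓝[>] 0) (𝓝 ((π : ℂ)⁻¹)) := by
  have hc : Tendsto (fun X : ℝ => (X : ℂ)) (𝓝[>] 0) (𝓝 0) := by
    have : Tendsto (fun X : ℝ => (X : ℂ)) (𝓝 0) (𝓝 ((0 : ℝ) : ℂ)) :=
      Complex.continuous_ofReal.tendsto 0
    rw [Complex.ofReal_zero] at this
    exact this.mono_left nhdsWithin_le_nhds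
  have hl : Tendsto (fun X : ℝ => Complex.log X * X) (𝓝[>] 0) (𝓝 0) := by
    have : Tendsto (fun X : ℝ => ((Real.log X * X : ℝ) : ℂ)) (𝓝[>] 0) (𝓝 ((0 : ℝ) : ℂ)) :=
      (Complex.continuous_ofReal.tendsto 0).comp tendsto_log_mul_self_nhdsGT
    rw [Complex.ofReal_zero] at this
    refine this.congr' ?_
    filter_upwards [self_mem_nhdsWithin] with X hX
    rw [Complex.ofReal_mul, Complex.ofReal_log (le_of_lt hX)]
  have cA := (continuous_besA.tendsto 0).comp hc
  have cB := (continuous_besB.tendsto 0).comp hc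
  have cA' := (continuous_besA'.tendsto 0).comp hc
  have cB' := (continuous_besB'.tendsto 0).comp hc
  set c : ℂ := Complex.I / 4 - eulerMascheroniConstant / (2 * π)
  have e := (((((hc.mul cA).const_mul c).sub ((hc.mul cB).const_mul (1 / (2 * π : ℂ)))).sub
    ((hl.mul cA).const_mul (1 / (4 * π : ℂ)))).add ((((hc.mul cA').const_mul c).sub
      ((hc.mul cB').const_mul (1 / (2 * π : ℂ)))).sub
        ((cA.add (hl.mul cA')).const_mul (1 / (4 * π : ℂ))))).const_mul (-4 : ℂ)
  have hpi : (π : ℂ) ≠ 0 := by exact_mod_cast pi_ne_zero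
  have hv : (-4 : ℂ) * (c * (0 * besA 0) - 1 / (2 * π) * (0 * besB 0) - 1 / (4 * π) * (0 * besA 0) +
      (c * (0 * besA' 0) - 1 / (2 * π) * (0 * besB' 0) -
        1 / (4 * π) * (besA 0 + 0 * besA' 0))) = (π : ℂ)⁻¹ := by
    rw [besA_zero]; field_simp; ring
  rw [hv] at e
  refine e.congr' ?_
  filter_upwards [self_mem_nhdsWithin] with X hX
  have hX0 : (X : ℂ) ≠ 0 := by exact_mod_cast (ne_of_gt hX)
  rw [mul_add (X : ℂ), mul_Efun' hX0, Efun]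
  simp only [Function.comp_apply]
  ring

/-- The regularised fundamental solution. -/
def grnε (ε : ℝ) (z : ℂ) : ℂ := Efun (z * conj z + (ε : ℂ) ^ 2)

lemma mul_conj_add_eq (ε : ℝ) (z : ℂ) :
    z * conj z + (ε : ℂ) ^ 2 = ((‖z‖ ^ 2 + ε ^ 2 : ℝ) : ℂ) := by
  rw [← ofReal_norm_sq_eq]; push_cast; rfl

lemma mul_conj_add_mem {ε : ℝ} (hε : 0 < ε) (z : ℂ) :
    z * conj z + (ε : ℂ) ^ 2 ∈ Complex.slitPlane := by
  rw [mul_conj_add_eq]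
  exact ofReal_mem_slitPlane (by positivity)

lemma contDiff_mul_conj_add (c : ℂ) : ContDiff ℝ ∞ fun z : ℂ => z * conj z + c :=
  (contDiff_id.mul contDiff_conj).add contDiff_const

lemma contDiff_grnε {ε : ℝ} (hε : 0 < ε) : ContDiff ℝ ∞ (grnε ε) := by
  rw [← contDiffOn_univ]
  exact contDiffOn_Efun.comp (contDiff_mul_conj_add _).contDiffOn fun z _ => mul_conj_add_mem hε z

lemma wd_wd_grnε {ε : ℝ} (hε : 0 < ε) (z : ℂ) :
    -(4 * wd (-Complex.I) (wd Complex.I (grnε ε)) z) - 4 * grnε ε z =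
      (fun X : ℝ => -4 * ((X : ℂ) * (Efun X + Efun' X))) (‖z‖ ^ 2 + ε ^ 2) *
        ((ε ^ 2 / (‖z‖ ^ 2 + ε ^ 2) ^ 2 : ℝ) : ℂ) := by
  have hY : ∀ z, DifferentiableAt ℝ (fun z : ℂ => z * conj z + (ε : ℂ) ^ 2) z := fun z =>
    (contDiff_mul_conj_add _).differentiable (by simp) z
  have h1 : wd Complex.I (grnε ε) = fun z => Efun' (z * conj z + (ε : ℂ) ^ 2) * z := by
    funext z
    have := wd_comp (σ := Complex.I) (Y := fun z : ℂ => z * conj z + (ε : ℂ) ^ 2)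
      (hasDerivAt_Efun (mul_conj_add_mem hε z)) (hY z)
    rw [wd_mul_conj_add, Complex.I_mul_I] at this
    rw [show grnε ε = fun z => Efun (z * conj z + (ε : ℂ) ^ 2) from rfl, this]
    ring
  have hm := mul_conj_add_mem hε z
  have h2 := wd_comp (σ := -Complex.I) (Y := fun z : ℂ => z * conj z + (ε : ℂ) ^ 2)
    (hasDerivAt_Efun' hm) (hY z)
  rw [wd_mul_conj_add, neg_mul, Complex.I_mul_I] at h2
  have h3 : DifferentiableAt ℝ (fun z => Efun' (z * conj z + (ε : ℂ) ^ 2)) z :=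
    DifferentiableAt.comp (g := Efun') z
      ((hasDerivAt_Efun' hm).differentiableAt.restrictScalars ℝ) (hY z)
  rw [h1, wd_mul (g := fun z => z) h3 differentiableAt_id, h2, wd_id, neg_mul, Complex.I_mul_I,
    grnε]
  have hne : z * conj z + (ε : ℂ) ^ 2 ≠ 0 := Complex.slitPlane_ne_zero hm
  simp only [Complex.ofReal_div, Complex.ofReal_pow _ 2, ← mul_conj_add_eq]
  field_simp
  ring

lemma locInt_kn {s : ℝ} (hs0 : 0 ≤ s) (hs : s < 2) {S : Set ℂ} (hS : volume S ≠ ⊤) (z : ℂ) :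
    ∫⁻ w in S, kn s (w - z) ≠ ⊤ :=
  ((lintegral_kn_le hs0 S z).trans_lt
    (ENNReal.add_lt_top.2 ⟨knC_lt_top hs, hS.lt_top⟩)).ne

lemma TF.hlm {φ : ℂ → ℂ} (hφ : TF φ) : TF (hlm φ) := by
  have h1 := ((hφ.wd (-Complex.I)).wd Complex.I).smooth_mul (contDiff_const (c := (-4 : ℂ)))
  have h2 := hφ.smooth_mul (contDiff_const (c := (-4 : ℂ)))
  have e : GKL.hlm φ = (fun z => -4 * GKL.wd Complex.I (GKL.wd (-Complex.I) φ) z) + fun z => -4 * φ z := by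
    funext z; simp only [GKL.hlm, Pi.add_apply]; ring
  rw [e]
  exact ⟨h1.smooth.add h2.smooth, h1.comp.add h2.comp⟩

/-- `grn` is the fundamental solution of `-Δ - 4`. -/
lemma integral_grn_mul_hlm {φ : ℂ → ℂ} (hφ : TF φ) : ∫ x, grn x * hlm φ x = φ 0 := by
  have hL := hφ.hlm
  obtain ⟨ρ, hρ⟩ := hL.comp.isCompact.isBounded.subset_closedBall 0
  obtain ⟨C, hC⟩ := enorm_Efun_add_le ρ
  obtain ⟨D, hD⟩ := hL.bm.bdd
  have hbnd : ∀ ε : ℝ, |ε| ≤ 1 → ∀ x, ‖grnε ε x * hlm φ x‖ₑ ≤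
      (Metric.closedBall (0 : ℂ) ρ).indicator (fun x => C * D * kn (1 / 2) x) x := by
    intro ε hε x
    by_cases hx : x ∈ Metric.closedBall (0 : ℂ) ρ
    · rw [indicator_of_mem hx, enorm_mul, grnε, mul_conj_add_eq]
      calc _ ≤ (C * kn (1 / 2) x) * D :=
            mul_le_mul' (hC x ε (by simpa using hx) hε) (hD x)
        _ = _ := by ring
    · have : hlm φ x = 0 := image_eq_zero_of_notMem_tsupport fun h => hx (hρ h)
      rw [this, mul_zero, enorm_zero]
      exact zero_le
  have hbm : Measurable fun x : ℂ => (C : ℝ≥0∞) * D * kn (1 / 2) x := (measurable_kn _).const_mul _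
  have hfin : ∫⁻ x, (Metric.closedBall (0 : ℂ) ρ).indicator
      (fun x => (C : ℝ≥0∞) * D * kn (1 / 2) x) x ≠ ⊤ := by
    rw [lintegral_indicator Metric.isClosed_closedBall.measurableSet,
      lintegral_const_mul _ (measurable_kn _)]
    have := locInt_kn (s := 1 / 2) (by norm_num) (by norm_num)
      (isCompact_closedBall (0 : ℂ) ρ).measure_lt_top.ne 0
    simp only [sub_zero] at this
    finiteness
  have hbI : Integrable fun x => ((Metric.closedBall (0 : ℂ) ρ).indicator
      (fun x => (C : ℝ≥0∞) * D * kn (1 / 2) x) x).toReal :=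
    integrable_toReal_of_lintegral_ne_top
      (hbm.indicator Metric.isClosed_closedBall.measurableSet).aemeasurable hfin
  have hlt := ae_lt_top (hbm.indicator Metric.isClosed_closedBall.measurableSet) hfin
  have t1 : Tendsto (fun ε : ℝ => ∫ x, grnε ε x * hlm φ x) (𝓝[>] 0)
      (𝓝 (∫ x, grn x * hlm φ x)) := by
    refine tendsto_integral_filter_of_dominated_convergence _ ?_ ?_ hbI ?_
    · filter_upwards [self_mem_nhdsWithin] with ε hε
      exact ((contDiff_grnε hε).continuous.mul hL.continuous).aestronglyMeasurable
    · filter_upwards [Ioo_mem_nhdsGT (zero_lt_one' ℝ)] with ε hε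
      filter_upwards [hlt] with x hx
      rw [← toReal_enorm]
      exact ENNReal.toReal_mono hx.ne (hbnd ε (by rw [abs_of_pos hε.1]; exact hε.2.le) x)
    · have h0 : ∀ᵐ x : ℂ, x ≠ 0 := by simp [ae_iff]
      filter_upwards [h0] with x hx
      refine Tendsto.mul_const _ ?_
      have hn : 0 < ‖x‖ := norm_pos_iff.2 hx
      have hc : ContinuousAt (fun ε : ℝ => Efun ((‖x‖ ^ 2 + ε ^ 2 : ℝ) : ℂ)) 0 := by
        refine ContinuousAt.comp (g := Efun) ?_ (by fun_prop)
        exact (hasDerivAt_Efun (ofReal_mem_slitPlane (by positivity))).continuousAt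
      have h2 := hc.tendsto
      simp only [ne_eq, OfNat.ofNat_ne_zero, not_false_eq_true, zero_pow, add_zero] at h2
      refine (h2.mono_left nhdsWithin_le_nhds).congr fun ε => ?_
      rw [grnε, mul_conj_add_eq]
  have hK : ContinuousOn (fun X : ℝ => -4 * ((X : ℂ) * (Efun X + Efun' X))) (Ioi 0) := by
    have hm : MapsTo (fun X : ℝ => (X : ℂ)) (Ioi 0) Complex.slitPlane := fun X hX =>
      ofReal_mem_slitPlane hX
    have hc : ContinuousOn (fun X : ℝ => (X : ℂ)) (Ioi 0) := Complex.continuous_ofReal.continuousOn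
    exact continuousOn_const.mul (hc.mul
      ((continuousOn_Efun.comp hc hm).add (continuousOn_Efun'.comp hc hm)))
  have t2 := tendsto_integral_approx hK tendsto_Efun_delta hφ.continuous hφ.comp
  have hpi : (π : ℂ) ≠ 0 := by exact_mod_cast pi_ne_zero
  rw [mul_inv_cancel₀ hpi, one_mul] at t2
  refine tendsto_nhds_unique t1 (t2.congr' ?_)
  filter_upwards [self_mem_nhdsWithin] with ε hε
  have hg := contDiff_grnε hε
  have i1 := integral_mul_wd hg (hφ.wd (-Complex.I)) Complex.I
  have i2 := integral_mul_wd (contDiff_wd hg Complex.I) hφ (-Complex.I)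
  have e1 : ∀ x, grnε ε x * hlm φ x =
      -4 * (grnε ε x * wd Complex.I (wd (-Complex.I) φ) x) - 4 * (grnε ε x * φ x) := by
    intro x; rw [hlm]; ring
  have e2 : ∀ x, (fun X : ℝ => -4 * ((X : ℂ) * (Efun X + Efun' X))) (‖x‖ ^ 2 + ε ^ 2) *
        ((ε ^ 2 / (‖x‖ ^ 2 + ε ^ 2) ^ 2 : ℝ) : ℂ) * φ x =
      -4 * (wd (-Complex.I) (wd Complex.I (grnε ε)) x * φ x) - 4 * (grnε ε x * φ x) := by
    intro x; rw [← wd_wd_grnε hε]; ring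
  have j0 := (hφ.integrable_mul hg.continuous).const_mul (4 : ℂ)
  have j1 := (((hφ.wd (-Complex.I)).wd Complex.I).integrable_mul hg.continuous).const_mul (-4 : ℂ)
  have j2 := (hφ.integrable_mul
    (contDiff_wd (contDiff_wd hg Complex.I) (-Complex.I)).continuous).const_mul (-4 : ℂ)
  simp_rw [e1]
  refine (integral_congr_ae (Eventually.of_forall e2)).trans ?_
  rw [integral_sub j1 j0, integral_sub j2 j0, integral_const_mul, integral_const_mul (-4 : ℂ), i1, i2,
    neg_neg]

end GKL

namespace GKL

open Filter Topology ComplexConjugate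
open scoped ENNReal NNReal ContDiff

/-! ### Potentials of bounded compactly supported sources -/

/-- Measurable functions bounded by `D` and vanishing outside the ball of radius `R`. -/
structure Src (D R : ℝ) (f : ℂ → ℂ) : Prop where
  meas : Measurable f
  bdd : ∀ z, ‖f z‖ ≤ D
  supp : ∀ z, R < ‖z‖ → f z = 0

/-- The outgoing potential of `f`. -/
def pot (f : ℂ → ℂ) (x : ℂ) : ℂ := ∫ z, grn (x - z) * f z

namespace Src

variable {D D' R R' : ℝ} {f g : ℂ → ℂ}

lemma nonneg (h : Src D R f) : 0 ≤ D := (norm_nonneg _).trans (h.bdd 0)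

lemma bm (h : Src D R f) : BM f := by
  refine ⟨h.meas, D.toNNReal, fun z => ?_⟩
  rw [← ofReal_norm]
  exact ENNReal.ofReal_le_ofReal (h.bdd z)

lemma mul_bdd (h : Src D R f) (hg : Measurable g) (hb : ∀ z, ‖z‖ ≤ R → ‖g z‖ ≤ D') (hD : 0 ≤ D') :
    Src (D * D') R fun z => f z * g z := by
  refine ⟨h.meas.mul hg, fun z => ?_, fun z hz => by rw [h.supp z hz, zero_mul]⟩
  rcases le_or_gt ‖z‖ R with hz | hz
  · rw [norm_mul]
    exact mul_le_mul (h.bdd z) (hb z hz) (norm_nonneg _) h.nonneg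
  · rw [h.supp z hz, zero_mul, norm_zero]
    exact mul_nonneg h.nonneg hD

lemma add (hf : Src D R f) (hg : Src D' R g) : Src (D + D') R fun z => f z + g z :=
  ⟨hf.meas.add hg.meas, fun z => (norm_add_le _ _).trans (add_le_add (hf.bdd z) (hg.bdd z)),
    fun z hz => by rw [hf.supp z hz, hg.supp z hz, add_zero]⟩

lemma integral_eq (h : Src D R f) (g : ℂ → ℂ) :
    ∫ z, g z * f z = ∫ z in Metric.closedBall 0 R, g z * f z := by
  refine (setIntegral_eq_integral_of_forall_compl_eq_zero fun z hz => ?_).symm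
  rw [h.supp z (by simpa using hz), mul_zero]

end Src

lemma TF.src {φ : ℂ → ℂ} (h : TF φ) : ∃ D R, Src D R φ := by
  obtain ⟨C, hC⟩ := h.continuous.bounded_above_of_compact_support h.comp
  obtain ⟨ρ, hρ⟩ := h.comp.isCompact.isBounded.subset_closedBall 0
  refine ⟨C, ρ, h.continuous.measurable, hC, fun z hz => ?_⟩
  by_contra h'
  have := hρ (subset_tsupport φ h')
  rw [mem_closedBall_zero_iff] at this
  linarith

lemma lintegral_enorm_grn_sub_le (ρ R : ℝ) : ∃ C : ℝ≥0, ∀ x : ℂ, ‖x‖ ≤ ρ →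
    ∫⁻ z in Metric.closedBall 0 R, ‖grn (x - z)‖ₑ ≤ C := by
  obtain ⟨C, hC⟩ := enorm_grn_le (ρ + R)
  set M : ℝ≥0∞ := C * (knC (1 / 2) + volume (Metric.closedBall (0 : ℂ) R)) with hM
  have hMt : M ≠ ⊤ := by
    have h1 := (knC_lt_top (s := 1 / 2) (by norm_num)).ne
    have h2 : volume (Metric.closedBall (0 : ℂ) R) ≠ ⊤ :=
      (isCompact_closedBall (0 : ℂ) R).measure_lt_top.ne
    finiteness
  refine ⟨M.toNNReal, fun x hx => ?_⟩
  rw [ENNReal.coe_toNNReal hMt, hM]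
  refine le_trans ?_ (mul_le_mul_right (lintegral_kn_le (s := 1 / 2) (by norm_num) _ x) _)
  have hk : Measurable fun w => kn (1 / 2) (w - x) :=
    (measurable_kn _).comp (measurable_id.sub_const x)
  rw [← lintegral_const_mul _ hk]
  refine setLIntegral_mono (hk.const_mul _) fun z hz => ?_
  have h1 : ‖x - z‖ ≤ ρ + R :=
    (norm_sub_le _ _).trans (add_le_add hx (mem_closedBall_zero_iff.1 hz))
  have := hC _ h1
  rwa [kn_sub_comm] at this

section

variable {D D' R R' : ℝ} {f g : ℂ → ℂ}

lemma measurable_grn_sub (x : ℂ) : Measurable fun z => grn (x - z) :=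
  measurable_grn.comp (measurable_id.const_sub x)

lemma Src.integrable_grn (hf : Src D R f) (x : ℂ) : Integrable fun z => grn (x - z) * f z := by
  obtain ⟨C, hC⟩ := lintegral_enorm_grn_sub_le ‖x‖ R
  have h1 : IntegrableOn (fun z => grn (x - z)) (Metric.closedBall 0 R) :=
    ⟨(measurable_grn_sub x).aestronglyMeasurable,
      (hC x le_rfl).trans_lt ENNReal.coe_lt_top⟩
  have h2 : IntegrableOn (fun z => grn (x - z) * f z) (Metric.closedBall 0 R) :=
    h1.mul_bdd hf.meas.aestronglyMeasurable (Eventually.of_forall hf.bdd)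
  refine (integrableOn_iff_integrable_of_support_subset fun z hz => ?_).1 h2
  by_contra h
  exact hz (by simp only [hf.supp z (by simpa using h), mul_zero])

lemma norm_pot_le (ρ R : ℝ) : ∃ C : ℝ, 0 ≤ C ∧ ∀ D f, Src D R f → ∀ x, ‖x‖ ≤ ρ →
    ‖pot f x‖ ≤ C * D := by
  obtain ⟨C, hC⟩ := lintegral_enorm_grn_sub_le ρ R
  refine ⟨C, C.2, fun D f hf x hx => ?_⟩
  have h2 : ‖pot f x‖ₑ ≤ C * ENNReal.ofReal D := by
    rw [pot, hf.integral_eq]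
    refine (enorm_integral_le_lintegral_enorm _).trans ?_
    calc _ ≤ ∫⁻ z in Metric.closedBall 0 R, ‖grn (x - z)‖ₑ * ENNReal.ofReal D := by
          refine lintegral_mono fun z => ?_
          rw [enorm_mul]
          refine mul_le_mul_right ?_ _
          rw [← ofReal_norm]
          exact ENNReal.ofReal_le_ofReal (hf.bdd z)
      _ = (∫⁻ z in Metric.closedBall 0 R, ‖grn (x - z)‖ₑ) * ENNReal.ofReal D :=
          lintegral_mul_const _ (measurable_grn_sub x).enorm
      _ ≤ _ := by gcongr; exact hC x hx
  rw [← ofReal_norm, ← ENNReal.ofReal_coe_nnreal, ← ENNReal.ofReal_mul C.coe_nonneg] at h2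
  exact (ENNReal.ofReal_le_ofReal_iff (mul_nonneg C.2 hf.nonneg)).1 h2

lemma measurable_pot (hf : Measurable f) : Measurable (pot f) := by
  have h : StronglyMeasurable fun p : ℂ × ℂ => grn (p.1 - p.2) * f p.2 :=
    ((measurable_grn.comp (measurable_fst.sub measurable_snd)).mul
      (hf.comp measurable_snd)).stronglyMeasurable
  exact h.integral_prod_right.measurable

/-- The operator `pot` is symmetric. -/
lemma integral_mul_pot (hf : Src D R f) (hg : Src D' R' g) :
    ∫ x, g x * pot f x = ∫ z, f z * pot g z := by
  have hm : Measurable fun p : ℂ × ℂ => g p.1 * (grn (p.1 - p.2) * f p.2) :=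
    (hg.meas.comp measurable_fst).mul
      ((measurable_grn.comp (measurable_fst.sub measurable_snd)).mul (hf.meas.comp measurable_snd))
  have hinteg : Integrable (Function.uncurry fun x z => g x * (grn (x - z) * f z))
      (volume.prod volume) := by
    obtain ⟨C, hC⟩ := lintegral_enorm_grn_sub_le R' R
    refine ⟨hm.aestronglyMeasurable, ?_⟩
    simp only [HasFiniteIntegral, Function.uncurry_def]
    rw [lintegral_prod _ hm.enorm.aemeasurable]
    have hb : ∀ x, ∫⁻ z, ‖g x * (grn (x - z) * f z)‖ₑ ≤
        (Metric.closedBall (0 : ℂ) R').indicator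
          (fun _ => ENNReal.ofReal D' * (C * ENNReal.ofReal D)) x := by
      intro x
      by_cases hx : x ∈ Metric.closedBall (0 : ℂ) R'
      · rw [indicator_of_mem hx]
        have hx' : ‖x‖ ≤ R' := mem_closedBall_zero_iff.1 hx
        have e : ∫⁻ z, ‖g x * (grn (x - z) * f z)‖ₑ =
            ∫⁻ z in Metric.closedBall 0 R, ‖g x * (grn (x - z) * f z)‖ₑ := by
          refine (setLIntegral_eq_of_support_subset fun z hz => ?_).symm
          by_contra h
          exact hz (by simp [hf.supp z (by simpa using h)])
        rw [e]
        calc _ ≤ ∫⁻ z in Metric.closedBall 0 R,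
              ENNReal.ofReal D' * (‖grn (x - z)‖ₑ * ENNReal.ofReal D) := by
              refine lintegral_mono fun z => ?_
              rw [enorm_mul, enorm_mul, ← ofReal_norm (g x), ← ofReal_norm (f z)]
              gcongr
              · exact hg.bdd x
              · exact hf.bdd z
          _ = ENNReal.ofReal D' * ((∫⁻ z in Metric.closedBall 0 R, ‖grn (x - z)‖ₑ) *
              ENNReal.ofReal D) := by
              rw [lintegral_const_mul _ ((measurable_grn_sub x).enorm.mul_const _),
                lintegral_mul_const _ (measurable_grn_sub x).enorm]
          _ ≤ _ := by gcongr; exact hC x hx'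
      · rw [hg.supp x (by simpa using hx)]
        simp
    refine (lintegral_mono hb).trans_lt ?_
    rw [lintegral_indicator Metric.isClosed_closedBall.measurableSet, setLIntegral_const]
    have h2 : volume (Metric.closedBall (0 : ℂ) R') ≠ ⊤ :=
      (isCompact_closedBall (0 : ℂ) R').measure_lt_top.ne
    exact Ne.lt_top (by finiteness)
  have hswap := integral_integral_swap hinteg
  calc ∫ x, g x * pot f x = ∫ x, ∫ z, g x * (grn (x - z) * f z) := by
        simp_rw [pot, integral_const_mul]
    _ = ∫ z, ∫ x, g x * (grn (x - z) * f z) := hswap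
    _ = ∫ z, f z * pot g z := by
        refine integral_congr_ae (Eventually.of_forall fun z => ?_)
        simp only [pot]
        rw [← integral_const_mul]
        refine integral_congr_ae (Eventually.of_forall fun x => ?_)
        simp only
        rw [grn_sub_comm x z]; ring

lemma hlm_comp_add (φ : ℂ → ℂ) (y z : ℂ) : hlm (fun x => φ (x + y)) z = hlm φ (z + y) := by
  have h : wd (-Complex.I) (fun x => φ (x + y)) = fun x => wd (-Complex.I) φ (x + y) :=
    funext fun x => wd_comp_add_right _ φ y x
  rw [hlm, hlm, h, wd_comp_add_right]

lemma pot_hlm {φ : ℂ → ℂ} (hφ : TF φ) (y : ℂ) : pot (hlm φ) y = φ y := by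
  have h := integral_grn_mul_hlm (hφ.comp_add y)
  simp_rw [hlm_comp_add, zero_add] at h
  rw [pot, ← h, ← integral_add_right_eq_self _ y]
  refine integral_congr_ae (Eventually.of_forall fun z => ?_)
  simp only
  rw [show y - (z + y) = -z by ring, grn_neg]

/-- The potential of `f` solves `(-Δ - 4) p = f` weakly. -/
lemma integral_hlm_mul_pot (hf : Src D R f) {φ : ℂ → ℂ} (hφ : TF φ) :
    ∫ x, hlm φ x * pot f x = ∫ x, f x * φ x := by
  obtain ⟨D', R', h⟩ := hφ.hlm.src
  rw [integral_mul_pot hf h]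
  simp_rw [pot_hlm hφ]

end

end GKL

namespace GKL

open Filter Topology ComplexConjugate
open scoped ENNReal NNReal ContDiff BoundedContinuousFunction

/-! ### Continuity of potentials and the Fredholm alternative -/

lemma tendsto_grnε {x : ℂ} (hx : x ≠ 0) :
    Tendsto (fun ε : ℝ => grnε ε x) (𝓝[>] 0) (𝓝 (grn x)) := by
  have hn : 0 < ‖x‖ := norm_pos_iff.2 hx
  have hc : ContinuousAt (fun ε : ℝ => Efun ((‖x‖ ^ 2 + ε ^ 2 : ℝ) : ℂ)) 0 := by
    refine ContinuousAt.comp (g := Efun) ?_ (by fun_prop)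
    exact (hasDerivAt_Efun (ofReal_mem_slitPlane (by positivity))).continuousAt
  have h2 := hc.tendsto
  simp only [ne_eq, OfNat.ofNat_ne_zero, not_false_eq_true, zero_pow, add_zero] at h2
  refine (h2.mono_left nhdsWithin_le_nhds).congr fun ε => ?_
  rw [grnε, mul_conj_add_eq]

lemma ae_ne_zero : ∀ᵐ x : ℂ, x ≠ 0 := by simp [ae_iff]

lemma tendsto_lintegral_grn_sub_grnε (ρ : ℝ) :
    Tendsto (fun ε : ℝ => ∫⁻ x in Metric.closedBall 0 ρ, ‖grn x - grnε ε x‖ₑ) (𝓝[>] 0) (𝓝 0) := by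
  obtain ⟨C, hC⟩ := enorm_Efun_add_le ρ
  have h0 : ∫⁻ x in Metric.closedBall (0 : ℂ) ρ, (0 : ℝ≥0∞) = 0 := by simp
  rw [← h0]
  refine tendsto_lintegral_filter_of_dominated_convergence
    (fun x => 2 * C * kn (1 / 2) x) ?_ ?_ ?_ ?_
  · filter_upwards [self_mem_nhdsWithin] with ε hε
    exact (measurable_grn.sub (contDiff_grnε hε).continuous.measurable).enorm
  · filter_upwards [Ioo_mem_nhdsGT (zero_lt_one' ℝ)] with ε hε
    filter_upwards [ae_restrict_mem Metric.isClosed_closedBall.measurableSet] with x hx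
    have hx := mem_closedBall_zero_iff.1 hx
    have h1 := hC x 0 hx (by simp)
    have h2 := hC x ε hx (by rw [abs_of_pos hε.1]; exact hε.2.le)
    rw [zero_pow two_ne_zero, add_zero] at h1
    rw [← mul_conj_add_eq] at h2
    refine enorm_sub_le.trans ((add_le_add h1 h2).trans_eq (by ring))
  · rw [lintegral_const_mul _ (measurable_kn _)]
    have := locInt_kn (s := 1 / 2) (by norm_num) (by norm_num)
      (isCompact_closedBall (0 : ℂ) ρ).measure_lt_top.ne 0
    simp only [sub_zero] at this
    finiteness
  · filter_upwards [ae_restrict_of_ae ae_ne_zero] with x hx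
    have := ((tendsto_const_nhds (x := grn x)).sub (tendsto_grnε hx)).enorm
    simpa using this

lemma lintegral_comp_sub_le {F : ℂ → ℝ≥0∞} {R ρ : ℝ} {y : ℂ}
    (hy : ‖y‖ + R ≤ ρ) : ∫⁻ z in Metric.closedBall 0 R, F (y - z) ≤
      ∫⁻ u in Metric.closedBall 0 ρ, F u := by
  rw [← lintegral_indicator Metric.isClosed_closedBall.measurableSet,
    ← lintegral_indicator Metric.isClosed_closedBall.measurableSet,
    ← lintegral_sub_left_eq_self ((Metric.closedBall (0 : ℂ) ρ).indicator F) y]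
  refine lintegral_mono fun z => ?_
  by_cases hz : z ∈ Metric.closedBall (0 : ℂ) R
  · have : y - z ∈ Metric.closedBall (0 : ℂ) ρ := by
      rw [mem_closedBall_zero_iff] at hz ⊢
      exact (norm_sub_le _ _).trans (by linarith)
    rw [indicator_of_mem hz, indicator_of_mem this]
  · rw [indicator_of_notMem hz]; exact zero_le

lemma tendsto_lintegral_grn_sub_grn (x : ℂ) (R : ℝ) :
    Tendsto (fun y => ∫⁻ z in Metric.closedBall 0 R, ‖grn (y - z) - grn (x - z)‖ₑ)
      (𝓝 x) (𝓝 0) := by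
  rw [ENNReal.tendsto_nhds_zero]
  intro η hη
  set ρ := ‖x‖ + 1 + |R| with hρ
  have hη3 : 0 < η / 3 := ENNReal.div_pos hη.ne' (by simp)
  obtain ⟨ε, hε1, hε⟩ := (((ENNReal.tendsto_nhds_zero.1
    (tendsto_lintegral_grn_sub_grnε ρ)) _ hη3).and self_mem_nhdsWithin).exists
  have hε : 0 < ε := hε
  have hgc := (contDiff_grnε hε).continuous
  obtain ⟨M, hM⟩ := (isCompact_closedBall (0 : ℂ) ρ).exists_bound_of_continuousOn hgc.continuousOn
  have hball : ∀ᶠ y in 𝓝 x, ‖y‖ ≤ ‖x‖ + 1 := by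
    filter_upwards [Metric.ball_mem_nhds x zero_lt_one] with y hy
    have : ‖y - x‖ < 1 := mem_ball_iff_norm.1 hy
    have := norm_le_norm_add_norm_sub x y
    rw [norm_sub_rev] at this
    linarith
  have hR := le_abs_self R
  have ht : Tendsto (fun y => ∫⁻ z in Metric.closedBall 0 R, ‖grnε ε (y - z) - grnε ε (x - z)‖ₑ)
      (𝓝 x) (𝓝 0) := by
    have h0 : ∫⁻ x in Metric.closedBall (0 : ℂ) R, (0 : ℝ≥0∞) = 0 := by simp
    rw [← h0]
    refine tendsto_lintegral_filter_of_dominated_convergence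
      (fun _ => ENNReal.ofReal (2 * M)) ?_ ?_ ?_ ?_
    · exact Eventually.of_forall fun y => by
        have : Continuous fun z => grnε ε (y - z) - grnε ε (x - z) := by fun_prop
        exact this.measurable.enorm
    · filter_upwards [hball] with y hy
      filter_upwards [ae_restrict_mem Metric.isClosed_closedBall.measurableSet] with z hz
      have hz := mem_closedBall_zero_iff.1 hz
      rw [← ofReal_norm]
      refine ENNReal.ofReal_le_ofReal ((norm_sub_le _ _).trans ?_)
      have h1 := hM (y - z) (mem_closedBall_zero_iff.2 ((norm_sub_le _ _).trans (by linarith)))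
      have h2 := hM (x - z) (mem_closedBall_zero_iff.2 ((norm_sub_le _ _).trans (by linarith)))
      linarith
    · rw [setLIntegral_const]
      have h2 : volume (Metric.closedBall (0 : ℂ) R) ≠ ⊤ :=
        (isCompact_closedBall (0 : ℂ) R).measure_lt_top.ne
      finiteness
    · refine Eventually.of_forall fun z => ?_
      have hc : Continuous fun y => ‖grnε ε (y - z) - grnε ε (x - z)‖ₑ := by fun_prop
      have := hc.tendsto x
      simpa using this
  have hI : ∀ y, ‖y‖ ≤ ‖x‖ + 1 →
      ∫⁻ z in Metric.closedBall 0 R, ‖grn (y - z) - grnε ε (y - z)‖ₑ ≤ η / 3 := fun y hy =>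
    (lintegral_comp_sub_le (F := fun u => ‖grn u - grnε ε u‖ₑ) (by linarith)).trans hε1
  filter_upwards [hball, (ENNReal.tendsto_nhds_zero.1 ht) _ hη3] with y hy hy2
  have m1 : ∀ y, Measurable fun z => ‖grn (y - z) - grnε ε (y - z)‖ₑ := fun y =>
    ((measurable_grn_sub y).sub (hgc.comp (continuous_const.sub continuous_id)).measurable).enorm
  calc ∫⁻ z in Metric.closedBall 0 R, ‖grn (y - z) - grn (x - z)‖ₑ
      ≤ ∫⁻ z in Metric.closedBall 0 R, (‖grn (y - z) - grnε ε (y - z)‖ₑ +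
          (‖grn (x - z) - grnε ε (x - z)‖ₑ + ‖grnε ε (y - z) - grnε ε (x - z)‖ₑ)) := by
        refine lintegral_mono fun z => ?_
        have e : grn (y - z) - grn (x - z) = (grn (y - z) - grnε ε (y - z)) +
          (-(grn (x - z) - grnε ε (x - z)) + (grnε ε (y - z) - grnε ε (x - z))) := by ring
        calc _ = _ := by rw [e]
          _ ≤ _ := (enorm_add_le _ _).trans (add_le_add le_rfl
            ((enorm_add_le _ _).trans (by rw [enorm_neg])))
    _ ≤ η / 3 + (η / 3 + η / 3) := by
        rw [lintegral_add_left (m1 y), lintegral_add_left (m1 x)]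
        exact add_le_add (hI y hy) (add_le_add (hI x (by linarith)) hy2)
    _ = η := by rw [← add_assoc, ENNReal.add_thirds]

lemma pot_equicontinuous (x : ℂ) (R : ℝ) {η : ℝ} (hη : 0 < η) : ∀ᶠ y in 𝓝 x, ∀ D f, Src D R f →
    ‖pot f y - pot f x‖ ≤ η * D := by
  have h := ENNReal.tendsto_nhds_zero.1 (tendsto_lintegral_grn_sub_grn x R) (ENNReal.ofReal η)
    (by simpa using hη)
  filter_upwards [h] with y hy D f hf
  have e : pot f y - pot f x = ∫ z in Metric.closedBall 0 R, (grn (y - z) - grn (x - z)) * f z := by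
    rw [pot, pot, ← integral_sub (hf.integrable_grn y) (hf.integrable_grn x), ← hf.integral_eq]
    simp_rw [sub_mul]
  have h2 : ‖pot f y - pot f x‖ₑ ≤ ENNReal.ofReal η * ENNReal.ofReal D := by
    rw [e]
    refine (enorm_integral_le_lintegral_enorm _).trans ?_
    calc _ ≤ ∫⁻ z in Metric.closedBall 0 R, ‖grn (y - z) - grn (x - z)‖ₑ * ENNReal.ofReal D := by
          refine lintegral_mono fun z => ?_
          rw [enorm_mul, ← ofReal_norm (f z)]
          gcongr
          exact hf.bdd z
      _ = (∫⁻ z in Metric.closedBall 0 R, ‖grn (y - z) - grn (x - z)‖ₑ) * ENNReal.ofReal D :=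
          lintegral_mul_const _ ((measurable_grn_sub y).sub (measurable_grn_sub x)).enorm
      _ ≤ _ := by gcongr
  rw [← ofReal_norm, ← ENNReal.ofReal_mul hη.le] at h2
  exact (ENNReal.ofReal_le_ofReal_iff (mul_nonneg hη.le hf.nonneg)).1 h2

lemma Src.continuous_pot {D R : ℝ} {f : ℂ → ℂ} (hf : Src D R f) : Continuous (pot f) := by
  refine continuous_iff_continuousAt.2 fun x => Metric.tendsto_nhds.2 fun η hη => ?_
  have hD : 0 < D + 1 := by linarith [hf.nonneg]
  filter_upwards [pot_equicontinuous x R (div_pos hη hD)] with y hy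
  rw [dist_eq_norm]
  refine (hy D f hf).trans_lt ?_
  rw [div_mul_eq_mul_div, div_lt_iff₀ hD]
  nlinarith

lemma Src.pot_add {D D' R : ℝ} {f g : ℂ → ℂ} (hf : Src D R f) (hg : Src D' R g) (x : ℂ) :
    pot (fun z => f z + g z) x = pot f x + pot g x := by
  simp only [pot]
  rw [← integral_add (hf.integrable_grn x) (hg.integrable_grn x)]
  simp_rw [mul_add]

lemma pot_const_mul (c : ℂ) (f : ℂ → ℂ) (x : ℂ) : pot (fun z => c * f z) x = c * pot f x := by
  simp only [pot]
  rw [← integral_const_mul]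
  congr 1; funext z; ring

section Fredholm

variable {R D : ℝ} {v : ℂ → ℂ}

/-- Extension by zero of a function on the ball. -/
def extZ (R : ℝ) (g : Metric.closedBall (0 : ℂ) R → ℂ) : ℂ → ℂ :=
  Function.extend Subtype.val g fun _ => 0

lemma extZ_of_mem {g : Metric.closedBall (0 : ℂ) R → ℂ} {z : ℂ} (hz : z ∈ Metric.closedBall 0 R) :
    extZ R g z = g ⟨z, hz⟩ :=
  Subtype.val_injective.extend_apply g _ ⟨z, hz⟩

lemma Src.mul_extZ (hv : Src D R v) (g : Metric.closedBall (0 : ℂ) R →ᵇ ℂ) :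
    Src (D * ‖g‖) R fun z => v z * extZ R g z := by
  refine hv.mul_bdd ?_ (fun z hz => ?_) (norm_nonneg g)
  · exact (MeasurableEmbedding.subtype_coe
      Metric.isClosed_closedBall.measurableSet).measurable_extend g.continuous.measurable
        measurable_const
  · rw [extZ_of_mem (mem_closedBall_zero_iff.2 hz)]
    exact g.norm_coe_le_norm _

/-- The Lippmann–Schwinger operator on the bounded continuous functions on a ball. -/
def lsOp (hv : Src D R v) :
    (Metric.closedBall (0 : ℂ) R →ᵇ ℂ) →L[ℂ] (Metric.closedBall (0 : ℂ) R →ᵇ ℂ) :=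
  haveI : CompactSpace (Metric.closedBall (0 : ℂ) R) :=
    isCompact_iff_compactSpace.1 (isCompact_closedBall 0 R)
  LinearMap.mkContinuous
    { toFun := fun g => BoundedContinuousFunction.mkOfCompact
        ⟨fun x => pot (fun z => v z * extZ R g z) x,
          (hv.mul_extZ g).continuous_pot.comp continuous_subtype_val⟩
      map_add' := fun g h => by
        ext x
        have h1 := (hv.mul_extZ g).pot_add (hv.mul_extZ h) x
        refine Eq.trans ?_ h1
        refine congrArg (fun F => pot F (x : ℂ)) (funext fun z => ?_)
        rcases le_or_gt ‖z‖ R with hz | hz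
        · simp only [extZ_of_mem (mem_closedBall_zero_iff.2 hz)]
          simp [mul_add]
        · simp [hv.supp z hz]
      map_smul' := fun c g => by
        ext x
        refine Eq.trans ?_ (pot_const_mul c (fun z => v z * extZ R g z) x)
        refine congrArg (fun F => pot F (x : ℂ)) (funext fun z => ?_)
        rcases le_or_gt ‖z‖ R with hz | hz
        · simp only [extZ_of_mem (mem_closedBall_zero_iff.2 hz)]
          simp; ring
        · simp [hv.supp z hz] }
    ((norm_pot_le R R).choose * D) fun g => by
      obtain ⟨h0, h1⟩ := (norm_pot_le R R).choose_spec
      refine (BoundedContinuousFunction.norm_le (by have := hv.nonneg; positivity)).2 fun x => ?_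
      rw [mul_assoc]
      exact h1 _ _ (hv.mul_extZ g) x (mem_closedBall_zero_iff.1 x.2)

lemma lsOp_apply (hv : Src D R v) (g : Metric.closedBall (0 : ℂ) R →ᵇ ℂ)
    (x : Metric.closedBall (0 : ℂ) R) : lsOp hv g x = pot (fun z => v z * extZ R g z) x := rfl

lemma isCompactOperator_lsOp (hv : Src D R v) : IsCompactOperator (lsOp hv) := by
  have : CompactSpace (Metric.closedBall (0 : ℂ) R) :=
    isCompact_iff_compactSpace.1 (isCompact_closedBall 0 R)
  rw [isCompactOperator_iff_exists_mem_nhds_isCompact_closure_image]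
  refine ⟨Metric.closedBall 0 1, Metric.closedBall_mem_nhds _ zero_lt_one, ?_⟩
  refine BoundedContinuousFunction.arzela_ascoli (Metric.closedBall 0 ‖lsOp hv‖)
    (isCompact_closedBall _ _) _ ?_ ?_
  · rintro f x ⟨g, hg, rfl⟩
    rw [mem_closedBall_zero_iff] at hg ⊢
    calc ‖lsOp hv g x‖ ≤ ‖lsOp hv g‖ := BoundedContinuousFunction.norm_coe_le_norm _ x
      _ ≤ ‖lsOp hv‖ * ‖g‖ := (lsOp hv).le_opNorm g
      _ ≤ ‖lsOp hv‖ * 1 := by gcongr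
      _ = _ := mul_one _
  · intro x
    rw [Metric.equicontinuousAt_iff_right]
    intro η hη
    have hD : 0 < D + 1 := by linarith [hv.nonneg]
    have h := continuous_subtype_val.continuousAt.eventually
      (pot_equicontinuous (x : ℂ) R (div_pos hη hD))
    filter_upwards [h] with y hy
    rintro ⟨f, g, hg, rfl⟩
    rw [mem_closedBall_zero_iff] at hg
    have := hy _ _ (hv.mul_extZ g)
    rw [dist_comm, dist_eq_norm]
    refine lt_of_le_of_lt this ?_
    have h2 : D * ‖g‖ ≤ D := mul_le_of_le_one_right hv.nonneg hg
    calc η / (D + 1) * (D * ‖g‖) ≤ η / (D + 1) * D := by gcongr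
      _ < η := by rw [div_mul_eq_mul_div, div_lt_iff₀ hD]; nlinarith

/-- Solvability of `p = pot (W + v p)` when the homogeneous equation has no bounded solution. -/
lemma exists_pot_solution (hv : Src D R v) {D' : ℝ} {W : ℂ → ℂ} (hW : Src D' R W)
    (hinj : ∀ p : ℂ → ℂ, Continuous p → (∀ x, p x = pot (fun z => v z * p z) x) →
      ∀ x, ‖x‖ ≤ R → p x = 0) :
    ∃ p : ℂ → ℂ, Continuous p ∧ ∀ x, p x = pot (fun z => W z + v z * p z) x := by
  have : CompactSpace (Metric.closedBall (0 : ℂ) R) :=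
    isCompact_iff_compactSpace.1 (isCompact_closedBall 0 R)
  have hloc : ∀ g p : ℂ → ℂ, (∀ x, ‖x‖ ≤ R → p x = g x) →
      (fun z => v z * p z) = fun z => v z * g z := fun g p h => by
    funext z
    rcases le_or_gt ‖z‖ R with hz | hz
    · rw [h z hz]
    · simp [hv.supp z hz]
  rcases (isCompactOperator_lsOp hv).hasEigenvalue_or_mem_resolventSet one_ne_zero with h | h
  · exfalso
    obtain ⟨g, hg⟩ := h.exists_hasEigenvector
    have hg1 : lsOp hv g = g := by simpa using hg.apply_eq_smul
    apply hg.2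
    set p := pot (fun z => v z * extZ R g z) with hp
    have hpg : ∀ x, ‖x‖ ≤ R → p x = extZ R g x := fun x hx => by
      rw [extZ_of_mem (mem_closedBall_zero_iff.2 hx)]
      conv_rhs => rw [← hg1]
      rfl
    have := hinj p (hv.mul_extZ g).continuous_pot fun x => by rw [hloc _ _ hpg]
    ext x
    have hx := mem_closedBall_zero_iff.1 x.2
    have h3 := hpg x hx
    rw [this x hx, extZ_of_mem x.2] at h3
    exact h3.symm
  · obtain ⟨S, hS⟩ := spectrum.mem_resolventSet_iff.1 h
    let w : Metric.closedBall (0 : ℂ) R →ᵇ ℂ := BoundedContinuousFunction.mkOfCompact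
      ⟨fun x => pot W x, hW.continuous_pot.comp continuous_subtype_val⟩
    set g := S⁻¹.val w with hg
    have hg1 : g - lsOp hv g = w := by
      have h1 : (S.val * S⁻¹.val) w = w := by
        rw [Units.mul_inv]; rfl
      rw [hS] at h1
      simpa using h1
    have hs := hv.mul_extZ g
    refine ⟨pot (fun z => W z + v z * extZ R g z), (hW.add hs).continuous_pot, fun x => ?_⟩
    have hpg : ∀ x, ‖x‖ ≤ R → pot (fun z => W z + v z * extZ R g z) x = extZ R g x := fun x hx => by
      rw [hW.pot_add hs, extZ_of_mem (mem_closedBall_zero_iff.2 hx)]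
      have := DFunLike.congr_fun hg1 ⟨x, mem_closedBall_zero_iff.2 hx⟩
      simp only [BoundedContinuousFunction.coe_sub, Pi.sub_apply, lsOp_apply] at this
      rw [sub_eq_iff_eq_add] at this
      rw [this]; rfl
    have e := hloc _ _ hpg
    have e' : (fun z => W z + v z * pot (fun z => W z + v z * extZ R g z) z) =
        fun z => W z + v z * extZ R g z := funext fun z => by rw [congrFun e z]
    rw [e']

end Fredholm

end GKL

namespace GKL

open Filter Topology ComplexConjugate
open scoped ENNReal NNReal ContDiff Convolution

/-- Convolution of complex valued functions on the plane. -/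
def cnv (p ρ : ℂ → ℂ) (x : ℂ) : ℂ := ∫ y, p y * ρ (x - y)

lemma cnv_eq_convolution (p ρ : ℂ → ℂ) :
    cnv p ρ = convolution p ρ (ContinuousLinearMap.mul ℝ ℂ) volume := rfl

section Convolution

variable {p ρ : ℂ → ℂ}

lemma contDiff_cnv (hp : LocallyIntegrable p) (hρ : TF ρ) : ContDiff ℝ ∞ (cnv p ρ) :=
  hρ.comp.contDiff_convolution_right (ContinuousLinearMap.mul ℝ ℂ) hp hρ.smooth

lemma wd_cnv (hp : LocallyIntegrable p) (hρ : TF ρ) (σ : ℂ) :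
    wd σ (cnv p ρ) = cnv p (wd σ ρ) := by
  funext x
  have h1 : ContDiff ℝ 1 ρ := hρ.smooth.of_le (by simp)
  have h := hρ.comp.hasFDerivAt_convolution_right (ContinuousLinearMap.mul ℝ ℂ) hp h1 x
  rw [cnv_eq_convolution, wd_eq h]
  have hex : ConvolutionExistsAt p (fderiv ℝ ρ) x
      ((ContinuousLinearMap.mul ℝ ℂ).precompR ℂ) volume :=
    (hρ.comp.fderiv ℝ).convolutionExists_right _ hp (h1.continuous_fderiv one_ne_zero) x
  have hi : Integrable fun y => (ContinuousLinearMap.mul ℝ ℂ).precompR ℂ (p y)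
      (fderiv ℝ ρ (x - y)) := hex
  rw [convolution, ContinuousLinearMap.integral_apply hi, ContinuousLinearMap.integral_apply hi,
    ← integral_const_mul, ← integral_add (hi.apply_continuousLinearMap 1)
      ((hi.apply_continuousLinearMap Complex.I).const_mul σ), ← integral_div]
  refine integral_congr_ae (Eventually.of_forall fun y => ?_)
  simp only [wd, ContinuousLinearMap.precompR_apply, ContinuousLinearMap.compL_apply,
    ContinuousLinearMap.comp_apply, ContinuousLinearMap.mul_apply']
  ring

lemma integrable_cnv (hp : LocallyIntegrable p) (hρ : TF ρ) (x : ℂ) :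
    Integrable fun y => p y * ρ (x - y) :=
  hρ.comp.convolutionExists_right (ContinuousLinearMap.mul ℝ ℂ) hp hρ.continuous x

lemma hlm_cnv (hp : LocallyIntegrable p) (hρ : TF ρ) : hlm (cnv p ρ) = cnv p (hlm ρ) := by
  funext x
  have i1 := integrable_cnv hp ((hρ.wd (-Complex.I)).wd Complex.I) x
  have i2 := integrable_cnv hp hρ x
  rw [hlm, wd_cnv hp hρ, wd_cnv hp (hρ.wd _)]
  simp only [cnv, hlm]
  have e : (fun y => p y * (-(4 * wd Complex.I (wd (-Complex.I) ρ) (x - y)) - 4 * ρ (x - y))) =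
      fun y => (-4) * (p y * wd Complex.I (wd (-Complex.I) ρ) (x - y)) - 4 * (p y * ρ (x - y)) :=
    funext fun y => by ring
  rw [e, integral_sub (i1.const_mul (-4)) (i2.const_mul 4), integral_const_mul, integral_const_mul]
  ring

end Convolution

lemma locallyIntegrable_grn : LocallyIntegrable grn := by
  rw [locallyIntegrable_iff]
  intro k hk
  obtain ⟨ρ, hρ⟩ := hk.isBounded.subset_closedBall 0
  obtain ⟨C, hC⟩ := lintegral_enorm_grn_sub_le 0 ρ
  refine IntegrableOn.mono_set ⟨measurable_grn.aestronglyMeasurable, ?_⟩ hρ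
  refine lt_of_le_of_lt ?_ (ENNReal.coe_lt_top (r := C))
  have := hC 0 (by simp)
  simpa [grn_neg] using this

section

variable {ψ : ℂ → ℂ}

lemma pot_eq_cnv (ψ : ℂ → ℂ) : pot ψ = cnv grn ψ := by
  funext x
  rw [pot, cnv, ← integral_sub_left_eq_self _ _ x]
  simp

lemma contDiff_pot (hψ : TF ψ) : ContDiff ℝ ∞ (pot ψ) := by
  rw [pot_eq_cnv]; exact contDiff_cnv locallyIntegrable_grn hψ

lemma hlm_pot (hψ : TF ψ) : hlm (pot ψ) = ψ := by
  rw [pot_eq_cnv, hlm_cnv locallyIntegrable_grn hψ, ← pot_eq_cnv]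
  exact funext fun x => pot_hlm hψ x

lemma hlm_congr {f g : ℂ → ℂ} {z : ℂ} (h : f =ᶠ[𝓝 z] g) : hlm f z = hlm g z := by
  have h1 : wd (-Complex.I) f =ᶠ[𝓝 z] wd (-Complex.I) g := by
    filter_upwards [h.eventuallyEq_nhds] with x hx using wd_congr hx
  rw [hlm, hlm, wd_congr h1, h.eq_of_nhds]

lemma hlm_eq_zero_of_notMem {z : ℂ} (h : z ∉ tsupport ψ) : hlm ψ z = 0 := by
  have : ψ =ᶠ[𝓝 z] fun _ => 0 := notMem_tsupport_iff_eventuallyEq.1 h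
  rw [hlm_congr this, hlm]
  have h0 : wd (-Complex.I) (fun _ => (0 : ℂ)) = fun _ => 0 := funext fun z => wd_const _ _ z
  rw [h0, wd_const]; simp

lemma Src.integrable_mul {D R : ℝ} {f g : ℂ → ℂ} (hf : Src D R f) (hg : LocallyIntegrable g) :
    Integrable fun z => g z * f z := by
  have h2 : IntegrableOn (fun z => g z * f z) (Metric.closedBall 0 R) :=
    (hg.integrableOn_isCompact (isCompact_closedBall 0 R)).mul_bdd hf.meas.aestronglyMeasurable
      (Eventually.of_forall hf.bdd)
  refine (integrableOn_iff_integrable_of_support_subset fun z hz => ?_).1 h2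
  rw [mem_closedBall_zero_iff]
  by_contra h
  exact hz (by simp [hf.supp z (not_le.1 h)])

lemma Src.locallyIntegrable {D R : ℝ} {f : ℂ → ℂ} (hf : Src D R f) : LocallyIntegrable f := by
  have := hf.integrable_mul (g := fun _ => 1) (continuous_const.locallyIntegrable)
  simpa using this.locallyIntegrable

/-- A smooth cut-off, equal to one on the ball of radius `R`. -/
lemma exists_cutoff (c : ℂ) {r R : ℝ} (hr : 0 < r) (hR : r < R) : ∃ χ : ℂ → ℂ, TF χ ∧
    (∀ z ∈ Metric.closedBall c r, χ z = 1) ∧ tsupport χ = Metric.closedBall c R := by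
  let b : ContDiffBump c := ⟨r, R, hr, hR⟩
  have hs : tsupport (fun z => ((b z : ℝ) : ℂ)) = Metric.closedBall c R := by
    rw [show Metric.closedBall c R = tsupport b from b.tsupport_eq.symm, tsupport, tsupport]
    congr 1; ext z; simp
  refine ⟨fun z => ((b z : ℝ) : ℂ), ⟨?_, ?_⟩, fun z hz => ?_, hs⟩
  · exact Complex.ofRealCLM.contDiff.comp b.contDiff
  · rw [HasCompactSupport, hs]; exact isCompact_closedBall c R
  · simp [b.one_of_mem_closedBall hz]

lemma ae_eq_of_forall_integral_mul {f g : ℂ → ℂ} (hf : LocallyIntegrable f)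
    (hg : LocallyIntegrable g) (h : ∀ φ, TF φ → ∫ z, f z * φ z = ∫ z, g z * φ z) :
    f =ᵐ[volume] g := by
  refine ae_eq_of_integral_contDiff_smul_eq hf hg fun φ hφ hc => ?_
  have hφ' : TF fun z => ((φ z : ℝ) : ℂ) :=
    ⟨Complex.ofRealCLM.contDiff.comp hφ, hc.comp_left (g := fun x : ℝ => (x : ℂ)) (by simp)⟩
  have := h _ hφ'
  simpa only [Complex.real_smul, mul_comm] using this

/-- A compactly supported weak solution is the outgoing potential of its source. -/
lemma ae_eq_pot_of_weak {D D' R R' : ℝ} {k f : ℂ → ℂ} (hk : Src D R k) (hf : Src D' R' f)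
    (h : ∀ φ, TF φ → ∫ z, k z * hlm φ z = ∫ z, f z * φ z) : k =ᵐ[volume] pot f := by
  refine ae_eq_of_forall_integral_mul hk.locallyIntegrable
    hf.continuous_pot.locallyIntegrable fun ψ hψ => ?_
  obtain ⟨D₂, R₂, hψ'⟩ := hψ.src
  set M := max (max R R') 0 + 1
  have hM : max (max R R') 0 < M := lt_add_one _
  obtain ⟨χ, hχ, hχ1, -⟩ := exists_cutoff 0 (r := M) (R := M + 1)
    ((le_max_right _ _).trans_lt hM) (lt_add_one _)
  have hT : TF fun z => pot ψ z * χ z := hχ.smooth_mul (contDiff_pot hψ)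
  have h1 := h _ hT
  have e1 : ∫ z, k z * hlm (fun z => pot ψ z * χ z) z = ∫ z, k z * ψ z := by
    refine integral_congr_ae (Eventually.of_forall fun z => ?_)
    simp only
    rcases le_or_gt ‖z‖ R with hz | hz
    · rw [hlm_congr (g := pot ψ), hlm_pot hψ]
      have hz' : ‖z‖ < M := (hz.trans ((le_max_left _ _).trans (le_max_left _ _))).trans_lt hM
      filter_upwards [Metric.isOpen_ball.mem_nhds (mem_ball_zero_iff.2 hz')] with x hx
      rw [hχ1 x (Metric.ball_subset_closedBall hx), mul_one]
    · simp [hk.supp z hz]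
  have e2 : ∫ z, f z * (pot ψ z * χ z) = ∫ z, f z * pot ψ z := by
    refine integral_congr_ae (Eventually.of_forall fun z => ?_)
    simp only
    rcases le_or_gt ‖z‖ R' with hz | hz
    · rw [hχ1 z, mul_one]
      rw [mem_closedBall_zero_iff]
      exact (hz.trans ((le_max_right _ _).trans (le_max_left _ _))).trans hM.le
    · simp [hf.supp z hz]
  rw [e1, e2, integral_mul_pot hψ' hf] at h1
  rw [h1]
  exact integral_congr_ae (Eventually.of_forall fun z => mul_comm _ _)

end

end GKL

namespace GKL

open Filter Topology ComplexConjugate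
open scoped ENNReal NNReal ContDiff Convolution

lemma wd_const_sub {σ : ℂ} {ρ : ℂ → ℂ} (x y : ℂ) (h : Differentiable ℝ ρ) :
    wd σ (fun y => ρ (x - y)) y = -wd σ ρ (x - y) := by
  have h1 : HasFDerivAt (fun y : ℂ => x - y) (-ContinuousLinearMap.id ℝ ℂ) y :=
    (hasFDerivAt_id y).const_sub x
  have h2 : HasFDerivAt (fun y => ρ (x - y)) _ y := (h (x - y)).hasFDerivAt.comp y h1
  rw [wd_eq h2, wd]
  simp; ring

lemma TF.comp_const_sub {ρ : ℂ → ℂ} (hρ : TF ρ) (x : ℂ) : TF fun y => ρ (x - y) :=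
  ⟨hρ.smooth.comp (contDiff_const.sub contDiff_id),
    hρ.comp.comp_homeomorph (Homeomorph.subLeft x)⟩

lemma hlm_const_sub {ρ : ℂ → ℂ} (hρ : TF ρ) (x y : ℂ) :
    hlm (fun y => ρ (x - y)) y = hlm ρ (x - y) := by
  have h : wd (-Complex.I) (fun y => ρ (x - y)) = fun y => -1 * wd (-Complex.I) ρ (x - y) :=
    funext fun y => by rw [wd_const_sub x y hρ.differentiable]; ring
  have hd : DifferentiableAt ℝ (fun y => wd (-Complex.I) ρ (x - y)) y :=
    ((hρ.wd (-Complex.I)).comp_const_sub x).differentiable y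
  rw [hlm, hlm, h, wd_mul (differentiableAt_const _) hd, wd_const,
    wd_const_sub x y (hρ.wd _).differentiable]
  ring

/-- An approximate identity of smooth compactly supported functions. -/
lemma exists_mollifier : ∃ ρ : ℕ → ℂ → ℂ, (∀ n, TF (ρ n)) ∧
    (∀ n D R g, Src D R g → Src D (R + 1) (cnv g (ρ n))) ∧
    ∀ g, LocallyIntegrable g → ∀ᵐ x, Tendsto (fun n => cnv g (ρ n) x) atTop (𝓝 (g x)) := by
  let b : ℕ → ContDiffBump (0 : ℂ) := fun n =>
    ⟨1 / (n + 1) / 2, 1 / (n + 1), by positivity, half_lt_self (by positivity)⟩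
  have hTF : ∀ n, TF fun z => (((b n).normed volume z : ℝ) : ℂ) := fun n =>
    ⟨Complex.ofRealCLM.contDiff.comp (b n).contDiff_normed,
      (b n).hasCompactSupport_normed.comp_left (g := fun x : ℝ => (x : ℂ)) (by simp)⟩
  refine ⟨fun n z => (((b n).normed volume z : ℝ) : ℂ), hTF, fun n D R g hg => ?_, fun g hg => ?_⟩
  · refine ⟨(contDiff_cnv hg.locallyIntegrable (hTF n)).continuous.measurable, fun x => ?_,
      fun x hx => ?_⟩
    · rw [cnv]
      have hi : Integrable fun y => D * (b n).normed volume (x - y) :=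
        (((b n).integrable_normed (μ := volume)).comp_sub_left x).const_mul D
      refine (norm_integral_le_of_norm_le hi (Eventually.of_forall fun y => ?_)).trans_eq ?_
      · rw [norm_mul, Complex.norm_real, Real.norm_of_nonneg ((b n).nonneg_normed _)]
        exact mul_le_mul_of_nonneg_right (hg.bdd y) ((b n).nonneg_normed _)
      · rw [integral_const_mul, integral_sub_left_eq_self (fun y => (b n).normed volume y),
          (b n).integral_normed, mul_one]
    · rw [cnv]
      refine integral_eq_zero_of_ae (Eventually.of_forall fun y => ?_)
      simp only [Pi.zero_apply]
      rcases le_or_gt ‖y‖ R with hy | hy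
      · have : x - y ∉ Function.support ((b n).normed volume) := by
          rw [(b n).support_normed_eq, mem_ball_zero_iff, not_lt]
          have h1 : (b n).rOut ≤ 1 := by
            show (1 : ℝ) / (n + 1) ≤ 1
            rw [div_le_one (by positivity)]; linarith [n.cast_nonneg (α := ℝ)]
          have h2 := norm_sub_norm_le x y
          linarith
        rw [Function.notMem_support.1 this]; simp
      · rw [hg.supp y hy, zero_mul]
  · have h0 : Tendsto (fun n => (b n).rOut) atTop (𝓝 0) := tendsto_one_div_add_atTop_nhds_zero_nat
    have := ContDiffBump.ae_convolution_tendsto_right_of_locallyIntegrable (φ := b) (K := 2) h0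
      (Eventually.of_forall fun n => by
        show (1 : ℝ) / (n + 1) ≤ 2 * (1 / (n + 1) / 2)
        linarith) hg
    filter_upwards [this] with x hx
    refine hx.congr fun n => ?_
    rw [cnv, convolution, ← integral_sub_left_eq_self _ _ x]
    refine integral_congr_ae (Eventually.of_forall fun y => ?_)
    simp [mul_comm]

/-- If the outgoing potential of `f` has compact support, then integrals of `f` against
solutions are given by Green's formula without boundary terms. -/
lemma integral_mul_eq_of_pot_eq_zero {D R R' ρ : ℝ} {f u v : ℂ → ℂ} (hf : Src D R f)
    (hp : ∀ x, R' < ‖x‖ → pot f x = 0) (hu : BM u) (hv : BM v) (hρ : R' + 1 < ρ)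
    (hw : ∀ φ, TF φ → tsupport φ ⊆ Metric.ball 0 ρ →
      ∫ z, u z * hlm φ z = ∫ z, v z * u z * φ z) :
    ∫ z, u z * f z = ∫ z, v z * u z * pot f z := by
  obtain ⟨C, hC⟩ := (isCompact_closedBall (0 : ℂ) R').exists_bound_of_continuousOn
    hf.continuous_pot.continuousOn
  have hP : Src (max C 0) R' (pot f) := by
    refine ⟨hf.continuous_pot.measurable, fun z => ?_, hp⟩
    rcases le_or_gt ‖z‖ R' with hz | hz
    · exact (hC z (mem_closedBall_zero_iff.2 hz)).trans (le_max_left _ _)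
    · rw [hp z hz, norm_zero]; exact le_max_right _ _
  obtain ⟨m, hm, hmS, hmT⟩ := exists_mollifier
  have hS1 := fun n => hmS n _ _ _ hP
  have hS2 := fun n => hmS n _ _ _ hf
  have hlmm : ∀ n, hlm (cnv (pot f) (m n)) = cnv f (m n) := fun n => by
    rw [hlm_cnv hP.locallyIntegrable (hm n)]
    funext x
    have := integral_hlm_mul_pot hf ((hm n).comp_const_sub x)
    simp_rw [hlm_const_sub (hm n)] at this
    rw [cnv, cnv, ← this]
    exact integral_congr_ae (Eventually.of_forall fun z => mul_comm _ _)
  have hts : ∀ n, tsupport (cnv (pot f) (m n)) ⊆ Metric.closedBall 0 (R' + 1) := fun n => by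
    refine closure_minimal (fun z hz => ?_) Metric.isClosed_closedBall
    rw [mem_closedBall_zero_iff]
    by_contra h
    exact hz ((hS1 n).supp z (not_le.1 h))
  have hT : ∀ n, TF (cnv (pot f) (m n)) := fun n =>
    ⟨contDiff_cnv hP.locallyIntegrable (hm n),
      (isCompact_closedBall (0 : ℂ) (R' + 1)).of_isClosed_subset (isClosed_tsupport _) (hts n)⟩
  have hlim : ∀ (D R : ℝ) (g w : ℂ → ℂ), Src D R g → BM w →
      Tendsto (fun n => ∫ z, w z * cnv g (m n) z) atTop (𝓝 (∫ z, w z * g z)) := by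
    intro D R g w hg hw
    obtain ⟨E, hE⟩ := hw.bdd
    have hE' : ∀ z, ‖w z‖ ≤ E := fun z => by
      have := hE z
      rw [← ofReal_norm] at this
      exact_mod_cast ENNReal.ofReal_le_coe.1 this
    have hi : Integrable ((Metric.closedBall (0 : ℂ) (R + 1)).indicator fun _ => (E : ℝ) * D) :=
      (integrable_indicator_iff Metric.isClosed_closedBall.measurableSet).2
        (by
          have h2 : volume (Metric.closedBall (0 : ℂ) (R + 1)) ≠ ⊤ :=
            (isCompact_closedBall _ _).measure_lt_top.ne
          exact integrableOn_const h2)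
    refine tendsto_integral_of_dominated_convergence _ (fun n => ?_) hi (fun n => ?_) ?_
    · exact (hw.meas.mul (hmS n _ _ _ hg).meas).aestronglyMeasurable
    · refine Eventually.of_forall fun z => ?_
      by_cases hz : z ∈ Metric.closedBall (0 : ℂ) (R + 1)
      · rw [indicator_of_mem hz, norm_mul]
        exact mul_le_mul (hE' z) ((hmS n _ _ _ hg).bdd z) (norm_nonneg _) E.2
      · rw [indicator_of_notMem hz, (hmS n _ _ _ hg).supp z (by simpa using hz)]; simp
    · filter_upwards [hmT g hg.locallyIntegrable] with z hz using hz.const_mul _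
  refine tendsto_nhds_unique (hlim _ _ _ _ hf hu) ((hlim _ _ _ _ hP (hv.mul hu)).congr fun n => ?_)
  rw [← hw _ (hT n) ((hts n).trans (Metric.closedBall_subset_ball hρ)), hlmm]

end GKL

namespace GKL

open Filter Topology ComplexConjugate Asymptotics
open scoped ENNReal NNReal ContDiff

section PhragmenLindelof

variable {h : ℂ → ℂ} {C A : ℝ}

lemma isBigO_of_exp_bound {S : Set ℂ} (hC : ∀ s ∈ S, ‖h s‖ ≤ C * rexp (A * ‖s‖)) :
    ∃ c < (2 : ℝ), ∃ B, h =O[Bornology.cobounded ℂ ⊓ 𝓟 S] fun z => rexp (B * ‖z‖ ^ c) := by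
  refine ⟨1, by norm_num, A, IsBigO.of_bound C ?_⟩
  have : ∀ᶠ z in Bornology.cobounded ℂ ⊓ 𝓟 S, z ∈ S := mem_inf_of_right (mem_principal_self S)
  filter_upwards [this] with z hz
  rw [Real.rpow_one, Real.norm_of_nonneg (Real.exp_pos _).le]
  exact hC z hz

/-- Exponential decay along the sides of a quadrant propagates to its interior. -/
lemma quadrant_exp_decay {g : ℂ → ℂ} (hd : DiffContOnCl ℂ g (Ioi 0 ×ℂ Ioi 0))
    (hC : ∀ s : ℂ, 0 ≤ s.re → 0 ≤ s.im → ‖g s‖ ≤ C * rexp (A * ‖s‖)) (c : ℂ) {K : ℝ}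
    (hre : ∀ x : ℝ, 0 ≤ x → ‖g x‖ * rexp (c.re * x) ≤ K)
    (him : ∀ x : ℝ, 0 ≤ x → ‖g (x * Complex.I)‖ * rexp (-(c.im * x)) ≤ K) {s : ℂ}
    (h1 : 0 ≤ s.re) (h2 : 0 ≤ s.im) : ‖g s‖ * rexp (c.re * s.re - c.im * s.im) ≤ K := by
  have hn : ∀ s : ℂ, ‖g s * Complex.exp (c * s)‖ = ‖g s‖ * rexp (c.re * s.re - c.im * s.im) :=
    fun s => by rw [norm_mul, Complex.norm_exp, Complex.mul_re]
  have hdk : DiffContOnCl ℂ (fun s => g s * Complex.exp (c * s)) (Ioi 0 ×ℂ Ioi 0) :=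
    hd.smul (Differentiable.diffContOnCl (by fun_prop))
  rw [← hn]
  refine PhragmenLindelof.quadrant_I (f := fun s => g s * Complex.exp (c * s)) hdk
    (isBigO_of_exp_bound (C := C) (A := A + ‖c‖) fun s hs => ?_) (fun x hx => ?_)
    (fun x hx => ?_) h1 h2
  · have hs' := Complex.mem_reProdIm.1 hs
    rw [norm_mul, add_mul, Real.exp_add, ← mul_assoc]
    refine mul_le_mul (hC s hs'.1.le hs'.2.le) ?_ (norm_nonneg _)
      ((norm_nonneg _).trans (hC s hs'.1.le hs'.2.le))
    rw [Complex.norm_exp]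
    exact Real.exp_le_exp.2 ((Complex.re_le_norm _).trans (norm_mul_le _ _))
  · rw [hn]; simpa using hre x hx
  · rw [hn]; simpa using him x hx

/-- A function in the right half plane, symmetric and decaying along the imaginary axis,
vanishes. -/
lemma eq_zero_of_symm_decay (hd : DifferentiableOn ℂ h {s | -1 < s.re})
    (hC : ∀ s : ℂ, 0 ≤ s.re → ‖h s‖ ≤ C * rexp (A * ‖s‖))
    (hsymm : ∀ s : ℂ, 0 ≤ s.re → ‖h (conj s)‖ = ‖h s‖)
    (hI : ∀ y : ℝ, 0 ≤ y → ‖h (y * Complex.I)‖ ≤ C * rexp (-(2 * y))) :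
    ∀ s : ℂ, 0 ≤ s.re → h s = 0 := by
  have hop : IsOpen {s : ℂ | -1 < s.re} := isOpen_lt continuous_const Complex.continuous_re
  have hC0 : 0 ≤ C := by
    have := (norm_nonneg _).trans (hC 0 le_rfl)
    simpa using this
  have hcl : ∀ {S : Set ℂ}, closure S ⊆ {s | 0 ≤ s.re} → DiffContOnCl ℂ h S := fun {S} hS =>
    DifferentiableOn.diffContOnCl (hd.mono fun s hs => by
      have : 0 ≤ s.re := hS hs
      rw [mem_ofPred_eq]; linarith)
  have hcl0 : IsClosed {s : ℂ | 0 ≤ s.re} := isClosed_le continuous_const Complex.continuous_re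
  have hmem : ∀ s : ℂ, 0 < s.re → s ∈ {s : ℂ | 0 ≤ s.re} := fun s hs => by
    rw [mem_ofPred_eq]; exact hs.le
  have hstep : ∀ β K : ℝ, C ≤ K → (∀ x : ℝ, 0 ≤ x → ‖h x‖ * rexp (β * x) ≤ K) →
      ∀ x : ℝ, 0 ≤ x → ‖h x‖ * rexp ((β + 2) * x) ≤ K := by
    intro β K hCK hβ
    have hq : ∀ x y : ℝ, 0 ≤ x → 0 ≤ y → ‖h (x + y * Complex.I)‖ * rexp (β * x + 2 * y) ≤ K := by
      intro x y hx hy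
      have := quadrant_exp_decay (g := h) (c := β - 2 * Complex.I) (K := K) (s := x + y * Complex.I)
        (hcl (closure_minimal (fun s hs => hmem s (Complex.mem_reProdIm.1 hs).1) hcl0))
        (fun s h1 _ => hC s h1) (by simpa using hβ) (fun y hy => ?_) (by simpa) (by simpa)
      · simpa using this
      · refine le_trans (mul_le_mul_of_nonneg_right (hI y hy) (Real.exp_pos _).le) ?_
        rw [mul_assoc, ← Real.exp_add]
        simpa using hCK
    have hq' : ∀ x y : ℝ, 0 ≤ x → 0 ≤ y →
        ‖h (x - y * Complex.I)‖ * rexp (β * x + 2 * y) ≤ K := by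
      intro x y hx hy
      have e : (x - y * Complex.I : ℂ) = conj (x + y * Complex.I : ℂ) := by
        simp [sub_eq_add_neg]
      rw [e, hsymm _ (by simpa)]
      exact hq x y hx hy
    intro x hx
    have hsub : MapsTo (fun w : ℂ => w * (1 - Complex.I)) (Ioi 0 ×ℂ Ioi 0) {s | 0 < s.re} :=
      fun w hw => by
        have := Complex.mem_reProdIm.1 hw
        simpa using add_pos this.1 this.2
    have hcl2 : DiffContOnCl ℂ h {s | 0 < s.re} :=
      hcl (closure_minimal (fun s hs => hmem s hs) hcl0)
    have hdk : DiffContOnCl ℂ (fun w => h (w * (1 - Complex.I))) (Ioi 0 ×ℂ Ioi 0) :=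
      hcl2.comp (Differentiable.diffContOnCl (by fun_prop)) hsub
    have := quadrant_exp_decay hdk (C := C) (A := |A| * ‖1 - Complex.I‖)
      (c := (β + 2) * (1 - Complex.I))
      (K := K) (s := x / 2 + x / 2 * Complex.I) (fun s h1 h2 => ?_) (fun y hy => ?_)
      (fun y hy => ?_) (by simp; positivity) (by simp; positivity)
    · have e : (x / 2 + x / 2 * Complex.I : ℂ) * (1 - Complex.I) = x := by
        ring_nf; rw [Complex.I_sq]; ring
      rw [e] at this
      convert this using 3
      simp; ring
    · refine (hC _ (by simpa using add_nonneg h1 h2)).trans ?_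
      refine mul_le_mul_of_nonneg_left (Real.exp_le_exp.2 ?_) hC0
      rw [norm_mul]
      calc A * (‖s‖ * ‖1 - Complex.I‖) ≤ |A| * (‖s‖ * ‖1 - Complex.I‖) := by
            gcongr; exact le_abs_self A
        _ = _ := by ring
    · have := hq' y y hy hy
      rw [show (y : ℂ) * (1 - Complex.I) = y - y * Complex.I by ring]
      convert this using 3
      simp; ring
    · have := hq y y hy hy
      rw [show (y : ℂ) * Complex.I * (1 - Complex.I) = y + y * Complex.I by
        ring_nf; rw [Complex.I_sq]; ring]
      convert this using 3
      simp; ring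
  have hall : ∀ n : ℕ, ∀ x : ℝ, 0 ≤ x → ‖h x‖ * rexp ((-A + 2 * n) * x) ≤ C := by
    intro n
    induction n with
    | zero =>
      intro x hx
      have := hC x (by simpa)
      rw [Complex.norm_real, Real.norm_of_nonneg hx] at this
      calc _ ≤ C * rexp (A * x) * rexp ((-A + 2 * ((0 : ℕ) : ℝ)) * x) := by gcongr
        _ = C := by rw [mul_assoc, ← Real.exp_add]; simp
    | succ n ih =>
      intro x hx
      convert hstep _ C le_rfl ih x hx using 4
      push_cast; ring
  refine PhragmenLindelof.eq_zero_on_right_half_plane_of_superexponential_decay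
    (hcl (closure_minimal (fun s hs => hmem s hs) hcl0))
    (isBigO_of_exp_bound (C := C) (A := A) fun s hs => hC s (le_of_lt hs)) ?_ ⟨C, fun y => ?_⟩
  · intro n
    obtain ⟨m, hm⟩ := exists_nat_gt (n + A + 1)
    have hz : Tendsto (fun x : ℝ => C * rexp (-x)) atTop (𝓝 0) := by
      simpa using Real.tendsto_exp_neg_atTop_nhds_zero.const_mul C
    refine squeeze_zero' (Eventually.of_forall fun x => by positivity) ?_ hz
    filter_upwards [eventually_ge_atTop 0] with x hx
    have := hall m x hx
    rw [Real.exp_neg, ← div_eq_mul_inv, le_div_iff₀ (Real.exp_pos _)]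
    refine le_trans ?_ this
    rw [← Real.exp_nat_mul, mul_comm (rexp _), mul_assoc, ← Real.exp_add]
    gcongr
    nlinarith [m.cast_nonneg (α := ℝ)]
  · have key : ∀ y : ℝ, 0 ≤ y → ‖h (y * Complex.I)‖ ≤ C := fun y hy => by
      refine (hI y hy).trans (mul_le_of_le_one_right hC0 (Real.exp_le_one_iff.2 (by linarith)))
    rcases le_total 0 y with hy | hy
    · exact key y hy
    · have := key (-y) (by linarith)
      rw [← hsymm _ (by simp)] at this
      simpa using this

end PhragmenLindelof

end GKL

namespace GKL

open Filter Topology ComplexConjugate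
open scoped ENNReal NNReal ContDiff

/-- The squared distance from the complexified point `t` of the real axis to `z`. -/
def lx (t z : ℂ) : ℂ := (t - z.re) ^ 2 + (z.im : ℂ) ^ 2

/-- The holomorphic extension of the restriction of `pot f` to the real axis. -/
def lpot (f : ℂ → ℂ) (t : ℂ) : ℂ := ∫ z, Efun (lx t z) * f z

/-- The domain where `lpot f` is holomorphic. -/
def lineDom (η R : ℝ) : Set ℂ := {t | |t.im| < η} ∪ {t | R < t.re}

lemma mem_lineDom {η R : ℝ} {t : ℂ} : t ∈ lineDom η R ↔ |t.im| < η ∨ R < t.re := Iff.rfl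

lemma lx_ofReal (x : ℝ) (z : ℂ) : lx x z = ((‖x - z‖ ^ 2 : ℝ) : ℂ) := by
  rw [← Complex.normSq_eq_norm_sq, Complex.normSq_apply, lx]
  simp; ring

lemma lpot_ofReal (f : ℂ → ℂ) (x : ℝ) : lpot f x = pot f x := by
  simp only [lpot, pot, lx_ofReal, grn]

lemma lx_factor (t z : ℂ) : lx t z = (t - conj z) * (t - z) := by
  rw [lx]
  conv_rhs => rw [← Complex.re_add_im z]
  simp only [map_add, map_mul, Complex.conj_ofReal, Complex.conj_I]
  ring_nf; rw [Complex.I_sq]; ring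

lemma lx_mem_slitPlane {t z : ℂ} (h : |t.im| < |z.im| ∨ (z.re < t.re ∧ z.im ≠ 0)) :
    lx t z ∈ Complex.slitPlane := by
  rw [Complex.mem_slitPlane_iff, lx]
  have e1 : ((t - z.re) ^ 2 + (z.im : ℂ) ^ 2).re = (t.re - z.re) ^ 2 - t.im ^ 2 + z.im ^ 2 := by
    simp [pow_two]
  have e2 : ((t - z.re) ^ 2 + (z.im : ℂ) ^ 2).im = 2 * (t.re - z.re) * t.im := by
    simp [pow_two]; ring
  rw [e1, e2]
  rcases h with h | ⟨h, h0⟩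
  · left
    have := sq_lt_sq.2 h
    nlinarith [sq_nonneg (t.re - z.re)]
  · rcases eq_or_ne t.im 0 with ht | ht
    · left; rw [ht]
      have : 0 < z.im ^ 2 := by positivity
      nlinarith [sq_nonneg (t.re - z.re)]
    · right
      have : t.re - z.re ≠ 0 := by linarith [sub_pos.2 h] |> fun (h' : 0 < t.re - z.re) => h'.ne'
      positivity

lemma isOpen_lineDom (η R : ℝ) : IsOpen (lineDom η R) :=
  (isOpen_lt (continuous_abs.comp Complex.continuous_im) continuous_const).union
    (isOpen_lt continuous_const Complex.continuous_re)

lemma isPreconnected_lineDom {η : ℝ} (R : ℝ) (hη : 0 < η) : IsPreconnected (lineDom η R) := by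
  have h1 : Convex ℝ {t : ℂ | |t.im| < η} := by
    have : {t : ℂ | |t.im| < η} = Complex.imLm ⁻¹' (Ioo (-η) η) := by
      ext t
      rw [mem_ofPred_eq, mem_preimage, mem_Ioo, abs_lt]; rfl
    rw [this]
    exact (convex_Ioo _ _).linear_preimage _
  have h2 : Convex ℝ {t : ℂ | R < t.re} := convex_halfSpace_re_gt R
  have m1 : ((R + 1 : ℝ) : ℂ) ∈ {t : ℂ | |t.im| < η} := by simpa using hη
  have m2 : ((R + 1 : ℝ) : ℂ) ∈ {t : ℂ | R < t.re} := by simp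
  exact IsPreconnected.union _ m1 m2 h1.isPreconnected h2.isPreconnected

section

variable {D R η : ℝ} {f : ℂ → ℂ}

/-- The region containing the support of the source. -/
def srcReg (η R : ℝ) : Set ℂ := Metric.closedBall 0 R ∩ {z | η ≤ |z.im|}

lemma isCompact_srcReg (η R : ℝ) : IsCompact (srcReg η R) :=
  (isCompact_closedBall 0 R).inter_right
    (isClosed_le continuous_const (continuous_abs.comp Complex.continuous_im))

lemma mem_srcReg {z : ℂ} : z ∈ srcReg η R ↔ ‖z‖ ≤ R ∧ η ≤ |z.im| := by
  rw [srcReg, mem_inter_iff, mem_closedBall_zero_iff, mem_ofPred_eq]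

lemma Src.eq_zero_of_notMem (hf : Src D R f) (hη : ∀ z, |z.im| < η → f z = 0) {z : ℂ}
    (hz : z ∉ srcReg η R) : f z = 0 := by
  rw [mem_srcReg, not_and_or, not_le, not_le] at hz
  exact hz.elim (hf.supp z) (hη z)

lemma lx_mem_of_mem (h0 : 0 < η) {t z : ℂ} (ht : t ∈ lineDom η R) (hz : z ∈ srcReg η R) :
    lx t z ∈ Complex.slitPlane := by
  rw [mem_srcReg] at hz
  rcases ht with h | h
  · exact lx_mem_slitPlane (Or.inl (h.trans_le hz.2))
  · refine lx_mem_slitPlane (Or.inr ⟨((Complex.re_le_norm z).trans hz.1).trans_lt h, ?_⟩)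
    exact abs_pos.1 (h0.trans_le hz.2)

lemma continuous_lx : Continuous fun p : ℂ × ℂ => lx p.1 p.2 := by
  unfold lx; fun_prop

lemma differentiableOn_lpot_of_slitPlane {U K : Set ℂ} (hf : Src D R f) (hU : IsOpen U)
    (hK : IsCompact K) (hfK : ∀ z, z ∉ K → f z = 0)
    (hUK : ∀ t ∈ U, ∀ z ∈ K, lx t z ∈ Complex.slitPlane) : DifferentiableOn ℂ (lpot f) U := by
  intro t₀ ht₀
  obtain ⟨ε, hε, hb⟩ := Metric.nhds_basis_closedBall.mem_iff.1
    (hU.mem_nhds ht₀)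
  have e : lpot f = fun t => ∫ z in K, Efun (lx t z) * f z := funext fun t =>
    (setIntegral_eq_integral_of_forall_compl_eq_zero fun z hz => by
      rw [hfK z hz, mul_zero]).symm
  have hKp := (isCompact_closedBall t₀ ε).prod hK
  have hc' : ContinuousOn (fun p : ℂ × ℂ => Efun' (lx p.1 p.2) * (2 * (p.1 - p.2.re)))
      (Metric.closedBall t₀ ε ×ˢ K) := by
    refine ContinuousOn.mul (continuousOn_Efun'.comp continuous_lx.continuousOn
      fun p hp => hUK _ (hb hp.1) _ hp.2) (Continuous.continuousOn (by fun_prop))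
  have hc : ContinuousOn (fun p : ℂ × ℂ => Efun (lx p.1 p.2))
      (Metric.closedBall t₀ ε ×ˢ K) :=
    continuousOn_Efun.comp continuous_lx.continuousOn fun p hp => hUK _ (hb hp.1) _ hp.2
  obtain ⟨C, hC⟩ := hKp.exists_bound_of_continuousOn hc'
  have hmem : t₀ ∈ Metric.closedBall t₀ ε := Metric.mem_closedBall_self hε.le
  have hsl : MapsTo (fun z => (t₀, z)) (K) (Metric.closedBall t₀ ε ×ˢ K) :=
    fun z hz => ⟨hmem, hz⟩
  have hms := hK.isClosed.measurableSet
  have hfi : IntegrableOn f (K) := hf.locallyIntegrable.integrableOn_isCompact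
    hK
  have hcs : ContinuousOn (fun z => Efun (lx t₀ z)) (K) :=
    hc.comp (f := fun z => (t₀, z)) (by fun_prop) hsl
  have hcs' : ContinuousOn (fun z => Efun' (lx t₀ z) * (2 * (t₀ - z.re))) (K) :=
    hc'.comp (f := fun z => (t₀, z)) (by fun_prop) hsl
  have := hasDerivAt_integral_of_dominated_loc_of_deriv_le (μ := volume.restrict (K))
    (F := fun t z => Efun (lx t z) * f z)
    (F' := fun t z => Efun' (lx t z) * (2 * (t - z.re)) * f z) (bound := fun z => C * ‖f z‖)
    (Metric.closedBall_mem_nhds t₀ hε) (Eventually.of_forall fun t => ?_) ?_ ?_ ?_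
    (hfi.norm.const_mul C) ?_
  · rw [e]; exact this.2.differentiableAt.differentiableWithinAt
  · refine ((measurable_Efun.comp ?_).mul hf.meas).aestronglyMeasurable
    exact (continuous_lx.comp (by fun_prop : Continuous fun z : ℂ => (t, z))).measurable
  · exact hfi.continuousOn_mul hcs hK
  · exact (hcs'.aestronglyMeasurable hms).mul hf.meas.aestronglyMeasurable
  · filter_upwards [ae_restrict_mem hms] with z hz t ht
    rw [norm_mul]
    exact mul_le_mul_of_nonneg_right (hC (t, z) ⟨ht, hz⟩) (norm_nonneg _)
  · filter_upwards [ae_restrict_mem hms] with z hz t ht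
    have h1 : HasDerivAt (fun t => lx t z) (2 * (t - z.re)) t := by
      unfold lx
      refine ((((hasDerivAt_id t).sub_const (z.re : ℂ)).pow 2).add_const _).congr_deriv ?_
      simp
    exact ((hasDerivAt_Efun (hUK t (hb ht) z hz)).comp t h1).mul_const _

lemma differentiableOn_lpot (hf : Src D R f) (h0 : 0 < η) (hη : ∀ z, |z.im| < η → f z = 0) :
    DifferentiableOn ℂ (lpot f) (lineDom η R) :=
  differentiableOn_lpot_of_slitPlane hf (isOpen_lineDom η R) (isCompact_srcReg η R)
    (fun _ hz => hf.eq_zero_of_notMem hη hz) fun _ ht _ hz => lx_mem_of_mem h0 ht hz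

lemma tendsto_ofReal_punctured (x₀ : ℝ) :
    Tendsto (fun x : ℝ => (x : ℂ)) (𝓝[≠] x₀) (𝓝[≠] (x₀ : ℂ)) :=
  tendsto_nhdsWithin_iff.2 ⟨(Complex.continuous_ofReal.tendsto x₀).mono_left nhdsWithin_le_nhds, by
    filter_upwards [self_mem_nhdsWithin] with x hx
    simpa using hx⟩

lemma pot_eq_zero_of_eventually_of_isPreconnected {U : Set ℂ} (hU : IsOpen U)
    (hU' : IsPreconnected U) (hd : DifferentiableOn ℂ (lpot f) U) {x₀ : ℝ} (hx₀ : (x₀ : ℂ) ∈ U)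
    (h : ∀ᶠ x : ℝ in 𝓝 x₀, pot f x = 0) {x : ℝ} (hx : (x : ℂ) ∈ U) : pot f x = 0 := by
  have hfr : ∃ᶠ t in 𝓝[≠] (x₀ : ℂ), lpot f t = 0 := by
    refine (tendsto_ofReal_punctured x₀).frequently (Eventually.frequently ?_)
    filter_upwards [h.filter_mono nhdsWithin_le_nhds] with x hx
    rw [lpot_ofReal, hx]
  have := (hd.analyticOnNhd hU).eqOn_zero_of_preconnected_of_frequently_eq_zero hU' hx₀ hfr hx
  rw [← lpot_ofReal, this, Pi.zero_apply]

/-- Vanishing propagates along the real axis. -/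
lemma pot_eq_zero_of_eventually (hf : Src D R f) (h0 : 0 < η) (hη : ∀ z, |z.im| < η → f z = 0)
    {x₀ : ℝ} (h : ∀ᶠ x : ℝ in 𝓝 x₀, pot f x = 0) (x : ℝ) : pot f x = 0 :=
  have hmem : ∀ x : ℝ, (x : ℂ) ∈ lineDom η R := fun x => Or.inl (by simpa using h0)
  pot_eq_zero_of_eventually_of_isPreconnected (isOpen_lineDom η R) (isPreconnected_lineDom R h0)
    (differentiableOn_lpot hf h0 hη) (hmem x₀) h (hmem x)

end

end GKL

namespace GKL

open Filter Topology ComplexConjugate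
open scoped ENNReal NNReal ContDiff

lemma norm_Efun_lx_le : ∃ C : ℝ, 0 ≤ C ∧ ∀ (R : ℝ) (t z : ℂ), ‖z‖ ≤ R → R + 1 ≤ t.re →
    ‖Efun (lx t z)‖ ≤ C * rexp (6 * (‖t‖ + R)) := by
  obtain ⟨C, hC0, hC⟩ := norm_Efun_le
  refine ⟨C, hC0, fun R t z hz ht => ?_⟩
  have hb : ∀ w : ℂ, ‖w‖ ≤ R → 1 ≤ ‖t - w‖ ∧ ‖t - w‖ ≤ ‖t‖ + R := fun w hw => by
    refine ⟨?_, (norm_sub_le _ _).trans (by linarith)⟩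
    have h1 := Complex.re_le_norm (t - w)
    have h2 := Complex.re_le_norm w
    rw [Complex.sub_re] at h1
    linarith
  have h1 := hb z hz
  have h2 := hb (conj z) (by rwa [RCLike.norm_conj])
  have hX : ‖lx t z‖ = ‖t - conj z‖ * ‖t - z‖ := by rw [lx_factor, norm_mul]
  have hX1 : 1 ≤ ‖lx t z‖ := by rw [hX]; nlinarith
  have hX0 : lx t z ≠ 0 := norm_pos_iff.1 (by linarith)
  set r := √‖lx t z‖ with hr
  have hr1 : 1 ≤ r := Real.one_le_sqrt.2 hX1
  have hrR : r ≤ ‖t‖ + R := by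
    rw [hr, Real.sqrt_le_left (by linarith [h1.1, h1.2]), hX, pow_two]
    exact mul_le_mul h2.2 h1.2 (norm_nonneg _) (by linarith [h1.1, h1.2])
  have hlog : |Real.log ‖lx t z‖| ≤ 2 * r := by
    rw [abs_of_nonneg (Real.log_nonneg hX1)]
    have e : ‖lx t z‖ = r ^ 2 := (Real.sq_sqrt (norm_nonneg _)).symm
    rw [e, Real.log_pow]
    have := Real.log_le_sub_one_of_pos (show 0 < r by linarith)
    push_cast; linarith
  calc ‖Efun (lx t z)‖ ≤ C * (1 + |Real.log ‖lx t z‖|) * rexp (4 * r) := hC _ hX0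
    _ ≤ C * rexp (2 * r) * rexp (4 * r) := by
        gcongr
        have := Real.add_one_le_exp (2 * r)
        linarith
    _ = C * rexp (6 * r) := by rw [mul_assoc, ← Real.exp_add]; ring_nf
    _ ≤ _ := by gcongr

lemma norm_Efun_lx_decay : ∃ C : ℝ, 0 ≤ C ∧ ∀ (R : ℝ) (t z : ℂ), ‖z‖ ≤ R → R + 1 ≤ t.re →
    R + 1 ≤ t.im → ‖Efun (lx t z)‖ ≤ C * rexp (2 * R) * rexp (-(2 * t.im)) := by
  obtain ⟨C, hC0, hC⟩ := norm_Efun_sq_le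
  refine ⟨C, hC0, fun R t z hz ht hy => ?_⟩
  have hzr := (Complex.re_le_norm z).trans hz
  have hzi := (Complex.abs_im_le_norm z).trans hz
  have hR : 0 ≤ R := (norm_nonneg z).trans hz
  obtain ⟨w, hw, hw0⟩ : ∃ w : ℂ, w ^ 2 = lx t z ∧ 0 ≤ w.re := by
    obtain ⟨w, hw⟩ := IsAlgClosed.exists_pow_nat_eq (lx t z) (n := 2) (by norm_num)
    rcases le_total 0 w.re with h | h
    · exact ⟨w, hw, h⟩
    · exact ⟨-w, by rw [neg_sq, hw], by simpa using h⟩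
  have him : 2 * w.re * w.im = 2 * (t.re - z.re) * t.im := by
    have := congrArg Complex.im hw
    simp [lx, pow_two] at this
    linarith
  have hpos : 0 < w.re * w.im := by
    have h1 : 0 < t.re - z.re := by linarith
    have h2 : 0 < t.im := by linarith
    have := mul_pos h1 h2
    linarith
  have hwre : 0 < w.re := lt_of_le_of_ne hw0 fun h => by rw [← h] at hpos; simp at hpos
  have hwim : 0 < w.im := (pos_iff_pos_of_mul_pos hpos).1 hwre
  have hprod : ‖w - (t - z.re)‖ * ‖w + (t - z.re)‖ = |z.im| ^ 2 := by
    rw [← norm_mul, show (w - (t - z.re)) * (w + (t - z.re)) = w ^ 2 - (t - z.re) ^ 2 by ring, hw, lx,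
      add_sub_cancel_left, norm_pow, Complex.norm_real, Real.norm_eq_abs]
  have hge : R < ‖w + (t - z.re)‖ := by
    have := Complex.im_le_norm (w + (t - z.re))
    simp at this
    linarith
  have hle : ‖w - (t - z.re)‖ ≤ R := by
    by_contra h
    push Not at h
    have := mul_lt_mul'' h hge hR hR
    have h3 : |z.im| ^ 2 ≤ R ^ 2 := by gcongr
    nlinarith
  have hwt : t.im - R ≤ w.im := by
    have := (Complex.abs_im_le_norm (w - (t - z.re))).trans hle
    have := (abs_le.1 this).1
    simp at this
    linarith
  rw [← hw]
  refine (hC w hwre (by linarith)).trans ?_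
  rw [mul_assoc, ← Real.exp_add]
  gcongr
  linarith

section

variable {D R η : ℝ} {f : ℂ → ℂ}

lemma norm_lpot_le (hf : Src D R f) {t : ℂ} {K : ℝ} (hK : ∀ z, ‖z‖ ≤ R → ‖Efun (lx t z)‖ ≤ K) :
    ‖lpot f t‖ ≤ K * D * volume.real (Metric.closedBall (0 : ℂ) R) := by
  rw [lpot, hf.integral_eq]
  refine norm_setIntegral_le_of_norm_le_const (isCompact_closedBall _ _).measure_lt_top
    fun z hz => ?_
  rw [mem_closedBall_zero_iff] at hz
  rw [norm_mul]
  exact mul_le_mul (hK z hz) (hf.bdd z) (norm_nonneg _) ((norm_nonneg _).trans (hK z hz))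

/-- An outgoing potential which is real on an interval vanishes on the whole line. -/
lemma pot_eq_zero_of_im (hf : Src D R f) (hR : 0 ≤ R) (h0 : 0 < η)
    (hη : ∀ z, |z.im| < η → f z = 0)
    {a b : ℝ} (hab : a < b) (him : ∀ x ∈ Ioo a b, (pot f (x : ℝ)).im = 0) (x : ℝ) :
    pot f x = 0 := by
  have hmem : ∀ x : ℝ, (x : ℂ) ∈ lineDom η R := fun x => Or.inl (by simpa using h0)
  have hd := differentiableOn_lpot hf h0 hη
  have ha := hd.analyticOnNhd (isOpen_lineDom η R)
  have hconj : ∀ t ∈ lineDom η R, conj t ∈ lineDom η R := fun t ht => by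
    rw [mem_lineDom] at ht ⊢; simpa using ht
  have hd' : DifferentiableOn ℂ (fun t => conj (lpot f (conj t))) (lineDom η R) := fun t ht => by
    have h1 := (hd.differentiableAt ((isOpen_lineDom η R).mem_nhds (hconj t ht))).conj_conj
    rw [Complex.conj_conj] at h1
    exact h1.differentiableWithinAt
  have hsymm : EqOn (lpot f) (fun t => conj (lpot f (conj t))) (lineDom η R) := by
    obtain ⟨x₀, hx₀⟩ := exists_between hab
    refine ha.eqOn_of_preconnected_of_frequently_eq (hd'.analyticOnNhd (isOpen_lineDom η R))
      (isPreconnected_lineDom R h0) (hmem x₀) ?_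
    refine (tendsto_ofReal_punctured x₀).frequently (Eventually.frequently ?_)
    filter_upwards [nhdsWithin_le_nhds (Ioo_mem_nhds hx₀.1 hx₀.2)] with x hx
    rw [Complex.conj_ofReal, lpot_ofReal]
    exact (Complex.conj_eq_iff_im.2 (him x hx)).symm
  obtain ⟨C₁, hC₁, hg⟩ := norm_Efun_lx_le
  obtain ⟨C₂, hC₂, hde⟩ := norm_Efun_lx_decay
  set V := volume.real (Metric.closedBall (0 : ℂ) R)
  have hV : 0 ≤ V := measureReal_nonneg
  have hD := hf.nonneg
  set K₁ := C₁ * rexp (6 * (2 * R + 1)) * D * V with hK₁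
  have hK₁0 : 0 ≤ K₁ := by positivity
  set K₂ := C₂ * rexp (2 * R) * D * V
  have hK₂0 : 0 ≤ K₂ := by positivity
  set C := K₁ * rexp (8 * (R + 1)) + K₂ with hC
  have hgr : ∀ s : ℂ, 0 ≤ s.re → ‖lpot f ((R + 1 : ℝ) + s)‖ ≤ K₁ * rexp (6 * ‖s‖) := by
    intro s hs
    refine (norm_lpot_le hf fun z hz => hg R _ z hz (by simpa using hs)).trans ?_
    have : ‖((R + 1 : ℝ) : ℂ) + s‖ ≤ R + 1 + ‖s‖ := by
      refine (norm_add_le _ _).trans_eq ?_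
      rw [Complex.norm_real, Real.norm_of_nonneg (by linarith)]
    calc C₁ * rexp (6 * (‖((R + 1 : ℝ) : ℂ) + s‖ + R)) * D * V
        ≤ C₁ * rexp (6 * (2 * R + 1) + 6 * ‖s‖) * D * V := by
          gcongr; linarith
      _ = _ := by rw [Real.exp_add, hK₁]; ring
  have hzero := eq_zero_of_symm_decay (h := fun s => lpot f ((R + 1 : ℝ) + s)) (C := C) (A := 6)
    (hd.comp (Differentiable.differentiableOn (by fun_prop)) fun s hs => Or.inr (by
      have hs' : -1 < s.re := hs
      rw [mem_ofPred_eq]; simp; linarith))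
    (fun s hs => (hgr s hs).trans (by
      have : 1 ≤ rexp (8 * (R + 1)) := Real.one_le_exp (by positivity)
      gcongr
      nlinarith))
    (fun s hs => by
      have := hsymm (x := (R + 1 : ℝ) + s) (Or.inr (by
        rw [mem_ofPred_eq]; simp; linarith))
      rw [this, RCLike.norm_conj, map_add, Complex.conj_ofReal])
    (fun y hy => by
      rcases le_total (R + 1) y with h | h
      · refine (norm_lpot_le hf fun z hz => hde R _ z hz (by simp) (by simpa using h)).trans ?_
        have e : (((R + 1 : ℝ) : ℂ) + y * Complex.I).im = y := by simp
        rw [e]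
        calc C₂ * rexp (2 * R) * rexp (-(2 * y)) * D * V = K₂ * rexp (-(2 * y)) := by ring
          _ ≤ _ := by
            gcongr
            rw [hC]
            have : 0 ≤ K₁ * rexp (8 * (R + 1)) := by positivity
            linarith
      · refine (hgr _ (by simp)).trans ?_
        have e : ‖(y * Complex.I : ℂ)‖ = y := by simp [abs_of_nonneg hy]
        rw [e]
        calc K₁ * rexp (6 * y) ≤ K₁ * (rexp (8 * (R + 1)) * rexp (-(2 * y))) := by
              rw [← Real.exp_add]; gcongr; linarith
          _ ≤ _ := by
            rw [← mul_assoc]; gcongr; linarith)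
  refine pot_eq_zero_of_eventually hf h0 hη (x₀ := R + 2) ?_ x
  filter_upwards [Ioi_mem_nhds (show R + 1 < R + 2 by linarith)] with x hx
  have := hzero ((x - (R + 1) : ℝ) : ℂ) (by simpa using le_of_lt hx)
  rw [← lpot_ofReal]
  simpa using this

end

end GKL

namespace GKL

open Filter Topology ComplexConjugate
open scoped ENNReal NNReal ContDiff

/-- The derivative in direction `v`. -/
def dv (v : ℂ) (q : ℂ → ℂ) (z : ℂ) : ℂ := fderiv ℝ q z v

section

variable {S : Set ℂ} {q : ℂ → ℂ}

lemma contDiffOn_dv (hS : IsOpen S) (hq : ContDiffOn ℝ ∞ q S) (v : ℂ) :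
    ContDiffOn ℝ ∞ (dv v q) S :=
  (hq.fderiv_of_isOpen hS (by simp)).clm_apply contDiffOn_const

lemma dv_congr {f g : ℂ → ℂ} {z : ℂ} (v : ℂ) (h : f =ᶠ[𝓝 z] g) : dv v f z = dv v g z := by
  rw [dv, dv, h.fderiv_eq]

lemma dv_dv {z : ℂ} (h : ContDiffAt ℝ 2 q z) (u v : ℂ) :
    dv u (dv v q) z = fderiv ℝ (fderiv ℝ q) z u v := by
  have hd : DifferentiableAt ℝ (fderiv ℝ q) z :=
    (h.fderiv_right (m := 1) (by norm_num)).differentiableAt (by simp)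
  have h1 : HasFDerivAt (fun w => fderiv ℝ q w v)
      ((ContinuousLinearMap.apply ℝ ℂ v).comp (fderiv ℝ (fderiv ℝ q) z)) z :=
    (ContinuousLinearMap.apply ℝ ℂ v).hasFDerivAt.comp z hd.hasFDerivAt
  rw [dv, show dv v q = fun w => fderiv ℝ q w v from rfl, h1.fderiv]
  rfl

lemma dv_comm {z : ℂ} (h : ContDiffAt ℝ 2 q z) (u v : ℂ) :
    dv u (dv v q) z = dv v (dv u q) z := by
  rw [dv_dv h, dv_dv h]
  exact h.isSymmSndFDerivAt (by simp) u v

lemma hlm_eq_dv {z : ℂ} (h : ContDiffAt ℝ 2 q z) :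
    hlm q z = -(dv 1 (dv 1 q) z + dv Complex.I (dv Complex.I q) z) - 4 * q z := by
  have hd : DifferentiableAt ℝ (fderiv ℝ q) z :=
    (h.fderiv_right (m := 1) (by norm_num)).differentiableAt (by simp)
  have h1 : ∀ v, HasFDerivAt (dv v q)
      ((ContinuousLinearMap.apply ℝ ℂ v).comp (fderiv ℝ (fderiv ℝ q) z)) z := fun v =>
    (ContinuousLinearMap.apply ℝ ℂ v).hasFDerivAt.comp z hd.hasFDerivAt
  have h2 : HasFDerivAt (wd (-Complex.I) q) _ z :=
    ((h1 1).add ((h1 Complex.I).const_mul (-Complex.I))).mul_const (2⁻¹ : ℂ)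
  have hs := h.isSymmSndFDerivAt (by simp) 1 Complex.I
  rw [hlm, wd_eq h2, dv_dv h, dv_dv h]
  simp
  rw [hs]
  linear_combination (fderiv ℝ (fderiv ℝ q) z Complex.I Complex.I) * Complex.I_sq

lemma dv_one_eq_zero (hd : ∀ x : ℝ, DifferentiableAt ℝ q x) (h0 : ∀ x : ℝ, q x = 0) (x : ℝ) :
    dv 1 q x = 0 := by
  have h1 : HasDerivAt (fun t : ℝ => q t) (fderiv ℝ q x 1) x :=
    (hd x).hasFDerivAt.comp_hasDerivAt x Complex.ofRealCLM.hasDerivAt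
  have h2 : (fun t : ℝ => q t) = fun _ => 0 := funext h0
  rw [h2] at h1
  exact h1.unique (hasDerivAt_const x 0)

/-- Solutions of the Helmholtz equation with vanishing Cauchy data on the real axis. -/
structure Cauchy0 (S : Set ℂ) (q : ℂ → ℂ) : Prop where
  cd : ContDiffOn ℝ ∞ q S
  eq : ∀ z ∈ S, dv 1 (dv 1 q) z + dv Complex.I (dv Complex.I q) z + 4 * q z = 0
  zero : ∀ x : ℝ, q x = 0
  zero' : ∀ x : ℝ, dv Complex.I q x = 0

lemma Cauchy0.dv_I (hS : IsOpen S) (hR : ∀ x : ℝ, (x : ℂ) ∈ S) (h : Cauchy0 S q) :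
    Cauchy0 S (dv Complex.I q) := by
  have hat : ∀ {f : ℂ → ℂ}, ContDiffOn ℝ ∞ f S → ∀ z ∈ S, ContDiffAt ℝ 2 f z := fun hf z hz =>
    (hf.contDiffAt (hS.mem_nhds hz)).of_le (by norm_cast)
  have hda : ∀ {f : ℂ → ℂ}, ContDiffOn ℝ ∞ f S → ∀ z ∈ S, DifferentiableAt ℝ f z := fun hf z hz =>
    (hat hf z hz).differentiableAt (by simp)
  have c1 := contDiffOn_dv hS h.cd 1
  have cI := contDiffOn_dv hS h.cd Complex.I
  have c11 := contDiffOn_dv hS c1 1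
  have cII := contDiffOn_dv hS cI Complex.I
  refine ⟨cI, fun z hz => ?_, h.zero', fun x => ?_⟩
  · have e1 : dv 1 (dv 1 (dv Complex.I q)) z = dv Complex.I (dv 1 (dv 1 q)) z := by
      rw [← dv_comm (hat c1 z hz) 1 Complex.I]
      refine dv_congr _ ?_
      filter_upwards [hS.mem_nhds hz] with w hw using dv_comm (hat h.cd w hw) _ _
    have hE : HasFDerivAt (fun z => dv 1 (dv 1 q) z + dv Complex.I (dv Complex.I q) z + 4 * q z)
        _ z := (((hda c11 z hz).hasFDerivAt.add (hda cII z hz).hasFDerivAt).add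
          ((hda h.cd z hz).hasFDerivAt.const_mul 4))
    have hZ : (fun z => dv 1 (dv 1 q) z + dv Complex.I (dv Complex.I q) z + 4 * q z) =ᶠ[𝓝 z]
        fun _ => 0 := by
      filter_upwards [hS.mem_nhds hz] with w hw using h.eq w hw
    have := congrArg (fun L : ℂ →L[ℝ] ℂ => L Complex.I)
      (hE.unique ((hasFDerivAt_const (0 : ℂ) z).congr_of_eventuallyEq hZ))
    rw [e1]
    simpa [dv] using this
  · have h2 := dv_one_eq_zero (fun x => hda c1 x (hR x))
      (dv_one_eq_zero (fun x => hda h.cd x (hR x)) h.zero) x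
    have := h.eq x (hR x)
    rw [h2, h.zero x] at this
    simpa using this

lemma Cauchy0.iteratedDeriv_eq_zero (hS : IsOpen S) (hR : ∀ x : ℝ, (x : ℂ) ∈ S) (x : ℝ) (n : ℕ) :
    ∀ {q : ℂ → ℂ}, Cauchy0 S q → iteratedDeriv n (fun t : ℝ => q (x + Complex.I * t)) 0 = 0 := by
  induction n with
  | zero =>
    intro q h
    simpa using h.zero x
  | succ n ih =>
    intro q h
    rw [iteratedDeriv_succ', ← ih (h.dv_I hS hR)]
    refine Filter.EventuallyEq.iteratedDeriv_eq n ?_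
    have hc : Continuous fun t : ℝ => (x + Complex.I * t : ℂ) := by fun_prop
    filter_upwards [(hS.preimage hc).mem_nhds (by simpa using hR x)] with t ht
    have hd : DifferentiableAt ℝ q (x + Complex.I * t) :=
      (h.cd.contDiffAt (hS.mem_nhds ht)).differentiableAt (by simp)
    have h1 : HasDerivAt (fun t : ℝ => (x + Complex.I * t : ℂ)) Complex.I t :=
      ((Complex.ofRealCLM.hasDerivAt (x := t)).const_mul Complex.I).const_add (x : ℂ)
        |>.congr_deriv (by simp)
    exact (hd.hasFDerivAt.comp_hasDerivAt t h1).deriv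

lemma Cauchy0.eventually_eq_zero (hS : IsOpen S) (hR : ∀ x : ℝ, (x : ℂ) ∈ S) (h : Cauchy0 S q)
    {x : ℝ} (ha : AnalyticAt ℝ (fun t : ℝ => q (x + Complex.I * t)) 0) :
    ∀ᶠ t : ℝ in 𝓝 0, q (x + Complex.I * t) = 0 := by
  rw [← analyticOrderAt_eq_top, ENat.eq_top_iff_forall_ge]
  exact fun n => (natCast_le_analyticOrderAt_iff_iteratedDeriv_eq_zero ha).2
    fun i _ => iteratedDeriv_eq_zero hS hR x i h

end

section LocalSmooth

variable {D R : ℝ} {f : ℂ → ℂ}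

lemma integral_mul_hlm {P φ : ℂ → ℂ} (hP : ContDiff ℝ ∞ P) (hφ : TF φ) :
    ∫ z, P z * hlm φ z = ∫ z, hlm P z * φ z := by
  have h1 := integral_mul_wd hP (hφ.wd (-Complex.I)) Complex.I
  have h2 := integral_mul_wd (contDiff_wd hP Complex.I) hφ (-Complex.I)
  have c2 := contDiff_wd (contDiff_wd hP (-Complex.I)) Complex.I
  have hc : ∀ z, wd (-Complex.I) (wd Complex.I P) z = wd Complex.I (wd (-Complex.I) P) z :=
    fun z => wd_comm (hP.contDiffAt.of_le (by norm_cast)) _ _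
  have h3 : ∫ z, P z * wd Complex.I (wd (-Complex.I) φ) z =
      ∫ z, wd Complex.I (wd (-Complex.I) P) z * φ z := by
    rw [h1, h2, neg_neg]; simp_rw [hc]
  have i0 : Integrable fun z => P z * φ z := (hφ.smooth_mul hP).integrable
  have i1 : Integrable fun z => P z * wd Complex.I (wd (-Complex.I) φ) z :=
    (((hφ.wd _).wd _).smooth_mul hP).integrable
  have i2 : Integrable fun z => wd Complex.I (wd (-Complex.I) P) z * φ z :=
    (hφ.smooth_mul c2).integrable
  have e1 : (fun z => P z * hlm φ z) =
      fun z => -4 * (P z * wd Complex.I (wd (-Complex.I) φ) z) - 4 * (P z * φ z) :=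
    funext fun z => by rw [hlm]; ring
  have e2 : (fun z => hlm P z * φ z) =
      fun z => -4 * (wd Complex.I (wd (-Complex.I) P) z * φ z) - 4 * (P z * φ z) :=
    funext fun z => by rw [hlm]; ring
  rw [e1, e2, integral_sub (i1.const_mul (-4)) (i0.const_mul 4),
    integral_sub (i2.const_mul (-4)) (i0.const_mul 4), integral_const_mul, integral_const_mul,
    integral_const_mul, h3]

lemma contDiffOn_grn : ContDiffOn ℝ ∞ grn {0}ᶜ := by
  unfold grn
  refine contDiffOn_Efun.comp (f := fun x : ℂ => ((‖x‖ ^ 2 : ℝ) : ℂ)) ?_ fun x hx => ?_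
  · exact (Complex.ofRealCLM.contDiff.comp (contDiff_norm_sq ℝ)).contDiffOn
  · have : 0 < ‖x‖ := norm_pos_iff.2 hx
    exact ofReal_mem_slitPlane (by positivity)

/-- Away from its source, an outgoing potential is a smooth solution. -/
lemma exists_smooth_pot (hf : Src D R f) {x₀ : ℂ} {r : ℝ} (hr : 0 < r)
    (h : ∀ z ∈ Metric.ball x₀ r, f z = 0) : ∃ P : ℂ → ℂ, ContDiff ℝ ∞ P ∧
    (∀ x ∈ Metric.ball x₀ (r / 2), pot f x = P x) ∧
    ∀ x ∈ Metric.ball x₀ (r / 2), hlm P x = 0 := by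
  set M := ‖x₀‖ + r + max R 0 with hM
  obtain ⟨χ₁, hχ₁, h1, h1s⟩ := exists_cutoff 0 (show 0 < r / 4 by positivity)
    (show r / 4 < r / 2 by linarith)
  have hM0 : 0 < M := by positivity
  obtain ⟨χ₂, hχ₂, h2, -⟩ := exists_cutoff 0 hM0 (lt_add_one M)
  have hsm : ContDiff ℝ ∞ fun z => (1 - χ₁ z) * grn z := by
    rw [contDiff_iff_contDiffAt]
    intro z
    rcases eq_or_ne z 0 with rfl | hz
    · have : (fun z => (1 - χ₁ z) * grn z) =ᶠ[𝓝 0] fun _ => 0 := by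
        filter_upwards [Metric.closedBall_mem_nhds (0 : ℂ) (show 0 < r / 4 by positivity)] with z hz
        rw [h1 z hz]; simp
      exact contDiffAt_const.congr_of_eventuallyEq this
    · exact (contDiffAt_const.sub hχ₁.smooth.contDiffAt).mul
        (contDiffOn_grn.contDiffAt (isOpen_compl_singleton.mem_nhds hz))
  have hK : TF fun z => (1 - χ₁ z) * grn z * χ₂ z := hχ₂.smooth_mul hsm
  have hP := contDiff_cnv hf.locallyIntegrable hK
  have heq : ∀ x ∈ Metric.ball x₀ (r / 2), pot f x = cnv f (fun z => (1 - χ₁ z) * grn z * χ₂ z) x := by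
    intro x hx
    rw [pot, cnv]
    refine integral_congr_ae (Eventually.of_forall fun z => ?_)
    simp only
    by_cases hz : f z = 0
    · simp [hz]
    have hzR : ‖z‖ ≤ R := by
      by_contra h'
      exact hz (hf.supp z (not_le.1 h'))
    have hzx : r ≤ ‖z - x₀‖ := by
      by_contra h'
      exact hz (h z (by rw [mem_ball_iff_norm]; exact not_le.1 h'))
    have hx' := mem_ball_iff_norm.1 hx
    have d1 : r / 2 < ‖x - z‖ := by
      have := norm_sub_le (x - x₀) (x - z)
      rw [show x - x₀ - (x - z) = z - x₀ by ring] at this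
      linarith
    have d2 : ‖x - z‖ ≤ M := by
      have e1 := norm_sub_le x z
      have e2 := norm_add_le (x - x₀) x₀
      rw [sub_add_cancel] at e2
      have := le_max_left R 0
      linarith
    have e1 : χ₁ (x - z) = 0 := by
      refine image_eq_zero_of_notMem_tsupport ?_
      rw [h1s, mem_closedBall_zero_iff, not_le]; exact d1
    rw [e1, h2 _ (mem_closedBall_zero_iff.2 d2)]
    ring
  refine ⟨_, hP, heq, ?_⟩
  set P := cnv f (fun z => (1 - χ₁ z) * grn z * χ₂ z)
  have hcont : Continuous (hlm P) := by
    have := (contDiff_wd (contDiff_wd hP (-Complex.I)) Complex.I).continuous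
    unfold hlm
    exact (continuous_const.mul this).neg.sub (continuous_const.mul hP.continuous)
  have hae : ∀ᵐ x, x ∈ Metric.ball x₀ (r / 2) → hlm P x = 0 := by
    refine Metric.isOpen_ball.ae_eq_zero_of_integral_contDiff_smul_eq_zero
      (hcont.locallyIntegrable.locallyIntegrableOn _) fun φ hφ hc hs => ?_
    have hφ' : TF fun z => ((φ z : ℝ) : ℂ) :=
      ⟨Complex.ofRealCLM.contDiff.comp hφ, hc.comp_left (g := fun x : ℝ => (x : ℂ)) (by simp)⟩
    have hs' : tsupport (fun z => ((φ z : ℝ) : ℂ)) ⊆ Metric.ball x₀ (r / 2) := by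
      refine subset_trans (closure_mono fun z hz => ?_) hs
      simpa using hz
    have e1 := integral_mul_hlm hP hφ'
    have e2 := integral_hlm_mul_pot hf hφ'
    have e3 : ∫ z, P z * hlm (fun z => ((φ z : ℝ) : ℂ)) z =
        ∫ z, hlm (fun z => ((φ z : ℝ) : ℂ)) z * pot f z := by
      refine integral_congr_ae (Eventually.of_forall fun z => ?_)
      simp only
      by_cases hz : z ∈ tsupport (fun z => ((φ z : ℝ) : ℂ))
      · rw [heq z (hs' hz), mul_comm]
      · rw [hlm_eq_zero_of_notMem hz]; simp
    have e4 : ∫ z, f z * ((φ z : ℝ) : ℂ) = 0 := by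
      refine integral_eq_zero_of_ae (Eventually.of_forall fun z => ?_)
      simp only [Pi.zero_apply]
      by_cases hz : z ∈ tsupport (fun z => ((φ z : ℝ) : ℂ))
      · rw [h z (Metric.ball_subset_ball (by linarith) (hs' hz)), zero_mul]
      · rw [image_eq_zero_of_notMem_tsupport hz, mul_zero]
    rw [e3, e2, e4] at e1
    simpa only [Complex.real_smul, mul_comm] using e1.symm
  have := Measure.eqOn_open_of_ae_eq (μ := volume) (f := hlm P) (g := fun _ => 0)
    ((ae_restrict_iff' Metric.isOpen_ball.measurableSet).2 hae) Metric.isOpen_ball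
    hcont.continuousOn continuousOn_const
  exact fun x hx => this hx

end LocalSmooth

end GKL

namespace GKL

open Filter Topology ComplexConjugate
open scoped ENNReal NNReal ContDiff

section

variable {D R η : ℝ} {f g : ℂ → ℂ}

lemma integral_comp_isometry (A : ℂ ≃ₗᵢ[ℝ] ℂ) (b : ℂ) (h : ℂ → ℂ) :
    ∫ w, h (b + A w) = ∫ z, h z :=
  ((measurePreserving_add_left volume b).comp A.measurePreserving).integral_comp
    ((MeasurableEquiv.addLeft b).measurableEmbedding.comp A.toHomeomorph.measurableEmbedding) h

lemma pot_isometry (A : ℂ ≃ₗᵢ[ℝ] ℂ) (b : ℂ) (f : ℂ → ℂ) (t : ℂ) :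
    pot f (b + A t) = pot (fun w => f (b + A w)) t := by
  rw [pot, pot, ← integral_comp_isometry A b]
  refine integral_congr_ae (Eventually.of_forall fun w => ?_)
  simp only
  rw [add_sub_add_left_eq_sub, ← map_sub, grn, grn, A.norm_map]

lemma Src.comp_isometry (hf : Src D R f) (A : ℂ ≃ₗᵢ[ℝ] ℂ) (b : ℂ) :
    Src D (R + ‖b‖) fun w => f (b + A w) := by
  refine ⟨hf.meas.comp ((A.continuous.const_add b).measurable), fun z => hf.bdd _, fun z hz => ?_⟩
  refine hf.supp _ ?_
  have := norm_sub_le (b + A z) b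
  rw [add_sub_cancel_left, A.norm_map] at this
  linarith

/-- Multiplication by the imaginary unit. -/
def mulI : ℂ ≃ₗᵢ[ℝ] ℂ := rotation ⟨Complex.I, by simp [Submonoid.unitSphere]⟩

lemma mulI_apply (z : ℂ) : mulI z = Complex.I * z := rfl

lemma differentiableOn_lpot_ball (hf : Src D R f) (hη : ∀ z, ‖z‖ < η → f z = 0) :
    DifferentiableOn ℂ (lpot f) (Metric.ball 0 (η / 3)) := by
  refine differentiableOn_lpot_of_slitPlane hf Metric.isOpen_ball
    (K := Metric.closedBall 0 R ∩ {z | η ≤ ‖z‖}) ((isCompact_closedBall 0 R).inter_right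
      (isClosed_le continuous_const continuous_norm)) (fun z hz => ?_) fun t ht z hz => ?_
  · by_contra h
    refine hz ⟨mem_closedBall_zero_iff.2 ?_, ?_⟩
    · by_contra h'; exact h (hf.supp z (not_le.1 h'))
    · rw [mem_ofPred_eq]; by_contra h'; exact h (hη z (not_le.1 h'))
  · rw [mem_ball_zero_iff] at ht
    have hz' : η ≤ ‖z‖ := hz.2
    rw [Complex.mem_slitPlane_iff, lx]
    left
    have e1 : ((t - z.re) ^ 2 + (z.im : ℂ) ^ 2).re = (t.re - z.re) ^ 2 - t.im ^ 2 + z.im ^ 2 := by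
      simp [pow_two]
    rw [e1]
    have n1 : ‖z‖ ^ 2 = z.re ^ 2 + z.im ^ 2 := by
      rw [← Complex.normSq_eq_norm_sq, Complex.normSq_apply]; ring
    have n2 : ‖t‖ ^ 2 = t.re ^ 2 + t.im ^ 2 := by
      rw [← Complex.normSq_eq_norm_sq, Complex.normSq_apply]; ring
    have h1 : t.re * z.re ≤ ‖t‖ * ‖z‖ := by
      refine (le_abs_self _).trans ?_
      rw [abs_mul]
      exact mul_le_mul (Complex.abs_re_le_norm t) (Complex.abs_re_le_norm z) (abs_nonneg _)
        (norm_nonneg _)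
    have h2 : 3 * ‖t‖ < ‖z‖ := by linarith
    nlinarith [norm_nonneg t, norm_nonneg z, sq_nonneg t.re]

lemma analyticAt_ofReal_lpot {U : Set ℂ} (hU : IsOpen U) (h : DifferentiableOn ℂ (lpot f) U)
    {x : ℝ} (hx : (x : ℂ) ∈ U) : AnalyticAt ℝ (fun t : ℝ => lpot f t) x := by
  have h1 : AnalyticAt ℝ (lpot f) (Complex.ofRealCLM x) :=
    (h.analyticAt (hU.mem_nhds hx)).restrictScalars
  exact h1.comp (f := Complex.ofRealCLM) (Complex.ofRealCLM.analyticAt x)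

lemma isOpen_strip (η : ℝ) : IsOpen {z : ℂ | |z.im| < η} :=
  isOpen_lt (continuous_abs.comp Complex.continuous_im) continuous_const

/-- An even potential which vanishes on the real axis has zero Cauchy data there. -/
lemma cauchy0_pot (hg : Src D R g) (h0 : 0 < η) (hη : ∀ z, |z.im| < η → g z = 0)
    (heven : ∀ z, pot g (conj z) = pot g z) (hz : ∀ x : ℝ, pot g x = 0) :
    Cauchy0 {z : ℂ | |z.im| < η} (pot g) := by
  have key : ∀ z₀ : ℂ, |z₀.im| < η → ∃ P : ℂ → ℂ, ContDiff ℝ ∞ P ∧ pot g =ᶠ[𝓝 z₀] P ∧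
      hlm P z₀ = 0 := by
    intro z₀ hz₀
    have hr : 0 < η - |z₀.im| := sub_pos.2 hz₀
    obtain ⟨P, h1, h2, h3⟩ := exists_smooth_pot hg hr (x₀ := z₀) fun z hz => by
      refine hη z ?_
      have e1 := (Complex.abs_im_le_norm (z - z₀)).trans_lt (mem_ball_iff_norm.1 hz)
      rw [Complex.sub_im] at e1
      have := abs_sub_abs_le_abs_sub z.im z₀.im
      linarith
    have hb := Metric.ball_mem_nhds z₀ (half_pos hr)
    exact ⟨P, h1, by filter_upwards [hb] with z hz using h2 z hz,
      h3 z₀ (Metric.mem_ball_self (half_pos hr))⟩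
  have hda : ∀ z₀ : ℂ, |z₀.im| < η → ContDiffAt ℝ ∞ (pot g) z₀ := fun z₀ hz₀ => by
    obtain ⟨P, h1, h2, -⟩ := key z₀ hz₀
    exact h1.contDiffAt.congr_of_eventuallyEq h2
  refine ⟨fun z hz => (hda z hz).contDiffWithinAt, fun z hz => ?_, hz, fun x => ?_⟩
  · obtain ⟨P, h1, h2, h3⟩ := key z hz
    rw [← hlm_congr h2, hlm_eq_dv ((hda z hz).of_le (by norm_cast))] at h3
    linear_combination -h3
  · have hd : DifferentiableAt ℝ (pot g) x :=
      (hda x (by simpa using h0)).differentiableAt (by simp)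
    have hd1 : HasFDerivAt (pot g) (fderiv ℝ (pot g) x) (conj (x : ℂ)) := by
      rw [Complex.conj_ofReal]; exact hd.hasFDerivAt
    have h2 : HasFDerivAt (pot g) ((fderiv ℝ (pot g) x).comp
        (Complex.conjCLE : ℂ →L[ℝ] ℂ)) (x : ℂ) := by
      have := hd1.comp (x : ℂ) (f := Complex.conjCLE) Complex.conjCLE.hasFDerivAt
      refine this.congr_of_eventuallyEq (Eventually.of_forall fun z => ?_)
      exact (heven z).symm
    have h3 := congrArg (fun L : ℂ →L[ℝ] ℂ => L Complex.I) (h2.unique hd.hasFDerivAt)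
    simp at h3
    rw [dv]
    linear_combination (-1 / 2 : ℂ) * h3

lemma pot_eq_zero_near_line (hg : Src D R g) (h0 : 0 < η) (hη : ∀ z, |z.im| < η → g z = 0)
    (heven : ∀ z, pot g (conj z) = pot g z) (hz : ∀ x : ℝ, pot g x = 0) {z : ℂ}
    (hzη : |z.im| < η / 3) : pot g z = 0 := by
  have hC := cauchy0_pot hg h0 hη heven hz
  have hR : ∀ x : ℝ, (x : ℂ) ∈ {z : ℂ | |z.im| < η} := fun x => by
    rw [mem_ofPred_eq]; simpa using h0
  have hs := hg.comp_isometry mulI z.re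
  have hb : ∀ w : ℂ, ‖w‖ < η → g (z.re + mulI w) = 0 := fun w hw => by
    refine hη _ ?_
    rw [mulI_apply]
    simpa using (Complex.abs_re_le_norm w).trans_lt hw
  have hd := differentiableOn_lpot_ball hs hb
  have e : ∀ t : ℝ, pot (fun w => g (z.re + mulI w)) t = pot g (z.re + Complex.I * t) := fun t =>
    (pot_isometry mulI z.re g t).symm
  have h03 : ((0 : ℝ) : ℂ) ∈ Metric.ball (0 : ℂ) (η / 3) := by
    simpa using (by positivity : 0 < η / 3)
  have ha := analyticAt_ofReal_lpot Metric.isOpen_ball hd h03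
  simp_rw [lpot_ofReal, e] at ha
  have hev := hC.eventually_eq_zero (isOpen_strip η) hR ha
  have := pot_eq_zero_of_eventually_of_isPreconnected Metric.isOpen_ball
    (convex_ball (0 : ℂ) (η / 3)).isPreconnected hd h03 (by simpa only [e] using hev)
    (x := z.im) (by simpa using hzη)
  rw [e, mul_comm, Complex.re_add_im] at this
  exact this

lemma pot_eq_zero_far_of_even (hg : Src D R g) (h0 : 0 < η) (hη : ∀ z, |z.im| < η → g z = 0)
    (heven : ∀ z, pot g (conj z) = pot g z) (hz : ∀ x : ℝ, pot g x = 0) {z : ℂ}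
    (hzR : 2 * R < ‖z‖) : pot g z = 0 := by
  have hv : ∀ x : ℝ, R < |x| → ∀ t : ℝ, pot g (x + Complex.I * t) = 0 := by
    intro x hx t
    have e : ∀ t : ℝ, pot (fun w => g (x + mulI w)) t = pot g (x + Complex.I * t) := fun t =>
      (pot_isometry mulI x g t).symm
    rw [← e]
    refine pot_eq_zero_of_eventually (η := |x| - R) (x₀ := 0) (hg.comp_isometry mulI x) (by linarith)
      (fun w hw => hg.supp _ ?_) ?_ t
    · refine lt_of_lt_of_le ?_ (Complex.abs_re_le_norm _)
      rw [mulI_apply]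
      simp only [Complex.add_re, Complex.ofReal_re, Complex.mul_re, Complex.I_re, zero_mul,
        Complex.I_im, one_mul, zero_sub, ← sub_eq_add_neg]
      have := abs_sub_abs_le_abs_sub x w.im
      linarith
    · filter_upwards [Metric.ball_mem_nhds (0 : ℝ) (show 0 < η / 3 by positivity)] with t ht
      rw [e]
      refine pot_eq_zero_near_line hg h0 hη heven hz ?_
      rw [mem_ball_zero_iff] at ht
      simpa using ht
  rcases le_or_gt |z.re| R with h1 | h1
  · have h2 : R < |z.im| := by
      have := Complex.norm_le_abs_re_add_abs_im z
      linarith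
    have e : ∀ s : ℝ, pot (fun w => g (Complex.I * z.im + LinearIsometryEquiv.refl ℝ ℂ w)) s =
        pot g (Complex.I * z.im + s) := fun s => (pot_isometry _ _ g s).symm
    have := pot_eq_zero_of_eventually (η := |z.im| - R) (x₀ := R + 1)
      (hg.comp_isometry (LinearIsometryEquiv.refl ℝ ℂ) (Complex.I * z.im)) (by linarith)
      (fun w hw => hg.supp _ ?_) ?_ z.re
    · rw [e, mul_comm, add_comm, Complex.re_add_im] at this
      exact this
    · refine lt_of_lt_of_le ?_ (Complex.abs_im_le_norm _)
      simp only [LinearIsometryEquiv.coe_refl, id, Complex.add_im, Complex.mul_im, Complex.I_re,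
        zero_mul, Complex.I_im, one_mul, Complex.ofReal_re, zero_add]
      have := abs_sub_abs_le_abs_sub z.im (-w.im)
      rw [abs_neg, sub_neg_eq_add] at this
      linarith
    · filter_upwards [lt_mem_nhds (lt_add_one R)] with s hs
      rw [e, add_comm]
      exact hv s (hs.trans_le (le_abs_self s)) _
  · have := hv z.re h1 z.im
    rwa [mul_comm, Complex.re_add_im] at this

/-- If the outgoing potential of a source in the upper half plane vanishes on the real axis, it
vanishes outside a bounded set. -/
theorem pot_eq_zero_far (hf : Src D R f) (h0 : 0 < η)
    (hη : ∀ z, z.im < η → f z = 0) (hz : ∀ x : ℝ, pot f x = 0) {x : ℂ}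
    (hx : 2 * R < ‖x‖) : pot f x = 0 := by
  have hpc : ∀ (h : ℂ → ℂ) z, pot h (conj z) = pot (fun w => h (conj w)) z := fun h z => by
    simpa using pot_isometry Complex.conjLIE 0 h z
  have hfc : Src D R fun w => f (conj w) := by simpa using hf.comp_isometry Complex.conjLIE 0
  set g : ℂ → ℂ := fun z => f z + f (conj z) with hgdef
  have hg : Src (D + D) R g := hf.add hfc
  have hgη : ∀ z, |z.im| < η → g z = 0 := fun z hz => by
    have := abs_lt.1 hz
    simp only [hgdef]
    rw [hη z this.2, hη (conj z) (by rw [Complex.conj_im]; linarith), add_zero]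
  have heven : ∀ z, pot g (conj z) = pot g z := fun z => by
    rw [hpc]
    congr 1
    funext w
    simp only [hgdef, Complex.conj_conj, add_comm]
  have hg0 : ∀ x : ℝ, pot g x = 0 := fun x => by
    rw [hgdef, hf.pot_add hfc, ← hpc, Complex.conj_ofReal, hz, add_zero]
  set χ : ℂ → ℂ := fun z => ((Real.smoothTransition (6 / η * z.im) : ℝ) : ℂ) with hχ
  have hχs : ContDiff ℝ ∞ χ := by
    refine Complex.ofRealCLM.contDiff.comp (Real.smoothTransition.contDiff.comp ?_)
    exact contDiff_const.mul Complex.imCLM.contDiff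
  have χ1 : ∀ z : ℂ, η / 6 ≤ z.im → χ z = 1 := fun z hz => by
    simp only [hχ]
    rw [Real.smoothTransition.one_of_one_le, Complex.ofReal_one]
    rw [div_mul_eq_mul_div, le_div_iff₀ h0]; linarith
  have χ0 : ∀ z : ℂ, z.im ≤ 0 → χ z = 0 := fun z hz => by
    simp only [hχ]
    rw [Real.smoothTransition.zero_of_nonpos, Complex.ofReal_zero]
    exact mul_nonpos_of_nonneg_of_nonpos (by positivity) hz
  obtain ⟨C, hC, hCb⟩ := norm_pot_le (2 * R) R
  have hk : Src (C * (D + D)) (2 * R) fun z => χ z * pot g z := by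
    refine ⟨hχs.continuous.measurable.mul (measurable_pot hg.meas), fun z => ?_, fun z hz => ?_⟩
    · rcases le_or_gt ‖z‖ (2 * R) with h | h
      · rw [norm_mul, ← one_mul (C * (D + D))]
        refine mul_le_mul ?_ (hCb _ _ hg z h) (norm_nonneg _) zero_le_one
        simp only [hχ, Complex.norm_real, Real.norm_eq_abs]
        rw [abs_of_nonneg (Real.smoothTransition.nonneg _)]
        exact Real.smoothTransition.le_one _
      · rw [pot_eq_zero_far_of_even hg h0 hgη heven hg0 h, mul_zero, norm_zero]
        exact mul_nonneg hC hg.nonneg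
    · rw [pot_eq_zero_far_of_even hg h0 hgη heven hg0 hz, mul_zero]
  have hae : (fun z => χ z * pot g z) =ᵐ[volume] pot f := by
    refine ae_eq_pot_of_weak hk hf fun φ hφ => ?_
    have e1 : (fun z => χ z * pot g z * hlm φ z) = fun z => hlm (fun w => χ w * φ w) z * pot g z := by
      funext z
      rcases lt_or_ge |z.im| (η / 3) with h | h
      · rw [pot_eq_zero_near_line hg h0 hgη heven hg0 h]; simp
      rcases le_abs'.1 h with h | h
      · have hn : (fun w => χ w * φ w) =ᶠ[𝓝 z] fun _ => 0 := by
          filter_upwards [(isOpen_lt Complex.continuous_im continuous_const).mem_nhds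
            (show z.im < 0 by linarith)] with w hw
          rw [χ0 w (le_of_lt hw), zero_mul]
        have hn' : z ∉ tsupport fun w => χ w * φ w := by
          rw [notMem_tsupport_iff_eventuallyEq]; exact hn
        rw [hlm_eq_zero_of_notMem hn', χ0 z (by linarith)]; simp
      · have hn : (fun w => χ w * φ w) =ᶠ[𝓝 z] φ := by
          filter_upwards [(isOpen_lt continuous_const Complex.continuous_im).mem_nhds
            (show η / 6 < z.im by linarith)] with w hw
          rw [χ1 w (le_of_lt hw), one_mul]
        rw [hlm_congr hn, χ1 z (by linarith)]; ring
    rw [e1, integral_hlm_mul_pot hg (hφ.smooth_mul hχs)]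
    refine integral_congr_ae (Eventually.of_forall fun z => ?_)
    simp only [hgdef]
    rcases lt_or_ge z.im η with h | h
    · rcases le_or_gt z.im 0 with h' | h'
      · rw [χ0 z h', hη z h]; ring
      · rw [hη z h, hη (conj z) (by rw [Complex.conj_im]; linarith)]; ring
    · rw [χ1 z (by linarith), hη (conj z) (by rw [Complex.conj_im]; linarith)]; ring
  have hU : IsOpen {z : ℂ | 2 * R < ‖z‖} := isOpen_lt continuous_const continuous_norm
  have h1 : (fun _ => (0 : ℂ)) =ᵐ[volume.restrict {z : ℂ | 2 * R < ‖z‖}] pot f := by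
    filter_upwards [ae_restrict_of_ae hae, ae_restrict_mem hU.measurableSet] with z h1 h2
    rw [← h1, hk.supp z h2]
  exact (Measure.eqOn_open_of_ae_eq h1 hU continuousOn_const hf.continuous_pot.continuousOn hx).symm

end

end GKL

namespace GKL

open Filter Topology ComplexConjugate
open scoped ENNReal NNReal ContDiff

section

variable {D D₁ D₂ R η ρ : ℝ} {f u v : ℂ → ℂ}

/-- Bounded weak solutions of `-Δu + vu = 4u` in the ball of radius `ρ`. -/
structure WeakSol (ρ : ℝ) (v u : ℂ → ℂ) : Prop where
  bm : BM u
  eq : ∀ φ, TF φ → tsupport φ ⊆ Metric.ball 0 ρ → ∫ z, u z * hlm φ z = ∫ z, v z * u z * φ z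

lemma BM.indicator_mul {c g : ℂ → ℂ} (hc : Continuous c) (hg : BM g) (ρ : ℝ) :
    BM ((Metric.ball 0 ρ).indicator fun z => c z * g z) := by
  obtain ⟨M, hM⟩ := hg.bdd
  obtain ⟨C, hC⟩ := (isCompact_closedBall (0 : ℂ) ρ).exists_bound_of_continuousOn hc.continuousOn
  refine ⟨(hc.measurable.mul hg.meas).indicator Metric.isOpen_ball.measurableSet,
    C.toNNReal * M, fun z => ?_⟩
  by_cases hz : z ∈ Metric.ball (0 : ℂ) ρ
  · rw [indicator_of_mem hz, enorm_mul]
    push_cast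
    refine mul_le_mul' ?_ (hM z)
    rw [← ofReal_norm]
    exact ENNReal.ofReal_le_ofReal (hC z (Metric.ball_subset_closedBall hz))
  · rw [indicator_of_notMem hz]; simp

lemma integral_indicator_mul {B : Set ℂ} (hB : MeasurableSet B) (w F : ℂ → ℂ) :
    ∫ z, B.indicator w z * F z = ∫ z in B, w z * F z := by
  rw [← integral_indicator hB]
  congr 1
  funext z
  by_cases hz : z ∈ B <;> simp [hz]

lemma IsCGO.weakSol (hv : BM v) {τ : ℝ} {z₀ : ℂ} {r h : ℂ → ℂ}
    (H : IsCGO (Metric.ball 0 ρ) (fun z => -(4 + v z)) τ z₀ r h) :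
    WeakSol ρ v ((Metric.ball 0 ρ).indicator fun z => hol τ z₀ z * (1 + r z)) := by
  have hBm : MeasurableSet (Metric.ball (0 : ℂ) ρ) := Metric.isOpen_ball.measurableSet
  have hB : volume (Metric.ball (0 : ℂ) ρ) ≠ ⊤ := measure_ball_lt_top.ne
  have hw := BM.indicator_mul (contDiff_hol τ z₀).continuous ((BM.const 1).add H.bm_r) ρ
  refine ⟨hw, fun φ hφ hs => ?_⟩
  have hq : BM fun z => -(4 + v z) := by
    simpa using (BM.const (-1)).mul ((BM.const 4).add hv)
  have h1 := H.weak hB hq hφ hs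
  rw [← integral_indicator_mul hBm] at h1
  have e1 : ∫ z in Metric.ball 0 ρ, -(4 + v z) * (hol τ z₀ z * (1 + r z)) * φ z =
      ∫ z, (Metric.ball 0 ρ).indicator (fun z => hol τ z₀ z * (1 + r z)) z * (-(4 + v z) * φ z) := by
    rw [integral_indicator_mul hBm]
    congr 1; funext z; ring
  rw [e1] at h1
  set w := (Metric.ball 0 ρ).indicator fun z => hol τ z₀ z * (1 + r z)
  have hwi : ∀ {g : ℂ → ℂ}, BM g → Integrable fun z => w z * g z := fun {g} hg => by
    have := ((integrable_indicator_iff hBm).2 ((hw.mul hg).integrable hB))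
    refine this.congr (Eventually.of_forall fun z => ?_)
    by_cases hz : z ∈ Metric.ball (0 : ℂ) ρ <;> simp [w, hz]
  have i1 := hwi ((BM.const 4).mul ((hφ.wd (-Complex.I)).wd Complex.I).bm)
  have i2 := hwi ((BM.const 4).mul hφ.bm)
  have i3 := hwi (hv.mul hφ.bm)
  have e2 : (fun z => w z * (-(4 + v z) * φ z)) =
      fun z => -(w z * (4 * φ z)) - w z * (v z * φ z) := funext fun z => by ring
  have e3 : (fun z => w z * hlm φ z) = fun z => -(w z * (4 * wd Complex.I (wd (-Complex.I) φ) z)) -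
      w z * (4 * φ z) := funext fun z => by rw [hlm]; ring
  have e4 : (fun z => v z * w z * φ z) = fun z => w z * (v z * φ z) := funext fun z => by ring
  rw [e2, integral_sub (μ := volume) (f := fun z => -(w z * (4 * φ z))) i2.neg i3,
    integral_neg] at h1
  rw [e3, integral_sub (μ := volume)
    (f := fun z => -(w z * (4 * wd Complex.I (wd (-Complex.I) φ) z))) i1.neg i2, integral_neg, h1, e4]
  ring

lemma hlm_conj {φ : ℂ → ℂ} (hφ : TF φ) (z : ℂ) :
    hlm (fun z => conj (φ z)) z = conj (hlm φ z) := by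
  have h1 : wd (-Complex.I) (fun z => conj (φ z)) = fun z => conj (wd Complex.I φ z) :=
    funext fun z => by rw [wd_comp_conj (hφ.differentiable z)]; simp
  rw [hlm, h1, wd_comp_conj ((hφ.wd _).differentiable z), Complex.conj_I,
    wd_comm (hφ.smooth.contDiffAt.of_le (by norm_cast)), hlm]
  simp [Complex.conj_ofNat]

lemma WeakSol.conj (h : WeakSol ρ (fun z => conj (v z)) u) : WeakSol ρ v fun z => conj (u z) := by
  refine ⟨h.bm.conj, fun φ hφ hs => ?_⟩
  have hs' : tsupport (fun z => starRingEnd ℂ (φ z)) ⊆ Metric.ball 0 ρ := by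
    refine subset_trans (closure_mono fun z hz => ?_) hs
    simpa using hz
  have h1 := congrArg (starRingEnd ℂ) (h.eq _ hφ.star hs')
  rw [← integral_conj, ← integral_conj] at h1
  simpa [hlm_conj hφ] using h1

lemma WeakSol.integral_mul_eq (hu : WeakSol ρ v u) (hv : BM v) (hf : Src D R f) (hR : 0 ≤ R)
    (h0 : 0 < η) (hη : ∀ z, z.im < η → f z = 0) {a b : ℝ} (hab : a < b)
    (him : ∀ x ∈ Ioo a b, (pot f (x : ℝ)).im = 0) (hρ : 2 * R + 1 < ρ) :
    ∫ z, u z * f z = ∫ z, v z * u z * pot f z :=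
  have h1 := pot_eq_zero_of_im hf hR h0 (fun z hz => hη z (abs_lt.1 hz).2) hab him
  integral_mul_eq_of_pot_eq_zero hf (fun _ hx => pot_eq_zero_far hf h0 hη h1 hx) hu.bm hv hρ hu.eq

lemma Src.sub {g : ℂ → ℂ} (hf : Src D₁ R f) (hg : Src D₂ R g) :
    Src (D₁ + D₂) R fun z => f z - g z :=
  ⟨hf.meas.sub hg.meas, fun z => (norm_sub_le _ _).trans (add_le_add (hf.bdd z) (hg.bdd z)),
    fun z hz => by rw [hf.supp z hz, hg.supp z hz, sub_zero]⟩

lemma Src.pot_sub {g : ℂ → ℂ} (hf : Src D₁ R f) (hg : Src D₂ R g) (x : ℂ) :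
    pot (fun z => f z - g z) x = pot f x - pot g x := by
  simp only [pot]
  rw [← integral_sub (hf.integrable_grn x) (hg.integrable_grn x)]
  congr 1; funext z; ring

lemma BM.locallyIntegrable (hu : BM u) : LocallyIntegrable u := by
  rw [locallyIntegrable_iff]
  exact fun K hK => hu.integrable hK.measure_lt_top.ne

lemma Src.mul_bm (hf : Src D R f) (hu : BM u) : ∃ D', Src D' R fun z => f z * u z := by
  obtain ⟨C, hC⟩ := hu.bdd
  refine ⟨_, hf.mul_bdd (D' := C) hu.meas (fun z _ => ?_) C.coe_nonneg⟩
  have := hC z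
  rwa [enorm_eq_nnnorm, ENNReal.coe_le_coe] at this

lemma Src.mul_continuous {p : ℂ → ℂ} (hf : Src D R f) (hp : Continuous p) :
    ∃ D', Src D' R fun z => f z * p z := by
  obtain ⟨C, hC⟩ := (isCompact_closedBall (0 : ℂ) R).exists_bound_of_continuousOn hp.continuousOn
  exact ⟨_, hf.mul_bdd (D' := max C 0) hp.measurable
    (fun z hz => (hC z (mem_closedBall_zero_iff.2 hz)).trans (le_max_left _ _)) (le_max_right _ _)⟩

/-- `f = vR(·,y)` for the outgoing Green function `R` of `v`. -/
structure GreenSrc (R : ℝ) (v : ℂ → ℂ) (y : ℂ) (f : ℂ → ℂ) : Prop where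
  src : ∃ D, Src D R f
  eq : ∀ x, f x = v x * (pot f x - grn (x - y))

/-- Unique solvability of the homogeneous integral equation. -/
def PotInj (R : ℝ) (v : ℂ → ℂ) : Prop :=
  ∀ p : ℂ → ℂ, Continuous p → (∀ x, p x = pot (fun z => v z * p z) x) → ∀ x, ‖x‖ ≤ R → p x = 0

variable {v₁ v₂ : ℂ → ℂ} {a b : ℝ}

lemma integral_sub_mul_green (hv₁ : Src D₁ R v₁) (hv₂ : Src D₂ R v₂) (hR : 0 ≤ R) (h0 : 0 < η)
    (hη₁ : ∀ z, z.im < η → v₁ z = 0) (hη₂ : ∀ z, z.im < η → v₂ z = 0) {y : ℂ}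
    {f₁ f₂ : ℂ → ℂ} (hf₁ : GreenSrc R v₁ y f₁) (hf₂ : GreenSrc R v₂ y f₂) (hab : a < b)
    (him : ∀ x ∈ Ioo a b, (pot f₁ (x : ℝ)).im = (pot f₂ (x : ℝ)).im) (hρ : 2 * R + 1 < ρ)
    (hu : WeakSol ρ v₂ u) :
    ∫ z, (v₁ z - v₂ z) * u z * pot f₁ z = pot (fun z => (v₁ z - v₂ z) * u z) y := by
  obtain ⟨E₁, h₁⟩ := hf₁.src
  obtain ⟨E₂, h₂⟩ := hf₂.src
  have hF := h₁.sub h₂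
  have h := hu.integral_mul_eq hv₂.bm hF hR h0 (fun z hz => by
    rw [hf₁.eq, hf₂.eq, hη₁ z hz, hη₂ z hz]; ring) hab (fun x hx => by
    rw [h₁.pot_sub h₂, Complex.sub_im, him x hx, sub_self]) hρ
  obtain ⟨D', hW⟩ := (hv₁.sub hv₂).mul_bm hu.bm
  obtain ⟨E, hWp⟩ := hW.mul_continuous h₁.continuous_pot
  have iW : Integrable fun z => (v₁ z - v₂ z) * u z * pot f₁ z := by
    simpa using hWp.integrable_mul (g := fun _ => 1) continuous_const.locallyIntegrable
  have iG := hW.integrable_grn y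
  obtain ⟨E', hvu⟩ := hv₂.mul_bm hu.bm
  obtain ⟨E'', hvuF⟩ := hvu.mul_continuous hF.continuous_pot
  have i1 : Integrable fun z => u z * (f₁ z - f₂ z) := hF.integrable_mul hu.bm.locallyIntegrable
  have i2 : Integrable fun z => v₂ z * u z * pot (fun z => f₁ z - f₂ z) z := by
    simpa using hvuF.integrable_mul (g := fun _ => 1) continuous_const.locallyIntegrable
  rw [pot, ← sub_eq_zero, ← integral_sub iW iG]
  rw [← sub_eq_zero, ← integral_sub i1 i2] at h
  rw [← h]
  congr 1
  funext z
  rw [h₁.pot_sub h₂, grn_sub_comm y z]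
  have e1 := hf₁.eq z
  have e2 := hf₂.eq z
  linear_combination u z * (-e1 + e2)

/-- Uniqueness in normalised position, in terms of potentials. -/
theorem ae_eq_of_green (hv₁ : Src D₁ R v₁) (hv₂ : Src D₂ R v₂) (hR : 0 ≤ R) (h0 : 0 < η)
    (hη₁ : ∀ z, z.im < η → v₁ z = 0) (hη₂ : ∀ z, z.im < η → v₂ z = 0) (hab : a < b)
    (hinj : PotInj R v₁) (f₁ f₂ : ℝ → ℂ → ℂ)
    (hf₁ : ∀ y ∈ Ioo a b, GreenSrc R v₁ y (f₁ y)) (hf₂ : ∀ y ∈ Ioo a b, GreenSrc R v₂ y (f₂ y))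
    (him : ∀ y ∈ Ioo a b, ∀ x ∈ Ioo y b, (pot (f₁ y) (x : ℝ)).im = (pot (f₂ y) (x : ℝ)).im) :
    v₁ =ᵐ[volume] v₂ := by
  set ρ := 2 * R + 2 with hρd
  have hρ : 2 * R + 1 < ρ := by linarith
  have hBm : MeasurableSet (Metric.ball (0 : ℂ) ρ) := Metric.isOpen_ball.measurableSet
  have hB : volume (Metric.ball (0 : ℂ) ρ) ≠ ⊤ := measure_ball_lt_top.ne
  have hq : ∀ {v : ℂ → ℂ}, BM v → BM fun z => -(4 + v z) := fun hv => by
    simpa using (BM.const (-1)).mul ((BM.const 4).add hv)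
  have hsub := hv₁.sub hv₂
  have key := ae_eq_zero_of_orthogonal_cgo hBm hB hsub.bm (hq hv₁.bm) (hq hv₂.bm) ?_
  · rw [ae_restrict_iff' hBm] at key
    filter_upwards [key] with z hz
    by_cases hzB : z ∈ Metric.ball (0 : ℂ) ρ
    · exact sub_eq_zero.1 (hz hzB)
    · rw [mem_ball_zero_iff, not_lt] at hzB
      rw [hv₁.supp z (by linarith), hv₂.supp z (by linarith)]
  intro τ z₀ r₁ h₁ r₂ h₂ H₁ H₂
  have hu₁ := H₁.weakSol hv₁.bm
  simp only [map_neg, map_add, Complex.conj_ofNat] at H₂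
  have hu₂ := (H₂.weakSol hv₂.bm.conj).conj
  set u₁ := (Metric.ball 0 ρ).indicator fun z => hol τ z₀ z * (1 + r₁ z) with hu₁d
  set u₂ := fun z => conj ((Metric.ball 0 ρ).indicator
    (fun z => hol (-τ) z₀ z * (1 + r₂ z)) z) with hu₂d
  obtain ⟨DW, hW⟩ := hsub.mul_bm hu₂.bm
  obtain ⟨p, hpc, hp⟩ := exists_pot_solution hv₁ hW hinj
  obtain ⟨E, hvp⟩ := hv₁.mul_continuous hpc
  have hF := hW.add hvp
  have hp' : ∀ x, p x = pot (fun z => (v₁ z - v₂ z) * u₂ z) x + pot (fun z => v₁ z * p z) x :=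
    fun x => by rw [← hW.pot_add hvp, ← hp]
  have hpy : ∀ y ∈ Ioo a b, p (y : ℝ) = 0 := by
    intro y hy
    obtain ⟨E₁, hs⟩ := (hf₁ y hy).src
    have e1 := integral_sub_mul_green hv₁ hv₂ hR h0 hη₁ hη₂ (hf₁ y hy) (hf₂ y hy) hy.2
      (him y hy) hρ hu₂
    rw [integral_mul_pot hs hW] at e1
    have e2 : (fun z => f₁ y z * pot (fun z => (v₁ z - v₂ z) * u₂ z) z) =
        fun z => p z * f₁ y z - f₁ y z * pot (fun z => v₁ z * p z) z := by
      funext z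
      linear_combination -f₁ y z * hp' z
    obtain ⟨E₂, hs2⟩ := hs.mul_continuous hvp.continuous_pot
    have i1 : Integrable fun z => p z * f₁ y z := hs.integrable_mul hpc.locallyIntegrable
    have i2 : Integrable fun z => f₁ y z * pot (fun z => v₁ z * p z) z := by
      simpa using hs2.integrable_mul (g := fun _ => 1) continuous_const.locallyIntegrable
    obtain ⟨E₃, hs3⟩ := hvp.mul_continuous hs.continuous_pot
    have i3 : Integrable fun z => v₁ z * p z * pot (f₁ y) z := by
      simpa using hs3.integrable_mul (g := fun _ => 1) continuous_const.locallyIntegrable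
    rw [e2, integral_sub i1 i2, integral_mul_pot hvp hs, ← integral_sub i1 i3] at e1
    have i4 : Integrable fun z => p z * f₁ y z - v₁ z * p z * pot (f₁ y) z := i1.sub i3
    rw [hp', ← e1, pot, ← integral_add i4 (hvp.integrable_grn y)]
    refine integral_eq_zero_of_ae (Eventually.of_forall fun z => ?_)
    simp only [Pi.zero_apply]
    rw [grn_sub_comm]
    linear_combination p z * (hf₁ y hy).eq z
  have e3 := hu₁.integral_mul_eq hv₁.bm hF hR h0 (fun z hz => by
    rw [hη₁ z hz, hη₂ z hz]; ring) hab (fun x hx => by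
    rw [← hp, hpy x hx, Complex.zero_im]) hρ
  have i1 : Integrable fun z => u₁ z * ((v₁ z - v₂ z) * u₂ z) :=
    hW.integrable_mul hu₁.bm.locallyIntegrable
  have i2 : Integrable fun z => u₁ z * (v₁ z * p z) := hvp.integrable_mul hu₁.bm.locallyIntegrable
  simp_rw [← hp, mul_add] at e3
  rw [integral_add i1 i2] at e3
  have e4 : (fun z => v₁ z * u₁ z * p z) = fun z => u₁ z * (v₁ z * p z) := funext fun z => by ring
  rw [e4, add_eq_right, hu₁d, integral_indicator_mul hBm] at e3
  refine Eq.trans ?_ e3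
  refine setIntegral_congr_fun hBm fun z hz => ?_
  simp only [hu₂d]
  rw [indicator_of_mem hz, osc_eq, map_mul, map_add, map_one]
  ring

end

end GKL

namespace GKL

open Filter Topology ComplexConjugate
open scoped ENNReal NNReal ContDiff

section

variable {D R η : ℝ} {S : Set ℂ} {h V W : ℂ → ℂ}

lemma lintegral_grn_mul_le (hm : Measurable h) (hR : ∀ z, R < ‖z‖ → h z = 0)
    (h2 : ∫⁻ z, ‖h z‖ₑ ^ 2 ≠ ⊤) (ρ : ℝ) : ∃ C : ℝ≥0, ∀ x : ℂ, ‖x‖ ≤ ρ →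
    ∫⁻ z, ‖grn (x - z) * h z‖ₑ ≤ C := by
  obtain ⟨C, hC⟩ := enorm_grn_le (ρ + R)
  set M : ℝ≥0∞ := (C : ℝ≥0∞) ^ 2 * (2 * (knC 1 + volume (Metric.closedBall (0 : ℂ) R))) +
    ∫⁻ z, ‖h z‖ₑ ^ 2 with hM
  have hMt : M ≠ ⊤ := by
    have h1 := (knC_lt_top (s := 1) (by norm_num)).ne
    have h2 : volume (Metric.closedBall (0 : ℂ) R) ≠ ⊤ := measure_closedBall_lt_top.ne
    finiteness
  refine ⟨M.toNNReal, fun x hx => ?_⟩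
  rw [ENNReal.coe_toNNReal hMt]
  have hB : MeasurableSet (Metric.closedBall (0 : ℂ) R) := Metric.isClosed_closedBall.measurableSet
  have e1 : ∀ z, ‖grn (x - z) * h z‖ₑ ≤ (Metric.closedBall (0 : ℂ) R).indicator
      (fun z => (C : ℝ≥0∞) ^ 2 * (2 * kn 1 (z - x))) z + ‖h z‖ₑ ^ 2 := by
    intro z
    by_cases hz : z ∈ Metric.closedBall (0 : ℂ) R
    · have hz' := mem_closedBall_zero_iff.1 hz
      rw [indicator_of_mem hz, enorm_mul]
      have b1 := hC (x - z) ((norm_sub_le _ _).trans (add_le_add hx hz'))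
      have b2 : kn (1 / 2) (x - z) * kn (1 / 2) (x - z) ≤ 2 * kn 1 (z - x) := by
        refine (kn_mul_kn_le (by norm_num) (by norm_num) (by norm_num) _ _).trans ?_
        rw [← two_mul, kn_sub_comm]
        norm_num
      have b3 : ‖grn (x - z)‖ₑ ^ 2 ≤ (C : ℝ≥0∞) ^ 2 * (2 * kn 1 (z - x)) := by
        refine (pow_le_pow_left' b1 2).trans ?_
        rw [mul_pow, pow_two (kn _ _)]
        gcongr
      have b4 : ‖grn (x - z)‖ₑ * ‖h z‖ₑ ≤ ‖grn (x - z)‖ₑ ^ 2 + ‖h z‖ₑ ^ 2 := by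
        rcases le_total ‖grn (x - z)‖ₑ ‖h z‖ₑ with hl | hl
        · refine le_add_left ?_
          rw [pow_two]; gcongr
        · refine le_add_right ?_
          rw [pow_two]; gcongr
      exact b4.trans (by gcongr)
    · rw [hR z (by simpa using hz)]; simp
  refine (lintegral_mono e1).trans ?_
  rw [lintegral_add_right _ (hm.enorm.pow_const 2), lintegral_indicator hB, hM]
  gcongr
  have m1 : Measurable fun z : ℂ => kn 1 (z - x) := (measurable_kn 1).comp (measurable_id.sub_const x)
  rw [lintegral_const_mul _ (m1.const_mul 2), lintegral_const_mul _ m1]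
  gcongr
  exact lintegral_kn_le (by norm_num) _ _

lemma exists_measurable_mul (hS : MeasurableSet S) (hV : Src D R V) (hVS : ∀ z, z ∉ S → V z = 0)
    (hW : MemLp W 2 (volume.restrict S)) : ∃ h : ℂ → ℂ, Measurable h ∧
    (∀ᵐ z, h z = V z * W z) ∧ (∀ z, R < ‖z‖ → h z = 0) ∧ ∫⁻ z, ‖h z‖ₑ ^ 2 ≠ ⊤ := by
  set W' := hW.1.mk W
  have hW' : MemLp W' 2 (volume.restrict S) := hW.ae_eq hW.1.ae_eq_mk
  obtain ⟨C, hC⟩ := hV.bm.bdd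
  refine ⟨fun z => V z * W' z, hV.meas.mul hW.1.stronglyMeasurable_mk.measurable, ?_,
    fun z hz => by simp [hV.supp z hz], ?_⟩
  · filter_upwards [(ae_restrict_iff' hS).1 hW.1.ae_eq_mk] with z hz
    by_cases hzS : z ∈ S
    · rw [hz hzS]
    · rw [hVS z hzS, zero_mul, zero_mul]
  · have h1 : ∫⁻ z in S, ‖W' z‖ₑ ^ 2 ≠ ⊤ := by
      have := lintegral_rpow_enorm_lt_top_of_eLpNorm_lt_top two_ne_zero (by simp) hW'.2
      simpa using this.ne
    have h2 : ∫⁻ z, ‖V z * W' z‖ₑ ^ 2 ≤ (C : ℝ≥0∞) ^ 2 * ∫⁻ z in S, ‖W' z‖ₑ ^ 2 := by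
      rw [← lintegral_const_mul' _ _ (by finiteness), ← lintegral_indicator hS]
      refine lintegral_mono fun z => ?_
      by_cases hzS : z ∈ S
      · rw [indicator_of_mem hzS, enorm_mul, mul_pow]
        gcongr
        exact hC z
      · rw [hVS z hzS]; simp
    exact ne_top_of_le_ne_top (by finiteness) h2

lemma exists_greenSrc (hS : MeasurableSet S) (hV : Src D R V) (hVS : ∀ z, z ∉ S → V z = 0)
    (h0 : 0 < η) (hη : ∀ z, z.im < η → V z = 0) (y : ℝ) (hW : MemLp W 2 (volume.restrict S))
    (hWe : ∀ x, x ≠ (y : ℂ) → W x = -grn (x - y) + ∫ z, grn (x - z) * (V z * W z)) :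
    ∃ f, GreenSrc R V y f ∧ ∀ x, x ≠ (y : ℂ) → W x = pot f x - grn (x - y) := by
  obtain ⟨h, hm, hae, hR, h2⟩ := exists_measurable_mul hS hV hVS hW
  have hP : ∀ x, ∫ z, grn (x - z) * (V z * W z) = pot h x := fun x => by
    rw [pot]
    refine integral_congr_ae ?_
    filter_upwards [hae] with z hz
    rw [hz]
  simp_rw [hP] at hWe
  have hf : (fun x => V x * (pot h x - grn (x - y))) =ᵐ[volume] h := by
    have : ∀ᵐ x : ℂ, x ≠ y := by simp [ae_iff]
    filter_upwards [hae, this] with x hx hxy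
    rw [hx, hWe x hxy]; ring
  have hpf : ∀ x, pot (fun x => V x * (pot h x - grn (x - y))) x = pot h x := fun x => by
    rw [pot, pot]
    refine integral_congr_ae ?_
    filter_upwards [hf] with z hz
    simp only [hz]
  refine ⟨_, ⟨?_, fun x => by rw [hpf]⟩, fun x hx => by rw [hpf, hWe x hx]; ring⟩
  obtain ⟨C, hC⟩ := lintegral_grn_mul_le hm hR h2 R
  have hK : IsCompact (Metric.closedBall (0 : ℂ) R ∩ {z | η ≤ z.im}) :=
    (isCompact_closedBall 0 R).inter_right (isClosed_le continuous_const Complex.continuous_im)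
  obtain ⟨C', hC'⟩ := hK.exists_bound_of_continuousOn (f := fun x => grn (x - y))
    (contDiffOn_grn.continuousOn.comp (by fun_prop) fun x hx => by
      rw [mem_compl_iff, mem_singleton_iff, sub_eq_zero]
      rintro rfl
      have := hx.2
      rw [mem_ofPred_eq, Complex.ofReal_im] at this
      linarith)
  have hb : ∀ x, ‖x‖ ≤ R → η ≤ x.im → ‖pot h x - grn (x - y)‖ ≤ C + C' := fun x hx hxi => by
    refine (norm_sub_le _ _).trans (add_le_add ?_ (hC' x ⟨mem_closedBall_zero_iff.2 hx, hxi⟩))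
    have := (enorm_integral_le_lintegral_enorm _).trans (hC x hx)
    rw [enorm_eq_nnnorm, ENNReal.coe_le_coe] at this
    exact this
  refine ⟨D * max (C + C') 0, hV.meas.mul ((measurable_pot hm).sub
    (measurable_grn.comp (measurable_id.sub_const _))), fun x => ?_,
    fun x hx => by rw [hV.supp x hx, zero_mul]⟩
  have hD : 0 ≤ D * max (C + C') 0 := mul_nonneg hV.nonneg (le_max_right _ _)
  rcases lt_or_ge x.im η with hi | hi
  · rw [hη x hi, zero_mul, norm_zero]; exact hD
  rcases lt_or_ge R ‖x‖ with hx | hx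
  · rw [hV.supp x hx, zero_mul, norm_zero]; exact hD
  rw [norm_mul]
  exact mul_le_mul (hV.bdd x) ((hb x hx hi).trans (le_max_left _ _)) (norm_nonneg _) hV.nonneg

lemma potInj_of_unique (hS : MeasurableSet S) (hSR : S ⊆ Metric.closedBall 0 R) (hV : Src D R V)
    (hVS : ∀ z, z ∉ S → V z = 0) (y : ℂ) (hW : MemLp W 2 (volume.restrict S))
    (hWe : ∀ x, x ≠ y → W x = -grn (x - y) + ∫ z, grn (x - z) * (V z * W z))
    (hu : ∀ w, MemLp w 2 (volume.restrict S) →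
      (∀ᵐ x, w x = -grn (x - y) + ∫ z, grn (x - z) * (V z * w z)) →
      W =ᵐ[volume.restrict S] w) : PotInj R V := by
  intro p hpc hp
  obtain ⟨h, hm, hae, hR, h2⟩ := exists_measurable_mul hS hV hVS hW
  have hi : ∀ x, Integrable fun z => grn (x - z) * (V z * W z) := fun x => by
    obtain ⟨C, hC⟩ := lintegral_grn_mul_le hm hR h2 ‖x‖
    have : Integrable fun z => grn (x - z) * h z :=
      ⟨((measurable_grn_sub x).mul hm).aestronglyMeasurable,
        (hC x le_rfl).trans_lt ENNReal.coe_lt_top⟩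
    refine this.congr ?_
    filter_upwards [hae] with z hz
    rw [hz]
  obtain ⟨E, hVp⟩ := hV.mul_continuous hpc
  obtain ⟨C, hC⟩ := (isCompact_closedBall (0 : ℂ) R).exists_bound_of_continuousOn hpc.continuousOn
  have hfin : IsFiniteMeasure (volume.restrict S) :=
    ⟨by simpa using (measure_mono hSR).trans_lt measure_closedBall_lt_top⟩
  have hpL : MemLp p 2 (volume.restrict S) := by
    refine MemLp.of_bound hpc.aestronglyMeasurable C ?_
    filter_upwards [ae_restrict_mem hS] with z hz using hC z (hSR hz)
  have key := hu (fun x => W x + p x) (hW.add hpL) (by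
    have : ∀ᵐ x : ℂ, x ≠ y := by simp [ae_iff]
    filter_upwards [this] with x hx
    have e1 : (fun z => grn (x - z) * (V z * (W z + p z))) =
        fun z => grn (x - z) * (V z * W z) + grn (x - z) * (V z * p z) := funext fun z => by ring
    have e2 := hp x
    rw [pot] at e2
    rw [e1, integral_add (hi x) (hVp.integrable_grn x), ← e2, ← add_assoc, ← hWe x hx])
  have hz : ∀ᵐ z, V z * p z = 0 := by
    filter_upwards [(ae_restrict_iff' hS).1 key] with z hz
    by_cases hzS : z ∈ S
    · have := hz hzS
      rw [left_eq_add.1 this, mul_zero]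
    · rw [hVS z hzS, zero_mul]
  intro x _
  rw [hp x, pot]
  refine integral_eq_zero_of_ae ?_
  filter_upwards [hz] with z hz
  rw [hz, mul_zero, Pi.zero_apply]

/-- Uniqueness in normalised position. -/
theorem ae_eq_of_im_green_eq {D₁ D₂ a b : ℝ} {v₁ v₂ : ℂ → ℂ} (hS : MeasurableSet S)
    (hSR : S ⊆ Metric.closedBall 0 R) (hR : 0 ≤ R) (h0 : 0 < η) (hSη : ∀ z ∈ S, η ≤ z.im)
    (hv₁ : Src D₁ R v₁) (hv₂ : Src D₂ R v₂)
    (hvS₁ : ∀ z, z ∉ S → v₁ z = 0) (hvS₂ : ∀ z, z ∉ S → v₂ z = 0) (hab : a < b)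
    (W₁ W₂ : ℂ → ℂ → ℂ) (hW₁ : ∀ y, MemLp (fun x => W₁ x y) 2 (volume.restrict S))
    (hW₂ : ∀ y, MemLp (fun x => W₂ x y) 2 (volume.restrict S))
    (hWe₁ : ∀ x y, x ≠ y → W₁ x y = -grn (x - y) + ∫ z, grn (x - z) * (v₁ z * W₁ z y))
    (hWe₂ : ∀ x y, x ≠ y → W₂ x y = -grn (x - y) + ∫ z, grn (x - z) * (v₂ z * W₂ z y))
    (hu : ∀ y w, MemLp w 2 (volume.restrict S) →
      (∀ᵐ x, w x = -grn (x - y) + ∫ z, grn (x - z) * (v₁ z * w z)) →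
      (fun x => W₁ x y) =ᵐ[volume.restrict S] w)
    (him : ∀ x ∈ Ioo a b, ∀ y ∈ Ioo a b, (W₁ (x : ℝ) (y : ℝ)).im = (W₂ (x : ℝ) (y : ℝ)).im) :
    v₁ =ᵐ[volume] v₂ := by
  have hη₁ : ∀ z, z.im < η → v₁ z = 0 := fun z hz => hvS₁ z fun h => hz.not_ge (hSη z h)
  have hη₂ : ∀ z, z.im < η → v₂ z = 0 := fun z hz => hvS₂ z fun h => hz.not_ge (hSη z h)
  choose f₁ hf₁ hg₁ using fun y : ℝ =>
    exists_greenSrc hS hv₁ hvS₁ h0 hη₁ y (hW₁ y) fun x hx => hWe₁ x y hx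
  choose f₂ hf₂ hg₂ using fun y : ℝ =>
    exists_greenSrc hS hv₂ hvS₂ h0 hη₂ y (hW₂ y) fun x hx => hWe₂ x y hx
  refine ae_eq_of_green hv₁ hv₂ hR h0 hη₁ hη₂ hab
    (potInj_of_unique hS hSR hv₁ hvS₁ 0 (hW₁ 0) (fun x hx => hWe₁ x 0 hx) (hu 0)) f₁ f₂
    (fun y _ => hf₁ y) (fun y _ => hf₂ y) fun y hy x hx => ?_
  have hxy : (x : ℂ) ≠ y := by exact_mod_cast hx.1.ne'
  have := him x ⟨hy.1.trans hx.1, hx.2⟩ y hy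
  rw [hg₁ y x hxy, hg₂ y x hxy, Complex.sub_im, Complex.sub_im] at this
  linarith

end

end GKL

namespace GKL

open Filter Topology ComplexConjugate
open scoped ENNReal NNReal ContDiff

/-! ### Transfer from the plane `R2` to `ℂ` -/

/-- The similarity `w ↦ x₀ + c A w` from `ℂ` to the plane. -/
def chart (A : ℂ ≃ₗᵢ[ℝ] R2) (x₀ : R2) {c : ℝ} (hc : c ≠ 0) : ℂ ≃ₜ R2 :=
  A.toHomeomorph.trans ((Homeomorph.smulOfNeZero c hc).trans (Homeomorph.addLeft x₀))

section chart

variable {A : ℂ ≃ₗᵢ[ℝ] R2} {x₀ : R2} {c : ℝ} {hc : c ≠ 0}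

lemma chart_apply (w : ℂ) : chart A x₀ hc w = x₀ + c • A w := rfl

lemma Gplus_chart {κ : ℝ} (hκ : 0 < κ) (hcκ : c = 2 / κ) (z w : ℂ) :
    Gplus κ (chart A x₀ hc z - chart A x₀ hc w) = grn (z - w) := by
  have h : ‖chart A x₀ hc z - chart A x₀ hc w‖ = 2 / κ * ‖z - w‖ := by
    rw [chart_apply, chart_apply, add_sub_add_left_eq_sub, ← smul_sub, ← map_sub, norm_smul,
      LinearIsometryEquiv.norm_map, hcκ, Real.norm_of_nonneg (by positivity)]
  rw [Gplus_eq κ hκ, grn, h]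
  congr 2
  field_simp
  norm_num

lemma map_chart : Measure.map (chart A x₀ hc) volume =
    ENNReal.ofReal ((c ^ 2)⁻¹) • (volume : Measure R2) := by
  have e : (chart A x₀ hc : ℂ → R2) = (fun x => x₀ + x) ∘ (fun x => c • x) ∘ A := rfl
  rw [e, ← Measure.map_map (by fun_prop) ((measurable_const_smul c).comp A.continuous.measurable),
    ← Measure.map_map (by fun_prop) A.continuous.measurable, A.measurePreserving.map_eq,
    Measure.map_addHaar_smul _ hc, Measure.map_smul, map_add_left_eq_self]
  congr 2
  rw [finrank_euclideanSpace_fin, abs_of_nonneg (by positivity)]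

lemma measurableEmbedding_chart : MeasurableEmbedding (chart A x₀ hc) :=
  (chart A x₀ hc).measurableEmbedding

lemma map_chart_restrict {Ω : Set R2} :
    Measure.map (chart A x₀ hc) (volume.restrict (chart A x₀ hc ⁻¹' Ω)) =
      ENNReal.ofReal ((c ^ 2)⁻¹) • (volume : Measure R2).restrict Ω := by
  rw [← measurableEmbedding_chart.restrict_map, map_chart, Measure.restrict_smul]

lemma ofReal_inv_sq_ne_zero (hc : c ≠ 0) : ENNReal.ofReal ((c ^ 2)⁻¹) ≠ 0 := by
  rw [Ne, ENNReal.ofReal_eq_zero, not_le]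
  positivity

lemma ae_chart {p : R2 → Prop} : (∀ᵐ z, p (chart A x₀ hc z)) ↔ ∀ᵐ x, p x := by
  rw [← measurableEmbedding_chart.ae_map_iff, map_chart,
    Measure.ae_ennreal_smul_measure_iff (ofReal_inv_sq_ne_zero hc)]

lemma ae_restrict_chart {Ω : Set R2} {p : R2 → Prop} :
    (∀ᵐ z ∂volume.restrict (chart A x₀ hc ⁻¹' Ω), p (chart A x₀ hc z)) ↔
      ∀ᵐ x ∂volume.restrict Ω, p x := by
  rw [← measurableEmbedding_chart.ae_map_iff, map_chart_restrict,
    Measure.ae_ennreal_smul_measure_iff (ofReal_inv_sq_ne_zero hc)]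

lemma memLp_smul_measure_iff {α : Type*} [MeasurableSpace α] {μ : Measure α} {f : α → ℂ}
    {p K : ℝ≥0∞} (h0 : K ≠ 0) (ht : K ≠ ⊤) : MemLp f p (K • μ) ↔ MemLp f p μ := by
  refine ⟨fun h => ?_, fun h => h.smul_measure ht⟩
  have := h.smul_measure (ENNReal.inv_ne_top.2 h0)
  rwa [smul_smul, ENNReal.inv_mul_cancel h0 ht, one_smul] at this

lemma memLp_chart {p : ℝ≥0∞} {f : R2 → ℂ} :
    MemLp (fun z => f (chart A x₀ hc z)) p volume ↔ MemLp f p volume := by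
  rw [← memLp_smul_measure_iff (μ := (volume : Measure R2)) (ofReal_inv_sq_ne_zero hc)
    ENNReal.ofReal_ne_top, ← map_chart (A := A) (x₀ := x₀) (hc := hc),
    measurableEmbedding_chart.memLp_map_measure_iff]
  rfl

lemma memLp_restrict_chart {p : ℝ≥0∞} {Ω : Set R2} {f : R2 → ℂ} :
    MemLp (fun z => f (chart A x₀ hc z)) p (volume.restrict (chart A x₀ hc ⁻¹' Ω)) ↔
      MemLp f p (volume.restrict Ω) := by
  rw [← memLp_smul_measure_iff (μ := (volume : Measure R2).restrict Ω) (ofReal_inv_sq_ne_zero hc)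
    ENNReal.ofReal_ne_top, ← map_chart_restrict (A := A) (x₀ := x₀) (hc := hc),
    measurableEmbedding_chart.memLp_map_measure_iff]
  rfl

lemma setIntegral_chart {Ω : Set R2} (f : R2 → ℂ) :
    ∫ x in Ω, f x = (c : ℂ) ^ 2 * ∫ z in chart A x₀ hc ⁻¹' Ω, f (chart A x₀ hc z) := by
  rw [← measurableEmbedding_chart.integral_map, map_chart_restrict, integral_smul_measure,
    ENNReal.toReal_ofReal (by positivity), Complex.real_smul]
  push_cast
  rw [← mul_assoc, mul_inv_cancel₀ (by exact_mod_cast pow_ne_zero 2 hc), one_mul]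

end chart

/-- A bounded measurable representative vanishing off `S`. -/
lemma exists_bounded_representative {g : ℂ → ℂ} {S : Set ℂ} (hg : MemLp g ⊤ volume)
    (hS : MeasurableSet S) (hgS : ∀ᵐ z, z ∉ S → g z = 0) :
    ∃ (M : ℝ) (V : ℂ → ℂ), Measurable V ∧ (∀ z, ‖V z‖ ≤ M) ∧ (∀ z, z ∉ S → V z = 0) ∧
      V =ᵐ[volume] g := by
  set M := (eLpNormEssSup g volume).toReal
  have hM : ∀ᵐ z, ‖g z‖ ≤ M := by
    have ht : eLpNormEssSup g volume ≠ ⊤ := by simpa using hg.2.ne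
    filter_upwards [ae_le_eLpNormEssSup (f := g) (μ := volume)] with z hz
    rw [← toReal_enorm]
    exact ENNReal.toReal_mono ht hz
  have hm := hg.1.stronglyMeasurable_mk.measurable
  have hme := hg.1.ae_eq_mk
  set h := hg.1.mk g
  refine ⟨M, (S ∩ {z | ‖h z‖ ≤ M}).indicator h,
    hm.indicator (hS.inter (measurableSet_le hm.norm measurable_const)), fun z => ?_,
    fun z hz => indicator_of_notMem (fun hz' => hz hz'.1) _, ?_⟩
  · by_cases hz : z ∈ S ∩ {z | ‖h z‖ ≤ M}
    · rw [indicator_of_mem hz]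
      exact hz.2
    · rw [indicator_of_notMem hz, norm_zero]
      exact ENNReal.toReal_nonneg
  · filter_upwards [hM, hme, hgS] with z h1 h2 h3
    by_cases hz : z ∈ S
    · have hz' : z ∈ S ∩ {z | ‖h z‖ ≤ M} := ⟨hz, by rw [mem_ofPred_eq, ← h2]; exact h1⟩
      rw [indicator_of_mem hz', h2]
    · rw [indicator_of_notMem fun hz' => hz hz'.1, h3 hz]

section transfer

variable {A : ℂ ≃ₗᵢ[ℝ] R2} {x₀ : R2} {κ c : ℝ} {hc : c ≠ 0} {Ω : Set R2} {v : R2 → ℂ} {V : ℂ → ℂ}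

lemma setIntegral_Gplus_chart (hκ : 0 < κ) (hcκ : c = 2 / κ)
    (hV0 : ∀ z, z ∉ chart A x₀ hc ⁻¹' Ω → V z = 0)
    (hV : V =ᵐ[volume] fun z => (c : ℂ) ^ 2 * v (chart A x₀ hc z)) (F : R2 → ℂ) (x : ℂ) :
    ∫ z in Ω, Gplus κ (chart A x₀ hc x - z) * v z * F z =
      ∫ z, grn (x - z) * (V z * F (chart A x₀ hc z)) := by
  rw [setIntegral_chart (A := A) (x₀ := x₀) (hc := hc), ← integral_const_mul,
    ← setIntegral_eq_integral_of_forall_compl_eq_zero (s := chart A x₀ hc ⁻¹' Ω)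
      (f := fun z => grn (x - z) * (V z * F (chart A x₀ hc z)))]
  · refine integral_congr_ae (ae_restrict_of_ae ?_)
    filter_upwards [hV] with z hz
    simp only [hz, Gplus_chart hκ hcκ]
    ring
  · intro z hz
    rw [hV0 z hz]
    ring

lemma green_chart (hκ : 0 < κ) (hcκ : c = 2 / κ)
    (hV0 : ∀ z, z ∉ chart A x₀ hc ⁻¹' Ω → V z = 0)
    (hV : V =ᵐ[volume] fun z => (c : ℂ) ^ 2 * v (chart A x₀ hc z)) {R : R2 → R2 → ℂ}
    (hR : IsOutgoingGreen κ Ω v R) (x y : ℂ) (hxy : x ≠ y) :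
    R (chart A x₀ hc x) (chart A x₀ hc y) = -grn (x - y) +
      ∫ z, grn (x - z) * (V z * R (chart A x₀ hc z) (chart A x₀ hc y)) := by
  rw [(hR _).2 _ ((chart A x₀ hc).injective.ne hxy), Gplus_chart hκ hcκ,
    setIntegral_Gplus_chart hκ hcκ hV0 hV (fun z => R z (chart A x₀ hc y))]

lemma unique_chart (hκ : 0 < κ) (hcκ : c = 2 / κ)
    (hV0 : ∀ z, z ∉ chart A x₀ hc ⁻¹' Ω → V z = 0)
    (hV : V =ᵐ[volume] fun z => (c : ℂ) ^ 2 * v (chart A x₀ hc z)) {R : R2 → R2 → ℂ}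
    (hR : IsOutgoingGreen κ Ω v R) (hu : UniqueSolvability κ Ω v) (y : ℂ) (w : ℂ → ℂ)
    (hw : MemLp w 2 (volume.restrict (chart A x₀ hc ⁻¹' Ω)))
    (hwe : ∀ᵐ x, w x = -grn (x - y) + ∫ z, grn (x - z) * (V z * w z)) :
    (fun x => R (chart A x₀ hc x) (chart A x₀ hc y)) =ᵐ[volume.restrict (chart A x₀ hc ⁻¹' Ω)]
      w := by
  have h1 : MemLp (fun x => w ((chart A x₀ hc).symm x)) 2 (volume.restrict Ω) := by
    rw [← memLp_restrict_chart (A := A) (x₀ := x₀) (hc := hc)]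
    simpa using hw
  have h2 : ∀ᵐ x, w ((chart A x₀ hc).symm x) = -Gplus κ (x - chart A x₀ hc y) +
      ∫ z in Ω, Gplus κ (x - z) * v z * w ((chart A x₀ hc).symm z) := by
    rw [← ae_chart (A := A) (x₀ := x₀) (hc := hc)]
    filter_upwards [hwe] with x hx
    rw [setIntegral_Gplus_chart hκ hcκ hV0 hV (fun z => w ((chart A x₀ hc).symm z)),
      Gplus_chart hκ hcκ]
    simpa using hx
  have h3 : ∀ᵐ x, R x (chart A x₀ hc y) = -Gplus κ (x - chart A x₀ hc y) +
      ∫ z in Ω, Gplus κ (x - z) * v z * R z (chart A x₀ hc y) := by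
    filter_upwards [Measure.ae_ne volume (chart A x₀ hc y)] with x hx
    exact (hR _).2 x hx
  have := hu (chart A x₀ hc y) _ _ (hR _).1 h1 (ae_restrict_of_ae h3) (ae_restrict_of_ae h2)
  filter_upwards [(ae_restrict_chart (A := A) (x₀ := x₀) (hc := hc)).2 this] with x hx
  simpa using hx

end transfer

lemma exists_isometry_one {θ : R2} (hθ : ‖θ‖ = 1) : ∃ A : ℂ ≃ₗᵢ[ℝ] R2, A 1 = θ := by
  set e := Complex.orthonormalBasisOneI.repr
  have h : e.symm θ ∈ Submonoid.unitSphere ℂ := by simp [Submonoid.unitSphere, hθ]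
  refine ⟨(rotation ⟨e.symm θ, h⟩).trans e, ?_⟩
  have : rotation ⟨e.symm θ, h⟩ 1 = e.symm θ := mul_one _
  rw [LinearIsometryEquiv.trans_apply, this, LinearIsometryEquiv.apply_symm_apply]

lemma ae_eq_of_chart_im_pos {A : ℂ ≃ₗᵢ[ℝ] R2} {x₀ : R2} {κ c : ℝ} (hκ : 0 < κ)
    (hc : c ≠ 0) (hcκ : c = 2 / κ) {Ω : Set R2} (hΩ : IsOpen Ω) (hΩb : Bornology.IsBounded Ω)
    (hL : ∀ z ∈ closure Ω, ((chart A x₀ hc).symm z).im ≠ 0)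
    (hpos : ∀ z ∈ Ω, 0 < ((chart A x₀ hc).symm z).im)
    {a b : ℝ} (hab : a < b) {v₁ v₂ : R2 → ℂ} {R₁ R₂ : R2 → R2 → ℂ}
    (hv₁L : MemLp v₁ ⊤ volume) (hv₂L : MemLp v₂ ⊤ volume)
    (hv₁0 : ∀ᵐ x ∂volume, x ∉ Ω → v₁ x = 0) (hv₂0 : ∀ᵐ x ∂volume, x ∉ Ω → v₂ x = 0)
    (hu₁ : UniqueSolvability κ Ω v₁)
    (hR₁ : IsOutgoingGreen κ Ω v₁ R₁) (hR₂ : IsOutgoingGreen κ Ω v₂ R₂)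
    (him : ∀ x ∈ Ioo a b, ∀ y ∈ Ioo a b,
      (R₁ (chart A x₀ hc (x : ℝ)) (chart A x₀ hc (y : ℝ))).im =
        (R₂ (chart A x₀ hc (x : ℝ)) (chart A x₀ hc (y : ℝ))).im) :
    v₁ =ᵐ[volume] v₂ := by
  set T := chart A x₀ hc with hT
  have hK : IsCompact (T.symm '' closure Ω) := hΩb.isCompact_closure.image T.symm.continuous
  have hsub : T ⁻¹' Ω ⊆ T.symm '' closure Ω := fun z hz =>
    ⟨T z, subset_closure hz, T.symm_apply_apply z⟩
  have hposK : ∀ z ∈ T.symm '' closure Ω, 0 < z.im := by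
    rintro _ ⟨z, hz, rfl⟩
    refine lt_of_le_of_ne (?_ : z ∈ {z | 0 ≤ (T.symm z).im}) (hL z hz).symm
    exact closure_minimal (fun z hz => (hpos z hz).le)
      (isClosed_le continuous_const (Complex.continuous_im.comp T.symm.continuous)) hz
  obtain ⟨η, h0, hη⟩ : ∃ η : ℝ, 0 < η ∧ ∀ z ∈ T.symm '' closure Ω, η ≤ z.im := by
    rcases (T.symm '' closure Ω).eq_empty_or_nonempty with h | h
    · exact ⟨1, one_pos, by simp [h]⟩
    · obtain ⟨z, hz, hmin⟩ := hK.exists_isMinOn h Complex.continuous_im.continuousOn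
      exact ⟨z.im, hposK z hz, fun w hw => hmin hw⟩
  obtain ⟨R, hR, hKR⟩ : ∃ R : ℝ, 0 ≤ R ∧ T.symm '' closure Ω ⊆ Metric.closedBall 0 R := by
    obtain ⟨R, hR⟩ := hK.isBounded.subset_closedBall 0
    exact ⟨max R 0, le_max_right _ _, hR.trans (Metric.closedBall_subset_closedBall (le_max_left _ _))⟩
  have hS : MeasurableSet (T ⁻¹' Ω) := (hΩ.preimage T.continuous).measurableSet
  have hrep : ∀ v : R2 → ℂ, MemLp v ⊤ volume → (∀ᵐ x ∂volume, x ∉ Ω → v x = 0) →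
      ∃ (M : ℝ) (V : ℂ → ℂ), Src M R V ∧ (∀ z, z ∉ T ⁻¹' Ω → V z = 0) ∧
        V =ᵐ[volume] fun z => (c : ℂ) ^ 2 * v (T z) := by
    intro v hv hv0
    have h1 : MemLp (fun z => (c : ℂ) ^ 2 * v (T z)) ⊤ volume := (memLp_chart.2 hv).const_mul _
    have h2 : ∀ᵐ z, z ∉ T ⁻¹' Ω → (c : ℂ) ^ 2 * v (T z) = 0 := by
      filter_upwards [(ae_chart (A := A) (x₀ := x₀) (hc := hc)).2 hv0] with z hz hz'
      rw [hz hz', mul_zero]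
    obtain ⟨M, V, hVm, hVb, hV0, hVe⟩ := exists_bounded_representative h1 hS h2
    exact ⟨M, V, ⟨hVm, hVb, fun z hz => hV0 z fun hz' =>
      hz.not_ge (mem_closedBall_zero_iff.1 (hKR (hsub hz')))⟩, hV0, hVe⟩
  obtain ⟨M₁, V₁, hs₁, hz₁, he₁⟩ := hrep v₁ hv₁L hv₁0
  obtain ⟨M₂, V₂, hs₂, hz₂, he₂⟩ := hrep v₂ hv₂L hv₂0
  have hV := ae_eq_of_im_green_eq hS (hsub.trans hKR) hR h0 (fun z hz => hη z (hsub hz)) hs₁ hs₂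
    hz₁ hz₂ hab (fun x y => R₁ (T x) (T y)) (fun x y => R₂ (T x) (T y))
    (fun y => memLp_restrict_chart.2 (hR₁ _).1)
    (fun y => memLp_restrict_chart.2 (hR₂ _).1)
    (green_chart hκ hcκ hz₁ he₁ hR₁)
    (green_chart hκ hcκ hz₂ he₂ hR₂)
    (unique_chart hκ hcκ hz₁ he₁ hR₁ hu₁) him
  refine (ae_chart (A := A) (x₀ := x₀) (hc := hc)).1 ?_
  filter_upwards [hV, he₁, he₂] with z h h1 h2
  rw [h1, h2] at h
  exact mul_left_cancel₀ (pow_ne_zero 2 (by exact_mod_cast hc)) h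

end GKL

theorem gelfand_krein_levitan_uniqueness_line
    (κ : ℝ) (hκ : 0 < κ)
    (Ω : Set R2) (hΩopen : IsOpen Ω) (hΩbdd : Bornology.IsBounded Ω) (hΩconn : IsConnected Ω)
    (x₀ θ : R2) (hθ : ‖θ‖ = 1)
    (L : Set R2) (hL : L = Set.range (fun s : ℝ => x₀ + s • θ))
    (hLΩ : L ⊆ (closure Ω)ᶜ)
    (a b : ℝ) (hab : a < b)
    (Λ : Set R2) (hΛ : Λ = (fun s : ℝ => x₀ + s • θ) '' Set.Ioo a b)
    (v₁ v₂ : R2 → ℂ) (R₁ R₂ : R2 → R2 → ℂ)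
    (hv₁L : MemLp v₁ ⊤ volume) (hv₂L : MemLp v₂ ⊤ volume)
    (hv₁0 : ∀ᵐ x ∂volume, x ∉ Ω → v₁ x = 0)
    (hv₂0 : ∀ᵐ x ∂volume, x ∉ Ω → v₂ x = 0)
    (hu₁ : UniqueSolvability κ Ω v₁) (hu₂ : UniqueSolvability κ Ω v₂)
    (hR₁ : IsOutgoingGreen κ Ω v₁ R₁) (hR₂ : IsOutgoingGreen κ Ω v₂ R₂)
    (him : ∀ x ∈ Λ, ∀ y ∈ Λ, (R₁ x y).im = (R₂ x y).im) :
    v₁ =ᵐ[volume] v₂ := by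
  subst hL hΛ
  obtain ⟨A, hA⟩ := GKL.exists_isometry_one hθ
  have hc : 2 / κ ≠ 0 := by positivity
  have hline : ∀ B : ℂ ≃ₗᵢ[ℝ] R2, B 1 = θ → ∀ x : ℝ,
      GKL.chart B x₀ hc x = x₀ + (2 / κ * x) • θ := by
    intro B hB x
    have : (x : ℂ) = x • (1 : ℂ) := by simp
    rw [GKL.chart_apply, this, map_smul, hB, smul_smul]
  have him' : ∀ B : ℂ ≃ₗᵢ[ℝ] R2, B 1 = θ → ∀ x ∈ Ioo (a / (2 / κ)) (b / (2 / κ)),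
      ∀ y ∈ Ioo (a / (2 / κ)) (b / (2 / κ)),
      (R₁ (GKL.chart B x₀ hc (x : ℝ)) (GKL.chart B x₀ hc (y : ℝ))).im =
        (R₂ (GKL.chart B x₀ hc (x : ℝ)) (GKL.chart B x₀ hc (y : ℝ))).im := by
    intro B hB
    have hmem : ∀ x ∈ Ioo (a / (2 / κ)) (b / (2 / κ)),
        GKL.chart B x₀ hc (x : ℝ) ∈ (fun s : ℝ => x₀ + s • θ) '' Set.Ioo a b := fun x hx =>
      ⟨2 / κ * x, ⟨(div_lt_iff₀' (by positivity)).1 hx.1, (lt_div_iff₀' (by positivity)).1 hx.2⟩,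
        (hline B hB x).symm⟩
    exact fun x hx y hy => him _ (hmem x hx) _ (hmem y hy)
  have him0 : ∀ B : ℂ ≃ₗᵢ[ℝ] R2, B 1 = θ → ∀ z ∈ closure Ω,
      ((GKL.chart B x₀ hc).symm z).im ≠ 0 := by
    intro B hB z hz h
    refine hLΩ ⟨2 / κ * ((GKL.chart B x₀ hc).symm z).re, ?_⟩ hz
    have e : ((((GKL.chart B x₀ hc).symm z).re : ℝ) : ℂ) = (GKL.chart B x₀ hc).symm z :=
      Complex.ext (by simp) (by simp [h])
    have := hline B hB ((GKL.chart B x₀ hc).symm z).re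
    rw [e, Homeomorph.apply_symm_apply] at this
    exact this.symm
  have hab' : a / (2 / κ) < b / (2 / κ) := by gcongr
  have hcont : Continuous fun z => ((GKL.chart A x₀ hc).symm z).im :=
    Complex.continuous_im.comp (GKL.chart A x₀ hc).symm.continuous
  by_cases hpos : ∀ z ∈ Ω, 0 < ((GKL.chart A x₀ hc).symm z).im
  · exact GKL.ae_eq_of_chart_im_pos hκ hc rfl hΩopen hΩbdd (him0 A hA) hpos hab' hv₁L hv₂L
      hv₁0 hv₂0 hu₁ hR₁ hR₂ (him' A hA)
  · push Not at hpos
    obtain ⟨p, hp, hp0⟩ := hpos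
    have hneg : ∀ z ∈ Ω, ((GKL.chart A x₀ hc).symm z).im < 0 := by
      intro z hz
      by_contra h
      obtain ⟨w, hw, hw0⟩ := hΩconn.isPreconnected.intermediate_value hp hz hcont.continuousOn
        ⟨hp0, not_lt.1 h⟩
      exact him0 A hA w (subset_closure hw) hw0
    have hB : (Complex.conjLIE.trans A) 1 = θ := by simp [hA]
    refine GKL.ae_eq_of_chart_im_pos hκ hc rfl hΩopen hΩbdd (him0 _ hB) (fun z hz => ?_) hab'
      hv₁L hv₂L hv₁0 hv₂0 hu₁ hR₁ hR₂ (him' _ hB)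
    have e : (GKL.chart (Complex.conjLIE.trans A) x₀ hc).symm z =
        (starRingEnd ℂ) ((GKL.chart A x₀ hc).symm z) := by
      rw [Homeomorph.symm_apply_eq, GKL.chart_apply]
      have : (Complex.conjLIE.trans A) ((starRingEnd ℂ) ((GKL.chart A x₀ hc).symm z)) =
          A ((GKL.chart A x₀ hc).symm z) := by simp
      rw [this, ← GKL.chart_apply (hc := hc), Homeomorph.apply_symm_apply]
    rw [e, Complex.conj_im]
    linarith [hneg z hz]
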